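/- Let K: ℝ^{2n+1} → ℝ be continuous and cylindrically symmetric, K(z,t) = K̃(|z|,t) with K̃ locally Hölder continuous on (0,∞)×ℝ, such that the limit K(∞) = lim_{|(z,t)|→∞} K(z,t) exists in ℝ, K is positive at some point, and sup_{t∈ℝ} K(0,t) ≤ K(∞). Assume that either K(∞) ≤ 0, or there exist μ > 0 and s ∈ ℝ such that ∫_{ℝ^{2n+1}} (K(z,t) − K(∞)) U_{μ,s}(z,t)^{Q*} dz dt ≥ 0. Then there exists a positive cylindrically symmetric finite-energy weak solution u of −Δ_{ℍⁿ}u = K u^{Q*−1}. -/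

import Mathlib

open MeasureTheory Filter Topology

noncomputable section

/-- Points of the Heisenberg group `ℍⁿ ≅ ℝⁿ × ℝⁿ × ℝ`, written `(x, y, t)`. -/
abbrev Pt (n : ℕ) : Type := (Fin n → ℝ) × (Fin n → ℝ) × ℝ

namespace Heis

/-- Unit vector in the `x_j` direction. -/
def ex (n : ℕ) (j : Fin n) : Pt n := (Pi.single j 1, 0, 0)

/-- Unit vector in the `y_j` direction. -/
def ey (n : ℕ) (j : Fin n) : Pt n := (0, Pi.single j 1, 0)

/-- Unit vector in the `t` direction. -/
def et (n : ℕ) : Pt n := (0, 0, 1)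

/-- The left-invariant vector field `X_j u = ∂u/∂x_j + 2 y_j ∂u/∂t`. -/
def Xd (n : ℕ) (j : Fin n) (u : Pt n → ℝ) (p : Pt n) : ℝ :=
  fderiv ℝ u p (ex n j) + 2 * p.2.1 j * fderiv ℝ u p (et n)

/-- The left-invariant vector field `Y_j u = ∂u/∂y_j - 2 x_j ∂u/∂t`. -/
def Yd (n : ℕ) (j : Fin n) (u : Pt n → ℝ) (p : Pt n) : ℝ :=
  fderiv ℝ u p (ey n j) - 2 * p.1 j * fderiv ℝ u p (et n)

/-- The Kohn Laplacian `Δ_{ℍⁿ} u = Σ_j (X_j² u + Y_j² u)`. -/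
def kohn (n : ℕ) (u : Pt n → ℝ) (p : Pt n) : ℝ :=
  ∑ j, (Xd n j (Xd n j u) p + Yd n j (Yd n j u) p)

/-- `|z|` for `p = (x, y, t)`, i.e. the Euclidean norm of `(x, y)`. -/
def znorm (n : ℕ) (p : Pt n) : ℝ :=
  Real.sqrt (∑ j, (p.1 j) ^ 2 + ∑ j, (p.2.1 j) ^ 2)

/-- Cylindrical symmetry: `u (z, t)` depends only on `(|z|, t)`. -/
def IsCyl (n : ℕ) (u : Pt n → ℝ) : Prop :=
  ∃ v : ℝ → ℝ → ℝ, ∀ p : Pt n, u p = v (znorm n p) p.2.2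

/-- Homogeneous dimension `Q = 2n + 2`. -/
def Qh (n : ℕ) : ℝ := 2 * n + 2

/-- Critical exponent `Q* = 2Q/(Q-2)`. -/
def Qs (n : ℕ) : ℝ := 2 * Qh n / (Qh n - 2)

/-- Smooth compactly supported test functions. -/
def TestFun (n : ℕ) (φ : Pt n → ℝ) : Prop :=
  ContDiff ℝ (⊤ : ℕ∞) φ ∧ HasCompactSupport φ

/-- Pointwise inner product of horizontal gradients `∇_{ℍⁿ}u · ∇_{ℍⁿ}v`. -/
def hDot (n : ℕ) (u v : Pt n → ℝ) (p : Pt n) : ℝ :=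
  ∑ j, (Xd n j u p * Xd n j v p + Yd n j u p * Yd n j v p)

/-- `|∇_{ℍⁿ}u|²`. -/
def hGradSq (n : ℕ) (u : Pt n → ℝ) (p : Pt n) : ℝ := hDot n u u p

/-- `G = (Gx, Gy)` is the weak horizontal gradient of `u`, and is in `L²`. -/
def HasWeakHGrad (n : ℕ) (u : Pt n → ℝ)
    (G : Pt n → (Fin n → ℝ) × (Fin n → ℝ)) : Prop :=
  (∀ j : Fin n, MemLp (fun p => (G p).1 j) 2 volume ∧
      MemLp (fun p => (G p).2 j) 2 volume) ∧
  ∀ φ : Pt n → ℝ, TestFun n φ → ∀ j : Fin n,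
    (∫ p : Pt n, u p * Xd n j φ p = -∫ p : Pt n, (G p).1 j * φ p) ∧
    (∫ p : Pt n, u p * Yd n j φ p = -∫ p : Pt n, (G p).2 j * φ p)

/-- `G · ∇_{ℍⁿ}φ` pointwise. -/
def gDot (n : ℕ) (G : Pt n → (Fin n → ℝ) × (Fin n → ℝ)) (φ : Pt n → ℝ)
    (p : Pt n) : ℝ :=
  ∑ j, ((G p).1 j * Xd n j φ p + (G p).2 j * Yd n j φ p)

/-- `u` is a positive cylindrically symmetric finite-energy weak solution of
`-Δ_{ℍⁿ} u = K u^{Q*-1}`. -/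
def IsWeakSol (n : ℕ) (K u : Pt n → ℝ) : Prop :=
  IsCyl n u ∧ MemLp u (ENNReal.ofReal (Qs n)) volume ∧
  (∀ᵐ p : Pt n, 0 < u p) ∧
  ∃ G : Pt n → (Fin n → ℝ) × (Fin n → ℝ), HasWeakHGrad n u G ∧
    ∀ φ : Pt n → ℝ, TestFun n φ →
      ∫ p : Pt n, gDot n G φ p = ∫ p : Pt n, K p * u p ^ (Qs n - 1) * φ p

/-- The standard bubble `U_{μ,s}`. -/
def bubble (n : ℕ) (μ s : ℝ) (p : Pt n) : ℝ :=
  μ ^ (-(Qh n - 2) / 2) *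
    (((p.2.2 - s) / μ ^ 2) ^ 2 + (1 + (znorm n p) ^ 2 / μ ^ 2) ^ 2)
      ^ (-(Qh n - 2) / 4)

/-- Local Hölder continuity of an uncurried function of two real variables on a set. -/
def LocHolderOn (f : ℝ → ℝ → ℝ) (s : Set (ℝ × ℝ)) : Prop :=
  ∀ x ∈ s, ∃ t ∈ nhdsWithin x s, ∃ C α : NNReal, 0 < α ∧
    HolderOnWith C α (fun q : ℝ × ℝ => f q.1 q.2) t

/-- `K` is cylindrically symmetric, `K(z,t) = K̃(|z|,t)`, with `K̃` locally Hölder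
continuous on `(0,∞) × ℝ`. -/
def CylHolder (n : ℕ) (K : Pt n → ℝ) : Prop :=
  ∃ Kt : ℝ → ℝ → ℝ, (∀ p : Pt n, K p = Kt (znorm n p) p.2.2) ∧
    LocHolderOn Kt (Set.Ioi 0 ×ˢ Set.univ)

/-- The standard solution `ω(z,t) = (Q-2)^{(Q-2)/2} (t² + (1+|z|²)²)^{-(Q-2)/4}`. -/
def omegaFun (n : ℕ) (p : Pt n) : ℝ :=
  (Qh n - 2) ^ ((Qh n - 2) / 2) *
    (p.2.2 ^ 2 + (1 + (znorm n p) ^ 2) ^ 2) ^ (-(Qh n - 2) / 4)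

end Heis
namespace Heis

/-- The Cayley transform `F : S^{2n+1} ∖ {(0,…,0,-1)} → ℍⁿ`. -/
def cayley (n : ℕ) (ζ : Fin (n + 1) → ℂ) : Pt n :=
  (fun j => (ζ j.castSucc / (1 + ζ (Fin.last n))).re,
   fun j => (ζ j.castSucc / (1 + ζ (Fin.last n))).im,
   (Complex.I * (1 - ζ (Fin.last n)) / (1 + ζ (Fin.last n))).re)

/-- The partial Laplacian `Δ_{x,y} k = Σ_i (∂²k/∂x_i² + ∂²k/∂y_i²)`. -/
def lapXY (n : ℕ) (k : Pt n → ℝ) (p : Pt n) : ℝ :=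
  ∑ j, (fderiv ℝ (fun q => fderiv ℝ k q (ex n j)) p (ex n j)
      + fderiv ℝ (fun q => fderiv ℝ k q (ey n j)) p (ey n j))

/-- The rescaling operator `(𝒰_{μ,s} u)(z,t) = μ^{-(Q-2)/2} u(z/μ, (t-s)/μ²)`. -/
def rescale (n : ℕ) (μ s : ℝ) (u : Pt n → ℝ) (p : Pt n) : ℝ :=
  μ ^ (-(Qh n - 2) / 2) *
    u (fun j => p.1 j / μ, fun j => p.2.1 j / μ, (p.2.2 - s) / μ ^ 2)

/-- The point `(μ z, μ² t + s)`. -/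
def scalePt (n : ℕ) (μ s : ℝ) (p : Pt n) : Pt n :=
  (fun j => μ * p.1 j, fun j => μ * p.2.1 j, μ ^ 2 * p.2.2 + s)

/-- The reduced functional `Γ(μ,s) = (1/Q*) ∫ k(μz, μ²t+s) ω^{Q*}`. -/
def Gam (n : ℕ) (k : Pt n → ℝ) (μ s : ℝ) : ℝ :=
  (1 / Qs n) * ∫ p : Pt n, k (scalePt n μ s p) * omegaFun n p ^ Qs n

/-- The Heisenberg group law
`(x,y,t) ∘ (x',y',t') = (x+x', y+y', t+t'+2x'·y-2x·y')`. -/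
def heisMul (n : ℕ) (a b : Pt n) : Pt n :=
  (fun j => a.1 j + b.1 j, fun j => a.2.1 j + b.2.1 j,
   a.2.2 + b.2.2 + 2 * (∑ j, b.1 j * a.2.1 j) - 2 * (∑ j, a.1 j * b.2.1 j))

end Heis

open Heis
set_option linter.all false
namespace Heis
theorem weak_cpt {V : Type*} [NormedAddCommGroup V] [InnerProductSpace ℝ V] [CompleteSpace V]
    (x : ℕ → V) (C : ℝ) (hx : ∀ k, ‖x k‖ ≤ C) :
    ∃ s : ℕ → ℕ, StrictMono s ∧ ∃ y : V, ∀ v : V,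
      Tendsto (fun k ↦ inner ℝ (x (s k)) v) atTop (𝓝 (inner ℝ y v)) := by
  have hC : 0 ≤ C := (norm_nonneg _).trans (hx 0)
  have hK : IsCompact (Set.pi Set.univ fun j : ℕ ↦ Set.Icc (-(C * ‖x j‖)) (C * ‖x j‖)) :=
    isCompact_univ_pi fun j ↦ isCompact_Icc
  have hin : ∀ k v, |inner ℝ (x k) v| ≤ C * ‖v‖ := fun k v ↦
    (abs_real_inner_le_norm _ _).trans (mul_le_mul_of_nonneg_right (hx k) (norm_nonneg _))
  obtain ⟨a, -, s, hs, ha⟩ := hK.tendsto_subseq (x := fun k j ↦ inner ℝ (x k) (x j))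
    (fun k j _ ↦ abs_le.1 (hin k (x j)))
  rw [tendsto_pi_nhds] at ha
  let S : Submodule ℝ V := Submodule.span ℝ (Set.range x)
  have h1 : ∀ v ∈ S, CauchySeq (fun k ↦ inner ℝ (x (s k)) v) := by
    intro v hv
    induction hv using Submodule.span_induction with
    | mem v hv => obtain ⟨j, rfl⟩ := hv; exact (ha j).cauchySeq
    | zero => simpa using cauchySeq_const (0 : ℝ)
    | add u v _ _ hu hv =>
      simp only [inner_add_right]; exact hu.add hv
    | smul c v _ hv => 
      simp only [inner_smul_right]
      obtain ⟨l, hl⟩ := cauchySeq_tendsto_of_complete hv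
      exact (hl.const_mul c).cauchySeq
  have h2 : ∀ v ∈ S.topologicalClosure, CauchySeq (fun k ↦ inner ℝ (x (s k)) v) := by
    intro v hv
    rw [Metric.cauchySeq_iff']
    intro ε hε
    have hv' : v ∈ closure (S : Set V) := hv
    obtain ⟨u, hu, huv⟩ := Metric.mem_closure_iff.1 hv' (ε / (4 * (C + 1))) (by positivity)
    obtain ⟨N, hN⟩ := Metric.cauchySeq_iff'.1 (h1 u hu) (ε / 2) (by positivity)
    refine ⟨N, fun k hk ↦ ?_⟩
    have e1 : ∀ k, |inner ℝ (x (s k)) (v - u)| ≤ ε / 4 := fun k ↦ by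
      refine (hin _ _).trans ?_
      rw [dist_eq_norm] at huv
      calc C * ‖v - u‖ ≤ (C + 1) * (ε / (4 * (C + 1))) := by gcongr; linarith
        _ = ε / 4 := by field_simp
    have := hN k hk
    rw [Real.dist_eq] at this ⊢
    have e2 := e1 k
    have e3 := e1 N
    simp only [inner_sub_right] at e2 e3
    rw [abs_le] at e2 e3
    rw [abs_lt] at this ⊢
    constructor <;> linarith
  have h3 : ∀ v, ∃ l, Tendsto (fun k ↦ inner ℝ (x (s k)) v) atTop (𝓝 l) := by
    intro v
    have hdec := S.topologicalClosure.starProjection_add_starProjection_orthogonal v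
    obtain ⟨l, hl⟩ := cauchySeq_tendsto_of_complete (h2 _ (S.topologicalClosure.starProjection_apply_mem v))
    refine ⟨l, hl.congr fun k ↦ ?_⟩
    conv_rhs => rw [← hdec]
    rw [inner_add_right, Submodule.inner_right_of_mem_orthogonal (K := S.topologicalClosure)
      (S.le_topologicalClosure (Submodule.subset_span ⟨_, rfl⟩)) (Submodule.starProjection_apply_mem _ v), add_zero]
  choose l hl using h3
  let L : V →ₗ[ℝ] ℝ :=
    { toFun := l
      map_add' := fun u v ↦ tendsto_nhds_unique (hl (u + v)) (by
        simpa only [inner_add_right] using (hl u).add (hl v))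
      map_smul' := fun c v ↦ tendsto_nhds_unique (hl (c • v)) (by
        simpa only [inner_smul_right, smul_eq_mul, RingHom.id_apply] using (hl v).const_mul c) }
  let L' : V →L[ℝ] ℝ := L.mkContinuous C fun v ↦
    le_of_tendsto (hl v).abs (Eventually.of_forall fun k ↦ hin _ _)
  refine ⟨s, hs, (InnerProductSpace.toDual ℝ V).symm L', fun v ↦ ?_⟩
  rw [InnerProductSpace.toDual_symm_apply]
  exact hl v
theorem lagrange {V : Type*} [NormedAddCommGroup V] [InnerProductSpace ℝ V]
    (S : Submodule ℝ V) (x : V) (hxS : x ∈ S) (d : V → ℝ)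
    (hadd : ∀ u ∈ S, ∀ v ∈ S, ∀ c : ℝ, d (u + c • v) = d u + c * d v)
    (h : ∀ y ∈ S, inner ℝ x y < 0 → d y ≤ 0) (y : V) (hy : y ∈ S) :
    d y * ‖x‖ ^ 2 = d x * inner ℝ x y := by
  by_cases hx : x = 0
  · subst hx
    have := hadd 0 S.zero_mem 0 S.zero_mem 1
    simp at this; simp [this]
  have hxp : 0 < ‖x‖ ^ 2 := by positivity
  have key : ∀ y ∈ S, inner ℝ x y = 0 → d y ≤ 0 := by
    intro y hy hxy
    refine le_of_forall_pos_le_add fun ε hε ↦ ?_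
    have h1 : ∀ c > (0:ℝ), d y ≤ c * d x := fun c hc ↦ by
      have := h (y + (-c) • x) (S.add_mem hy (S.smul_mem _ hxS)) (by
        rw [inner_add_right, inner_smul_right, hxy, real_inner_self_eq_norm_sq]; nlinarith)
      rw [hadd y hy x hxS] at this; linarith
    by_cases hd : d x ≤ 0
    · have := h1 1 one_pos; linarith
    · push Not at hd
      have := h1 (ε / d x) (by positivity)
      rw [div_mul_cancel₀ _ hd.ne'] at this; linarith
  set c := inner ℝ x y / ‖x‖ ^ 2 with hc
  have hc' : inner ℝ x y = c * ‖x‖ ^ 2 := by rw [hc]; field_simp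
  have hz : inner ℝ x (y + (-c) • x) = 0 := by
    rw [inner_add_right, inner_smul_right, real_inner_self_eq_norm_sq, hc']; ring
  have hzS : y + (-c) • x ∈ S := S.add_mem hy (S.smul_mem _ hxS)
  have h1 := key _ hzS hz
  have h2 := key _ (S.neg_mem hzS) (by rw [inner_neg_right, hz, neg_zero])
  have h3 : d (-(y + (-c) • x)) = - d (y + (-c) • x) := by
    have := hadd 0 S.zero_mem _ hzS (-1)
    have h0 := hadd 0 S.zero_mem 0 S.zero_mem 1
    simp at h0 
    rw [zero_add, neg_one_smul, h0] at this; linarith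
  rw [h3] at h2
  rw [hadd y hy x hxS] at h1 h2
  have : d y = c * d x := by linarith
  rw [this, hc']; ring
end Heis
namespace Heis
abbrev DD : Set ℂ := Metric.ball (0:ℂ) 1
def fD (z : ℂ) : ℝ := 1 - ‖z‖ ^ 2
def bet (k : ℕ) : Measure ℂ := (volume.restrict DD).withDensity (fun z ↦ ENNReal.ofReal (fD z ^ k))
def NN (k : ℕ) : ℝ := (k:ℝ) + 1
structure Core (φ : ℂ → ℝ) : Prop where
  cd : ContDiff ℝ 1 φ
  cpt : HasCompactSupport φ
  sub : tsupport φ ⊆ DD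
def gr (φ : ℂ → ℝ) (z : ℂ) : ℂ := ⟨fderiv ℝ φ z 1, fderiv ℝ φ z Complex.I⟩
abbrev VV (k : ℕ) := WithLp 2 (Lp ℝ 2 (bet k) × Lp ℂ 2 (bet k))
theorem NN_pos (k : ℕ) : 0 < NN k := by unfold NN; positivity
theorem fD_pos {z : ℂ} (h : z ∈ DD) : 0 < fD z := by
  simp only [Metric.mem_ball, dist_zero_right] at h
  unfold fD; nlinarith [norm_nonneg z]
theorem fD_le (z : ℂ) : fD z ≤ 1 := by unfold fD; nlinarith [norm_nonneg z]
theorem fD_cd : ContDiff ℝ ⊤ fD := by unfold fD; exact contDiff_const.sub (contDiff_norm_sq ℝ)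
theorem fD_cont : Continuous fD := fD_cd.continuous
theorem bet_ae (k : ℕ) : ae (bet k) = ae (volume.restrict DD) := by
  apply le_antisymm
  · exact (withDensity_absolutelyContinuous _ _).ae_le
  · have : volume.restrict DD ≪ bet k := by
      refine withDensity_absolutelyContinuous' (by have := fD_cont; fun_prop) ?_
      filter_upwards [ae_restrict_mem measurableSet_ball] with z hz
      simp only [ne_eq, ENNReal.ofReal_eq_zero, not_le]
      exact pow_pos (fD_pos hz) k
    exact this.ae_le
theorem bet_D (k : ℕ) : ∀ᵐ z ∂(bet k), z ∈ DD := by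
  have := ae_restrict_mem (μ := (volume : Measure ℂ)) (s := DD) measurableSet_ball
  rwa [← bet_ae k] at this
theorem bet_le (k : ℕ) : bet k ≤ volume.restrict DD := by
  refine Measure.le_iff.2 fun s hs ↦ ?_
  rw [bet, withDensity_apply _ hs]
  calc _ ≤ ∫⁻ z in s, 1 ∂(volume.restrict DD) := by
        refine setLIntegral_mono_ae (by fun_prop) ?_
        filter_upwards [ae_restrict_mem measurableSet_ball] with z hz _
        rw [ENNReal.ofReal_le_one]
        exact pow_le_one₀ (fD_pos hz).le (fD_le z)
    _ = _ := by simp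
instance (k : ℕ) : IsFiniteMeasure (bet k) := by
  have : IsFiniteMeasure (volume.restrict DD) := ⟨by
    rw [Measure.restrict_apply_univ]; exact measure_ball_lt_top⟩
  exact isFiniteMeasure_of_le _ (bet_le k)
theorem bet_lint (k : ℕ) (F : ℂ → ENNReal) (hF : AEMeasurable F (volume.restrict DD)) :
    ∫⁻ z, F z ∂(bet k) = ∫⁻ z in DD, ENNReal.ofReal (fD z ^ k) * F z := by
  rw [bet, lintegral_withDensity_eq_lintegral_mul₀ (by have := fD_cont; fun_prop) hF]; rfl
theorem bet_int {E : Type*} [NormedAddCommGroup E] [NormedSpace ℝ E] (k : ℕ) (F : ℂ → E) :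
    ∫ z, F z ∂(bet k) = ∫ z in DD, (fD z ^ k) • F z := by
  rw [bet, integral_withDensity_eq_integral_toReal_smul (by have := fD_cont; fun_prop)
    (Eventually.of_forall fun z ↦ ENNReal.ofReal_lt_top)]
  refine integral_congr_ae ?_
  filter_upwards [ae_restrict_mem measurableSet_ball] with z hz
  rw [ENNReal.toReal_ofReal (pow_pos (fD_pos hz) k).le]
theorem bet_intble {E : Type*} [NormedAddCommGroup E] [NormedSpace ℝ E] (k : ℕ) (F : ℂ → E) :
    Integrable F (bet k) ↔ IntegrableOn (fun z ↦ (fD z ^ k) • F z) DD := by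
  rw [bet, integrable_withDensity_iff_integrable_smul' (by have := fD_cont; fun_prop)
    (Eventually.of_forall fun z ↦ ENNReal.ofReal_lt_top)]
  refine integrable_congr ?_
  filter_upwards [ae_restrict_mem measurableSet_ball] with z hz
  rw [ENNReal.toReal_ofReal (pow_pos (fD_pos hz) k).le]
theorem fderiv_gr (φ : ℂ → ℝ) (z v : ℂ) : fderiv ℝ φ z v = (gr φ z).re * v.re + (gr φ z).im * v.im := by
  have : v = v.re • (1:ℂ) + v.im • Complex.I := by
    apply Complex.ext <;> simp
  conv_lhs => rw [this]
  rw [map_add, map_smul, map_smul]; simp [gr]; ring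
theorem inner_C (a b : ℂ) : inner ℝ a b = a.re * b.re + a.im * b.im := by
  rw [Complex.inner]; simp; ring
theorem fderiv_gr' (φ : ℂ → ℝ) (z v : ℂ) : fderiv ℝ φ z v = inner ℝ (gr φ z) v := by
  rw [fderiv_gr, inner_C]
theorem normsq_C (a : ℂ) : ‖a‖ ^ 2 = a.re ^ 2 + a.im ^ 2 := by
  rw [← Complex.normSq_eq_norm_sq, Complex.normSq_apply]; ring
theorem gr_eq {φ : ℂ → ℝ} {z : ℂ} {L : ℂ →L[ℝ] ℝ} (h : HasFDerivAt φ L z) : gr φ z = ⟨L 1, L Complex.I⟩ := by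
  rw [gr, h.fderiv]
theorem gr_add {φ ψ : ℂ → ℝ} {z : ℂ} (h : DifferentiableAt ℝ φ z) (h' : DifferentiableAt ℝ ψ z) :
    gr (fun z ↦ φ z + ψ z) z = gr φ z + gr ψ z := by
  refine (gr_eq (h.hasFDerivAt.add h'.hasFDerivAt)).trans ?_; apply Complex.ext <;> simp [gr]
theorem gr_sub {φ ψ : ℂ → ℝ} {z : ℂ} (h : DifferentiableAt ℝ φ z) (h' : DifferentiableAt ℝ ψ z) :
    gr (fun z ↦ φ z - ψ z) z = gr φ z - gr ψ z := by
  refine (gr_eq (h.hasFDerivAt.sub h'.hasFDerivAt)).trans ?_; apply Complex.ext <;> simp [gr]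
theorem gr_mul {φ ψ : ℂ → ℝ} {z : ℂ} (h : DifferentiableAt ℝ φ z) (h' : DifferentiableAt ℝ ψ z) :
    gr (fun z ↦ φ z * ψ z) z = (φ z : ℂ) * gr ψ z + (ψ z : ℂ) * gr φ z := by
  refine (gr_eq (h.hasFDerivAt.mul h'.hasFDerivAt)).trans ?_; apply Complex.ext <;> simp [gr]
theorem gr_const_mul {φ : ℂ → ℝ} {z : ℂ} (c : ℝ) (h : DifferentiableAt ℝ φ z) :
    gr (fun z ↦ c * φ z) z = (c : ℂ) * gr φ z := by
  rw [gr_eq (h.hasFDerivAt.const_mul c)]; apply Complex.ext <;> simp [gr]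
theorem gr_comp {φ : ℂ → ℝ} {g : ℝ → ℝ} {g' : ℝ} {z : ℂ} (hg : HasDerivAt g g' (φ z)) (h : DifferentiableAt ℝ φ z) :
    gr (fun z ↦ g (φ z)) z = (g' : ℂ) * gr φ z := by
  refine (gr_eq (hg.comp_hasFDerivAt z h.hasFDerivAt)).trans ?_; apply Complex.ext <;> simp [gr]
theorem gr_cont {φ : ℂ → ℝ} (h : ContDiff ℝ 1 φ) : Continuous (gr φ) := by
  have h1 := (h.continuous_fderiv one_ne_zero).clm_apply (continuous_const (y := (1:ℂ)))
  have h2 := (h.continuous_fderiv one_ne_zero).clm_apply (continuous_const (y := Complex.I))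
  have : gr φ = fun z ↦ (fderiv ℝ φ z 1 : ℂ) + (fderiv ℝ φ z Complex.I : ℂ) * Complex.I := by
    funext z; apply Complex.ext <;> simp [gr]
  rw [this]
  fun_prop
theorem gr_supp (φ : ℂ → ℝ) {z : ℂ} (h : z ∉ tsupport φ) : gr φ z = 0 := by
  have := image_eq_zero_of_notMem_tsupport (fun h' ↦ h (tsupport_fderiv_subset ℝ h'))
  simp [gr, this]; rfl
theorem norm_fderiv_le_gr (φ : ℂ → ℝ) (z : ℂ) : ‖fderiv ℝ φ z‖ ≤ ‖gr φ z‖ := by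
  refine ContinuousLinearMap.opNorm_le_bound _ (norm_nonneg _) fun v ↦ ?_
  rw [fderiv_gr']; exact norm_inner_le_norm _ _
namespace Core
theorem diff {φ : ℂ → ℝ} (h : Core φ) : Differentiable ℝ φ := h.cd.differentiable one_ne_zero
theorem cont {φ : ℂ → ℝ} (h : Core φ) : Continuous φ := h.cd.continuous
theorem grc {φ : ℂ → ℝ} (h : Core φ) : Continuous (gr φ) := gr_cont h.cd
theorem grs {φ : ℂ → ℝ} (h : Core φ) : HasCompactSupport (gr φ) :=
  h.cpt.mono' fun z hz ↦ by
    by_contra h'; exact hz (gr_supp φ h')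
theorem add {φ ψ : ℂ → ℝ} (h : Core φ) (h' : Core ψ) : Core (fun z ↦ φ z + ψ z) where
  cd := h.cd.add h'.cd
  cpt := h.cpt.add h'.cpt
  sub := (tsupport_add φ ψ).trans (Set.union_subset h.sub h'.sub)
theorem smul {φ : ℂ → ℝ} (h : Core φ) (c : ℝ) : Core (fun z ↦ c * φ z) where
  cd := contDiff_const.mul h.cd
  cpt := h.cpt.mul_left
  sub := (tsupport_mul_subset_right (f := fun _ : ℂ ↦ c) (g := φ)).trans h.sub
theorem neg {φ : ℂ → ℝ} (h : Core φ) : Core (fun z ↦ - φ z) := by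
  simpa using h.smul (-1)
theorem sub' {φ ψ : ℂ → ℝ} (h : Core φ) (h' : Core ψ) : Core (fun z ↦ φ z - ψ z) := by
  simpa [sub_eq_add_neg] using h.add h'.neg
theorem mul {φ ψ : ℂ → ℝ} (h : Core φ) (h' : ContDiff ℝ 1 ψ) : Core (fun z ↦ ψ z * φ z) where
  cd := h'.mul h.cd
  cpt := h.cpt.mul_left
  sub := (tsupport_mul_subset_right (f := ψ) (g := φ)).trans h.sub
theorem comp {φ : ℂ → ℝ} (h : Core φ) {g : ℝ → ℝ} (hg : ContDiff ℝ 1 g) (h0 : g 0 = 0) : Core (fun z ↦ g (φ z)) where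
  cd := hg.comp h.cd
  cpt := h.cpt.comp_left h0
  sub := (closure_mono (Function.support_comp_subset h0 φ)).trans h.sub
theorem zero : Core (fun _ ↦ 0) := ⟨contDiff_const, HasCompactSupport.zero, by simp [tsupport]⟩
theorem eq0 {φ : ℂ → ℝ} (h : Core φ) {z : ℂ} (hz : z ∉ DD) : φ z = 0 :=
  image_eq_zero_of_notMem_tsupport (fun h' ↦ hz (h.sub h'))
theorem gr0 {φ : ℂ → ℝ} (h : Core φ) {z : ℂ} (hz : z ∉ DD) : gr φ z = 0 :=
  gr_supp φ (fun h' ↦ hz (h.sub h'))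
theorem rad {φ : ℂ → ℝ} (h : Core φ) : ∃ R, 0 < R ∧ R < 1 ∧ ∀ z, R ≤ ‖z‖ → z ∉ tsupport φ := by
  obtain ⟨R, hR, hR'⟩ : ∃ R < 1, tsupport φ ⊆ Metric.closedBall 0 R := by
    by_cases hn : (tsupport φ).Nonempty
    · obtain ⟨z, hz, hm⟩ := h.cpt.isCompact.exists_isMaxOn hn continuous_norm.continuousOn
      refine ⟨‖z‖, by simpa using h.sub hz, fun y hy ↦ by simpa using hm hy⟩
    · rw [Set.not_nonempty_iff_eq_empty] at hn
      exact ⟨0, one_pos, by simp [hn]⟩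
  refine ⟨max ((R + 1) / 2) (1/2), by positivity, by rw [max_lt_iff]; constructor <;> linarith, fun z hz hz' ↦ ?_⟩
  have := hR' hz'
  simp only [Metric.mem_closedBall, dist_zero_right] at this
  have := (le_max_left _ _).trans hz
  linarith
end Core
def sf (z : ℂ) : ℝ := Real.sqrt (fD z)
theorem sf_cont : Continuous sf := fD_cont.sqrt
theorem sf_le (z : ℂ) : sf z ≤ 1 := Real.sqrt_le_one.2 (fD_le z)
theorem sf_nn (z : ℂ) : 0 ≤ sf z := Real.sqrt_nonneg _
theorem sf_sq {z : ℂ} (h : z ∈ DD) : sf z ^ 2 = fD z := Real.sq_sqrt (fD_pos h).le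
theorem sf_pos {z : ℂ} (h : z ∈ DD) : 0 < sf z := Real.sqrt_pos.2 (fD_pos h)
theorem memLp_cs {E : Type*} [NormedAddCommGroup E] {F : ℂ → E} (h : Continuous F)
    (hc : HasCompactSupport F) (k : ℕ) (p : ENNReal) : MemLp F p (bet k) := by
  obtain ⟨C, hC⟩ := h.bounded_above_of_compact_support hc
  exact MemLp.of_bound h.aestronglyMeasurable C (Eventually.of_forall hC)
theorem Core.mL {φ : ℂ → ℝ} (h : Core φ) (k : ℕ) : MemLp (fun z ↦ NN k * φ z) 2 (bet k) :=
  memLp_cs (h.smul (NN k)).cont (h.smul (NN k)).cpt k 2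
theorem Core.mG {φ : ℂ → ℝ} (h : Core φ) (k : ℕ) : MemLp (fun z ↦ (sf z : ℂ) * gr φ z) 2 (bet k) :=
  memLp_cs (by have := h.grc; have := sf_cont; fun_prop) h.grs.mul_left k 2
def emb (k : ℕ) (φ : ℂ → ℝ) (h : Core φ) : VV k := WithLp.toLp 2 ((h.mL k).toLp _, (h.mG k).toLp _)
def wf {k : ℕ} (x : VV k) (z : ℂ) : ℝ := x.fst z / NN k
def gf {k : ℕ} (x : VV k) (z : ℂ) : ℂ := x.snd z
theorem emb_w (k : ℕ) {φ : ℂ → ℝ} (h : Core φ) : wf (emb k φ h) =ᵐ[bet k] φ := by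
  filter_upwards [(h.mL k).coeFn_toLp] with z hz
  have : (emb k φ h).fst z = NN k * φ z := hz
  rw [wf, this, mul_div_cancel_left₀ _ (NN_pos k).ne']
theorem emb_g (k : ℕ) {φ : ℂ → ℝ} (h : Core φ) : gf (emb k φ h) =ᵐ[bet k] fun z ↦ (sf z : ℂ) * gr φ z := by
  filter_upwards [(h.mG k).coeFn_toLp] with z hz
  exact hz
theorem wf_mem {k : ℕ} (x : VV k) : MemLp (wf x) 2 (bet k) := by
  have := (Lp.memLp x.fst).const_mul (NN k)⁻¹
  refine this.ae_eq (Eventually.of_forall fun z ↦ ?_)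
  simp [wf, div_eq_inv_mul]
theorem gf_mem {k : ℕ} (x : VV k) : MemLp (gf x) 2 (bet k) := Lp.memLp x.snd
theorem wf_add {k : ℕ} (x y : VV k) : wf (x + y) =ᵐ[bet k] fun z ↦ wf x z + wf y z := by
  filter_upwards [Lp.coeFn_add x.fst y.fst] with z hz
  simp only [wf, WithLp.add_fst, hz, Pi.add_apply, add_div]
theorem wf_sub {k : ℕ} (x y : VV k) : wf (x - y) =ᵐ[bet k] fun z ↦ wf x z - wf y z := by
  filter_upwards [Lp.coeFn_sub x.fst y.fst] with z hz
  simp only [wf, WithLp.sub_fst, hz, Pi.sub_apply, sub_div]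
theorem wf_smul {k : ℕ} (c : ℝ) (x : VV k) : wf (c • x) =ᵐ[bet k] fun z ↦ c * wf x z := by
  filter_upwards [Lp.coeFn_smul c x.fst] with z hz
  simp only [wf, WithLp.smul_fst, hz, Pi.smul_apply, smul_eq_mul, mul_div_assoc]
theorem mm {f g : ℂ → ℝ} {k : ℕ} (hf : MemLp f 2 (bet k)) (hg : MemLp g 2 (bet k)) :
    Integrable (fun z ↦ f z * g z) (bet k) := hf.integrable_mul hg
theorem inner_VV {k : ℕ} (x y : VV k) : inner ℝ x y =
    (NN k ^ 2 * ∫ z, wf x z * wf y z ∂(bet k)) + ∫ z, inner ℝ (gf x z) (gf y z) ∂(bet k) := by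
  rw [WithLp.prod_inner_apply, L2.inner_def, L2.inner_def, ← integral_const_mul]
  congr 1
  refine integral_congr_ae (Eventually.of_forall fun z ↦ ?_)
  have := NN_pos k
  simp only [wf]; simp; field_simp
theorem norm_VV {k : ℕ} (x : VV k) : ‖x‖ ^ 2 =
    (NN k ^ 2 * ∫ z, wf x z ^ 2 ∂(bet k)) + ∫ z, ‖gf x z‖ ^ 2 ∂(bet k) := by
  rw [← real_inner_self_eq_norm_sq, inner_VV]
  simp only [real_inner_self_eq_norm_sq, sq]
theorem inner_emb {k : ℕ} (x : VV k) {φ : ℂ → ℝ} (h : Core φ) : inner ℝ x (emb k φ h) =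
    (NN k ^ 2 * ∫ z, wf x z * φ z ∂(bet k)) + ∫ z, inner ℝ (gf x z) ((sf z : ℂ) * gr φ z) ∂(bet k) := by
  rw [inner_VV]
  congr 1
  · congr 1; exact integral_congr_ae (by filter_upwards [emb_w k h] with z hz; rw [hz])
  · exact integral_congr_ae (by filter_upwards [emb_g k h] with z hz; rw [hz])
theorem norm_emb {k : ℕ} {φ : ℂ → ℝ} (h : Core φ) : ‖emb k φ h‖ ^ 2 =
    (NN k ^ 2 * ∫ z, φ z ^ 2 ∂(bet k)) + ∫ z, ‖(sf z : ℂ) * gr φ z‖ ^ 2 ∂(bet k) := by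
  rw [norm_VV]
  congr 1
  · congr 1; exact integral_congr_ae (by filter_upwards [emb_w k h] with z hz; rw [hz])
  · exact integral_congr_ae (by filter_upwards [emb_g k h] with z hz; rw [hz])
theorem VV_ext {k : ℕ} {x y : VV k} (h : wf x =ᵐ[bet k] wf y) (h' : gf x =ᵐ[bet k] gf y) : x = y := by
  have h1 : x.fst = y.fst := Lp.ext (by
    filter_upwards [h] with z hz
    simp only [wf] at hz
    have := NN_pos k
    field_simp at hz; exact hz)
  have h2 : x.snd = y.snd := Lp.ext h'
  exact WithLp.ofLp_injective 2 (Prod.ext h1 h2)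
theorem emb_add {k : ℕ} {φ ψ : ℂ → ℝ} (h : Core φ) (h' : Core ψ) :
    emb k φ h + emb k ψ h' = emb k _ (h.add h') := by
  apply VV_ext
  · filter_upwards [wf_add (emb k φ h) (emb k ψ h'), emb_w k h, emb_w k h', emb_w k (h.add h')] with z h1 h2 h3 h4
    rw [h1, h2, h3, h4]
  · filter_upwards [Lp.coeFn_add (emb k φ h).snd (emb k ψ h').snd, emb_g k h, emb_g k h', emb_g k (h.add h')] with z h1 h2 h3 h4
    rw [h4, gr_add h.diff.differentiableAt h'.diff.differentiableAt]
    simp only [gf] at *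
    rw [WithLp.add_snd, h1, Pi.add_apply, h2, h3]; ring
theorem emb_smul {k : ℕ} {φ : ℂ → ℝ} (h : Core φ) (c : ℝ) :
    c • emb k φ h = emb k _ (h.smul c) := by
  apply VV_ext
  · filter_upwards [wf_smul c (emb k φ h), emb_w k h, emb_w k (h.smul c)] with z h1 h2 h4
    rw [h1, h2, h4]
  · filter_upwards [Lp.coeFn_smul c (emb k φ h).snd, emb_g k h, emb_g k (h.smul c)] with z h1 h2 h4
    rw [h4, gr_const_mul c h.diff.differentiableAt]
    simp only [gf] at *
    rw [WithLp.smul_snd, h1, Pi.smul_apply, h2, Complex.real_smul]; ring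
theorem emb_sub {k : ℕ} {φ ψ : ℂ → ℝ} (h : Core φ) (h' : Core ψ) :
    emb k φ h - emb k ψ h' = emb k _ (h.sub' h') := by
  rw [sub_eq_add_neg, ← neg_one_smul ℝ, emb_smul, emb_add]
  congr 1; funext z; ring
def Hc (k : ℕ) : Submodule ℝ (VV k) where
  carrier := {x | ∃ φ, ∃ h : Core φ, x = emb k φ h}
  add_mem' := by
    rintro _ _ ⟨φ, h, rfl⟩ ⟨ψ, h', rfl⟩
    exact ⟨_, _, emb_add h h'⟩
  zero_mem' := ⟨_, Core.zero.smul 0, by rw [← emb_smul Core.zero, zero_smul]⟩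
  smul_mem' := by
    rintro c _ ⟨φ, h, rfl⟩
    exact ⟨_, _, emb_smul h c⟩
def HH (k : ℕ) : Submodule ℝ (VV k) := (Hc k).topologicalClosure
theorem emb_HH {k : ℕ} {φ : ℂ → ℝ} (h : Core φ) : emb k φ h ∈ HH k :=
  (Hc k).le_topologicalClosure ⟨φ, h, rfl⟩
theorem HH_approx {k : ℕ} {x : VV k} (hx : x ∈ HH k) {ε : ℝ} (hε : 0 < ε) :
    ∃ φ, ∃ h : Core φ, ‖x - emb k φ h‖ < ε := by
  have hx' : x ∈ closure (Hc k : Set (VV k)) := hx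
  obtain ⟨_, ⟨φ, h, rfl⟩, h2⟩ := Metric.mem_closure_iff.1 hx' ε hε
  exact ⟨φ, h, by rwa [← dist_eq_norm]⟩
theorem HH_seq {k : ℕ} {x : VV k} (hx : x ∈ HH k) :
    ∃ φ : ℕ → ℂ → ℝ, ∃ h : ∀ j, Core (φ j), Tendsto (fun j ↦ emb k (φ j) (h j)) atTop (𝓝 x) := by
  choose φ h hφ using fun j : ℕ ↦ HH_approx hx (ε := 1 / ((j:ℝ) + 1)) (by positivity)
  refine ⟨φ, h, ?_⟩
  rw [tendsto_iff_norm_sub_tendsto_zero]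
  refine squeeze_zero (fun _ ↦ norm_nonneg _) (fun j ↦ ?_) tendsto_one_div_add_atTop_nhds_zero_nat
  rw [norm_sub_rev]; exact (hφ j).le
end Heis
namespace Heis
theorem sq_int_le {α : Type*} [MeasurableSpace α] (ν : Measure α) [IsFiniteMeasure ν] (F : α → ℝ)
    (h1 : Integrable F ν) (h2 : Integrable (fun a ↦ F a ^ 2) ν) :
    (∫ a, F a ∂ν) ^ 2 ≤ ν.real Set.univ * ∫ a, F a ^ 2 ∂ν := by
  have key : ∀ t : ℝ, 0 ≤ (∫ a, F a ^ 2 ∂ν) - 2 * t * (∫ a, F a ∂ν) + t ^ 2 * ν.real Set.univ := by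
    intro t
    have : ∫ a, (F a - t) ^ 2 ∂ν = (∫ a, F a ^ 2 ∂ν) - 2 * t * (∫ a, F a ∂ν) + t ^ 2 * ν.real Set.univ := by
      have e : ∀ a, (F a - t) ^ 2 = (F a ^ 2 - (2 * t) * F a) + t ^ 2 := fun a ↦ by ring
      simp_rw [e]
      rw [integral_add (by exact h2.sub (h1.const_mul _)) (integrable_const _), integral_sub h2 (h1.const_mul _),
        integral_const_mul]
      simp [mul_comm]
    rw [← this]; exact integral_nonneg fun a ↦ sq_nonneg _
  by_cases hV : ν.real Set.univ = 0
  · have : ν = 0 := by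
      rw [← Measure.measure_univ_eq_zero]
      rwa [measureReal_eq_zero_iff] at hV
    simp [this]
  · have hV' : 0 < ν.real Set.univ := lt_of_le_of_ne measureReal_nonneg (Ne.symm hV)
    have := key ((∫ a, F a ∂ν) / ν.real Set.univ)
    field_simp at this
    nlinarith
theorem seg_le {u : ℂ → ℝ} (hu : ContDiff ℝ 1 u) (a b : ℂ) :
    ENNReal.ofReal ((u b - u a) ^ 2) ≤ ENNReal.ofReal (‖b - a‖ ^ 2) *
      ∫⁻ t in Set.Icc (0:ℝ) 1, ENNReal.ofReal (‖gr u (a + (t:ℂ) * (b - a))‖ ^ 2) := by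
  have hline : Continuous fun t : ℝ ↦ a + (t:ℂ) * (b - a) := by fun_prop
  have hgc : Continuous fun t : ℝ ↦ gr u (a + (t:ℂ) * (b - a)) := (gr_cont hu).comp hline
  have hder : ∀ t : ℝ, HasDerivAt (fun t : ℝ ↦ u (a + (t:ℂ) * (b - a)))
      (inner ℝ (gr u (a + (t:ℂ) * (b - a))) (b - a)) t := by
    intro t
    have h1 : HasDerivAt (fun t : ℝ ↦ a + (t:ℂ) * (b - a)) (b - a) t := by
      simpa using ((Complex.ofRealCLM.hasDerivAt (x := t)).mul_const (b - a)).const_add a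
    have := ((hu.differentiable one_ne_zero) (a + (t:ℂ) * (b - a))).hasFDerivAt.comp_hasDerivAt t h1
    rwa [fderiv_gr'] at this
  have hF : Continuous fun t : ℝ ↦ (inner ℝ (gr u (a + (t:ℂ) * (b - a))) (b - a) : ℝ) := by fun_prop
  have ftc : u b - u a = ∫ t in (0:ℝ)..1, (inner ℝ (gr u (a + (t:ℂ) * (b - a))) (b - a) : ℝ) := by
    rw [intervalIntegral.integral_eq_sub_of_hasDerivAt (fun t _ ↦ hder t) (hF.intervalIntegrable _ _)]
    simp
  rw [intervalIntegral.integral_of_le zero_le_one, ← integral_Icc_eq_integral_Ioc] at ftc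
  have i1 : ∀ g : ℝ → ℝ, Continuous g → Integrable g (volume.restrict (Set.Icc (0:ℝ) 1)) :=
    fun g hg ↦ hg.integrableOn_Icc
  have hle := sq_int_le (volume.restrict (Set.Icc (0:ℝ) 1)) _ (i1 _ hF) (i1 _ (hF.pow 2))
  rw [← ftc] at hle
  simp only [measureReal_restrict_apply_univ, Real.volume_real_Icc, sub_zero, max_eq_left zero_le_one, one_mul] at hle
  rw [← ofReal_integral_eq_lintegral_ofReal (i1 (fun t ↦ ‖gr u (a + (t:ℂ) * (b - a))‖ ^ 2) (hgc.norm.pow 2)) (Eventually.of_forall fun t ↦ by positivity),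
    ← ENNReal.ofReal_mul (by positivity), ← integral_const_mul]
  refine ENNReal.ofReal_le_ofReal (hle.trans (integral_mono (i1 _ (hF.pow 2)) (i1 _ (by fun_prop)) fun t ↦ ?_))
  have := abs_real_inner_le_norm (gr u (a + (t:ℂ) * (b - a))) (b - a)
  rw [← sq_abs]
  calc _ ≤ (‖gr u (a + (t:ℂ) * (b - a))‖ * ‖b - a‖) ^ 2 := by gcongr
    _ = _ := by ring
theorem trans_le {u : ℂ → ℝ} (hu : ContDiff ℝ 1 u) (y : ℂ) :
    ∫⁻ x, ENNReal.ofReal ((u x - u (x + y)) ^ 2) ≤ ENNReal.ofReal (‖y‖ ^ 2) *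
      ∫⁻ x, ENNReal.ofReal (‖gr u x‖ ^ 2) := by
  have hg := gr_cont hu
  calc _ ≤ ∫⁻ x, ENNReal.ofReal (‖y‖ ^ 2) *
      ∫⁻ t in Set.Icc (0:ℝ) 1, ENNReal.ofReal (‖gr u (x + (t:ℂ) * y)‖ ^ 2) := by
        refine lintegral_mono fun x ↦ ?_
        have := seg_le hu x (x + y)
        rw [add_sub_cancel_left] at this
        convert this using 2
        ring
    _ = ENNReal.ofReal (‖y‖ ^ 2) * ∫⁻ t in Set.Icc (0:ℝ) 1, ∫⁻ x, ENNReal.ofReal (‖gr u (x + (t:ℂ) * y)‖ ^ 2) := by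
        rw [lintegral_const_mul' _ _ ENNReal.ofReal_ne_top, lintegral_lintegral_swap]
        exact (ENNReal.continuous_ofReal.comp (by fun_prop : Continuous fun p : ℂ × ℝ ↦ ‖gr u (p.1 + (p.2:ℂ) * y)‖ ^ 2)).measurable.aemeasurable
    _ = _ := by
        congr 1
        simp_rw [fun t : ℝ ↦ lintegral_add_right_eq_self (μ := (volume : Measure ℂ))
          (fun x ↦ ENNReal.ofReal (‖gr u x‖ ^ 2)) ((t:ℂ) * y)]
        simp
theorem rell_h {d : ℂ → ℝ} (hd : ContDiff ℝ 1 d) {h : ℝ} (hh : 0 < h) :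
    ∫⁻ x, ENNReal.ofReal (d x ^ 2) ≤ ENNReal.ofReal (2 * h ^ 2) * (∫⁻ x, ENNReal.ofReal (‖gr d x‖ ^ 2)) +
      ENNReal.ofReal (2 / (volume.real (Metric.ball (0:ℂ) h)) ^ 2) *
        ∫⁻ x, ENNReal.ofReal ((∫ y in Metric.ball (0:ℂ) h, d (x + y)) ^ 2) := by
  set V := volume.real (Metric.ball (0:ℂ) h) with hV
  have hVp : 0 < V := by
    rw [hV]; exact ENNReal.toReal_pos (Metric.measure_ball_pos _ _ hh).ne' measure_ball_lt_top.ne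
  have hdc := hd.continuous
  have fin : IsFiniteMeasure (volume.restrict (Metric.ball (0:ℂ) h)) := ⟨by
    rw [Measure.restrict_apply_univ]; exact measure_ball_lt_top⟩
  have ib : ∀ g : ℂ → ℝ, Continuous g → Integrable g (volume.restrict (Metric.ball (0:ℂ) h)) := fun g hg ↦
    (hg.continuousOn.integrableOn_compact (isCompact_closedBall (0:ℂ) h)).mono_set Metric.ball_subset_closedBall
  have pt : ∀ x, ENNReal.ofReal (d x ^ 2) ≤ ENNReal.ofReal (2 / V) * (∫⁻ y in Metric.ball (0:ℂ) h, ENNReal.ofReal ((d x - d (x + y)) ^ 2))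
      + ENNReal.ofReal (2 / V ^ 2) * ENNReal.ofReal ((∫ y in Metric.ball (0:ℂ) h, d (x + y)) ^ 2) := by
    intro x
    have c1 : Continuous fun y ↦ d x - d (x + y) := by fun_prop
    rw [← ofReal_integral_eq_lintegral_ofReal (ib (fun y ↦ (d x - d (x + y)) ^ 2) (c1.pow 2)) (Eventually.of_forall fun t ↦ by positivity),
      ← ENNReal.ofReal_mul (by positivity), ← ENNReal.ofReal_mul (by positivity), ← ENNReal.ofReal_add
      (mul_nonneg (by positivity) (integral_nonneg fun _ ↦ sq_nonneg _)) (by positivity)]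
    apply ENNReal.ofReal_le_ofReal
    have h1 := sq_int_le _ _ (ib _ c1) (ib _ (c1.pow 2))
    have h2 : d x * V = (∫ y in Metric.ball (0:ℂ) h, (d x - d (x + y))) + ∫ y in Metric.ball (0:ℂ) h, d (x + y) := by
      rw [← integral_add (ib _ c1) (ib _ (by fun_prop))]
      simp [mul_comm, hV]
    rw [measureReal_restrict_apply_univ, ← hV] at h1
    set A := ∫ y in Metric.ball (0:ℂ) h, (d x - d (x + y))
    set B := ∫ y in Metric.ball (0:ℂ) h, d (x + y)
    set I := ∫ y in Metric.ball (0:ℂ) h, (d x - d (x + y)) ^ 2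
    have h3 : (d x * V) ^ 2 ≤ 2 * (V * I) + 2 * B ^ 2 := by
      rw [h2]; nlinarith [sq_nonneg (A - B)]
    rw [show 2 / V * I + 2 / V ^ 2 * B ^ 2 = (2 * (V * I) + 2 * B ^ 2) / V ^ 2 by field_simp]
    rw [le_div_iff₀ (by positivity)]; linarith
  have m1 : Measurable fun p : ℂ × ℂ ↦ ENNReal.ofReal ((d p.1 - d (p.1 + p.2)) ^ 2) :=
    (ENNReal.continuous_ofReal.comp (by fun_prop)).measurable
  calc _ ≤ _ := lintegral_mono pt
    _ = ENNReal.ofReal (2 / V) * (∫⁻ y in Metric.ball (0:ℂ) h, ∫⁻ x, ENNReal.ofReal ((d x - d (x + y)) ^ 2))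
      + ENNReal.ofReal (2 / V ^ 2) * ∫⁻ x, ENNReal.ofReal ((∫ y in Metric.ball (0:ℂ) h, d (x + y)) ^ 2) := by
        rw [lintegral_add_left (by exact (m1.lintegral_prod_right').const_mul _), lintegral_const_mul' _ _ ENNReal.ofReal_ne_top, lintegral_const_mul' _ _ ENNReal.ofReal_ne_top,
          lintegral_lintegral_swap m1.aemeasurable]
    _ ≤ _ := by
        refine add_le_add ?_ le_rfl
        calc _ ≤ ENNReal.ofReal (2 / V) * (∫⁻ y in Metric.ball (0:ℂ) h, ENNReal.ofReal (h ^ 2) * ∫⁻ x, ENNReal.ofReal (‖gr d x‖ ^ 2)) := by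
              refine mul_le_mul_right (setLIntegral_mono' measurableSet_ball fun y hy ↦ ?_) _
              refine (trans_le hd y).trans ?_
              gcongr
              simpa using (Metric.mem_ball.1 hy).le
          _ = ENNReal.ofReal (2 * h ^ 2) * (∫⁻ x, ENNReal.ofReal (‖gr d x‖ ^ 2)) := by
              rw [setLIntegral_const, ← ENNReal.ofReal_toReal (measure_ball_lt_top (μ := (volume:Measure ℂ)) (x := 0) (r := h)).ne,
                mul_comm _ (ENNReal.ofReal _), ← mul_assoc, ← mul_assoc, ← ENNReal.ofReal_mul (by positivity), ← ENNReal.ofReal_mul (by positivity)]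
              congr 2
              change 2 / V * V * h ^ 2 = _
              field_simp
theorem poin {u : ℂ → ℝ} (hu : ContDiff ℝ 1 u) (R : ℝ) (hR : R ≤ 1) :
    ∫⁻ x in Metric.ball (0:ℂ) R, ∫⁻ y in Metric.ball (0:ℂ) R, ENNReal.ofReal ((u x - u y) ^ 2) ≤
      16 * volume (Metric.ball (0:ℂ) R) * ∫⁻ x in Metric.ball (0:ℂ) R, ENNReal.ofReal (‖gr u x‖ ^ 2) := by
  set B := Metric.ball (0:ℂ) R with hB
  have hgc := gr_cont hu
  set F : ℂ → ENNReal := B.indicator (fun x ↦ ENNReal.ofReal (‖gr u x‖ ^ 2)) with hF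
  have hFm : Measurable F := (ENNReal.continuous_ofReal.comp (by fun_prop : Continuous fun x ↦ ‖gr u x‖ ^ 2)).measurable.indicator measurableSet_ball
  have sc : ∀ t : ℝ, 1/2 ≤ t → ∀ c : ℂ, ∫⁻ y, F (c + (t:ℂ) * y) ≤ 4 * ∫⁻ y, F y := by
    intro t ht c
    have ht0 : t ≠ 0 := by linarith
    have h1 : ∫⁻ y, F (c + (t:ℂ) * y) = ∫⁻ y, F (c + y) ∂(Measure.map (fun y : ℂ ↦ t • y) volume) := by
      rw [lintegral_map (by fun_prop) (by fun_prop)]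
      simp
    rw [h1, Measure.map_addHaar_smul _ ht0, lintegral_smul_measure, lintegral_add_left_eq_self (μ := (volume : Measure ℂ)) F c]
    simp only [Complex.finrank_real_complex, smul_eq_mul]
    gcongr
    rw [show (4:ENNReal) = ENNReal.ofReal 4 by simp]
    apply ENNReal.ofReal_le_ofReal
    rw [abs_of_nonneg (by positivity), inv_le_comm₀ (by positivity) (by norm_num)]
    nlinarith
  have key : ∀ t ∈ Set.Icc (0:ℝ) 1, ∫⁻ x in B, ∫⁻ y in B, F (x + (t:ℂ) * (y - x)) ≤ 4 * volume B * ∫⁻ y, F y := by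
    have one : ∀ t ∈ Set.Icc (1/2:ℝ) 1, ∀ x : ℂ, ∫⁻ y in B, F (x + (t:ℂ) * (y - x)) ≤ 4 * ∫⁻ y, F y := fun t ht x ↦
      (setLIntegral_le_lintegral _ _).trans (by
        refine le_trans (le_of_eq ?_) (sc t ht.1 (x - t * x))
        congr 1; funext y; congr 1; ring)
    have two : ∀ t ∈ Set.Icc (1/2:ℝ) 1, ∫⁻ x in B, ∫⁻ y in B, F (x + (t:ℂ) * (y - x)) ≤ 4 * volume B * ∫⁻ y, F y := fun t ht ↦ by
      calc _ ≤ ∫⁻ x in B, 4 * ∫⁻ y, F y := lintegral_mono fun x ↦ one t ht x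
        _ = _ := by rw [setLIntegral_const]; ring
    intro t ht
    rcases le_total (1/2) t with h | h
    · exact two t ⟨h, ht.2⟩
    · rw [lintegral_lintegral_swap (by exact (hFm.comp (by fun_prop : Measurable fun p : ℂ × ℂ ↦ p.1 + (t:ℂ) * (p.2 - p.1))).aemeasurable)]
      refine le_trans (le_of_eq ?_) (two (1 - t) ⟨by linarith, by linarith [ht.1]⟩)
      congr 1; funext x; congr 1; funext y; congr 1; push_cast; ring
  calc _ ≤ ∫⁻ x in B, ∫⁻ y in B, 4 * ∫⁻ t in Set.Icc (0:ℝ) 1, F (x + (t:ℂ) * (y - x)) := by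
        refine setLIntegral_mono' measurableSet_ball fun x hx ↦ setLIntegral_mono' measurableSet_ball fun y hy ↦ ?_
        have := seg_le hu x y
        rw [show (u y - u x) ^ 2 = (u x - u y) ^ 2 by ring, norm_sub_rev] at this
        refine this.trans ?_
        gcongr ?_ * ?_
        · rw [show (4:ENNReal) = ENNReal.ofReal 4 by simp]
          apply ENNReal.ofReal_le_ofReal
          simp only [hB, Metric.mem_ball, dist_zero_right] at hx hy
          have := norm_sub_le x y
          nlinarith [norm_nonneg (x - y)]
        · refine setLIntegral_mono' measurableSet_Icc fun t ht ↦ ?_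
          have := (convex_ball (0:ℂ) R).add_smul_sub_mem hx hy ht
          rw [hF, Set.indicator_of_mem (by simpa [hB] using this)]
    _ = 4 * ∫⁻ t in Set.Icc (0:ℝ) 1, ∫⁻ x in B, ∫⁻ y in B, F (x + (t:ℂ) * (y - x)) := by
        have m3 : Measurable fun p : (ℂ × ℂ) × ℝ ↦ F (p.1.1 + (p.2:ℂ) * (p.1.2 - p.1.1)) := hFm.comp (by fun_prop)
        simp_rw [lintegral_const_mul' _ _ (show (4:ENNReal) ≠ ⊤ by simp)]
        congr 1
        have : ∀ x : ℂ, ∫⁻ y in B, ∫⁻ t in Set.Icc (0:ℝ) 1, F (x + (t:ℂ) * (y - x)) = 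
            ∫⁻ t in Set.Icc (0:ℝ) 1, ∫⁻ y in B, F (x + (t:ℂ) * (y - x)) := fun x ↦
          lintegral_lintegral_swap (hFm.comp (by fun_prop : Measurable fun p : ℂ × ℝ ↦ x + (p.2:ℂ) * (p.1 - x))).aemeasurable
        simp_rw [this]
        rw [lintegral_lintegral_swap]
        refine Measurable.aemeasurable ?_
        have : Measurable fun q : (ℂ × ℝ) × ℂ ↦ F (q.1.1 + (q.1.2:ℂ) * (q.2 - q.1.1)) := hFm.comp (by fun_prop)
        exact this.lintegral_prod_right'
    _ ≤ 4 * ∫⁻ t in Set.Icc (0:ℝ) 1, 4 * volume B * ∫⁻ y, F y := by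
        gcongr 4 * ?_
        exact setLIntegral_mono' measurableSet_Icc key
    _ = _ := by
        rw [setLIntegral_const, hF, lintegral_indicator measurableSet_ball]
        simp
        ring
end Heis
namespace Heis
theorem exists_cut (R : ℝ) (hR : R < 1) : ∃ χ : ℂ → ℝ, Core χ ∧ ContDiff ℝ (⊤:ℕ∞) χ ∧ (∀ z, 0 ≤ χ z ∧ χ z ≤ 1) ∧
    ∀ z, ‖z‖ ≤ R → χ z = 1 := by
  set R0 := max R (1/2) with h0
  have h1 : R0 < 1 := max_lt hR (by norm_num)
  have h2 : 0 < R0 := lt_of_lt_of_le (by norm_num) (le_max_right _ _)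
  let b : ContDiffBump (0:ℂ) := ⟨R0, (1 + R0) / 2, h2, by linarith⟩
  refine ⟨b, ⟨b.contDiff, b.hasCompactSupport, ?_⟩, b.contDiff, fun z ↦ ⟨b.nonneg, b.le_one⟩, fun z hz ↦ ?_⟩
  · rw [b.tsupport_eq]
    intro z hz
    simp only [Metric.mem_closedBall, Metric.mem_ball] at *
    have : dist z 0 ≤ (1 + R0) / 2 := hz
    linarith
  · apply b.one_of_mem_closedBall
    simp only [Metric.mem_closedBall, dist_zero_right]
    exact hz.trans (le_max_left _ _)
theorem setInt_core {E : Type*} [NormedAddCommGroup E] [NormedSpace ℝ E] {F : ℂ → E} (h : ∀ z, z ∉ DD → F z = 0) :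
    ∫ z in DD, F z = ∫ z, F z := setIntegral_eq_integral_of_forall_compl_eq_zero h
theorem NN_ge (k : ℕ) : 1 ≤ NN k := by unfold NN; linarith [Nat.cast_nonneg (α := ℝ) k]
theorem norm_emb' {k : ℕ} {φ : ℂ → ℝ} (h : Core φ) : ‖emb k φ h‖ ^ 2 =
    ∫ z, fD z ^ k * (NN k ^ 2 * φ z ^ 2 + fD z * ‖gr φ z‖ ^ 2) := by
  have hc := h.cont
  have hg := h.grc
  have hs := sf_cont
  have i1 : Integrable (fun z ↦ NN k ^ 2 * φ z ^ 2) (bet k) := by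
    have := (h.mL k).integrable_sq
    simpa [mul_pow] using this
  have i2 : Integrable (fun z ↦ ‖(sf z : ℂ) * gr φ z‖ ^ 2) (bet k) := (h.mG k).integrable_norm_pow two_ne_zero
  rw [norm_emb, ← integral_const_mul, ← integral_add i1 i2, bet_int, setInt_core]
  · refine integral_congr_ae (Eventually.of_forall fun z ↦ ?_)
    by_cases hz : z ∈ DD
    · simp [mul_pow, sf_sq hz]
    · simp [h.eq0 hz, h.gr0 hz]
  · intro z hz; simp [h.eq0 hz, h.gr0 hz]
theorem int_cs {E : Type*} [NormedAddCommGroup E] {F : ℂ → E} (h : Continuous F) (hc : HasCompactSupport F) :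
    Integrable F := h.integrable_of_hasCompactSupport hc
theorem Core.isq {φ : ℂ → ℝ} (h : Core φ) : Integrable fun z ↦ φ z ^ 2 := by
  have := h.cont
  exact int_cs (by fun_prop) (h.cpt.comp_left (g := fun x : ℝ ↦ x ^ 2) (by simp))
theorem Core.igr {φ : ℂ → ℝ} (h : Core φ) : Integrable fun z ↦ ‖gr φ z‖ ^ 2 := by
  have := h.grc
  exact int_cs (by fun_prop) (h.grs.comp_left (g := fun x : ℂ ↦ ‖x‖ ^ 2) (by simp))
theorem grad_loc (k : ℕ) {χ : ℂ → ℝ} (hχ : Core χ) : ∃ A : ℝ, 0 < A ∧ ∀ φ, ∀ h : Core φ,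
    (∫ z, ‖gr (fun z ↦ χ z * φ z) z‖ ^ 2) ≤ A * ‖emb k φ h‖ ^ 2 ∧ (∫ z, (χ z * φ z) ^ 2) ≤ A * ‖emb k φ h‖ ^ 2 := by
  obtain ⟨ρ, hρ0, hρ1, hρ⟩ := hχ.rad
  obtain ⟨C1, hC1⟩ := hχ.cont.bounded_above_of_compact_support hχ.cpt
  obtain ⟨C2, hC2⟩ := hχ.grc.bounded_above_of_compact_support hχ.grs
  set c := 1 - ρ ^ 2
  have hc : 0 < c := by simp only [c]; nlinarith
  have hf : ∀ z ∈ tsupport χ, c ≤ fD z ∧ z ∈ DD := fun z hz ↦ by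
    have : ‖z‖ < ρ := by by_contra h; push Not at h; exact hρ z h hz
    exact ⟨by simp only [c, fD]; nlinarith [norm_nonneg z], hχ.sub hz⟩
  have hc1 : c ≤ 1 := by simp only [c]; nlinarith
  refine ⟨2 * (C1 ^ 2 + C2 ^ 2 + 1) / c ^ (k + 1), by positivity, fun φ h ↦ ?_⟩
  have hm := h.mul hχ.cd
  have hcont := h.cont
  have hgc := h.grc
  have hfc := fD_cont
  have iR : Integrable fun z ↦ fD z ^ k * (NN k ^ 2 * φ z ^ 2 + fD z * ‖gr φ z‖ ^ 2) := by
    refine int_cs (by fun_prop) (HasCompactSupport.intro h.cpt (fun z hz ↦ ?_))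
    simp [image_eq_zero_of_notMem_tsupport hz, gr_supp φ hz]
  have lowb : ∀ z ∈ tsupport χ, c ^ (k + 1) * (φ z ^ 2 + ‖gr φ z‖ ^ 2) ≤ fD z ^ k * (NN k ^ 2 * φ z ^ 2 + fD z * ‖gr φ z‖ ^ 2) := by
    intro z hz
    obtain ⟨h1, h2⟩ := hf z hz
    have hN : 1 ≤ NN k ^ 2 := one_le_pow₀ (NN_ge k)
    calc c ^ (k + 1) * (φ z ^ 2 + ‖gr φ z‖ ^ 2) = c ^ k * (c * φ z ^ 2 + c * ‖gr φ z‖ ^ 2) := by ring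
      _ ≤ fD z ^ k * (NN k ^ 2 * φ z ^ 2 + fD z * ‖gr φ z‖ ^ 2) := by
        have hf0 := fD_pos h2
        gcongr
        nlinarith [sq_nonneg (φ z)]
  have nn : ∀ z, 0 ≤ fD z ^ k * (NN k ^ 2 * φ z ^ 2 + fD z * ‖gr φ z‖ ^ 2) := fun z ↦ by
    by_cases hz : z ∈ DD
    · have := fD_pos hz; positivity
    · simp [h.eq0 hz, h.gr0 hz]
  rw [norm_emb', ← integral_const_mul]
  constructor
  · refine integral_mono hm.igr (iR.const_mul _) fun z ↦ ?_
    by_cases hz : z ∈ tsupport χ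
    · have e : ‖gr (fun z ↦ χ z * φ z) z‖ ≤ C1 * ‖gr φ z‖ + C2 * |φ z| := by
        rw [gr_mul hχ.diff.differentiableAt h.diff.differentiableAt]
        refine (norm_add_le _ _).trans ?_
        rw [norm_mul, norm_mul, Complex.norm_real, Complex.norm_real, mul_comm ‖φ z‖, ← Real.norm_eq_abs]
        exact add_le_add (mul_le_mul_of_nonneg_right (hC1 z) (norm_nonneg _)) (mul_le_mul_of_nonneg_right (hC2 z) (norm_nonneg _))
      calc ‖gr (fun z ↦ χ z * φ z) z‖ ^ 2 ≤ (C1 * ‖gr φ z‖ + C2 * |φ z|) ^ 2 := by gcongr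
        _ ≤ 2 * (C1 ^ 2 + C2 ^ 2 + 1) * (φ z ^ 2 + ‖gr φ z‖ ^ 2) := by
          rw [← sq_abs (φ z)]
          nlinarith [sq_nonneg (C1 * ‖gr φ z‖ - C2 * |φ z|), sq_nonneg (C1 * |φ z|), sq_nonneg (C2 * ‖gr φ z‖), sq_nonneg (|φ z|), sq_nonneg (‖gr φ z‖)]
        _ = 2 * (C1 ^ 2 + C2 ^ 2 + 1) / c ^ (k + 1) * (c ^ (k+1) * (φ z ^ 2 + ‖gr φ z‖ ^ 2)) := by field_simp
        _ ≤ _ := by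
          exact mul_le_mul_of_nonneg_left (lowb z hz) (by positivity)
    · have : gr (fun z ↦ χ z * φ z) z = 0 := gr_supp _ (fun h' ↦ hz (tsupport_mul_subset_left h'))
      simp only [this]; simp only [norm_zero]
      have := nn z
      rw [zero_pow two_ne_zero]; positivity
  · refine integral_mono hm.isq (iR.const_mul _) fun z ↦ ?_
    by_cases hz : z ∈ tsupport χ
    · have e := hC1 z
      calc (χ z * φ z) ^ 2 = ‖χ z‖ ^ 2 * φ z ^ 2 := by rw [Real.norm_eq_abs, sq_abs]; ring
        _ ≤ C1 ^ 2 * φ z ^ 2 := by gcongr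
        _ ≤ 2 * (C1 ^ 2 + C2 ^ 2 + 1) * (φ z ^ 2 + ‖gr φ z‖ ^ 2) := by
          nlinarith [sq_nonneg (C1 * φ z), sq_nonneg (C2 * φ z), sq_nonneg (C1 * ‖gr φ z‖), sq_nonneg (C2 * ‖gr φ z‖), sq_nonneg (φ z), sq_nonneg (‖gr φ z‖)]
        _ = 2 * (C1 ^ 2 + C2 ^ 2 + 1) / c ^ (k + 1) * (c ^ (k+1) * (φ z ^ 2 + ‖gr φ z‖ ^ 2)) := by field_simp
        _ ≤ _ := by
          exact mul_le_mul_of_nonneg_left (lowb z hz) (by positivity)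
    · simp only [image_eq_zero_of_notMem_tsupport hz]
      have := nn z
      rw [zero_mul, zero_pow two_ne_zero]; positivity
theorem rellich (k : ℕ) (φ : ℕ → ℂ → ℝ) (h : ∀ j, Core (φ j)) (C : ℝ) (hC : ∀ j, ‖emb k (φ j) (h j)‖ ≤ C)
    (hw : ∀ ψ : ℂ → ℝ, Measurable ψ → (∃ c, ∀ z, |ψ z| ≤ c) → Tendsto (fun j ↦ ∫ z, φ j z * ψ z ∂(bet k)) atTop (𝓝 0))
    {χ : ℂ → ℝ} (hχ : Core χ) : Tendsto (fun j ↦ ∫ z, (χ z * φ j z) ^ 2) atTop (𝓝 0) := by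
  obtain ⟨A, hA, hA'⟩ := grad_loc k hχ
  obtain ⟨ρ, hρ0, hρ1, hρ⟩ := hχ.rad
  have hm := fun j ↦ (h j).mul hχ.cd
  set d : ℕ → ℂ → ℝ := fun j z ↦ χ z * φ j z with hd
  set a : ℝ → ℕ → ℂ → ℝ := fun r j x ↦ ∫ y in Metric.ball (0:ℂ) r, d j (x + y) with ha
  have dsup : ∀ j z, 1 ≤ ‖z‖ → d j z = 0 := fun j z hz ↦ by
    simp only [hd]
    rw [image_eq_zero_of_notMem_tsupport (hρ z (hρ1.le.trans hz)), zero_mul]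
  have hlim : ∀ r, 0 < r → r < 1 → (∀ j, Integrable fun x ↦ a r j x ^ 2) ∧ Tendsto (fun j ↦ ∫ x, a r j x ^ 2) atTop (𝓝 0) := by
    intro r hr hr1
    obtain ⟨C1, hC1⟩ := hχ.cont.bounded_above_of_compact_support hχ.cpt
    have hC10 : 0 ≤ C1 := (norm_nonneg _).trans (hC1 0)
    set c := 1 - ρ ^ 2
    have hc : 0 < c := by simp only [c]; nlinarith
    let ψ : ℂ → ℂ → ℝ := fun x ↦ (Metric.ball x r).indicator (fun z ↦ χ z / fD z ^ k)
    have hψm : ∀ x, Measurable (ψ x) := fun x ↦ by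
      refine Measurable.indicator ?_ measurableSet_ball
      have := hχ.cont.measurable
      have := fD_cont.measurable
      fun_prop
    have hψb : ∀ x z, |ψ x z| ≤ C1 / c ^ k := by
      intro x z
      have hb : |χ z / fD z ^ k| ≤ C1 / c ^ k := by
        by_cases hz : ‖z‖ < ρ
        · have : c ≤ fD z := by simp only [c, fD]; nlinarith [norm_nonneg z]
          rw [abs_div, abs_of_nonneg (pow_nonneg (hc.le.trans this) k)]
          gcongr
          exact hC1 z
        · rw [image_eq_zero_of_notMem_tsupport (hρ z (not_lt.1 hz))]; simp; positivity
      simp only [ψ, Set.indicator]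
      split_ifs
      · exact hb
      · simp; positivity
    have hae : ∀ j x, a r j x = ∫ z, φ j z * ψ x z ∂(bet k) := by
      intro j x
      rw [bet_int]
      have e1 : a r j x = ∫ y in Metric.ball x r, d j y := by
        have : ∀ y, (Metric.ball x r).indicator (d j) (x + y) = (Metric.ball (0:ℂ) r).indicator (fun y ↦ d j (x + y)) y := by
          intro y; simp [Set.indicator]
        rw [show a r j x = ∫ y in Metric.ball (0:ℂ) r, d j (x + y) from rfl, ← integral_indicator measurableSet_ball, ← integral_indicator measurableSet_ball,
          ← integral_add_left_eq_self ((Metric.ball x r).indicator (d j)) x]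
        exact integral_congr_ae (Eventually.of_forall fun y ↦ (this y).symm)
      rw [e1, ← integral_indicator measurableSet_ball, setInt_core]
      · refine integral_congr_ae (Eventually.of_forall fun z ↦ ?_)
        simp only [ψ, Set.indicator, hd, smul_eq_mul]
        split_ifs
        · by_cases hz : z ∈ DD
          · have := fD_pos hz; field_simp
          · simp [(h j).eq0 hz]
        · simp
      · intro z hz; simp [(h j).eq0 hz]
    have hbd : ∀ j x, |a r j x| ≤ C1 / c ^ k * ((bet k).real Set.univ + C ^ 2) := by
      intro j x
      rw [hae]
      have hi1 : Integrable (fun z ↦ 1 + φ j z ^ 2) (bet k) :=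
        (integrable_const _).add (by have := (memLp_cs (h j).cont (h j).cpt k 2).integrable_sq; simpa using this)
      have hi2 : ∫ z, (1 + φ j z ^ 2) ∂(bet k) ≤ (bet k).real Set.univ + C ^ 2 := by
        rw [integral_add (integrable_const _) (by have := (memLp_cs (h j).cont (h j).cpt k 2).integrable_sq; simpa using this)]
        have h1 : (NN k ^ 2 * ∫ z, φ j z ^ 2 ∂(bet k)) ≤ C ^ 2 := by
          have := norm_emb (k := k) (h j)
          have h2 : 0 ≤ ∫ z, ‖(sf z : ℂ) * gr (φ j) z‖ ^ 2 ∂(bet k) := integral_nonneg fun _ ↦ by positivity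
          have h3 : ‖emb k (φ j) (h j)‖ ^ 2 ≤ C ^ 2 := pow_le_pow_left₀ (norm_nonneg _) (hC j) 2
          linarith
        have h4 : (∫ z, φ j z ^ 2 ∂(bet k)) ≤ NN k ^ 2 * ∫ z, φ j z ^ 2 ∂(bet k) :=
          le_mul_of_one_le_left (integral_nonneg fun _ ↦ sq_nonneg _) (one_le_pow₀ (NN_ge k))
        simp; linarith
      calc |∫ z, φ j z * ψ x z ∂(bet k)| ≤ ∫ z, C1 / c ^ k * (1 + φ j z ^ 2) ∂(bet k) := by
            rw [← Real.norm_eq_abs]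
            refine norm_integral_le_of_norm_le (hi1.const_mul _) (Eventually.of_forall fun z ↦ ?_)
            rw [norm_mul, mul_comm]
            refine mul_le_mul (hψb x z) ?_ (norm_nonneg _) (by positivity)
            rw [Real.norm_eq_abs, ← sq_abs (φ j z)]; nlinarith [sq_nonneg (|φ j z| - 1), abs_nonneg (φ j z)]
        _ ≤ _ := by rw [integral_const_mul]; gcongr
    have hsup : ∀ j x, 2 ≤ ‖x‖ → a r j x = 0 := by
      intro j x hx
      simp only [ha]
      refine setIntegral_eq_zero_of_forall_eq_zero fun y hy ↦ dsup j _ ?_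
      have := norm_sub_norm_le x (-y)
      simp at this hy
      linarith
    have hmeas : ∀ j, AEStronglyMeasurable (fun x ↦ a r j x ^ 2) volume := fun j ↦ by
      have hcd := (hm j).cont
      have : StronglyMeasurable (fun p : ℂ × ℂ ↦ d j (p.1 + p.2)) := (by fun_prop : Continuous fun p : ℂ × ℂ ↦ d j (p.1 + p.2)).stronglyMeasurable
      exact ((this.integral_prod_right' (ν := volume.restrict (Metric.ball (0:ℂ) r))).pow 2).aestronglyMeasurable
    have hint : Integrable ((Metric.ball (0:ℂ) 2).indicator fun _ ↦ (C1 / c ^ k * ((bet k).real Set.univ + C ^ 2)) ^ 2) := by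
      rw [integrable_indicator_iff measurableSet_ball]
      exact integrableOn_const measure_ball_lt_top.ne
    have hdom : ∀ j, ∀ᵐ x, ‖a r j x ^ 2‖ ≤ (Metric.ball (0:ℂ) 2).indicator (fun _ ↦ (C1 / c ^ k * ((bet k).real Set.univ + C ^ 2)) ^ 2) x := by
      refine fun j ↦ Eventually.of_forall fun x ↦ ?_
      simp only [Set.indicator]
      split_ifs with hx
      · rw [norm_pow, Real.norm_eq_abs]
        exact pow_le_pow_left₀ (abs_nonneg _) (hbd j x) 2
      · rw [hsup j x (by simpa using hx)]; simp
    refine ⟨fun j ↦ hint.mono' (hmeas j) (hdom j), ?_⟩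
    have := tendsto_integral_of_dominated_convergence (μ := (volume : Measure ℂ)) (F := fun j x ↦ a r j x ^ 2) (f := fun _ ↦ 0)
      _ hmeas hint hdom ?_
    · simpa using this
    · refine Eventually.of_forall fun x ↦ ?_
      have := (hw (ψ x) (hψm x) ⟨_, hψb x⟩).pow 2
      simpa [hae] using this
  have hineq : ∀ r, 0 < r → r < 1 → ∀ j, ∫ z, d j z ^ 2 ≤ 2 * r ^ 2 * (A * C ^ 2) + 2 / (volume.real (Metric.ball (0:ℂ) r)) ^ 2 * ∫ x, a r j x ^ 2 := by
    intro r hr hr1 j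
    have h1 := rell_h (hm j).cd hr
    have i1 : Integrable fun z ↦ d j z ^ 2 := (hm j).isq
    have i2 : Integrable fun z ↦ ‖gr (d j) z‖ ^ 2 := (hm j).igr
    have i3 : Integrable fun x ↦ a r j x ^ 2 := (hlim r hr hr1).1 j
    rw [← ofReal_integral_eq_lintegral_ofReal i1 (Eventually.of_forall fun t ↦ by positivity),
      ← ofReal_integral_eq_lintegral_ofReal i2 (Eventually.of_forall fun t ↦ by positivity),
      ← ofReal_integral_eq_lintegral_ofReal i3 (Eventually.of_forall fun t ↦ by positivity),
      ← ENNReal.ofReal_mul (by positivity), ← ENNReal.ofReal_mul (by positivity), ← ENNReal.ofReal_add (by positivity) (by positivity),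
      ENNReal.ofReal_le_ofReal_iff (by positivity)] at h1
    refine h1.trans ?_
    gcongr
    refine (hA' _ (h j)).1.trans ?_
    gcongr
    exact hC j
  have hC0 : 0 ≤ C := (norm_nonneg _).trans (hC 0)
  rw [Metric.tendsto_atTop]
  intro ε hε
  obtain ⟨r, hr, hr1, hr2⟩ : ∃ r : ℝ, 0 < r ∧ r < 1 ∧ 2 * r ^ 2 * (A * C ^ 2) < ε / 2 := by
    have : Tendsto (fun r : ℝ ↦ 2 * r ^ 2 * (A * C ^ 2)) (𝓝[>] 0) (𝓝 (2 * 0 ^ 2 * (A * C ^ 2))) :=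
      (Continuous.tendsto (by fun_prop) 0).mono_left nhdsWithin_le_nhds
    have h1 := this.eventually_lt_const (u := ε / 2) (by simp; positivity)
    have h2 : ∀ᶠ r : ℝ in 𝓝[>] 0, r ∈ Set.Ioo (0:ℝ) 1 := Ioo_mem_nhdsGT one_pos
    obtain ⟨r, h3, h4⟩ := (h1.and h2).exists
    exact ⟨r, h4.1, h4.2, h3⟩
  have h5 := ((hlim r hr hr1).2.const_mul (2 / (volume.real (Metric.ball (0:ℂ) r)) ^ 2)).eventually_lt_const (u := ε / 2) (by simp; positivity)
  obtain ⟨J, hJ⟩ := eventually_atTop.1 h5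
  refine ⟨J, fun j hj ↦ ?_⟩
  have := hineq r hr hr1 j
  have := hJ j hj
  rw [Real.dist_eq, sub_zero, abs_of_nonneg (integral_nonneg fun _ ↦ sq_nonneg _)]
  linarith
end Heis
namespace Heis
theorem cut_seq : ∃ χ : ℕ → ℂ → ℝ, (∀ j, Core (χ j)) ∧ (∀ j, ContDiff ℝ (⊤:ℕ∞) (χ j)) ∧ (∀ j z, 0 ≤ χ j z ∧ χ j z ≤ 1) ∧
    ∀ z ∈ DD, ∀ᶠ j in atTop, χ j z = 1 := by
  choose χ h1 h2 h3 h4 using fun j : ℕ ↦ exists_cut (1 - 1 / ((j:ℝ) + 1)) (by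
    have : 0 < 1 / ((j:ℝ) + 1) := by positivity
    linarith)
  refine ⟨χ, h1, h2, h3, fun z hz ↦ ?_⟩
  have : Tendsto (fun j : ℕ ↦ 1 - 1 / ((j:ℝ) + 1)) atTop (𝓝 (1 - 0)) :=
    tendsto_const_nhds.sub tendsto_one_div_add_atTop_nhds_zero_nat
  filter_upwards [this.eventually_const_lt (u := ‖z‖) (by simpa using hz)] with j hj
  exact h4 j z hj.le
theorem cut_small (k : ℕ) {ε : ℝ} (hε : 0 < ε) : ∃ χ : ℂ → ℝ, Core χ ∧ (∀ z, 0 ≤ χ z ∧ χ z ≤ 1) ∧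
    ∫ z, (1 - χ z) ^ 2 ∂(bet k) < ε := by
  obtain ⟨χ, h1, -, h3, h4⟩ := cut_seq
  have := tendsto_integral_of_dominated_convergence (μ := bet k) (F := fun j z ↦ (1 - χ j z) ^ 2) (f := fun _ ↦ 0)
    (fun _ ↦ 1) (fun j ↦ by have := (h1 j).cont; exact (by fun_prop : Continuous fun z ↦ (1 - χ j z) ^ 2).aestronglyMeasurable)
    (integrable_const _) (fun j ↦ Eventually.of_forall fun z ↦ by
      have := h3 j z
      rw [Real.norm_eq_abs, abs_of_nonneg (sq_nonneg _)]; nlinarith)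
    (by
      filter_upwards [bet_D k] with z hz
      refine tendsto_const_nhds.congr' ?_
      filter_upwards [h4 z hz] with j hj
      simp [hj])
  simp only [integral_zero] at this
  obtain ⟨j, hj⟩ := (this.eventually_lt_const hε).exists
  exact ⟨χ j, h1 j, h3 j, hj⟩
theorem Core.bsq {φ : ℂ → ℝ} (h : Core φ) (k : ℕ) : Integrable (fun z ↦ φ z ^ 2) (bet k) := by
  have := (memLp_cs h.cont h.cpt k 2).integrable_sq
  simpa using this
theorem w_sq_le {k : ℕ} (x : VV k) : ∫ z, wf x z ^ 2 ∂(bet k) ≤ ‖x‖ ^ 2 := by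
  rw [norm_VV]
  have h2 : 0 ≤ ∫ z, ‖gf x z‖ ^ 2 ∂(bet k) := integral_nonneg fun _ ↦ by positivity
  have h4 : (∫ z, wf x z ^ 2 ∂(bet k)) ≤ NN k ^ 2 * ∫ z, wf x z ^ 2 ∂(bet k) :=
    le_mul_of_one_le_left (integral_nonneg fun _ ↦ sq_nonneg _) (one_le_pow₀ (NN_ge k))
  linarith
theorem w_abs_le {k : ℕ} (x : VV k) : ∫ z, |wf x z| ∂(bet k) ≤ ((bet k).real Set.univ + 1) * ‖x‖ := by
  have h1 := sq_int_le (bet k) (fun z ↦ |wf x z|) ((wf_mem x).integrable one_le_two).abs (by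
    simpa using (wf_mem x).integrable_sq)
  simp only [sq_abs] at h1
  have h2 := w_sq_le x
  have hB : 0 ≤ (bet k).real Set.univ := measureReal_nonneg
  refine abs_le_of_sq_le_sq' (h1.trans ?_) (by positivity) |>.2
  calc _ ≤ (bet k).real Set.univ * ‖x‖ ^ 2 := by gcongr
    _ ≤ _ := by rw [mul_pow]; gcongr; nlinarith
theorem loc_L1 (k : ℕ) (φ : ℕ → ℂ → ℝ) (h : ∀ j, Core (φ j)) (C : ℝ) (hC : ∀ j, ‖emb k (φ j) (h j)‖ ≤ C)
    (hl : ∀ χ, Core χ → Tendsto (fun j ↦ ∫ z, (χ z * φ j z) ^ 2) atTop (𝓝 0)) :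
    Tendsto (fun j ↦ ∫ z, |φ j z| ∂(bet k)) atTop (𝓝 0) := by
  have hB : 0 ≤ (bet k).real Set.univ := measureReal_nonneg
  set B := (bet k).real Set.univ
  rw [Metric.tendsto_atTop]
  intro ε hε
  set η := ε / (4 * (C ^ 2 + B + 1)) with hη
  have hη0 : 0 < η := by positivity
  obtain ⟨χ, hχ, hχ1, hχ2⟩ := cut_small k (ε := ε * η / 2) (by positivity)
  obtain ⟨J, hJ⟩ := eventually_atTop.1 ((hl χ hχ).eventually_lt_const (u := ε * η / 2) (by positivity))
  refine ⟨J, fun j hj ↦ ?_⟩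
  rw [Real.dist_eq, sub_zero, abs_of_nonneg (integral_nonneg fun _ ↦ abs_nonneg _)]
  have hm := (h j).mul hχ.cd
  have i1 : Integrable (fun z ↦ (1 - χ z) ^ 2) (bet k) := by
    have := hχ.cont
    refine (integrable_const (1:ℝ)).mono' (by exact (by fun_prop : Continuous fun z ↦ (1 - χ z) ^ 2).aestronglyMeasurable) (Eventually.of_forall fun z ↦ ?_)
    have := hχ1 z
    rw [Real.norm_eq_abs, abs_of_nonneg (sq_nonneg _)]; nlinarith
  have e1 : ∫ z, |φ j z| ∂(bet k) ≤ ∫ z, (((1 / (2*η)) * (1 - χ z) ^ 2 + (η/2) * φ j z ^ 2) + (η / 2 + (1 / (2*η)) * (χ z * φ j z) ^ 2)) ∂(bet k) := by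
    refine integral_mono (by have := memLp_cs (h j).cont (h j).cpt k 1; exact (memLp_one_iff_integrable.1 this).abs) (((i1.const_mul _).add (((h j).bsq k).const_mul _)).add ((integrable_const _).add ((hm.bsq k).const_mul _))) fun z ↦ ?_
    have h1 := hχ1 z
    have a1 : (1 - χ z) * |φ j z| ≤ (1 / (2*η)) * (1 - χ z) ^ 2 + (η/2) * φ j z ^ 2 := by
      rw [← sq_abs (φ j z)]
      have := sq_nonneg ((1 - χ z) - η * |φ j z|)
      field_simp; nlinarith
    have a2 : χ z * |φ j z| ≤ η / 2 + (1 / (2*η)) * (χ z * φ j z) ^ 2 := by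
      rw [mul_pow, ← sq_abs (φ j z), ← mul_pow]
      have := sq_nonneg (χ z * |φ j z| - η)
      field_simp; nlinarith
    simp only; linarith
  rw [integral_add (by exact (i1.const_mul _).add (((h j).bsq k).const_mul _)) (by exact (integrable_const _).add ((hm.bsq k).const_mul _)),
    integral_add (i1.const_mul _) (((h j).bsq k).const_mul _), integral_add (integrable_const _) ((hm.bsq k).const_mul _),
    integral_const_mul, integral_const_mul, integral_const_mul] at e1
  have e2 : ∫ z, φ j z ^ 2 ∂(bet k) ≤ C ^ 2 := by
    have h1 := w_sq_le (emb k (φ j) (h j))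
    rw [integral_congr_ae (by filter_upwards [emb_w k (h j)] with z hz; rw [hz])] at h1
    exact h1.trans (pow_le_pow_left₀ (norm_nonneg _) (hC j) 2)
  have e3 : ∫ z, (χ z * φ j z) ^ 2 ∂(bet k) ≤ ∫ z, (χ z * φ j z) ^ 2 := by
    rw [bet_int]
    rw [setInt_core (by intro z hz; simp [(h j).eq0 hz])]
    refine integral_mono ?_ hm.isq fun z ↦ ?_
    · have := hm.cont; have := fD_cont
      refine int_cs (by simp only [smul_eq_mul]; fun_prop) (HasCompactSupport.intro hm.cpt fun z hz ↦ ?_)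
      simp [image_eq_zero_of_notMem_tsupport hz]
    · by_cases hz : z ∈ DD
      · simp only [smul_eq_mul]
        exact mul_le_of_le_one_left (sq_nonneg _) (pow_le_one₀ (fD_pos hz).le (fD_le z))
      · simp [(h j).eq0 hz]
  have e4 := hJ j hj
  have e5 : η * (C ^ 2 + B + 1) = ε / 4 := by rw [hη]; field_simp
  have e6 : 1 / (2 * η) * ∫ z, (1 - χ z) ^ 2 ∂(bet k) < ε / 4 := by
    calc _ < 1 / (2 * η) * (ε * η / 2) := by gcongr
      _ = _ := by field_simp; ring
  have e7 : 1 / (2 * η) * ∫ z, (χ z * φ j z) ^ 2 ∂(bet k) < ε / 4 := by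
    calc _ < 1 / (2 * η) * (ε * η / 2) := by gcongr; linarith
      _ = _ := by field_simp; ring
  have e8 : η / 2 * ∫ z, φ j z ^ 2 ∂(bet k) ≤ η / 2 * C ^ 2 := by gcongr
  have e9 : ∫ z, η / 2 ∂(bet k) = η / 2 * B := by simp [B, mul_comm]
  rw [e9] at e1
  nlinarith
theorem ae_sub {k : ℕ} (f : ℕ → ℂ → ℝ) (hf : ∀ j, Integrable (f j) (bet k)) (h : Tendsto (fun j ↦ ∫ z, |f j z| ∂(bet k)) atTop (𝓝 0)) :
    ∃ s : ℕ → ℕ, StrictMono s ∧ ∀ᵐ z ∂(bet k), Tendsto (fun j ↦ f (s j) z) atTop (𝓝 0) := by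
  have : TendstoInMeasure (bet k) f atTop (fun _ ↦ (0:ℝ)) := by
    refine tendstoInMeasure_of_tendsto_eLpNorm (p := 1) one_ne_zero (fun j ↦ (hf j).aestronglyMeasurable) aestronglyMeasurable_const ?_
    have e : ∀ j, eLpNorm (f j - fun _ ↦ (0:ℝ)) 1 (bet k) = ENNReal.ofReal (∫ z, |f j z| ∂(bet k)) := by
      intro j
      have : (f j - fun _ ↦ (0:ℝ)) = f j := by funext z; simp
      rw [this, eLpNorm_one_eq_lintegral_enorm, ← ofReal_integral_norm_eq_lintegral_enorm (hf j)]; rfl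
    simp_rw [e]
    simpa using ENNReal.tendsto_ofReal h
  exact this.exists_seq_tendsto_ae
theorem HH_eq (k : ℕ) : HH k = (Hc k)ᗮᗮ := (Submodule.orthogonal_orthogonal_eq_closure (Hc k)).symm
theorem int_psi {k : ℕ} {ψ : ℂ → ℝ} (hm : Measurable ψ) (hb : ∃ c, ∀ z, |ψ z| ≤ c) :
    ∃ v : VV k, ∀ x : VV k, inner ℝ x v = ∫ z, wf x z * ψ z ∂(bet k) := by
  obtain ⟨c, hc⟩ := hb
  have hN := NN_pos k
  have hp : MemLp (fun z ↦ ψ z / NN k) 2 (bet k) := MemLp.of_bound (by fun_prop) (c / NN k) (Eventually.of_forall fun z ↦ by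
    rw [norm_div, Real.norm_eq_abs, Real.norm_eq_abs, abs_of_pos hN]; gcongr; exact hc z)
  refine ⟨WithLp.toLp 2 (hp.toLp _, 0), fun x ↦ ?_⟩
  rw [WithLp.prod_inner_apply]
  simp only [inner_zero_right, add_zero]
  rw [L2.inner_def]
  refine integral_congr_ae ?_
  filter_upwards [hp.coeFn_toLp] with z hz
  rw [hz]; simp [wf]; field_simp
theorem L3 {k : ℕ} (x : ℕ → VV k) (hx : ∀ j, x j ∈ HH k) (C : ℝ) (hC : ∀ j, ‖x j‖ ≤ C) :
    ∃ s : ℕ → ℕ, StrictMono s ∧ ∃ y ∈ HH k, (∀ v, Tendsto (fun j ↦ inner ℝ (x (s j)) v) atTop (𝓝 (inner ℝ y v))) ∧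
      (∀ᵐ z ∂(bet k), Tendsto (fun j ↦ wf (x (s j)) z) atTop (𝓝 (wf y z))) ∧
      ∃ δ : ℕ → ℂ → ℝ, ∃ hδ : ∀ j, Core (δ j), Tendsto (fun j ↦ ‖x (s j) - y - emb k (δ j) (hδ j)‖) atTop (𝓝 0) ∧
        (∀ j, ‖emb k (δ j) (hδ j)‖ ≤ 2 * C + 1) ∧
        ∀ χ, Core χ → Tendsto (fun j ↦ ∫ z, (χ z * δ j z) ^ 2) atTop (𝓝 0) := by
  obtain ⟨s, hs, y, hy⟩ := weak_cpt x C hC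
  have hyH : y ∈ HH k := by
    rw [HH_eq, Submodule.mem_orthogonal']
    intro u hu
    refine tendsto_nhds_unique (hy u) (tendsto_const_nhds.congr fun j ↦ ?_)
    have h1 := hx (s j)
    rw [HH_eq, Submodule.mem_orthogonal'] at h1
    exact (h1 u hu).symm
  have hyC : ‖y‖ ≤ C := by
    have h1 := le_of_tendsto (hy y) (Eventually.of_forall fun j ↦ (real_inner_le_norm _ _).trans (mul_le_mul_of_nonneg_right (hC (s j)) (norm_nonneg y)))
    rw [real_inner_self_eq_norm_sq] at h1
    by_contra! hlt
    have : 0 ≤ C := (norm_nonneg _).trans (hC 0)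
    nlinarith
  choose δ hδ hδ' using fun j : ℕ ↦ HH_approx ((HH k).sub_mem (hx (s j)) hyH) (ε := 1 / ((j:ℝ) + 1)) (by positivity)
  have hr : Tendsto (fun j ↦ ‖x (s j) - y - emb k (δ j) (hδ j)‖) atTop (𝓝 0) :=
    squeeze_zero (fun _ ↦ norm_nonneg _) (fun j ↦ (hδ' j).le) tendsto_one_div_add_atTop_nhds_zero_nat
  have hb : ∀ j, ‖emb k (δ j) (hδ j)‖ ≤ 2 * C + 1 := fun j ↦ by
    have h1 := norm_sub_norm_le (emb k (δ j) (hδ j)) (x (s j) - y)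
    rw [norm_sub_rev (emb k (δ j) (hδ j)) (x (s j) - y)] at h1
    have h2 := norm_sub_le (x (s j)) y
    have h3 : 1 / ((j:ℝ) + 1) ≤ 1 := by rw [div_le_one (by positivity)]; linarith [Nat.cast_nonneg (α := ℝ) j]
    linarith [hC (s j), hδ' j]
  have hloc : ∀ χ, Core χ → Tendsto (fun j ↦ ∫ z, (χ z * δ j z) ^ 2) atTop (𝓝 0) := by
    intro χ hχ
    refine rellich k δ hδ _ hb (fun ψ hm hψ ↦ ?_) hχ
    obtain ⟨v, hv⟩ := int_psi (k := k) hm hψ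
    have e : ∀ j, ∫ z, δ j z * ψ z ∂(bet k) = inner ℝ (x (s j)) v - inner ℝ y v - inner ℝ (x (s j) - y - emb k (δ j) (hδ j)) v := by
      intro j
      rw [inner_sub_left, inner_sub_left, hv (emb k (δ j) (hδ j))]
      have e0 : ∫ z, wf (emb k (δ j) (hδ j)) z * ψ z ∂(bet k) = ∫ z, δ j z * ψ z ∂(bet k) := integral_congr_ae (by filter_upwards [emb_w k (hδ j)] with z hz; rw [hz])
      rw [e0]; ring
    simp_rw [e]
    have t1 := (hy v).sub_const (inner ℝ y v)
    have t2 : Tendsto (fun j ↦ inner ℝ (x (s j) - y - emb k (δ j) (hδ j)) v) atTop (𝓝 0) := by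
      refine squeeze_zero_norm (fun j ↦ norm_inner_le_norm _ _) ?_
      simpa using hr.mul_const ‖v‖
    simpa using t1.sub t2
  have hL1 := loc_L1 k δ hδ _ hb hloc
  have hL2 : Tendsto (fun j ↦ ∫ z, |wf (x (s j)) z - wf y z| ∂(bet k)) atTop (𝓝 0) := by
    have := (hr.const_mul ((bet k).real Set.univ + 1)).add hL1
    rw [mul_zero, add_zero] at this
    refine squeeze_zero (fun j ↦ integral_nonneg fun _ ↦ abs_nonneg _) (fun j ↦ ?_) this
    have iδ : Integrable (fun z ↦ |δ j z|) (bet k) := (memLp_one_iff_integrable.1 (memLp_cs (hδ j).cont (hδ j).cpt k 1)).abs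
    have iw : Integrable (fun z ↦ |wf (x (s j) - y - emb k (δ j) (hδ j)) z|) (bet k) := ((wf_mem _).integrable one_le_two).abs
    refine le_trans ?_ (add_le_add (w_abs_le _) le_rfl)
    rw [← integral_add iw iδ]
    refine integral_mono_ae (((wf_mem _).integrable one_le_two).sub ((wf_mem _).integrable one_le_two)).abs (iw.add iδ) ?_
    filter_upwards [wf_sub (x (s j) - y) (emb k (δ j) (hδ j)), wf_sub (x (s j)) y, emb_w k (hδ j)] with z h1 h2 h3
    rw [h1, h2, h3]
    have := abs_add_le (wf (x (s j)) z - wf y z - δ j z) (δ j z)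
    simpa using this
  obtain ⟨s', hs', hae⟩ := ae_sub _ (fun j ↦ ((wf_mem (x (s j))).integrable one_le_two).sub ((wf_mem y).integrable one_le_two)) hL2
  refine ⟨s ∘ s', hs.comp hs', y, hyH, fun v ↦ (hy v).comp hs'.tendsto_atTop, ?_, fun j ↦ δ (s' j), fun j ↦ hδ (s' j), hr.comp hs'.tendsto_atTop, fun j ↦ hb _, fun χ hχ ↦ (hloc χ hχ).comp hs'.tendsto_atTop⟩
  filter_upwards [hae] with z hz
  have := hz.add_const (wf y z)
  simpa using this
theorem LSC {k : ℕ} (x : ℕ → VV k) (hx : ∀ j, x j ∈ HH k) (c : ℕ → ℝ) (c0 : ℝ) (hc : Tendsto c atTop (𝓝 c0))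
    (hC : ∀ j, ‖x j‖ ^ 2 ≤ c j) (w : ℂ → ℝ) (hw : ∀ᵐ z ∂(bet k), Tendsto (fun j ↦ wf (x j) z) atTop (𝓝 (w z))) :
    ∃ y ∈ HH k, wf y =ᵐ[bet k] w ∧ ‖y‖ ^ 2 ≤ c0 := by
  obtain ⟨B, hB⟩ := hc.bddAbove_range
  have hB' : ∀ j, ‖x j‖ ≤ |B| + 1 := fun j ↦ by
    have h1 : ‖x j‖ ^ 2 ≤ |B| := (hC j).trans ((hB ⟨j, rfl⟩).trans (le_abs_self B))
    nlinarith [norm_nonneg (x j), abs_nonneg B]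
  obtain ⟨s, hs, y, hy, hweak, hae, -⟩ := L3 x hx _ hB'
  refine ⟨y, hy, ?_, ?_⟩
  · filter_upwards [hw, hae] with z h1 h2
    exact tendsto_nhds_unique h2 (h1.comp hs.tendsto_atTop)
  · have h1 : ∀ j, 2 * inner ℝ (x (s j)) y - ‖y‖ ^ 2 ≤ c (s j) := fun j ↦ by
      have := norm_sub_sq_real (x (s j)) y
      have h3 := hC (s j)
      nlinarith [sq_nonneg ‖x (s j) - y‖]
    have h2 := le_of_tendsto_of_tendsto (((hweak y).const_mul 2).sub_const (‖y‖ ^ 2)) (hc.comp hs.tendsto_atTop) (Eventually.of_forall h1)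
    rw [real_inner_self_eq_norm_sq] at h2
    linarith
end Heis
namespace Heis
theorem seq_ae {k : ℕ} (x : ℕ → VV k) (y : VV k) (h : Tendsto x atTop (𝓝 y)) :
    ∃ s : ℕ → ℕ, StrictMono s ∧ ∀ᵐ z ∂(bet k), Tendsto (fun j ↦ wf (x (s j)) z) atTop (𝓝 (wf y z)) := by
  rw [tendsto_iff_norm_sub_tendsto_zero] at h
  have h2 : Tendsto (fun j ↦ ∫ z, |wf (x j - y) z| ∂(bet k)) atTop (𝓝 0) := by
    refine squeeze_zero (fun j ↦ integral_nonneg fun _ ↦ abs_nonneg _) (fun j ↦ w_abs_le _) ?_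
    simpa using h.const_mul ((bet k).real Set.univ + 1)
  obtain ⟨s, hs, h3⟩ := ae_sub _ (fun j ↦ (wf_mem (x j - y)).integrable one_le_two) h2
  refine ⟨s, hs, ?_⟩
  filter_upwards [h3, ae_all_iff.2 fun j ↦ wf_sub (x j) y] with z h4 h5
  have := h4.add_const (wf y z)
  simpa [h5] using this
theorem HH_seq_ae {k : ℕ} {x : VV k} (hx : x ∈ HH k) :
    ∃ φ : ℕ → ℂ → ℝ, ∃ h : ∀ j, Core (φ j), Tendsto (fun j ↦ emb k (φ j) (h j)) atTop (𝓝 x) ∧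
      ∀ᵐ z ∂(bet k), Tendsto (fun j ↦ φ j z) atTop (𝓝 (wf x z)) := by
  obtain ⟨φ, h, hφ⟩ := HH_seq hx
  obtain ⟨s, hs, hae⟩ := seq_ae _ _ hφ
  refine ⟨fun j ↦ φ (s j), fun j ↦ h (s j), hφ.comp hs.tendsto_atTop, ?_⟩
  filter_upwards [hae, ae_all_iff.2 fun j ↦ emb_w k (h j)] with z h1 h2
  simpa [h2] using h1
theorem emb_mono {k : ℕ} {φ ψ : ℂ → ℝ} (h : Core φ) (h' : Core ψ) (h1 : ∀ z, |ψ z| ≤ |φ z|)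
    (h2 : ∀ z, ‖gr ψ z‖ ≤ ‖gr φ z‖) : ‖emb k ψ h'‖ ^ 2 ≤ ‖emb k φ h‖ ^ 2 := by
  rw [norm_emb, norm_emb]
  gcongr ?_ * ?_ + ?_
  · exact integral_mono (h'.bsq k) (h.bsq k) fun z ↦ sq_le_sq.2 (h1 z)
  · have hi : ∀ {φ}, Core φ → Integrable (fun z ↦ ‖(sf z : ℂ) * gr φ z‖ ^ 2) (bet k) := fun h ↦ (h.mG k).integrable_norm_pow two_ne_zero
    refine integral_mono (hi h') (hi h) fun z ↦ ?_
    simp only [norm_mul]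
    gcongr; exact h2 z
theorem HH_abs {k : ℕ} {x : VV k} (hx : x ∈ HH k) :
    ∃ y ∈ HH k, wf y =ᵐ[bet k] (fun z ↦ |wf x z|) ∧ ‖y‖ ^ 2 ≤ ‖x‖ ^ 2 := by
  obtain ⟨φ, h, h1, h2⟩ := HH_seq_ae hx
  set d : ℕ → ℝ := fun j ↦ 1 / ((j:ℝ) + 1) with hd
  have hd0 : ∀ j, 0 < d j := fun j ↦ by positivity
  have hs : ∀ (j : ℕ) (t : ℝ), 0 < t ^ 2 + d j ^ 2 := fun j t ↦ by have := hd0 j; positivity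
  have hc : ∀ j, ContDiff ℝ 1 fun t : ℝ ↦ √(t ^ 2 + d j ^ 2) - d j := fun j ↦
    (ContDiff.sqrt (by fun_prop) fun t ↦ (hs j t).ne').sub contDiff_const
  have hC := fun j ↦ (h j).comp (hc j) (by simp [Real.sqrt_sq (hd0 j).le])
  refine LSC (fun j ↦ emb k _ (hC j)) (fun j ↦ emb_HH _) (fun j ↦ ‖emb k _ (h j)‖ ^ 2) _ (h1.norm.pow 2)
    (fun j ↦ emb_mono (h j) (hC j) (fun z ↦ ?_) fun z ↦ ?_) _ ?_
  · have h3 : √(φ j z ^ 2 + d j ^ 2) ≤ |φ j z| + d j := by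
      rw [Real.sqrt_le_left (by have := hd0 j; positivity)]
      nlinarith [abs_nonneg (φ j z), hd0 j, sq_abs (φ j z)]
    have h4 : d j ≤ √(φ j z ^ 2 + d j ^ 2) := Real.le_sqrt_of_sq_le (by nlinarith [sq_nonneg (φ j z)])
    rw [abs_of_nonneg (by linarith)]; linarith
  · have hD : HasDerivAt (fun t : ℝ ↦ √(t ^ 2 + d j ^ 2) - d j) (φ j z / √(φ j z ^ 2 + d j ^ 2)) (φ j z) := by
      have := (((hasDerivAt_pow 2 (φ j z)).add_const (d j ^ 2)).sqrt (hs j _).ne').sub_const (d j)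
      refine this.congr_deriv ?_
      have := Real.sqrt_pos.2 (hs j (φ j z))
      field_simp; simp
    rw [gr_comp hD (h j).diff.differentiableAt, norm_mul]
    refine mul_le_of_le_one_left (norm_nonneg _) ?_
    rw [Complex.norm_real, norm_div, Real.norm_eq_abs, Real.norm_eq_abs, abs_of_nonneg (Real.sqrt_nonneg _)]
    refine div_le_one_of_le₀ ?_ (Real.sqrt_nonneg _)
    exact Real.abs_le_sqrt (by nlinarith [hd0 j])
  · filter_upwards [h2, ae_all_iff.2 fun j ↦ emb_w k (hC j)] with z h3 h4
    simp only [h4]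
    have hd : Tendsto d atTop (𝓝 0) := tendsto_one_div_add_atTop_nhds_zero_nat
    have := (((h3.pow 2).add (hd.pow 2)).sqrt).sub hd
    simpa [Real.sqrt_sq_eq_abs] using this
theorem st_bd : ∃ C : ℝ, 0 < C ∧ ∀ t, |deriv Real.smoothTransition t| ≤ C := by
  have hc : Continuous (deriv Real.smoothTransition) := (Real.smoothTransition.contDiff (n := 1)).continuous_deriv le_rfl
  have hcs : HasCompactSupport (deriv Real.smoothTransition) := by
    refine HasCompactSupport.intro (K := Set.Icc 0 1) isCompact_Icc fun t ht ↦ ?_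
    rw [Set.mem_Icc, not_and_or, not_le, not_le] at ht
    rcases ht with ht | ht
    · have : Real.smoothTransition =ᶠ[𝓝 t] fun _ ↦ 0 := by
        filter_upwards [eventually_lt_nhds ht] with s hs using Real.smoothTransition.zero_of_nonpos hs.le
      rw [this.deriv_eq]; simp
    · have : Real.smoothTransition =ᶠ[𝓝 t] fun _ ↦ 1 := by
        filter_upwards [eventually_gt_nhds ht] with s hs using Real.smoothTransition.one_of_one_le hs.le
      rw [this.deriv_eq]; simp
  obtain ⟨C, hC⟩ := hc.bounded_above_of_compact_support hcs
  exact ⟨|C| + 1, by positivity, fun t ↦ (hC t).trans (by linarith [le_abs_self C])⟩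
theorem gr_fD (z : ℂ) : gr fD z = -2 * z := by
  have : HasFDerivAt fD (-(2 • innerSL ℝ z)) z := by
    have h := (hasStrictFDerivAt_norm_sq z).hasFDerivAt.const_sub 1
    exact h
  rw [gr_eq this]; apply Complex.ext <;> simp [inner_C]
theorem gr_comp_fD {g : ℝ → ℝ} {g' : ℝ} {z : ℂ} (hg : HasDerivAt g g' (fD z)) :
    gr (fun z ↦ g (fD z)) z = (g' : ℂ) * (-2 * z) := by
  rw [gr_comp hg (fD_cd.differentiable (by simp) z), gr_fD]
theorem ann_vol (r : ℝ) (h0 : 0 ≤ r) : (volume : Measure ℂ).real {z | z ∈ DD ∧ fD z ≤ r} ≤ Real.pi * r := by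
  by_cases h1 : r ≤ 1
  · have hs : {z | z ∈ DD ∧ fD z ≤ r} = DD \ Metric.ball 0 (√(1 - r)) := by
      ext z
      simp only [Set.mem_ofPred_eq, Set.mem_sdiff, Metric.mem_ball, dist_zero_right, not_lt, fD, Real.sqrt_le_left (norm_nonneg z)]
      exact and_congr_right fun _ ↦ by constructor <;> intro <;> linarith
    rw [hs, measureReal_sdiff (Metric.ball_subset_ball (Real.sqrt_le_one.2 (by linarith))) measurableSet_ball measure_ball_lt_top.ne]
    simp only [Measure.real, Complex.volume_ball]
    simp only [ENNReal.toReal_mul, ENNReal.toReal_pow, ENNReal.toReal_ofReal, zero_le_one, Real.sqrt_nonneg, Real.sq_sqrt (show 0 ≤ 1 - r by linarith), ENNReal.coe_toReal, NNReal.coe_real_pi, one_pow]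
    linarith
  · calc _ ≤ (volume : Measure ℂ).real DD := measureReal_mono (fun z hz ↦ hz.1) measure_ball_lt_top.ne
      _ = Real.pi := by simp [Measure.real, Complex.volume_ball]
      _ ≤ _ := by nlinarith [Real.pi_pos]
theorem cutB (k : ℕ) : ∃ φ : ℕ → ℂ → ℝ, ∃ hcore : ∀ j, Core (φ j), ∃ B : ℝ, (∀ j, ‖emb k (φ j) (hcore j)‖ ^ 2 ≤ B) ∧
    (∀ j z, 0 ≤ φ j z ∧ φ j z ≤ 1) ∧ ∀ r : ℝ, r < 1 → ∀ᶠ j : ℕ in atTop, ∀ z : ℂ, ‖z‖ ≤ r → φ j z = 1 ∧ gr (φ j) z = 0 := by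
  obtain ⟨C, hC0, hC⟩ := st_bd
  set T := Real.smoothTransition
  set φ : ℕ → ℂ → ℝ := fun j z ↦ T (((j:ℝ) + 1) * fD z - 1) with hφ
  have hTd : Differentiable ℝ T := (Real.smoothTransition.contDiff (n := 1)).differentiable one_ne_zero
  have hg : ∀ j z, gr (φ j) z = ((deriv T (((j:ℝ)+1) * fD z - 1) * ((j:ℝ)+1) : ℝ) : ℂ) * (-2 * z) := fun j z ↦ by
    refine gr_comp_fD (g := fun t ↦ T (((j:ℝ)+1) * t - 1)) ?_
    have h1 : HasDerivAt (fun t : ℝ ↦ ((j:ℝ)+1) * t - 1) ((j:ℝ)+1) (fD z) := by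
      simpa using ((hasDerivAt_id (fD z)).const_mul ((j:ℝ)+1)).sub_const 1
    exact (hTd _).hasDerivAt.comp (fD z) h1
  have hsup : ∀ j : ℕ, tsupport (φ j) ⊆ {z | 1 ≤ ((j:ℝ)+1) * fD z} := fun j ↦ by
    refine closure_minimal (fun z hz ↦ ?_) (isClosed_le continuous_const (by have := fD_cont; fun_prop))
    by_contra h
    simp only [Set.mem_ofPred_eq, not_le] at h
    exact hz (Real.smoothTransition.zero_of_nonpos (by linarith))
  have hsub : ∀ j : ℕ, {z | 1 ≤ ((j:ℝ)+1) * fD z} ⊆ DD := fun j z hz ↦ by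
    have h1 : 0 < fD z := by
      by_contra! h
      have : ((j:ℝ)+1) * fD z ≤ 0 := mul_nonpos_of_nonneg_of_nonpos (by positivity) h
      simp only [Set.mem_ofPred_eq] at hz; linarith
    simp only [Metric.mem_ball, dist_zero_right]
    unfold fD at h1; nlinarith [norm_nonneg z]
  have hcore : ∀ j, Core (φ j) := fun j ↦ by
    have hs := (hsup j).trans (hsub j)
    refine ⟨(Real.smoothTransition.contDiff).comp ((contDiff_const.mul (fD_cd.of_le (by simp))).sub contDiff_const), ?_, hs⟩
    exact Metric.isCompact_of_isClosed_isBounded (isClosed_tsupport _) (Metric.isBounded_ball.subset hs)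
  have hgz : ∀ (j : ℕ) z, 2 < ((j:ℝ)+1) * fD z → gr (φ j) z = 0 := fun j z hz ↦ by
    have h1 : deriv T (((j:ℝ)+1) * fD z - 1) = 0 := by
      have : T =ᶠ[𝓝 (((j:ℝ)+1) * fD z - 1)] fun _ ↦ 1 := by
        filter_upwards [eventually_gt_nhds (show 1 < ((j:ℝ)+1) * fD z - 1 by linarith)] with s hs using Real.smoothTransition.one_of_one_le hs.le
      rw [this.deriv_eq]; simp
    rw [hg, h1]; simp
  have hbd : ∀ j, ‖emb k (φ j) (hcore j)‖ ^ 2 ≤ NN k ^ 2 * (bet k).real Set.univ + 8 * C ^ 2 * (2 * Real.pi) * 2 := fun j ↦ by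
    rw [norm_emb]
    gcongr ?_ * ?_ + ?_
    · have : ∫ z, φ j z ^ 2 ∂(bet k) ≤ ∫ z, (1:ℝ) ∂(bet k) := integral_mono ((hcore j).bsq k) (integrable_const _) fun z ↦
        pow_le_one₀ (Real.smoothTransition.nonneg _) (Real.smoothTransition.le_one _)
      simpa using this
    · set A := {z | z ∈ DD ∧ fD z ≤ 2 / ((j:ℝ)+1)}
      have hA : MeasurableSet A := measurableSet_ball.inter (fD_cont.measurable measurableSet_Iic)
      have hAv : (bet k).real A ≤ Real.pi * (2 / ((j:ℝ)+1)) :=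
        (ENNReal.toReal_mono ((measure_mono (fun z hz ↦ hz.1)).trans_lt measure_ball_lt_top).ne ((bet_le k A).trans (Measure.restrict_le_self A))).trans (ann_vol _ (by positivity))
      have : ∫ z, ‖(sf z : ℂ) * gr (φ j) z‖ ^ 2 ∂(bet k) ≤ ∫ z, A.indicator (fun _ ↦ 8 * C ^ 2 * ((j:ℝ)+1)) z ∂(bet k) := by
        refine integral_mono_ae (((hcore j).mG k).integrable_norm_pow two_ne_zero) ((integrable_const _).indicator hA) ?_
        filter_upwards [bet_D k] with z hz
        by_cases hzA : z ∈ A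
        · rw [Set.indicator_of_mem hzA, hg, norm_mul, mul_pow, Complex.norm_real, Real.norm_eq_abs, sq_abs, sf_sq hz, norm_mul, norm_mul, Complex.norm_real, Real.norm_eq_abs, abs_mul]
          have h1 : |(j:ℝ)+1| = (j:ℝ)+1 := abs_of_pos (by positivity)
          have h2 : ‖(-2:ℂ)‖ * ‖z‖ ≤ 2 := by
            have : ‖z‖ < 1 := by simpa using hz
            simp; linarith
          have h3 := hC (((j:ℝ)+1) * fD z - 1)
          have h4 : fD z * ((j:ℝ)+1) ≤ 2 := by have := hzA.2; rwa [le_div_iff₀ (by positivity)] at this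
          rw [h1]
          calc fD z * (|deriv T (((j:ℝ)+1) * fD z - 1)| * ((j:ℝ)+1) * (‖(-2:ℂ)‖ * ‖z‖)) ^ 2 ≤ fD z * (C * ((j:ℝ)+1) * 2) ^ 2 := by
                have := (fD_pos hz).le
                gcongr
            _ = (fD z * ((j:ℝ)+1)) * (4 * C ^ 2 * ((j:ℝ)+1)) := by ring
            _ ≤ 2 * (4 * C ^ 2 * ((j:ℝ)+1)) := by gcongr
            _ = _ := by ring
        · rw [Set.indicator_of_notMem hzA, hgz j z]
          · simp
          · by_contra! h
            exact hzA ⟨hz, by rw [le_div_iff₀ (by positivity)]; linarith⟩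
      refine this.trans ?_
      rw [integral_indicator_const _ hA, smul_eq_mul]
      calc _ ≤ Real.pi * (2 / ((j:ℝ)+1)) * (8 * C ^ 2 * ((j:ℝ)+1)) := by gcongr
        _ ≤ _ := by field_simp; nlinarith [Real.pi_pos, sq_nonneg C, mul_nonneg Real.pi_pos.le (sq_nonneg C)]
  have hlarge : ∀ r : ℝ, r < 1 → ∀ᶠ j : ℕ in atTop, ∀ z : ℂ, ‖z‖ ≤ r → 2 < ((j:ℝ)+1) * fD z := fun r hr ↦ by
    by_cases hr0 : 0 ≤ r
    · have h1 : 0 < 1 - r ^ 2 := by nlinarith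
      have : Tendsto (fun j : ℕ ↦ ((j:ℝ)+1) * (1 - r ^ 2)) atTop atTop :=
        (tendsto_atTop_add_const_right _ 1 tendsto_natCast_atTop_atTop).atTop_mul_const h1
      filter_upwards [this.eventually_gt_atTop 2] with j hj z hz
      refine hj.trans_le ?_
      unfold fD
      gcongr
    · exact Eventually.of_forall fun j z hz ↦ absurd ((norm_nonneg z).trans hz) hr0
  exact ⟨φ, hcore, _, hbd, fun j z ↦ ⟨Real.smoothTransition.nonneg _, Real.smoothTransition.le_one _⟩, fun r hr ↦ (hlarge r hr).mono fun j hj z hz ↦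
    ⟨Real.smoothTransition.one_of_one_le (by linarith [hj z hz]), hgz j z (hj z hz)⟩⟩
theorem one_HH (k : ℕ) : ∃ x ∈ HH k, wf x =ᵐ[bet k] (fun _ ↦ 1) ∧ gf x =ᵐ[bet k] 0 := by
  obtain ⟨φ, hcore, B, hbd, -, hlarge⟩ := cutB k
  obtain ⟨s, hs, y, hy, hweak, hae, -⟩ := L3 (fun j ↦ emb k (φ j) (hcore j)) (fun j ↦ emb_HH _) (|B| + 1) fun j ↦ by
    have h1 := (hbd j).trans (le_abs_self B)
    nlinarith [norm_nonneg (emb k (φ j) (hcore j)), abs_nonneg B]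
  refine ⟨y, hy, ?_, ?_⟩
  · filter_upwards [hae, bet_D k, ae_all_iff.2 fun j ↦ emb_w k (hcore j)] with z h1 h2 h3
    refine tendsto_nhds_unique h1 (tendsto_const_nhds.congr' ?_)
    filter_upwards [hs.tendsto_atTop.eventually (hlarge ‖z‖ (by simpa using h2))] with j hj
    rw [h3]
    exact (hj z le_rfl).1.symm
  · have key : ∀ m : ℕ, ∀ᵐ z ∂(bet k), ‖z‖ ≤ 1 - 1 / ((m:ℝ)+1) → gf y z = 0 := fun m ↦ by
      set S : Set ℂ := Metric.closedBall 0 (1 - 1 / ((m:ℝ)+1))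
      have hS : MeasurableSet S := measurableSet_closedBall
      have hm : MemLp (S.indicator (gf y)) 2 (bet k) := (gf_mem y).indicator hS
      have e : ∀ x : VV k, inner ℝ x (WithLp.toLp 2 (0, hm.toLp _) : VV k) = ∫ z, inner ℝ (gf x z) (S.indicator (gf y) z) ∂(bet k) := fun x ↦ by
        rw [WithLp.prod_inner_apply]
        simp only [inner_zero_right, zero_add]
        rw [L2.inner_def]
        exact integral_congr_ae (by filter_upwards [hm.coeFn_toLp] with z hz; rw [hz]; rfl)
      have h1 := hweak (WithLp.toLp 2 (0, hm.toLp _))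
      have h2 : inner ℝ y (WithLp.toLp 2 (0, hm.toLp _) : VV k) = 0 := by
        refine tendsto_nhds_unique h1 (tendsto_const_nhds.congr' ?_)
        filter_upwards [hs.tendsto_atTop.eventually (hlarge (1 - 1 / ((m:ℝ)+1)) (by linarith [show 0 < 1 / ((m:ℝ)+1) by positivity]))] with j hj
        rw [e]
        symm
        refine integral_eq_zero_of_ae ?_
        filter_upwards [emb_g k (hcore (s j))] with z hz
        by_cases hzS : z ∈ S
        · rw [hz, (hj z (by simpa [S] using hzS)).2]; simp
        · simp [Set.indicator_of_notMem hzS]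
      rw [e] at h2
      have h3 : ∀ z, inner ℝ (gf y z) (S.indicator (gf y) z) = ‖S.indicator (gf y) z‖ ^ 2 := fun z ↦ by
        by_cases hzS : z ∈ S
        · rw [Set.indicator_of_mem hzS, real_inner_self_eq_norm_sq]
        · simp [Set.indicator_of_notMem hzS]
      simp_rw [h3] at h2
      rw [integral_eq_zero_iff_of_nonneg (fun z ↦ by positivity) (hm.integrable_norm_pow two_ne_zero)] at h2
      filter_upwards [h2] with z hz hzr
      have hzS : z ∈ S := by simpa [S] using hzr
      simpa [Set.indicator_of_mem hzS] using hz
    filter_upwards [ae_all_iff.2 key, bet_D k] with z h1 h2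
    have : Tendsto (fun j : ℕ ↦ 1 - 1 / ((j:ℝ) + 1)) atTop (𝓝 (1 - 0)) :=
      tendsto_const_nhds.sub tendsto_one_div_add_atTop_nhds_zero_nat
    obtain ⟨m, hm⟩ := (this.eventually_const_lt (u := ‖z‖) (by simpa using h2)).exists
    exact h1 m hm.le
end Heis
namespace Heis
theorem int_gr0 {ψ : ℂ → ℝ} (h : ContDiff ℝ 1 ψ) (hc : HasCompactSupport ψ) (v : ℂ) : ∫ z, fderiv ℝ ψ z v = 0 := by
  have h1 : Continuous fun z ↦ fderiv ℝ ψ z v := (h.continuous_fderiv one_ne_zero).clm_apply continuous_const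
  have h2 : HasCompactSupport fun z ↦ fderiv ℝ ψ z v := hc.fderiv_apply ℝ v
  have := integral_mul_fderiv_eq_neg_fderiv_mul_of_integrable (𝕜 := ℝ) (μ := (volume : Measure ℂ)) (f := ψ) (g := fun _ ↦ (1:ℝ)) (v := v)
    (by simpa using int_cs h1 h2) (by simp) (by simpa using int_cs h.continuous hc) (fun x _ ↦ h.differentiable one_ne_zero x) (fun x _ ↦ differentiableAt_const _)
  simpa using this.symm
theorem cd_tsupp {E : Type*} [NormedAddCommGroup E] [NormedSpace ℝ E] {ψ : E → ℝ} (h : ∀ z ∈ tsupport ψ, ContDiffAt ℝ 1 ψ z) : ContDiff ℝ 1 ψ := by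
  refine contDiff_iff_contDiffAt.2 fun z ↦ ?_
  by_cases hz : z ∈ tsupport ψ
  · exact h z hz
  · exact contDiffAt_const.congr_of_eventuallyEq (notMem_tsupport_iff_eventuallyEq.1 hz)
theorem Core.mulOn {φ ψ : ℂ → ℝ} (h : Core φ) (h' : ∀ z ∈ DD, ContDiffAt ℝ 1 ψ z) : Core (fun z ↦ ψ z * φ z) where
  cd := cd_tsupp fun z hz ↦ (h' z (h.sub (tsupport_mul_subset_right (f := ψ) (g := φ) hz))).mul h.cd.contDiffAt
  cpt := h.cpt.mul_left
  sub := (tsupport_mul_subset_right (f := ψ) (g := φ)).trans h.sub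
theorem Core.gr_mulOn {φ ψ : ℂ → ℝ} (h : Core φ) (h' : ∀ z ∈ DD, ContDiffAt ℝ 1 ψ z) (z : ℂ) :
    gr (fun z ↦ ψ z * φ z) z = (ψ z : ℂ) * gr φ z + (φ z : ℂ) * gr ψ z := by
  by_cases hz : z ∈ DD
  · exact gr_mul ((h' z hz).differentiableAt one_ne_zero) h.diff.differentiableAt
  · rw [(h.mulOn h').gr0 hz, h.gr0 hz, h.eq0 hz]; simp
theorem ibp {ψ Y1 Y2 : ℂ → ℝ} (h : Core ψ) (h1 : ∀ z ∈ DD, ContDiffAt ℝ 1 Y1 z) (h2 : ∀ z ∈ DD, ContDiffAt ℝ 1 Y2 z) :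
    Integrable (fun z ↦ (((gr ψ z).re * Y1 z + (gr ψ z).im * Y2 z) + ψ z * ((gr Y1 z).re + (gr Y2 z).im))) ∧
    ∫ z, (((gr ψ z).re * Y1 z + (gr ψ z).im * Y2 z) + ψ z * ((gr Y1 z).re + (gr Y2 z).im)) = 0 := by
  have a1 := h.mulOn h1
  have a2 := h.mulOn h2
  have i1 : Integrable fun z ↦ fderiv ℝ (fun z ↦ Y1 z * ψ z) z 1 :=
    int_cs ((a1.cd.continuous_fderiv one_ne_zero).clm_apply continuous_const) (a1.cpt.fderiv_apply ℝ _)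
  have i2 : Integrable fun z ↦ fderiv ℝ (fun z ↦ Y2 z * ψ z) z Complex.I :=
    int_cs ((a2.cd.continuous_fderiv one_ne_zero).clm_apply continuous_const) (a2.cpt.fderiv_apply ℝ _)
  have e : (fun z ↦ (((gr ψ z).re * Y1 z + (gr ψ z).im * Y2 z) + ψ z * ((gr Y1 z).re + (gr Y2 z).im))) =
      fun z ↦ fderiv ℝ (fun z ↦ Y1 z * ψ z) z 1 + fderiv ℝ (fun z ↦ Y2 z * ψ z) z Complex.I := by
    funext z
    simp only [fderiv_gr, h.gr_mulOn h1, h.gr_mulOn h2]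
    simp; ring
  rw [e]
  exact ⟨i1.add i2, by rw [integral_add i1 i2, int_gr0 a1.cd a1.cpt, int_gr0 a2.cd a2.cpt, add_zero]⟩
theorem fpow_cd (r : ℝ) : ∀ z ∈ DD, ContDiffAt ℝ 1 (fun z ↦ fD z ^ r) z := fun z hz ↦
  (fD_cd.contDiffAt.of_le (by simp)).rpow_const_of_ne (fD_pos hz).ne'
theorem fpow_gr (r : ℝ) {z : ℂ} (hz : z ∈ DD) : gr (fun z ↦ fD z ^ r) z = ((-2 * r * fD z ^ (r - 1) : ℝ) : ℂ) * z := by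
  rw [gr_comp_fD (Real.hasDerivAt_rpow_const (p := r) (Or.inl (fD_pos hz).ne'))]
  push_cast; ring
def Ev (k : ℕ) (v : ℂ → ℝ) : ℝ := ∫ z, (‖gr v z‖ ^ 2 + NN k * (NN k - 2) * (v z ^ 2 / fD z ^ 2))
theorem divi {ψ χ : ℂ → ℝ} (h : Core ψ) (hc : ∀ z ∈ DD, ContinuousAt χ z) : Integrable fun z ↦ χ z * ψ z := by
  refine int_cs (continuous_iff_continuousAt.2 fun z ↦ ?_) h.cpt.mul_left
  by_cases hz : z ∈ DD
  · exact (hc z hz).mul h.cont.continuousAt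
  · have h1 : z ∉ tsupport ψ := fun h' ↦ hz (h.sub h')
    have : (fun z ↦ χ z * ψ z) =ᶠ[𝓝 z] fun _ ↦ 0 := by
      filter_upwards [notMem_tsupport_iff_eventuallyEq.1 h1] with y hy
      simp [hy]
    exact continuousAt_const.congr this.symm
theorem Core.sqc {φ : ℂ → ℝ} (h : Core φ) : Core fun z ↦ φ z ^ 2 := by
  simpa [sq] using h.mul h.cd
theorem id_cd : ContDiff ℝ ⊤ (fun z : ℂ ↦ z.re) ∧ ContDiff ℝ ⊤ (fun z : ℂ ↦ z.im) :=
  ⟨Complex.reCLM.contDiff, Complex.imCLM.contDiff⟩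
theorem gr_re (z : ℂ) : gr (fun z ↦ z.re) z = 1 := by
  refine (gr_eq (Complex.reCLM.hasFDerivAt (x := z))).trans ?_; apply Complex.ext <;> simp
theorem gr_im (z : ℂ) : gr (fun z ↦ z.im) z = Complex.I := by
  refine (gr_eq (Complex.imCLM.hasFDerivAt (x := z))).trans ?_; apply Complex.ext <;> simp
theorem Ev_eq {k : ℕ} {w : ℂ → ℝ} (h : Core w) : Ev k (fun z ↦ fD z ^ (NN k / 2) * w z) = ‖emb k w h‖ ^ 2 := by
  set N := NN k with hN
  have hc1 : ∀ z ∈ DD, ContDiffAt ℝ 1 (fun z ↦ -N * (fD z ^ (N - 1) * z.re)) z := fun z hz ↦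
    contDiffAt_const.mul ((fpow_cd (N - 1) z hz).mul (id_cd.1.contDiffAt.of_le (by simp)))
  have hc2 : ∀ z ∈ DD, ContDiffAt ℝ 1 (fun z ↦ -N * (fD z ^ (N - 1) * z.im)) z := fun z hz ↦
    contDiffAt_const.mul ((fpow_cd (N - 1) z hz).mul (id_cd.2.contDiffAt.of_le (by simp)))
  have key := ibp h.sqc hc1 hc2
  rw [norm_emb', Ev, ← add_zero (∫ z, fD z ^ k * (NN k ^ 2 * w z ^ 2 + fD z * ‖gr w z‖ ^ 2)), ← key.2, ← integral_add]
  · congr 1; funext z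
    by_cases hz : z ∈ DD
    · have hf := fD_pos hz
      rw [h.gr_mulOn (fpow_cd _), fpow_gr _ hz]
      have d1 : gr (fun z ↦ -N * (fD z ^ (N - 1) * z.re)) z = -N * ((fD z ^ (N - 1) : ℝ) + (z.re : ℂ) * (((-2 * (N - 1) * fD z ^ (N - 1 - 1) : ℝ) : ℂ) * z)) := by
        have hd := (fpow_cd (N - 1) z hz).differentiableAt one_ne_zero
        have hd' : DifferentiableAt ℝ (fun z : ℂ ↦ z.re) z := id_cd.1.differentiable (by simp) z
        rw [gr_const_mul (φ := fun z ↦ fD z ^ (N - 1) * z.re) (-N) (hd.mul hd'), gr_mul hd hd', gr_re, fpow_gr _ hz]; push_cast; ring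
      have d2 : gr (fun z ↦ -N * (fD z ^ (N - 1) * z.im)) z = -N * ((fD z ^ (N - 1) : ℝ) * Complex.I + (z.im : ℂ) * (((-2 * (N - 1) * fD z ^ (N - 1 - 1) : ℝ) : ℂ) * z)) := by
        have hd := (fpow_cd (N - 1) z hz).differentiableAt one_ne_zero
        have hd' : DifferentiableAt ℝ (fun z : ℂ ↦ z.im) z := id_cd.2.differentiable (by simp) z
        rw [gr_const_mul (φ := fun z ↦ fD z ^ (N - 1) * z.im) (-N) (hd.mul hd'), gr_mul hd hd', gr_im, fpow_gr _ hz]; push_cast; ring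
      have hsq : gr (fun z ↦ w z ^ 2) z = ((2 * w z : ℝ) : ℂ) * gr w z := by
        refine gr_comp (g := fun t ↦ t ^ 2) ?_ h.diff.differentiableAt
        simpa using hasDerivAt_pow 2 (w z)
      rw [d1, d2, hsq]
      have p1 : fD z ^ k = fD z ^ (N - 2) * fD z := by
        rw [← Real.rpow_natCast, ← Real.rpow_add_one hf.ne']; congr 1; simp [hN, NN]; ring
      have p2 : fD z ^ (N / 2 - 1) = fD z ^ (N / 2) / fD z := by
        rw [Real.rpow_sub_one hf.ne']
      have p3 : fD z ^ (N - 1) = fD z ^ (N - 2) * fD z := by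
        rw [← Real.rpow_add_one hf.ne']; congr 1; ring
      have p4 : fD z ^ (N - 1 - 1) = fD z ^ (N - 2) := by congr 1; ring
      have p5 : (fD z ^ (N / 2)) ^ 2 = fD z ^ (N - 2) * fD z ^ 2 := by
        rw [← Real.rpow_natCast (fD z) 2, ← Real.rpow_add hf, ← Real.rpow_natCast, ← Real.rpow_mul hf.le]; congr 1; push_cast; ring
      rw [p1, p2, p3, p4, normsq_C, normsq_C]
      simp only [Complex.add_re, Complex.add_im, Complex.mul_re, Complex.mul_im, Complex.ofReal_re, Complex.ofReal_im, Complex.neg_re, Complex.neg_im, Complex.I_re, Complex.I_im]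
      have hz2 : z.re ^ 2 = 1 - fD z - z.im ^ 2 := by unfold fD; rw [normsq_C]; ring
      set A := fD z ^ (N - 2)
      set B := fD z ^ (N / 2)
      set f := fD z
      set x := z.re
      set y := z.im
      field_simp
      ring_nf
      rw [show B ^ 2 = A * f ^ 2 from p5, hz2]
      ring
    · simp [h.gr0 hz, (h.mulOn (fpow_cd (N/2))).gr0 hz, h.eq0 hz, h.sqc.gr0 hz]
  · have := h.cont; have := h.grc; have := fD_cont
    refine int_cs (by fun_prop) (HasCompactSupport.intro h.cpt fun z hz ↦ ?_)
    simp [gr_supp w hz, image_eq_zero_of_notMem_tsupport hz]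
  · exact key.1
end Heis
namespace Heis
def tau (a : ℝ) (z : ℂ) : ℂ := ((a:ℂ) - (starRingEnd ℂ) z) / (1 - a * (starRingEnd ℂ) z)
def Jt (a : ℝ) (z : ℂ) : ℝ := (1 - a ^ 2) / ‖1 - (a:ℂ) * (starRingEnd ℂ) z‖ ^ 2
def ct (a : ℝ) (z : ℂ) : ℂ := (a ^ 2 - 1) / (1 - (a:ℂ) * (starRingEnd ℂ) z) ^ 2
section
variable {a : ℝ} (ha : 0 < a) (ha1 : a < 1)
include ha ha1
theorem tau_den {z : ℂ} (hz : z ∈ DD) : 1 - (a:ℂ) * (starRingEnd ℂ) z ≠ 0 := by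
  intro h
  have h1 : (a:ℂ) * (starRingEnd ℂ) z = 1 := (sub_eq_zero.1 h).symm
  have h2 : ‖(a:ℂ) * (starRingEnd ℂ) z‖ = 1 := by rw [h1]; simp
  simp only [norm_mul, RCLike.norm_conj, Complex.norm_real, Real.norm_eq_abs, abs_of_pos ha] at h2
  simp only [Metric.mem_ball, dist_zero_right] at hz
  nlinarith [norm_nonneg z]
theorem Jt_pos {z : ℂ} (hz : z ∈ DD) : 0 < Jt a z :=
  div_pos (by nlinarith) (by have := norm_pos_iff.2 (tau_den ha ha1 hz); positivity)
theorem fD_tau {z : ℂ} (hz : z ∈ DD) : fD (tau a z) = Jt a z * fD z := by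
  have h := norm_pos_iff.2 (tau_den ha ha1 hz)
  unfold fD Jt tau
  rw [norm_div, div_pow]
  field_simp
  rw [normsq_C, normsq_C, normsq_C]
  simp; ring
theorem tau_DD {z : ℂ} (hz : z ∈ DD) : tau a z ∈ DD := by
  have := fD_tau ha ha1 hz
  have h2 : 0 < fD (tau a z) := by rw [this]; exact mul_pos (Jt_pos ha ha1 hz) (fD_pos hz)
  unfold fD at h2
  simp only [Metric.mem_ball, dist_zero_right]
  nlinarith [norm_nonneg (tau a z)]
theorem tau_tau {z : ℂ} (hz : z ∈ DD) : tau a (tau a z) = z := by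
  have h := tau_den ha ha1 hz
  have h' : 1 - (a:ℂ) * z ≠ 0 := by
    intro h0; apply h
    have := congrArg (starRingEnd ℂ) h0
    simpa using this
  have h2 : (1:ℂ) - a ^ 2 ≠ 0 := by
    intro h0
    have : (1:ℝ) - a ^ 2 = 0 := by exact_mod_cast h0
    nlinarith
  unfold tau
  simp only [map_div₀, map_sub, map_mul, map_one, Complex.conj_conj, Complex.conj_ofReal]
  have e1 : (a:ℂ) - (a - z) / (1 - a * z) = z * (1 - a ^ 2) / (1 - a * z) := by field_simp; ring
  have e2 : 1 - (a:ℂ) * ((a - z) / (1 - a * z)) = (1 - a ^ 2) / (1 - a * z) := by field_simp; ring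
  rw [e1, e2, div_div_div_cancel_right₀ h', mul_div_cancel_right₀ _ h2]
theorem Jt_tau {z : ℂ} (hz : z ∈ DD) : Jt a (tau a z) = (Jt a z)⁻¹ := by
  have h1 := fD_tau ha ha1 (tau_DD ha ha1 hz)
  rw [tau_tau ha ha1 hz, fD_tau ha ha1 hz] at h1
  have := fD_pos hz; have := Jt_pos ha ha1 hz
  field_simp
  nlinarith
theorem Jt_one {z : ℂ} (hz : z ∈ DD) (h : Jt a z = 1) : tau a z = z := by
  have h0 := tau_den ha ha1 hz
  have h1 := norm_pos_iff.2 h0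
  unfold Jt at h
  rw [div_eq_one_iff_eq (by positivity), normsq_C] at h
  simp at h
  unfold tau
  rw [div_eq_iff h0]
  have e : a * (1 + z.re ^ 2 + z.im ^ 2) = 2 * z.re := by
    apply mul_left_cancel₀ ha.ne'; nlinarith
  apply Complex.ext <;> simp
  · linarith
  · ring
theorem norm_ct {z : ℂ} : ‖ct a z‖ = Jt a z := by
  unfold ct Jt
  rw [norm_div, norm_pow]
  congr 1
  rw [← Complex.ofReal_one, ← Complex.ofReal_pow, ← Complex.ofReal_sub, Complex.norm_real, Real.norm_eq_abs, abs_of_neg (by nlinarith)]; ring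
theorem tau_der {z : ℂ} (hz : z ∈ DD) : HasFDerivAt (tau a)
    ((ct a z) • (Complex.conjCLE : ℂ →L[ℝ] ℂ)) z := by
  have h := tau_den ha ha1 hz
  have h1 : HasDerivAt (fun w : ℂ ↦ ((a:ℂ) - w) / (1 - a * w)) (ct a z) ((starRingEnd ℂ) z) := by
    have := ((hasDerivAt_id ((starRingEnd ℂ) z)).const_sub (a:ℂ)).div (((hasDerivAt_id ((starRingEnd ℂ) z)).const_mul (a:ℂ)).const_sub 1) h
    refine this.congr_deriv ?_
    unfold ct; simp; ring_nf
  have h2 : HasFDerivAt (starRingEnd ℂ) (Complex.conjCLE : ℂ →L[ℝ] ℂ) z := Complex.conjCLE.hasFDerivAt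
  refine ((h1.hasFDerivAt.restrictScalars ℝ).comp z h2).congr_fderiv ?_
  ext v; simp [mul_comm]
theorem tau_cd {z : ℂ} (hz : z ∈ DD) : ContDiffAt ℝ 1 (tau a) z := by
  have h2 : ContDiff ℝ 1 (starRingEnd ℂ) := Complex.conjCLE.contDiff
  have h3 : ContDiffAt ℝ 1 (fun z ↦ 1 - (a:ℂ) * (starRingEnd ℂ) z) z := contDiffAt_const.sub (contDiffAt_const.mul h2.contDiffAt)
  exact (contDiffAt_const.sub h2.contDiffAt).mul (h3.inv (tau_den ha ha1 hz))
theorem Jt_cd {z : ℂ} (hz : z ∈ DD) : ContDiffAt ℝ 1 (Jt a) z := by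
  have h2 : ContDiff ℝ 1 (starRingEnd ℂ) := Complex.conjCLE.contDiff
  have h3 : ContDiffAt ℝ 1 (fun z ↦ 1 - (a:ℂ) * (starRingEnd ℂ) z) z := contDiffAt_const.sub (contDiffAt_const.mul h2.contDiffAt)
  exact contDiffAt_const.div (h3.norm_sq ℝ) (by simpa using tau_den ha ha1 hz)
theorem tau_img : tau a '' DD = DD := by
  ext z; constructor
  · rintro ⟨w, hw, rfl⟩; exact tau_DD ha ha1 hw
  · intro hz; exact ⟨tau a z, tau_DD ha ha1 hz, tau_tau ha ha1 hz⟩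
theorem tau_inj : Set.InjOn (tau a) DD := fun z hz w hw h ↦ by
  rw [← tau_tau ha ha1 hz, h, tau_tau ha ha1 hw]
omit ha ha1 in
theorem det_cc (c : ℂ) : |(c • (Complex.conjCLE : ℂ →L[ℝ] ℂ)).det| = ‖c‖ ^ 2 := by
  have : ((c • (Complex.conjCLE : ℂ →L[ℝ] ℂ) : ℂ →L[ℝ] ℂ) : ℂ →ₗ[ℝ] ℂ) = (Algebra.lmul ℝ ℂ c) ∘ₗ (Complex.conjAe.toLinearMap) := by
    ext v; simp
  rw [ContinuousLinearMap.det, this, LinearMap.det_comp, ← Algebra.norm_apply, Algebra.norm_complex_apply, Complex.det_conjAe, Complex.normSq_eq_norm_sq]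
  simp
theorem cov_int (F : ℂ → ℝ) : ∫ z in DD, F z = ∫ z in DD, Jt a z ^ 2 * F (tau a z) := by
  have := integral_image_eq_integral_abs_det_fderiv_smul volume measurableSet_ball (fun z hz ↦ (tau_der ha ha1 hz).hasFDerivWithinAt) (tau_inj ha ha1) F
  rw [tau_img ha ha1] at this
  rw [this]
  refine setIntegral_congr_fun measurableSet_ball fun z hz ↦ ?_
  simp only [det_cc, norm_ct ha ha1, smul_eq_mul]
theorem cov_intble (F : ℂ → ℝ) : IntegrableOn F DD ↔ IntegrableOn (fun z ↦ Jt a z ^ 2 * F (tau a z)) DD := by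
  have := integrableOn_image_iff_integrableOn_abs_det_fderiv_smul volume measurableSet_ball (fun z hz ↦ (tau_der ha ha1 hz).hasFDerivWithinAt) (tau_inj ha ha1) F
  rw [tau_img ha ha1] at this
  rw [this]
  refine integrableOn_congr_fun (fun z hz ↦ ?_) measurableSet_ball
  simp only [det_cc, norm_ct ha ha1, smul_eq_mul]
theorem cov_bet (k : ℕ) (F : ℂ → ℝ) : ∫ z, F z ∂(bet k) = ∫ z, Jt a z ^ (k + 2) * F (tau a z) ∂(bet k) := by
  rw [bet_int, bet_int, cov_int ha ha1]
  refine setIntegral_congr_fun measurableSet_ball fun z hz ↦ ?_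
  simp only [fD_tau ha ha1 hz, smul_eq_mul, mul_pow]; ring
theorem cov_bet_intble (k : ℕ) (F : ℂ → ℝ) : Integrable F (bet k) ↔ Integrable (fun z ↦ Jt a z ^ (k + 2) * F (tau a z)) (bet k) := by
  rw [bet_intble, bet_intble, cov_intble ha ha1]
  refine integrableOn_congr_fun (fun z hz ↦ ?_) measurableSet_ball
  simp only [fD_tau ha ha1 hz, smul_eq_mul, mul_pow]; ring
omit ha ha1 in
theorem tau_meas : Measurable (tau a) := by
  have h2 : Measurable (starRingEnd ℂ) := Complex.continuous_conj.measurable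
  unfold tau; fun_prop
omit ha ha1 in
theorem Jt_meas : Measurable (Jt a) := by
  have h2 : Measurable (starRingEnd ℂ) := Complex.continuous_conj.measurable
  unfold Jt; fun_prop
theorem tau_qmp (k : ℕ) : Measure.QuasiMeasurePreserving (tau a) (bet k) (bet k) := by
  refine ⟨tau_meas, ?_⟩
  have h0 : Measure.map (tau a) (volume.restrict DD) ≪ volume.restrict DD := by
    refine Measure.AbsolutelyContinuous.mk fun s hs h ↦ ?_
    rw [Measure.map_apply tau_meas hs]
    rw [Measure.restrict_apply hs] at h
    rw [Measure.restrict_apply (tau_meas hs)]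
    have e : tau a ⁻¹' s ∩ DD ⊆ tau a '' (s ∩ DD) := fun z hz ↦
      ⟨tau a z, ⟨hz.1, tau_DD ha ha1 hz.2⟩, tau_tau ha ha1 hz.2⟩
    refine measure_mono_null e (addHaar_image_eq_zero_of_differentiableOn_of_addHaar_eq_zero volume ?_ h)
    exact fun z hz ↦ (tau_der ha ha1 hz.2).differentiableAt.differentiableWithinAt
  have h1 : bet k ≪ volume.restrict DD := Measure.ae_le_iff_absolutelyContinuous.1 (bet_ae k).le
  have h2 : volume.restrict DD ≪ bet k := Measure.ae_le_iff_absolutelyContinuous.1 (bet_ae k).ge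
  exact ((h1.map tau_meas).trans h0).trans h2
theorem tau_ae (k : ℕ) {p : ℂ → Prop} (h : ∀ᵐ z ∂(bet k), p z) : ∀ᵐ z ∂(bet k), p (tau a z) :=
  (tau_qmp ha ha1 k).ae h
theorem Core.tau {v : ℂ → ℝ} (h : Core v) : Core (DD.indicator fun z ↦ v (tau a z)) := by
  have hs : tsupport (DD.indicator fun z ↦ v (Heis.tau a z)) ⊆ Heis.tau a '' tsupport v := by
    have hK : IsCompact (Heis.tau a '' tsupport v) := h.cpt.isCompact.image_of_continuousOn
      fun z hz ↦ (tau_cd ha ha1 (h.sub hz)).continuousAt.continuousWithinAt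
    refine closure_minimal (fun z hz ↦ ?_) hK.isClosed
    rw [Function.mem_support, Set.indicator_apply_ne_zero] at hz
    exact ⟨Heis.tau a z, subset_tsupport _ hz.2, tau_tau ha ha1 hz.1⟩
  have hD : tsupport (DD.indicator fun z ↦ v (Heis.tau a z)) ⊆ DD := hs.trans (by
    rintro _ ⟨w, hw, rfl⟩; exact tau_DD ha ha1 (h.sub hw))
  refine ⟨cd_tsupp fun z hz ↦ ?_, ?_, hD⟩
  · have := (h.cd.contDiffAt (x := Heis.tau a z)).comp z (tau_cd ha ha1 (hD hz))
    refine this.congr_of_eventuallyEq ?_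
    filter_upwards [Metric.isOpen_ball.mem_nhds (hD hz)] with y hy
    simp [Set.indicator_of_mem hy]
  · exact (h.cpt.isCompact.image_of_continuousOn
      fun z hz ↦ (tau_cd ha ha1 (h.sub hz)).continuousAt.continuousWithinAt).of_isClosed_subset (isClosed_tsupport _) hs
theorem gr_tau {v : ℂ → ℝ} {z : ℂ} (hz : z ∈ DD) (h : DifferentiableAt ℝ v (tau a z)) :
    gr (DD.indicator fun z ↦ v (tau a z)) z = ct a z * (starRingEnd ℂ) (gr v (tau a z)) := by
  have h1 : HasFDerivAt (DD.indicator fun z ↦ v (tau a z)) _ z := (h.hasFDerivAt.comp z (tau_der ha ha1 hz)).congr_of_eventuallyEq (by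
    filter_upwards [Metric.isOpen_ball.mem_nhds hz] with y hy
    simp [Set.indicator_of_mem hy])
  rw [gr_eq h1]
  apply Complex.ext <;> simp [fderiv_gr] <;> ring
end
end Heis
namespace Heis
theorem fder0 {h : ℂ → ℝ} {z : ℂ} (h0 : gr h z = 0) : fderiv ℝ h z = 0 := by
  ext v; simp [fderiv_gr, h0]
theorem sgn_core {h : ℂ → ℝ} (hc : Core h) {σ : ℂ → ℝ} (hs : ∀ z, |σ z| = 1)
    (hl : ∀ z ∈ DD, (∀ᶠ y in 𝓝 z, σ y = σ z) ∨ (h z = 0 ∧ gr h z = 0)) :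
    Core (fun z ↦ σ z * h z) ∧ ∀ z, gr (fun z ↦ σ z * h z) z = (σ z : ℂ) * gr h z := by
  have hl' : ∀ z, (∀ᶠ y in 𝓝 z, σ y = σ z) ∨ (h z = 0 ∧ gr h z = 0) := fun z ↦ by
    by_cases hz : z ∈ DD
    · exact hl z hz
    · exact Or.inr ⟨hc.eq0 hz, hc.gr0 hz⟩
  have hD : ∀ z, HasFDerivAt (fun z ↦ σ z * h z) (σ z • fderiv ℝ h z) z := fun z ↦ by
    rcases hl' z with h1 | ⟨h1, h2⟩
    · refine (hc.diff.differentiableAt.hasFDerivAt.const_mul (σ z)).congr_of_eventuallyEq ?_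
      filter_upwards [h1] with y hy; rw [hy]
    · have h3 := hc.diff.differentiableAt.hasFDerivAt (x := z)
      rw [fder0 h2, hasFDerivAt_iff_isLittleO] at h3
      rw [fder0 h2, smul_zero, hasFDerivAt_iff_isLittleO]
      refine (Asymptotics.IsBigO.of_bound 1 (Eventually.of_forall fun y ↦ ?_)).trans_isLittleO h3
      simp [h1, abs_mul, hs]
  refine ⟨⟨contDiff_one_iff_fderiv.2 ⟨fun z ↦ (hD z).differentiableAt, ?_⟩, hc.cpt.mul_left,
    (tsupport_mul_subset_right (f := σ) (g := h)).trans hc.sub⟩, fun z ↦ ?_⟩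
  · have hcf := hc.cd.continuous_fderiv one_ne_zero
    rw [show fderiv ℝ (fun z ↦ σ z * h z) = fun z ↦ σ z • fderiv ℝ h z from funext fun z ↦ (hD z).fderiv]
    refine continuous_iff_continuousAt.2 fun z ↦ ?_
    rcases hl' z with h1 | ⟨h1, h2⟩
    · refine (hcf.continuousAt.const_smul (σ z)).congr ?_
      filter_upwards [h1] with y hy; rw [hy]; rfl
    · rw [ContinuousAt, fder0 h2, smul_zero, tendsto_zero_iff_norm_tendsto_zero]
      have := hcf.norm.tendsto z
      rw [fder0 h2, norm_zero] at this
      simpa [norm_smul, hs] using this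
  · rw [gr_eq (hD z)]; apply Complex.ext <;> simp [gr]
def en (k : ℕ) (v : ℂ → ℝ) (z : ℂ) : ℝ := ‖gr v z‖ ^ 2 + NN k * (NN k - 2) * (v z ^ 2 / fD z ^ 2)
theorem en_0 {k : ℕ} {v : ℂ → ℝ} (h : Core v) {z : ℂ} (hz : z ∉ DD) : en k v z = 0 := by
  simp [en, h.eq0 hz, h.gr0 hz]
theorem f2_cont (c : ℝ) : ∀ z ∈ DD, ContinuousAt (fun z ↦ c / fD z ^ 2) z := fun z hz ↦
  continuousAt_const.div (fD_cont.pow 2).continuousAt (by have := fD_pos hz; positivity)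
theorem en_i {k : ℕ} {v : ℂ → ℝ} (h : Core v) : Integrable (en k v) := by
  have h1 : Integrable fun z ↦ ‖gr v z‖ ^ 2 := int_cs (h.grc.norm.pow 2) (h.grs.norm.comp_left (g := fun t ↦ t ^ 2) (by simp))
  refine h1.add ((divi h.sqc (f2_cont (NN k * (NN k - 2)))).congr (Eventually.of_forall fun z ↦ ?_))
  simp only; ring
theorem Ev_D {k : ℕ} {v : ℂ → ℝ} (h : Core v) : Ev k v = ∫ z in DD, en k v z :=
  (setIntegral_eq_integral_of_forall_compl_eq_zero fun z hz ↦ en_0 h hz).symm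
theorem Ev_tau {k : ℕ} {a : ℝ} (ha : 0 < a) (ha1 : a < 1) {v : ℂ → ℝ} (h : Core v) :
    Ev k (DD.indicator fun z ↦ v (tau a z)) = Ev k v := by
  rw [Ev_D (h.tau ha ha1), Ev_D h, cov_int ha ha1 (en k v)]
  refine setIntegral_congr_fun measurableSet_ball fun z hz ↦ ?_
  have := fD_pos hz; have := Jt_pos ha ha1 hz
  simp only [en, gr_tau ha ha1 hz h.diff.differentiableAt, Set.indicator_of_mem hz, norm_mul, norm_ct ha ha1, RCLike.norm_conj, fD_tau ha ha1 hz]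
  field_simp
theorem Ev_par {k : ℕ} {u v : ℂ → ℝ} (h : Core u) (h' : Core v) :
    Ev k (fun z ↦ u z + v z) + Ev k (fun z ↦ u z - v z) = 2 * Ev k u + 2 * Ev k v := by
  change (∫ z, en k _ z) + (∫ z, en k _ z) = 2 * (∫ z, en k _ z) + 2 * (∫ z, en k _ z)
  rw [← integral_add (en_i (h.add h')) (en_i (h.sub' h')), ← integral_const_mul, ← integral_const_mul,
    ← integral_add ((en_i h).const_mul 2) ((en_i h').const_mul 2)]
  congr 1; funext z
  simp only [en, gr_add h.diff.differentiableAt h'.diff.differentiableAt, gr_sub h.diff.differentiableAt h'.diff.differentiableAt, normsq_C,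
    Complex.add_re, Complex.add_im, Complex.sub_re, Complex.sub_im]; ring
theorem Ev_smul {k : ℕ} {u : ℂ → ℝ} (h : Core u) (c : ℝ) : Ev k (fun z ↦ c * u z) = c ^ 2 * Ev k u := by
  change ∫ z, en k _ z = c ^ 2 * ∫ z, en k _ z
  rw [← integral_const_mul]; congr 1; funext z
  simp only [en, gr_const_mul c h.diff.differentiableAt, norm_mul, mul_pow, Complex.norm_real, Real.norm_eq_abs, sq_abs]; ring
def wsig (a : ℝ) (k : ℕ) (w : ℂ → ℝ) (z : ℂ) : ℝ :=
  if Jt a z < 1 then max (w z) (Jt a z ^ (NN k / 2) * w (tau a z)) else min (w z) (Jt a z ^ (NN k / 2) * w (tau a z))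
def jr (e t : ℝ) : ℝ := √(t ^ 2 + e ^ 2) - e
theorem jr_cd {e : ℝ} (he : 0 < e) : ContDiff ℝ 1 (jr e) :=
    (ContDiff.sqrt (by fun_prop) fun t ↦ (by positivity : t ^ 2 + e ^ 2 ≠ 0)).sub contDiff_const
theorem jr_bd {e : ℝ} (he : 0 < e) (t : ℝ) : |t| - e ≤ jr e t ∧ 0 ≤ jr e t ∧ jr e t ≤ |t| ∧ jr e 0 = 0 ∧ jr e (-t) = jr e t := by
  refine ⟨?_, ?_, ?_, by simp [jr, Real.sqrt_sq he.le], by simp [jr]⟩ <;> unfold jr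
  · have : |t| ≤ √(t ^ 2 + e ^ 2) := Real.abs_le_sqrt (by nlinarith)
    linarith
  · have : e ≤ √(t ^ 2 + e ^ 2) := Real.le_sqrt_of_sq_le (by nlinarith [sq_nonneg t])
    linarith
  · rw [sub_le_iff_le_add, Real.sqrt_le_left (by positivity)]
    nlinarith [abs_nonneg t, sq_abs t]
theorem jr_d {e : ℝ} (he : 0 < e) (t : ℝ) : HasDerivAt (jr e) (t / √(t ^ 2 + e ^ 2)) t ∧ |t / √(t ^ 2 + e ^ 2)| ≤ 1 := by
  have hs := Real.sqrt_pos.2 (by positivity : 0 < t ^ 2 + e ^ 2)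
  constructor
  · refine ((((hasDerivAt_pow 2 t).add_const (e ^ 2)).sqrt (by positivity)).sub_const e).congr_deriv ?_
    field_simp; simp
  · rw [abs_div, abs_of_pos hs, div_le_one hs]; exact Real.abs_le_sqrt (by nlinarith)
theorem POL_core {k : ℕ} {a : ℝ} (ha : 0 < a) (ha1 : a < 1) {w : ℂ → ℝ} (h : Core w) :
    ∃ y ∈ HH k, wf y =ᵐ[bet k] wsig a k w ∧ ‖y‖ ^ 2 ≤ ‖emb k w h‖ ^ 2 := by
  set N := NN k with hN
  set v : ℂ → ℝ := fun z ↦ fD z ^ (N / 2) * w z with hv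
  have hvc : Core v := h.mulOn (fpow_cd _)
  set v' : ℂ → ℝ := DD.indicator fun z ↦ v (tau a z) with hv'
  have hvc' : Core v' := hvc.tau ha ha1
  set S : ℂ → ℝ := fun z ↦ v z + v' z with hS
  set d : ℂ → ℝ := fun z ↦ v z - v' z with hd
  have hSc : Core S := hvc.add hvc'
  have hdc : Core d := hvc.sub' hvc'
  set σ : ℂ → ℝ := fun z ↦ if Jt a z < 1 then 1 else -1 with hσ
  have hσ1 : ∀ z, |σ z| = 1 := fun z ↦ by simp only [hσ]; split_ifs <;> simp
  have hvt : ∀ z ∈ DD, v' (tau a z) = v z := fun z hz ↦ by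
    simp only [hv', Set.indicator_of_mem (tau_DD ha ha1 hz), tau_tau ha ha1 hz]
  have hvz : ∀ z ∈ DD, v' z = v (tau a z) := fun z hz ↦ by simp only [hv', Set.indicator_of_mem hz]
  have hd1 : ∀ z ∈ DD, Jt a z = 1 → d z = 0 := fun z hz hJ ↦ by
    simp only [hd, hvz z hz, Jt_one ha ha1 hz hJ, sub_self]
  have hcore : ∀ e, 0 < e → Core (fun z ↦ σ z * jr e (d z)) ∧ ∀ z, gr (fun z ↦ σ z * jr e (d z)) z = (σ z : ℂ) * gr (fun z ↦ jr e (d z)) z := fun e he ↦ by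
    refine sgn_core (hdc.comp (jr_cd he) (jr_bd he 0).2.2.2.1) hσ1 fun z hz ↦ ?_
    rcases lt_trichotomy (Jt a z) 1 with hJ | hJ | hJ
    · left
      filter_upwards [(Jt_cd ha ha1 hz).continuousAt.eventually_lt_const hJ] with y hy
      simp [hσ, hJ, hy]
    · right
      have h0 := hd1 z hz hJ
      refine ⟨by simp [h0, (jr_bd he 0).2.2.2.1], ?_⟩
      rw [gr_comp (jr_d he (d z)).1 hdc.diff.differentiableAt, h0]; simp
    · left
      filter_upwards [(Jt_cd ha ha1 hz).continuousAt.eventually_const_lt hJ] with y hy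
      simp [hσ, hJ.not_gt, hy.not_gt]
  have hEv : ∀ e, 0 < e → Ev k (fun z ↦ (1/2) * (S z + σ z * jr e (d z))) ≤ Ev k v + e * ∫ z, |N * (N - 2)| / fD z ^ 2 * |d z| / 2 := fun e he ↦ by
    obtain ⟨hc, hg⟩ := hcore e he
    have e1 : (DD.indicator fun z ↦ S (tau a z) + σ (tau a z) * jr e (d (tau a z))) = fun z ↦ S z - σ z * jr e (d z) := by
      funext z
      by_cases hz : z ∈ DD
      · rw [Set.indicator_of_mem hz]
        have s1 : S (tau a z) = S z := by simp only [hS, hvt z hz, hvz z hz]; ring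
        have s2 : d (tau a z) = - d z := by simp only [hd, hvt z hz, hvz z hz]; ring
        rw [s1, s2, (jr_bd he (d z)).2.2.2.2]
        have hJ := Jt_pos ha ha1 hz
        rcases eq_or_ne (Jt a z) 1 with h1 | h1
        · rw [hd1 z hz h1, (jr_bd he 0).2.2.2.1]; ring
        · have : σ (tau a z) = - σ z := by
            simp only [hσ, Jt_tau ha ha1 hz, inv_lt_one_iff₀]
            rcases h1.lt_or_gt with h1 | h1
            · rw [if_neg (by push Not; exact ⟨hJ, h1.le⟩), if_pos h1]
            · rw [if_pos (Or.inr h1), if_neg h1.not_gt]; ring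
          rw [this]; ring
      · rw [Set.indicator_of_notMem hz, hSc.eq0 hz, hdc.eq0 hz, (jr_bd he 0).2.2.2.1]; ring
    have e2 := Ev_tau (k := k) ha ha1 (hSc.add hc)
    rw [e1] at e2
    have e3 := Ev_par (k := k) hSc hc
    have e4 := Ev_par (k := k) hvc hvc'
    have e5 : Ev k v' = Ev k v := Ev_tau ha ha1 hvc
    have e6 := Ev_smul (k := k) (hSc.add hc) (1/2)
    have iI : Integrable fun z ↦ |N * (N - 2)| / fD z ^ 2 * |d z| / 2 := by
      have := divi hdc (f2_cont |N * (N - 2)|)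
      refine (this.abs.div_const 2).congr (Eventually.of_forall fun z ↦ ?_)
      simp only [abs_mul, abs_div, abs_abs, abs_pow, sq_abs]
    have e7 : Ev k (fun z ↦ σ z * jr e (d z)) ≤ Ev k d + 4 * (e * ∫ z, |N * (N - 2)| / fD z ^ 2 * |d z| / 2) := by
      change (∫ z, en k _ z) ≤ (∫ z, en k _ z) + _
      rw [← integral_const_mul, ← integral_const_mul, ← integral_add (en_i hdc) ((iI.const_mul e).const_mul 4)]
      refine integral_mono (en_i hc) ((en_i hdc).add ((iI.const_mul e).const_mul 4)) fun z ↦ ?_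
      simp only [en, hg, gr_comp (jr_d he (d z)).1 hdc.diff.differentiableAt, norm_mul, Complex.norm_real, Real.norm_eq_abs, hσ1, mul_pow, one_mul, one_pow]
      have b1 := mul_le_mul_of_nonneg_right (pow_le_one₀ (n := 2) (abs_nonneg _) (jr_d he (d z)).2) (sq_nonneg ‖gr d z‖)
      have b2 : N * (N - 2) * (jr e (d z) ^ 2) ≤ N * (N - 2) * d z ^ 2 + |N * (N - 2)| * (2 * e * |d z|) := by
        obtain ⟨j1, j2, j3, -, -⟩ := jr_bd he (d z)
        have j4 : |jr e (d z) ^ 2 - d z ^ 2| ≤ 2 * e * |d z| := by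
          rw [abs_le, ← sq_abs (d z)]; constructor <;> nlinarith [abs_nonneg (d z)]
        have := le_abs_self (N * (N - 2) * (jr e (d z) ^ 2 - d z ^ 2))
        rw [abs_mul] at this
        nlinarith [mul_le_mul_of_nonneg_left j4 (abs_nonneg (N * (N - 2)))]
      have b3 := div_le_div_of_nonneg_right b2 (sq_nonneg (fD z))
      have b4 : σ z ^ 2 = 1 := by rw [← sq_abs, hσ1]; simp
      rw [one_mul] at b1
      rw [b4, one_mul, ← hN]
      calc _ ≤ ‖gr d z‖ ^ 2 + (N * (N - 2) * d z ^ 2 + |N * (N - 2)| * (2 * e * |d z|)) / fD z ^ 2 := by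
            rw [← mul_div_assoc]; linarith
        _ = _ := by ring
    have e8 : Ev k S + Ev k d = 4 * Ev k v := by simp only [hS, hd]; linarith
    have e6' : Ev k (fun z ↦ (1/2) * (S z + σ z * jr e (d z))) = (1/2) ^ 2 * Ev k (fun z ↦ S z + σ z * jr e (d z)) := e6
    have e2' : Ev k (fun z ↦ S z - σ z * jr e (d z)) = Ev k (fun z ↦ S z + σ z * jr e (d z)) := e2
    rw [e6']; linarith
  set ee : ℕ → ℝ := fun j ↦ 1 / ((j:ℝ) + 1) with hee
  have hee0 : ∀ j, 0 < ee j := fun j ↦ by positivity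
  have hel : Tendsto ee atTop (𝓝 0) := tendsto_one_div_add_atTop_nhds_zero_nat
  have hwc := fun j ↦ ((hSc.add (hcore (ee j) (hee0 j)).1).smul (1/2)).mulOn (fpow_cd (-(N/2)))
  obtain ⟨y, hy, h1, h2⟩ := LSC (fun j ↦ emb k _ (hwc j)) (fun j ↦ emb_HH _) (fun j ↦ Ev k v + ee j * ∫ z, |N * (N - 2)| / fD z ^ 2 * |d z| / 2) (Ev k v)
    (by simpa using (hel.mul_const _).const_add (Ev k v)) (fun j ↦ by
      rw [← Ev_eq]
      refine le_of_eq_of_le ?_ (hEv (ee j) (hee0 j))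
      congr 1; funext z
      by_cases hz : z ∈ DD
      · rw [← mul_assoc, ← Real.rpow_add (fD_pos hz), hN]; simp
      · simp [hSc.eq0 hz, hdc.eq0 hz, (jr_bd (hee0 j) 0).2.2.2.1]) (wsig a k w) (by
      filter_upwards [ae_all_iff.2 fun j ↦ emb_w k (hwc j), bet_D k] with z hz hD
      simp only [hz]
      have hl : Tendsto (fun j ↦ jr (ee j) (d z)) atTop (𝓝 |d z|) := by
        refine tendsto_of_tendsto_of_tendsto_of_le_of_le (by simpa using hel.const_sub |d z|) tendsto_const_nhds (fun j ↦ (jr_bd (hee0 j) (d z)).1) fun j ↦ (jr_bd (hee0 j) (d z)).2.2.1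
      have hf := fD_pos hD
      have hJ := Jt_pos ha ha1 hD
      have := (((hl.const_mul (σ z)).const_add (S z)).const_mul (1/2)).const_mul (fD z ^ (-(N/2)))
      convert this using 2
      have hF := Real.rpow_pos_of_pos hf (N/2)
      have s1 : v' z = fD z ^ (N/2) * (Jt a z ^ (N/2) * w (tau a z)) := by
        rw [hvz z hD]; simp only [hv, fD_tau ha ha1 hD, Real.mul_rpow hJ.le hf.le]; ring
      simp only [hS, hd, s1, Real.rpow_neg hf.le, wsig, ← hN, hσ, hv, ← mul_sub, ← mul_add, abs_mul, abs_of_pos hF]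
      set A := w z
      set B := Jt a z ^ (N/2) * w (tau a z)
      split_ifs <;> rcases le_total A B with hAB | hAB <;> field_simp <;> simp only [abs_of_nonneg, abs_of_nonpos, hAB, sub_nonneg, sub_nonpos, max_eq_right, max_eq_left, min_eq_left, min_eq_right] <;> ring)
  refine ⟨y, hy, h1, h2.trans_eq (Ev_eq h)⟩
theorem POL {k : ℕ} {a : ℝ} (ha : 0 < a) (ha1 : a < 1) {x : VV k} (hx : x ∈ HH k) :
    ∃ y ∈ HH k, wf y =ᵐ[bet k] wsig a k (wf x) ∧ ‖y‖ ^ 2 ≤ ‖x‖ ^ 2 := by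
  obtain ⟨φ, h, h1, h2⟩ := HH_seq_ae hx
  choose y hy hyw hyn using fun j ↦ POL_core (k := k) ha ha1 (h j)
  refine LSC y hy (fun j ↦ ‖emb k _ (h j)‖ ^ 2) _ (h1.norm.pow 2) hyn _ ?_
  filter_upwards [h2, tau_ae ha ha1 k h2, ae_all_iff.2 hyw] with z z1 z2 z3
  simp only [z3, wsig]
  split_ifs
  · exact z1.max (z2.const_mul _)
  · exact z1.min (z2.const_mul _)
end Heis
namespace Heis
def qq (k : ℕ) : ℝ := 1 + 2 / NN k
def pp (k : ℕ) : ℝ := 2 + 2 / NN k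
theorem pp_qq (k : ℕ) : pp k = qq k + 1 := by unfold pp qq; ring
theorem qq_gt (k : ℕ) : 1 < qq k := by unfold qq; have := NN_pos k; have : 0 < 2 / NN k := by positivity
                                       linarith
structure Gd (k : ℕ) (ε L : ℝ) (g G : ℝ → ℝ) : Prop where
  gc : Continuous g
  gpos : ∀ y, 0 < g y
  gL : ∀ y, g y ≤ L
  hG : ∀ y, HasDerivAt G (g y) y
  G0 : G 0 = 0
  GB : ∀ y, 0 ≤ y → G y ≤ L
  sub : ∀ c, 1 < c → ∀ y, 0 ≤ y → g (c * y) < c ^ qq k * g y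
  gd : ∃ g0 g1 : ℝ → ℝ, ∀ y, 0 ≤ y → g0 y = g y ∧ HasDerivAt g0 (g1 y) y ∧ (ε + y) * g1 y ≤ qq k * g y
def XX (k : ℕ) (ε y : ℝ) : ℝ := (ε + y) ^ pp k
def gg (k : ℕ) (ε y : ℝ) : ℝ := (ε + y) ^ qq k / (1 + ε * XX k ε y) ^ 2
def GG (k : ℕ) (ε y : ℝ) : ℝ := XX k ε y / (1 + ε * XX k ε y) / pp k
theorem Gd_exists (k : ℕ) {ε : ℝ} (he : 0 < ε) : ∃ g G : ℝ → ℝ, Gd k ε (1 + 1 / ε) g G ∧ ∀ y, 0 ≤ y → G y = GG k ε y - GG k ε 0 := by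
  have hq := qq_gt k
  have hp : 1 < pp k := by rw [pp_qq]; linarith
  have hXp : ∀ y, 0 ≤ y → 0 < XX k ε y := fun y hy ↦ Real.rpow_pos_of_pos (by linarith) _
  have hX' : ∀ y, 0 ≤ y → HasDerivAt (XX k ε) (pp k * (ε + y) ^ qq k) y := fun y hy ↦ by
    have := ((hasDerivAt_id y).const_add ε).rpow_const (p := pp k) (Or.inl (by simp; linarith))
    refine this.congr_deriv ?_
    rw [pp_qq]; simp
  have hgd : ∀ y, 0 ≤ y → HasDerivAt (GG k ε) (gg k ε y) y := fun y hy ↦ by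
    have := hXp y hy
    have h1 := ((hX' y hy).div (((hX' y hy).const_mul ε).const_add 1) (by positivity)).div_const (pp k)
    refine h1.congr_deriv ?_
    unfold gg; field_simp; ring
  have hgp : ∀ y, 0 ≤ y → 0 < gg k ε y := fun y hy ↦ by
    have := hXp y hy
    exact div_pos (Real.rpow_pos_of_pos (by linarith) _) (by positivity)
  have hgL : ∀ y, 0 ≤ y → gg k ε y ≤ 1 + 1 / ε := fun y hy ↦ by
    have h0 := hXp y hy
    have hY : 0 < ε + y := by linarith
    unfold gg
    rw [div_le_iff₀ (by positivity)]
    have h2 : (ε + y) ^ qq k ≤ 1 + XX k ε y := by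
      rcases le_total (ε + y) 1 with h | h
      · exact (Real.rpow_le_one hY.le h (by linarith)).trans (by linarith)
      · have := Real.rpow_le_rpow_of_exponent_le h (show qq k ≤ pp k by rw [pp_qq]; linarith)
        unfold XX; linarith
    refine h2.trans ?_
    have : (1 + 1/ε) * (1 + ε * XX k ε y) ^ 2 = (1 + 1/ε) + (1 + 1/ε) * (2 * ε * XX k ε y) + (1 + 1/ε) * (ε * XX k ε y) ^ 2 := by ring
    rw [this]
    have h5 : (1 + 1/ε) * (2 * ε * XX k ε y) = 2 * ε * XX k ε y + 2 * XX k ε y := by field_simp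
    have : 0 < 1 / ε := by positivity
    have : 0 ≤ (1 + 1/ε) * (ε * XX k ε y) ^ 2 := by positivity
    have : 0 < 2 * ε * XX k ε y := by positivity
    linarith
  have hgc : Continuous fun y : ℝ ↦ gg k ε (max y 0) := by
    have h3 : ∀ r : ℝ, Continuous fun y : ℝ ↦ (ε + max y 0) ^ r := fun r ↦
      (by fun_prop : Continuous fun y : ℝ ↦ ε + max y 0).rpow_const fun y ↦ Or.inl (by have := le_max_right y 0; positivity)
    exact (h3 _).div (by have := h3 (pp k); unfold XX; fun_prop) fun y ↦ by have := hXp _ (le_max_right y 0); positivity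
  have hG : ∀ y, HasDerivAt (fun y : ℝ ↦ ∫ t in (0:ℝ)..y, gg k ε (max t 0)) (gg k ε (max y 0)) y := fun y ↦
    intervalIntegral.integral_hasDerivAt_right (hgc.intervalIntegrable _ _) (hgc.stronglyMeasurableAtFilter _ _) hgc.continuousAt
  have hGf : ∀ y, 0 ≤ y → (∫ t in (0:ℝ)..y, gg k ε (max t 0)) = GG k ε y - GG k ε 0 := fun y hy ↦ by
    refine intervalIntegral.integral_eq_sub_of_hasDerivAt (fun t ht ↦ ?_) (hgc.intervalIntegrable _ _)
    rw [Set.uIcc_of_le hy] at ht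
    rw [max_eq_left ht.1]; exact hgd t ht.1
  refine ⟨fun y ↦ gg k ε (max y 0), _, ⟨hgc, fun y ↦ hgp _ (le_max_right _ _), fun y ↦ hgL _ (le_max_right _ _), hG, by simp, ?_, ?_, ?_⟩, hGf⟩
  · intro y hy
    rw [hGf y hy]
    have h0 := hXp y hy; have h1 := hXp 0 le_rfl
    have h2 : 0 ≤ GG k ε 0 := by unfold GG; positivity
    have h3 : XX k ε y / (1 + ε * XX k ε y) ≤ 1 / ε := by
      rw [div_le_div_iff₀ (by positivity) he]; linarith
    have h4 : GG k ε y ≤ XX k ε y / (1 + ε * XX k ε y) := div_le_self (by positivity) hp.le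
    linarith
  · intro c hc y hy
    have hcy : 0 ≤ c * y := by positivity
    simp only [max_eq_left hy, max_eq_left hcy]
    have h1 : (ε + c * y) ^ qq k < c ^ qq k * (ε + y) ^ qq k := by
      rw [← Real.mul_rpow (by linarith) (by linarith)]
      exact Real.rpow_lt_rpow (by positivity) (by nlinarith) (by linarith)
    have h2 : XX k ε y ≤ XX k ε (c * y) := Real.rpow_le_rpow (by positivity) (by nlinarith) (by linarith)
    have h0 := hXp y hy
    have h3 : (1 + ε * XX k ε y) ^ 2 ≤ (1 + ε * XX k ε (c * y)) ^ 2 := by gcongr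
    unfold gg
    rw [← mul_div_assoc]
    calc _ ≤ (ε + c * y) ^ qq k / (1 + ε * XX k ε y) ^ 2 := by gcongr
      _ < _ := by gcongr
  · refine ⟨gg k ε, fun y ↦ (qq k * (ε + y) ^ (qq k - 1) * (1 + ε * XX k ε y) ^ 2 - (ε + y) ^ qq k * (2 * (1 + ε * XX k ε y) * (ε * (pp k * (ε + y) ^ qq k)))) / ((1 + ε * XX k ε y) ^ 2) ^ 2, fun y hy ↦ ⟨by simp [max_eq_left hy], ?_, ?_⟩⟩
    · have := hXp y hy
      have h1 := ((hasDerivAt_id y).const_add ε).rpow_const (p := qq k) (Or.inl (by simp; linarith))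
      have h2 := h1.div ((((hX' y hy).const_mul ε).const_add 1).pow 2) (by simp only [Pi.pow_apply]; exact pow_ne_zero _ (by positivity))
      refine h2.congr_deriv ?_
      simp
    · have := hXp y hy
      have hY : 0 < ε + y := by linarith
      have := Real.rpow_pos_of_pos hY (qq k)
      simp only [max_eq_left hy]
      unfold gg
      rw [Real.rpow_sub_one hY.ne', ← sub_nonneg]
      have : qq k * ((ε + y) ^ qq k / (1 + ε * XX k ε y) ^ 2) - (ε + y) * ((qq k * ((ε + y) ^ qq k / (ε + y)) * (1 + ε * XX k ε y) ^ 2 - (ε + y) ^ qq k * (2 * (1 + ε * XX k ε y) * (ε * (pp k * (ε + y) ^ qq k)))) / ((1 + ε * XX k ε y) ^ 2) ^ 2)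
        = (ε + y) * ((ε + y) ^ qq k * (2 * (1 + ε * XX k ε y) * (ε * (pp k * (ε + y) ^ qq k)))) / ((1 + ε * XX k ε y) ^ 2) ^ 2 := by
        field_simp; ring
      rw [this]; positivity
theorem EL {k : ℕ} {x : VV k} (hx : x ∈ HH k) (Φ d : VV k → ℝ) (hmax : ∀ y ∈ HH k, ‖y‖ ≤ ‖x‖ → Φ y ≤ Φ x)
    (hadd : ∀ u ∈ HH k, ∀ v ∈ HH k, ∀ c : ℝ, d (u + c • v) = d u + c * d v)
    (hder : ∀ y ∈ HH k, HasDerivAt (fun t : ℝ ↦ Φ (x + t • y)) (d y) 0) (y : VV k) (hy : y ∈ HH k) :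
    d y * ‖x‖ ^ 2 = d x * inner ℝ x y := by
  refine lagrange (HH k) x hx d hadd (fun y hy hi ↦ ?_) y hy
  have h1 := (hder y hy).tendsto_slope_zero_right
  refine le_of_tendsto h1 ?_
  have hy0 : 0 < ‖y‖ := by
    rw [norm_pos_iff]; rintro rfl; simp at hi
  have hp : 0 < -(2 * inner ℝ x y) / ‖y‖ ^ 2 := div_pos (by linarith) (by positivity)
  filter_upwards [self_mem_nhdsWithin, mem_nhdsWithin_of_mem_nhds (eventually_lt_nhds hp)] with t ht ht2
  have ht : 0 < t := ht
  rw [lt_div_iff₀ (by positivity)] at ht2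
  have h3 : ‖x + t • y‖ ≤ ‖x‖ := by
    have := norm_add_sq_real x (t • y)
    rw [inner_smul_right, norm_smul, mul_pow, Real.norm_eq_abs, sq_abs] at this
    have : ‖x + t • y‖ ^ 2 ≤ ‖x‖ ^ 2 := by nlinarith
    exact abs_le_of_sq_le_sq' this (norm_nonneg _) |>.2
  have h4 := hmax _ ((HH k).add_mem hx ((HH k).smul_mem t hy)) h3
  simp only [zero_add, zero_smul, add_zero, smul_eq_mul]
  exact mul_nonpos_of_nonneg_of_nonpos (by positivity) (by linarith)
section
variable {k : ℕ} {ε L : ℝ} {g G : ℝ → ℝ} (hg : Gd k ε L g G)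
include hg
theorem Gd.Gc : Continuous G := continuous_iff_continuousAt.2 fun y ↦ (hg.hG y).continuousAt
theorem Gd.mono : StrictMono G := strictMono_of_deriv_pos fun y ↦ by rw [(hg.hG y).deriv]; exact hg.gpos y
theorem Gd.lip (a b : ℝ) : |G a - G b| ≤ L * |a - b| := by
  have := Convex.norm_image_sub_le_of_norm_hasDerivWithin_le (f := G) (f' := g) (s := Set.univ) (C := L) (x := b) (y := a)
    (fun y _ ↦ (hg.hG y).hasDerivWithinAt) (fun y _ ↦ by rw [Real.norm_eq_abs, abs_of_pos (hg.gpos y)]; exact hg.gL y) convex_univ trivial trivial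
  simpa using this
theorem Gd.int (x : VV k) : Integrable (fun z ↦ G (wf x z)) (bet k) := by
  refine (((wf_mem x).integrable one_le_two).norm.const_mul L).mono' (hg.Gc.comp_aestronglyMeasurable (wf_mem x).1) (Eventually.of_forall fun z ↦ ?_)
  have := hg.lip (wf x z) 0
  simpa [hg.G0] using this
theorem Gd.gint (x y : VV k) : Integrable (fun z ↦ g (wf x z) * wf y z) (bet k) := by
  refine (((wf_mem y).integrable one_le_two).norm.const_mul L).mono' ((hg.gc.comp_aestronglyMeasurable (wf_mem x).1).mul (wf_mem y).1) (Eventually.of_forall fun z ↦ ?_)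
  rw [norm_mul, Real.norm_eq_abs (g _), abs_of_pos (hg.gpos _)]
  exact mul_le_mul_of_nonneg_right (hg.gL _) (norm_nonneg _)
theorem Gd.swap {c : ℝ} (hc : 1 < c) {a b : ℝ} (ha : 0 ≤ a) (hab : a < b) :
    G a + (c ^ pp k)⁻¹ * G (c * b) < G b + (c ^ pp k)⁻¹ * G (c * a) := by
  have hm : StrictMonoOn (fun y ↦ G y - (c ^ pp k)⁻¹ * G (c * y)) (Set.Ici 0) := by
    have hD : ∀ y, HasDerivAt (fun y ↦ G y - (c ^ pp k)⁻¹ * G (c * y)) (g y - (c ^ pp k)⁻¹ * (g (c * y) * c)) y := fun y ↦ by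
      have h1 : HasDerivAt (fun y ↦ G (c * y)) (g (c * y) * c) y := by
        exact ((hg.hG (c * y)).comp y ((hasDerivAt_id y).const_mul c)).congr_deriv (by simp)
      exact (hg.hG y).sub (h1.const_mul _)
    refine strictMonoOn_of_deriv_pos (convex_Ici 0) (fun y _ ↦ (hD y).continuousAt.continuousWithinAt) fun y hy ↦ ?_
    rw [interior_Ici] at hy
    rw [(hD y).deriv, pp_qq, Real.rpow_add_one (by linarith)]
    have h1 := hg.sub c hc y (le_of_lt hy)
    have h2 : 0 < c ^ qq k := Real.rpow_pos_of_pos (by linarith) _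
    have h3 : (c ^ qq k * c)⁻¹ * (g (c * y) * c) = g (c * y) / c ^ qq k := by field_simp
    rw [h3, sub_pos, div_lt_iff₀ h2]; linarith
  have := hm (Set.mem_Ici.2 ha) (Set.mem_Ici.2 (ha.trans hab.le)) hab
  simp only at this
  linarith
theorem Gd.max {m : ℝ} (hm : 0 < m) : ∃ x ∈ HH k, ‖x‖ ^ 2 ≤ m ∧ (∀ᵐ z ∂(bet k), 0 ≤ wf x z) ∧
    ∀ y ∈ HH k, ‖y‖ ^ 2 ≤ m → ∫ z, G (wf y z) ∂(bet k) ≤ ∫ z, G (wf x z) ∂(bet k) := by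
  set I := fun y : VV k ↦ ∫ z, G |wf y z| ∂(bet k)
  have hb : ∀ y : VV k, Integrable (fun z ↦ G |wf y z|) (bet k) ∧ ∀ z, ‖G |wf y z|‖ ≤ L := fun y ↦ by
    have : ∀ z, ‖G |wf y z|‖ ≤ L := fun z ↦ by
      have h0 : 0 ≤ G |wf y z| := by rw [← hg.G0]; exact hg.mono.monotone (abs_nonneg _)
      rw [Real.norm_eq_abs, abs_of_nonneg h0]; exact hg.GB _ (abs_nonneg _)
    exact ⟨Integrable.of_bound (hg.Gc.comp_aestronglyMeasurable (continuous_abs.comp_aestronglyMeasurable (wf_mem y).1)) L (Eventually.of_forall this), this⟩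
  set A := I '' {y | y ∈ HH k ∧ ‖y‖ ^ 2 ≤ m}
  have hne : A.Nonempty := ⟨_, 0, ⟨(HH k).zero_mem, by simpa using hm.le⟩, rfl⟩
  have hbd : BddAbove A := ⟨L * (bet k).real Set.univ, by
    rintro _ ⟨y, -, rfl⟩
    exact (le_abs_self _).trans (norm_integral_le_of_norm_le_const (Eventually.of_forall (hb y).2))⟩
  obtain ⟨u, -, hu, huA⟩ := exists_seq_tendsto_sSup hne hbd
  choose x hx hxu using huA
  have hC : ∀ j, ‖x j‖ ≤ m + 1 := fun j ↦ by nlinarith [(hx j).2, norm_nonneg (x j)]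
  obtain ⟨s, hs, y, hy, -, hae, -⟩ := L3 x (fun j ↦ (hx j).1) _ hC
  obtain ⟨y1, hy1, hw1, hn1⟩ := LSC (fun j ↦ x (s j)) (fun j ↦ (hx _).1) (fun _ ↦ m) m tendsto_const_nhds (fun j ↦ (hx _).2) _ hae
  obtain ⟨y2, hy2, hw2, hn2⟩ := HH_abs hy1
  refine ⟨y2, hy2, hn2.trans hn1, ?_, fun v hv hvm ↦ ?_⟩
  · filter_upwards [hw2] with z hz; rw [hz]; exact abs_nonneg _
  have hl : Tendsto (fun j ↦ I (x (s j))) atTop (𝓝 (∫ z, G (wf y2 z) ∂(bet k))) := by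
    refine tendsto_integral_of_dominated_convergence (fun _ ↦ L) (fun j ↦ (hb _).1.1) (integrable_const _) (fun j ↦ Eventually.of_forall (hb _).2) ?_
    filter_upwards [hae, hw1, hw2] with z h1 h2 h3
    rw [h3, h2]
    exact (hg.Gc.tendsto _).comp h1.abs
  have h5 : Tendsto (fun j ↦ I (x (s j))) atTop (𝓝 (sSup A)) := by
    refine (hu.comp hs.tendsto_atTop).congr fun j ↦ (hxu _).symm
  rw [tendsto_nhds_unique hl h5]
  refine le_trans ?_ (le_csSup hbd ⟨v, ⟨hv, hvm⟩, rfl⟩)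
  exact integral_mono (hg.int v) (hb v).1 fun z ↦ hg.mono.monotone (le_abs_self _)
theorem Gd.EL {m : ℝ} (hm : 0 < m) {x : VV k} (hx : x ∈ HH k) (hxm : ‖x‖ ^ 2 ≤ m)
    (hmax : ∀ y ∈ HH k, ‖y‖ ^ 2 ≤ m → ∫ z, G (wf y z) ∂(bet k) ≤ ∫ z, G (wf x z) ∂(bet k)) (hp : ∀ᵐ z ∂(bet k), 0 ≤ wf x z) :
    ∃ l, 0 < l ∧ ∀ y ∈ HH k, inner ℝ x y = l * ∫ z, g (wf x z) * wf y z ∂(bet k) := by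
  have key := Heis.EL hx (fun y ↦ ∫ z, G (wf y z) ∂(bet k)) (fun y ↦ ∫ z, g (wf x z) * wf y z ∂(bet k))
    (fun y hy hyx ↦ hmax y hy ((pow_le_pow_left₀ (norm_nonneg _) hyx 2).trans hxm)) (fun u _ v _ c ↦ by
      rw [← integral_const_mul, ← integral_add (hg.gint x u) ((hg.gint x v).const_mul c)]
      refine integral_congr_ae ?_
      filter_upwards [wf_add u (c • v), wf_smul c v] with z h1 h2
      rw [h1, h2]; ring) (fun y hy ↦ by
      have h1 := hasDerivAt_integral_of_dominated_loc_of_deriv_le (μ := bet k) (F := fun (t : ℝ) z ↦ G (wf x z + t * wf y z)) (x₀ := 0) (s := Set.univ)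
        (F' := fun t z ↦ g (wf x z + t * wf y z) * wf y z) (bound := fun z ↦ L * ‖wf y z‖) univ_mem
        (Eventually.of_forall fun t ↦ hg.Gc.comp_aestronglyMeasurable ((wf_mem x).1.add ((wf_mem y).1.const_mul t)))
        (by simpa using hg.int x) (by simpa using (hg.gint x y).1)
        (Eventually.of_forall fun z t _ ↦ by
          rw [norm_mul, Real.norm_eq_abs (g _), abs_of_pos (hg.gpos _)]
          exact mul_le_mul_of_nonneg_right (hg.gL _) (norm_nonneg _))
        (((wf_mem y).integrable one_le_two).norm.const_mul L)
        (Eventually.of_forall fun z t _ ↦ by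
          exact ((hg.hG (wf x z + t * wf y z)).comp t (((hasDerivAt_id t).mul_const (wf y z)).const_add (wf x z))).congr_deriv (by simp))
      have h2 := h1.2
      simp only [zero_mul, add_zero] at h2
      refine h2.congr_of_eventuallyEq (Eventually.of_forall fun t ↦ integral_congr_ae ?_)
      filter_upwards [wf_add x (t • y), wf_smul t y] with z h3 h4
      rw [h3, h4])
  have hB : 0 < (bet k).real Set.univ := by
    rw [measureReal_def, ENNReal.toReal_pos_iff]
    refine ⟨pos_iff_ne_zero.2 fun h ↦ ?_, measure_lt_top _ _⟩
    have h0 : bet k = 0 := Measure.measure_univ_eq_zero.1 h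
    have := bet_ae k
    rw [h0, ae_zero] at this
    have h2 : volume.restrict DD = 0 := ae_eq_bot.1 this.symm
    rw [Measure.restrict_eq_zero] at h2
    exact (Metric.measure_ball_pos volume (0:ℂ) one_pos).ne' h2
  obtain ⟨o, ho, ho1, ho2⟩ := one_HH k
  have hd1 : 0 < ∫ z, g (wf x z) * wf o z ∂(bet k) := by
    have e : ∫ z, g (wf x z) * wf o z ∂(bet k) = ∫ z, g (wf x z) ∂(bet k) := integral_congr_ae (by
      filter_upwards [ho1] with z hz; rw [hz, mul_one])
    have i : Integrable (fun z ↦ g (wf x z)) (bet k) := (hg.gint x o).congr (by filter_upwards [ho1] with z hz; rw [hz, mul_one])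
    rw [e, integral_pos_iff_support_of_nonneg (fun z ↦ (hg.gpos _).le) i, show (Function.support fun z ↦ g (wf x z)) = Set.univ from Set.eq_univ_of_forall fun z ↦ (hg.gpos _).ne']
    rw [measureReal_def, ENNReal.toReal_pos_iff] at hB; exact hB.1
  have hx0 : x ≠ 0 := by
    rintro rfl
    obtain ⟨c, hc, hcm⟩ : ∃ c : ℝ, 0 < c ∧ ‖c • o‖ ^ 2 ≤ m := by
      refine ⟨√m / (‖o‖ + 1), by positivity, ?_⟩
      rw [norm_smul, mul_pow, Real.norm_eq_abs, sq_abs, div_pow, Real.sq_sqrt hm.le, div_mul_eq_mul_div, div_le_iff₀ (by positivity)]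
      exact mul_le_mul_of_nonneg_left (by nlinarith [norm_nonneg o]) hm.le
    have h1 := hmax _ ((HH k).smul_mem c ho) hcm
    have e1 : ∫ z, G (wf (c • o) z) ∂(bet k) = ∫ z, G c ∂(bet k) := integral_congr_ae (by
      filter_upwards [ho1, wf_smul c o] with z hz h2; rw [h2, hz, mul_one])
    have e2 : ∫ z, G (wf (0 : VV k) z) ∂(bet k) = ∫ z, G 0 ∂(bet k) := integral_congr_ae (by
      filter_upwards [wf_smul 0 o] with z h2; rw [← zero_smul ℝ o, h2, zero_mul])
    rw [e1, e2, integral_const, integral_const, hg.G0, smul_eq_mul, smul_zero] at h1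
    have := hg.mono hc
    rw [hg.G0] at this
    exact absurd h1 (not_le.2 (mul_pos hB this))
  have hxp : 0 < ‖x‖ ^ 2 := by have := norm_pos_iff.2 hx0; positivity
  have k1 := key o ho
  have hdx0 : 0 ≤ ∫ z, g (wf x z) * wf x z ∂(bet k) := integral_nonneg_of_ae (by
    filter_upwards [hp] with z hz; exact mul_nonneg (hg.gpos _).le hz)
  have hdx : 0 < ∫ z, g (wf x z) * wf x z ∂(bet k) := by
    refine hdx0.lt_of_ne fun h ↦ ?_
    rw [← h, zero_mul] at k1
    exact (mul_pos hd1 hxp).ne' k1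
  refine ⟨‖x‖ ^ 2 / ∫ z, g (wf x z) * wf x z ∂(bet k), by positivity, fun y hy ↦ ?_⟩
  have := key y hy
  field_simp
  linarith
end
end Heis
namespace Heis
theorem Gd_pt {k : ℕ} {ε L : ℝ} {g G : ℝ → ℝ} (hg : Gd k ε L g G) {a : ℝ} (ha : 0 < a) (ha1 : a < 1) {w : ℂ → ℝ} {z : ℂ} (hz : z ∈ DD)
    (h0 : 0 ≤ w z) (h1 : 0 ≤ w (tau a z)) :
    G (w z) + Jt a z ^ (k + 2) * G (w (tau a z)) ≤ G (wsig a k w z) + Jt a z ^ (k + 2) * G (wsig a k w (tau a z)) ∧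
    (Jt a z < 1 → w z < Jt a z ^ (NN k / 2) * w (tau a z) →
      G (w z) + Jt a z ^ (k + 2) * G (w (tau a z)) < G (wsig a k w z) + Jt a z ^ (k + 2) * G (wsig a k w (tau a z))) := by
  have hJ := Jt_pos ha ha1 hz
  have hN := NN_pos k
  have hJi := Jt_tau ha ha1 hz
  have htt := tau_tau ha ha1 hz
  have hJ1 := Jt_one ha ha1 hz
  set J := Jt a z
  set A := w z
  set B := w (tau a z)
  obtain ⟨c, hc⟩ : ∃ c, c = J ^ (-(NN k / 2)) := ⟨_, rfl⟩
  have hc0 : 0 < c := hc ▸ Real.rpow_pos_of_pos hJ _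
  have hcp : J ^ (k + 2) = (c ^ pp k)⁻¹ := by
    rw [hc, ← Real.rpow_mul hJ.le, ← Real.rpow_neg hJ.le, ← Real.rpow_natCast]
    congr 1
    unfold pp
    field_simp
    unfold NN; push_cast; ring
  have e1 : J ^ (NN k / 2) = c⁻¹ := by rw [hc, Real.rpow_neg hJ.le, inv_inv]
  have e2 : J⁻¹ ^ (NN k / 2) = c := by rw [Real.inv_rpow hJ.le, e1, inv_inv]
  have d1 : wsig a k w z = if J < 1 then max A (c⁻¹ * B) else min A (c⁻¹ * B) := by
    unfold wsig; rw [← e1]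
  have d2 : wsig a k w (tau a z) = if J⁻¹ < 1 then max B (c * A) else min B (c * A) := by
    unfold wsig; rw [hJi, htt, e2]
  rw [d1, d2, hcp, e1]
  have hcB : c * (c⁻¹ * B) = B := by field_simp
  rcases lt_trichotomy J 1 with h | h | h
  · have hc1 : 1 < c := by rw [hc]; exact Real.one_lt_rpow_of_pos_of_lt_one_of_neg hJ h (by linarith)
    have h' : ¬ J⁻¹ < 1 := not_lt.2 (one_le_inv₀ hJ |>.2 h.le)
    rw [if_pos h, if_neg h']
    by_cases hAB : A < c⁻¹ * B
    · have hs := hg.swap hc1 h0 hAB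
      rw [hcB] at hs
      have h3 : c * A ≤ B := by rw [← hcB]; gcongr
      rw [max_eq_right hAB.le, min_eq_right h3]
      exact ⟨hs.le, fun _ _ ↦ hs⟩
    · rw [not_lt] at hAB
      have h3 : B ≤ c * A := by rw [← hcB]; gcongr
      rw [max_eq_left hAB, min_eq_left h3]
      exact ⟨le_rfl, fun _ h ↦ absurd h (not_lt.2 hAB)⟩
  · refine ⟨?_, fun h' ↦ absurd h h'.ne⟩
    have hc1 : c = 1 := by rw [hc, h, Real.one_rpow]
    have : B = A := by simp only [A, B]; rw [hJ1 h]
    simp [h, this, hc1]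
  · refine ⟨?_, fun h' ↦ absurd h' (not_lt.2 h.le)⟩
    have hc1 : c < 1 := by rw [hc]; exact Real.rpow_lt_one_of_one_lt_of_neg h (by linarith)
    rw [if_neg (not_lt.2 h.le), if_pos (inv_lt_one_of_one_lt₀ h)]
    by_cases hAB : c⁻¹ * B < A
    · have h3 : B < c * A := by rw [← hcB]; gcongr
      rw [min_eq_right hAB.le, max_eq_right h3.le]
      have hs := hg.swap ((one_lt_inv₀ hc0).2 hc1) h1 h3
      rw [Real.inv_rpow hc0.le, inv_inv, show c⁻¹ * (c * A) = A by field_simp] at hs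
      have hp : 0 < c ^ pp k := Real.rpow_pos_of_pos hc0 _
      have := mul_lt_mul_of_pos_left hs (inv_pos.2 hp)
      rw [mul_add, mul_add, ← mul_assoc, ← mul_assoc, inv_mul_cancel₀ hp.ne'] at this
      linarith
    · rw [not_lt] at hAB
      have h3 : c * A ≤ B := by rw [← hcB]; gcongr
      rw [min_eq_left hAB, max_eq_left h3]
theorem Gd.pol {k : ℕ} {ε L : ℝ} {g G : ℝ → ℝ} (hg : Gd k ε L g G) {a : ℝ} (ha : 0 < a) (ha1 : a < 1) {m : ℝ} {x : VV k} (hx : x ∈ HH k) (hxm : ‖x‖ ^ 2 ≤ m)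
    (hmax : ∀ y ∈ HH k, ‖y‖ ^ 2 ≤ m → ∫ z, G (wf y z) ∂(bet k) ≤ ∫ z, G (wf x z) ∂(bet k)) (hp : ∀ᵐ z ∂(bet k), 0 ≤ wf x z) :
    ∀ᵐ z ∂(bet k), Jt a z < 1 → Jt a z ^ (NN k / 2) * wf x (tau a z) ≤ wf x z := by
  obtain ⟨y, hy, hyw, hyn⟩ := POL ha ha1 hx
  have hle := hmax y hy (hyn.trans hxm)
  have i1 := hg.int x
  have i2 := hg.int y
  have i3 := (cov_bet_intble ha ha1 k _).1 i1
  have i4 := (cov_bet_intble ha ha1 k _).1 i2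
  have e1 := cov_bet ha ha1 k (fun z ↦ G (wf x z))
  have e2 := cov_bet ha ha1 k (fun z ↦ G (wf y z))
  have hnn : 0 ≤ᵐ[bet k] fun z ↦ (G (wf y z) + Jt a z ^ (k + 2) * G (wf y (tau a z))) - (G (wf x z) + Jt a z ^ (k + 2) * G (wf x (tau a z))) := by
    filter_upwards [hyw, tau_ae ha ha1 k hyw, hp, tau_ae ha ha1 k hp, bet_D k] with z h1 h2 h3 h4 h5
    simp only [Pi.zero_apply]
    rw [h1, h2, sub_nonneg]
    exact (Gd_pt hg ha ha1 h5 h3 h4).1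
  have hint := (i2.add i4).sub (i1.add i3)
  have h0 : ∫ z, ((G (wf y z) + Jt a z ^ (k + 2) * G (wf y (tau a z))) - (G (wf x z) + Jt a z ^ (k + 2) * G (wf x (tau a z)))) ∂(bet k) = 0 := by
    refine le_antisymm ?_ (integral_nonneg_of_ae hnn)
    rw [integral_sub (by exact i2.add i4) (by exact i1.add i3), integral_add i2 i4, integral_add i1 i3, ← e1, ← e2]
    linarith
  have h00 := (integral_eq_zero_iff_of_nonneg_ae hnn hint).1 h0
  filter_upwards [h00, hyw, tau_ae ha ha1 k hyw, hp, tau_ae ha ha1 k hp, bet_D k] with z h0 h1 h2 h3 h4 h5 hJ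
  by_contra h
  have := (Gd_pt hg ha ha1 h5 h3 h4).2 hJ (not_le.1 h)
  simp only [Pi.zero_apply] at h0
  rw [h1, h2] at h0
  linarith
section
variable (Λ : ℂ ≃ₗᵢ[ℝ] ℂ)
theorem iso_fD (z : ℂ) : fD (Λ z) = fD z := by simp [fD]
theorem iso_mp : MeasurePreserving Λ volume volume := Λ.measurePreserving
theorem iso_bet (k : ℕ) : MeasurePreserving Λ (bet k) (bet k) := by
  have h1 : MeasurePreserving Λ (volume.restrict DD) (volume.restrict DD) := by
    have := (iso_mp Λ).restrict_preimage (s := DD) measurableSet_ball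
    have e : Λ ⁻¹' DD = DD := by ext z; simp
    rwa [e] at this
  refine ⟨Λ.continuous.measurable, ?_⟩
  ext s hs
  have hm : Measurable (fun z ↦ ENNReal.ofReal (fD z ^ k)) := (fD_cont.pow k).measurable.ennreal_ofReal
  rw [Measure.map_apply Λ.continuous.measurable hs, bet, withDensity_apply _ hs, withDensity_apply _ (Λ.continuous.measurable hs)]
  rw [← (h1.restrict_preimage hs).lintegral_comp hm]
  simp only [iso_fD]
theorem iso_gr {φ : ℂ → ℝ} (h : Differentiable ℝ φ) (z : ℂ) : ‖gr (fun z ↦ φ (Λ z)) z‖ = ‖gr φ (Λ z)‖ := by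
  have h1 : HasFDerivAt (fun z ↦ φ (Λ z)) ((fderiv ℝ φ (Λ z)).comp (Λ : ℂ →L[ℝ] ℂ)) z :=
    (h (Λ z)).hasFDerivAt.comp z Λ.toContinuousLinearEquiv.hasFDerivAt
  have h2 : gr (fun z ↦ φ (Λ z)) z = Λ.symm (gr φ (Λ z)) := by
    refine ext_inner_right ℝ fun v ↦ ?_
    rw [← fderiv_gr', h1.fderiv]
    have := Λ.inner_map_map (Λ.symm (gr φ (Λ z))) v
    rw [← this]
    simp [fderiv_gr']
  rw [h2]; simp
theorem Core.iso {φ : ℂ → ℝ} (h : Core φ) : Core (fun z ↦ φ (Λ z)) where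
  cd := h.cd.comp Λ.contDiff
  cpt := h.cpt.comp_homeomorph Λ.toHomeomorph
  sub := by
    have : tsupport (fun z ↦ φ (Λ z)) = Λ ⁻¹' tsupport φ := tsupport_comp_eq_preimage φ Λ.toHomeomorph
    rw [this]
    intro z hz
    have := h.sub hz
    simpa using this
theorem iso_HH {k : ℕ} {x : VV k} (hx : x ∈ HH k) : ∃ y ∈ HH k, wf y =ᵐ[bet k] (fun z ↦ wf x (Λ z)) ∧ ‖y‖ ^ 2 ≤ ‖x‖ ^ 2 := by
  obtain ⟨φ, h, h1, h2⟩ := HH_seq_ae hx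
  refine LSC (fun j ↦ emb k _ ((h j).iso Λ)) (fun j ↦ emb_HH _) (fun j ↦ ‖emb k _ (h j)‖ ^ 2) _ (h1.norm.pow 2) (fun j ↦ le_of_eq ?_) _ ?_
  · rw [norm_emb', norm_emb', ← (iso_mp Λ).integral_comp Λ.toHomeomorph.measurableEmbedding (fun z ↦ fD z ^ k * (NN k ^ 2 * φ j z ^ 2 + fD z * ‖gr (φ j) z‖ ^ 2))]
    simp only [iso_fD, iso_gr Λ (h j).diff]
  · filter_upwards [(iso_bet Λ k).quasiMeasurePreserving.ae h2, ae_all_iff.2 fun j ↦ emb_w k ((h j).iso Λ)] with z h3 h4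
    simpa only [h4] using h3
end
end Heis
namespace Heis
structure Mx (k : ℕ) (G : ℝ → ℝ) (m : ℝ) (x : VV k) : Prop where
  hx : x ∈ HH k
  hm : ‖x‖ ^ 2 ≤ m
  hp : ∀ᵐ z ∂(bet k), 0 ≤ wf x z
  mx : ∀ y ∈ HH k, ‖y‖ ^ 2 ≤ m → ∫ z, G (wf y z) ∂(bet k) ≤ ∫ z, G (wf x z) ∂(bet k)
theorem iso_int (Λ : ℂ ≃ₗᵢ[ℝ] ℂ) (k : ℕ) (F : ℂ → ℝ) : ∫ z, F (Λ z) ∂(bet k) = ∫ z, F z ∂(bet k) :=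
  (iso_bet Λ k).integral_comp Λ.toHomeomorph.measurableEmbedding F
theorem iso_ae (Λ : ℂ ≃ₗᵢ[ℝ] ℂ) {k : ℕ} {p : ℂ → Prop} (h : ∀ᵐ z ∂(bet k), p z) : ∀ᵐ z ∂(bet k), p (Λ z) :=
  (iso_bet Λ k).quasiMeasurePreserving.ae h
theorem iso_intble (Λ : ℂ ≃ₗᵢ[ℝ] ℂ) {k : ℕ} {F : ℂ → ℝ} (h : Integrable F (bet k)) : Integrable (fun z ↦ F (Λ z)) (bet k) :=
  ((iso_bet Λ k).integrable_comp_emb Λ.toHomeomorph.measurableEmbedding).2 h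
theorem Mx.iso {k : ℕ} {G : ℝ → ℝ} {m : ℝ} {x : VV k} (h : Mx k G m x) (Λ : ℂ ≃ₗᵢ[ℝ] ℂ) :
    ∃ y, Mx k G m y ∧ wf y =ᵐ[bet k] (fun z ↦ wf x (Λ z)) := by
  obtain ⟨y, hy, hw, hn⟩ := iso_HH Λ h.hx
  refine ⟨y, ⟨hy, hn.trans h.hm, ?_, fun v hv hvm ↦ (h.mx v hv hvm).trans (le_of_eq ?_)⟩, hw⟩
  · filter_upwards [hw, iso_ae Λ h.hp] with z h1 h2
    rw [h1]; exact h2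
  · rw [← iso_int Λ k (fun z ↦ G (wf x z))]
    refine integral_congr_ae ?_
    filter_upwards [hw] with z h1
    rw [h1]
def RR : ℂ ≃ₗᵢ[ℝ] ℂ := Complex.conjLIE.trans (LinearIsometryEquiv.neg ℝ)
theorem RR_apply (z : ℂ) : RR z = -(starRingEnd ℂ) z := by simp [RR]
theorem Jt_bd {a : ℝ} (ha : 0 < a) (ha1 : a ≤ 1 / 2) {z : ℂ} (hz : z ∈ DD) : 1 / 3 ≤ Jt a z ∧ Jt a z ≤ 4 := by
  have h0 : ‖(a:ℂ) * (starRingEnd ℂ) z‖ ≤ a := by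
    rw [norm_mul, RCLike.norm_conj, Complex.norm_real, Real.norm_eq_abs, abs_of_pos ha]
    have : ‖z‖ < 1 := by simpa using hz
    nlinarith
  have h1 : 1 - a ≤ ‖1 - (a:ℂ) * (starRingEnd ℂ) z‖ := by
    have := norm_sub_norm_le (1:ℂ) ((a:ℂ) * (starRingEnd ℂ) z)
    rw [norm_one] at this; linarith
  have h2 : ‖1 - (a:ℂ) * (starRingEnd ℂ) z‖ ≤ 1 + a := by
    have := norm_sub_le (1:ℂ) ((a:ℂ) * (starRingEnd ℂ) z)
    rw [norm_one] at this; linarith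
  have h3 : 0 < ‖1 - (a:ℂ) * (starRingEnd ℂ) z‖ := by linarith
  unfold Jt
  constructor
  · rw [le_div_iff₀ (by positivity)]; nlinarith
  · rw [div_le_iff₀ (by positivity)]; nlinarith
theorem Jt_lt {a : ℝ} (ha : 0 < a) (ha1 : a < 1) {z : ℂ} (hz : z ∈ DD) (hr : z.re < 0) : Jt a z < 1 := by
  have h3 := norm_pos_iff.2 (tau_den ha ha1 hz)
  unfold Jt
  rw [div_lt_one (by positivity), normsq_C]
  simp
  nlinarith [mul_pos ha (neg_pos.2 hr), sq_nonneg (1 - a * z.re), sq_nonneg (a * z.im), sq_nonneg (a * z.re)]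
theorem tau_lim (z : ℂ) : ContinuousAt (fun a : ℝ ↦ tau a z) 0 := by
  unfold tau
  refine ContinuousAt.div (by fun_prop) (by fun_prop) (by simp)
theorem Jt_lim (z : ℂ) : ContinuousAt (fun a : ℝ ↦ Jt a z) 0 := by
  unfold Jt
  refine ContinuousAt.div (by fun_prop) (by fun_prop) (by simp)
section
variable {k : ℕ} {ε L : ℝ} {g G : ℝ → ℝ} (hg : Gd k ε L g G) {m : ℝ} {x : VV k} (h : Mx k G m x)
include hg h
theorem refl_ineq {ψ : ℂ → ℝ} (hc : Continuous ψ) (hs : HasCompactSupport ψ) (hU : tsupport ψ ⊆ DD ∩ {z | z.re < 0}) (h0 : ∀ z, 0 ≤ ψ z) :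
    ∫ z, ψ (RR z) * wf x z ∂(bet k) ≤ ∫ z, ψ z * wf x z ∂(bet k) := by
  obtain ⟨C, hC⟩ := hc.bounded_above_of_compact_support hs
  have hN := NN_pos k
  have hw := (wf_mem x).integrable one_le_two
  set a : ℕ → ℝ := fun j ↦ 1 / ((j:ℝ) + 2) with hadef
  have ha : ∀ j, 0 < a j := fun j ↦ by positivity
  have ha2 : ∀ j, a j ≤ 1 / 2 := fun j ↦ by simp only [hadef]; gcongr; linarith [Nat.cast_nonneg (α := ℝ) j]
  have ha1 : ∀ j, a j < 1 := fun j ↦ by linarith [ha2 j]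
  have hal : Tendsto a atTop (𝓝 0) := by
    have := (tendsto_one_div_add_atTop_nhds_zero_nat (𝕜 := ℝ)).comp (tendsto_add_atTop_nat 1)
    refine this.congr fun j ↦ ?_
    simp only [hadef, Function.comp]; push_cast; ring
  set F : ℕ → ℂ → ℝ := fun j z ↦ Jt (a j) z ^ (k + 2) * (ψ (tau (a j) z) * (Jt (a j) z)⁻¹ ^ (NN k / 2)) * wf x z with hF
  have hFm : ∀ j, AEStronglyMeasurable (F j) (bet k) := fun j ↦ by
    have h1 := Jt_meas (a := a j)
    have h2 := tau_meas (a := a j)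
    have h3 := hc.measurable
    have : Measurable (fun z ↦ Jt (a j) z ^ (k + 2) * (ψ (tau (a j) z) * (Jt (a j) z)⁻¹ ^ (NN k / 2))) := by fun_prop
    exact this.aestronglyMeasurable.mul hw.1
  have hFb : ∀ j, ∀ᵐ z ∂(bet k), ‖F j z‖ ≤ (4 ^ (k + 2) * (C * 3 ^ (NN k / 2))) * ‖wf x z‖ := fun j ↦ by
    filter_upwards [bet_D k] with z hz
    obtain ⟨h1, h2⟩ := Jt_bd (ha j) (ha2 j) hz
    have hJ := Jt_pos (ha j) (ha1 j) hz
    have h3 : (Jt (a j) z)⁻¹ ≤ 3 := by rw [inv_le_comm₀ hJ (by norm_num)]; linarith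
    rw [hF]; simp only
    have hr := Real.rpow_pos_of_pos (inv_pos.2 hJ) (NN k / 2)
    rw [norm_mul, norm_mul, norm_mul, Real.norm_of_nonneg hr.le, Real.norm_of_nonneg (pow_nonneg hJ.le _)]
    have := hC (tau (a j) z)
    have := (norm_nonneg _).trans this
    gcongr
  have hFi : ∀ j, Integrable (F j) (bet k) := fun j ↦ (hw.norm.const_mul _).mono' (hFm j) (hFb j)
  have heq : ∀ j, (fun z ↦ Jt (a j) z ^ (k + 2) * (fun z ↦ ψ z * Jt (a j) z ^ (NN k / 2) * wf x (tau (a j) z)) (tau (a j) z)) =ᵐ[bet k] F j := fun j ↦ by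
    filter_upwards [bet_D k] with z hz
    simp only [hF, tau_tau (ha j) (ha1 j) hz, Jt_tau (ha j) (ha1 j) hz]; ring
  have hle : ∀ j, ∫ z, F j z ∂(bet k) ≤ ∫ z, ψ z * wf x z ∂(bet k) := fun j ↦ by
    rw [← integral_congr_ae (heq j), ← cov_bet (ha j) (ha1 j) k (fun z ↦ ψ z * Jt (a j) z ^ (NN k / 2) * wf x (tau (a j) z))]
    refine integral_mono_ae ((cov_bet_intble (ha j) (ha1 j) k _).2 ((hFi j).congr (heq j).symm)) (hw.bdd_mul hc.aestronglyMeasurable (Eventually.of_forall hC)) ?_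
    filter_upwards [hg.pol (ha j) (ha1 j) h.hx h.hm h.mx h.hp, bet_D k] with z h1 hz
    by_cases hp : ψ z = 0
    · simp [hp]
    · have := hU (subset_tsupport _ (Function.mem_support.2 hp))
      have := h1 (Jt_lt (ha j) (ha1 j) hz this.2)
      rw [mul_assoc]
      exact mul_le_mul_of_nonneg_left this (h0 z)
  refine le_of_tendsto (tendsto_integral_of_dominated_convergence _ hFm (hw.norm.const_mul _) hFb ?_) (Eventually.of_forall hle)
  refine Eventually.of_forall fun z ↦ ?_
  have h1 : Tendsto (fun j ↦ Jt (a j) z) atTop (𝓝 1) := by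
    have := (Jt_lim z).tendsto.comp hal
    rw [show Jt 0 z = 1 by simp [Jt]] at this
    exact this
  have h2 : Tendsto (fun j ↦ tau (a j) z) atTop (𝓝 (RR z)) := by
    have := (tau_lim z).tendsto.comp hal
    rw [show tau 0 z = RR z by simp [tau, RR_apply]] at this
    exact this
  have h3 := ((h1.pow (k + 2)).mul (((hc.tendsto _).comp h2).mul ((h1.inv₀ one_ne_zero).rpow_const (p := NN k / 2) (Or.inl (by simp))))).mul_const (wf x z)
  simpa using h3
theorem refl_eq : ∀ᵐ z ∂(bet k), wf x z = wf x (RR z) := by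
  have hw := (wf_mem x).integrable one_le_two
  have hw' := iso_intble RR hw
  have hRR : ∀ z, RR (RR z) = z := fun z ↦ by simp [RR_apply]
  have hkey : ∀ ψ : ℂ → ℝ, Continuous ψ → HasCompactSupport ψ → tsupport ψ ⊆ DD ∩ {z | z.re < 0} → (∀ z, 0 ≤ ψ z) →
      ∫ z, ψ z * wf x (RR z) ∂(bet k) = ∫ z, ψ z * wf x z ∂(bet k) := fun ψ hc hs hU h0 ↦ by
    have e1 : ∫ z, ψ z * wf x (RR z) ∂(bet k) = ∫ z, ψ (RR z) * wf x z ∂(bet k) := by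
      rw [← iso_int RR]; simp only [hRR]
    rw [e1]
    refine le_antisymm (refl_ineq hg h hc hs hU h0) ?_
    obtain ⟨y, hy, hyw⟩ := h.iso (LinearIsometryEquiv.neg ℝ)
    have := refl_ineq hg hy (ψ := fun z ↦ ψ (Complex.conjLIE z)) (hc.comp Complex.conjLIE.continuous) (hs.comp_homeomorph Complex.conjLIE.toHomeomorph) (by
      have : tsupport (fun z ↦ ψ (Complex.conjLIE z)) = Complex.conjLIE ⁻¹' tsupport ψ := tsupport_comp_eq_preimage ψ Complex.conjLIE.toHomeomorph
      rw [this]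
      intro z hz
      have := hU hz
      simpa using this) (fun z ↦ h0 _)
    have e2 : ∫ z, ψ (Complex.conjLIE (RR z)) * wf y z ∂(bet k) = ∫ z, ψ z * wf x z ∂(bet k) := by
      rw [← iso_int (LinearIsometryEquiv.neg ℝ) k (fun z ↦ ψ z * wf x z)]
      refine integral_congr_ae ?_
      filter_upwards [hyw] with z hz
      rw [hz]; simp [RR_apply]
    have e3 : ∫ z, ψ (Complex.conjLIE z) * wf y z ∂(bet k) = ∫ z, ψ (RR z) * wf x z ∂(bet k) := by
      rw [← iso_int (LinearIsometryEquiv.neg ℝ) k (fun z ↦ ψ (RR z) * wf x z)]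
      refine integral_congr_ae ?_
      filter_upwards [hyw] with z hz
      rw [hz]; simp [RR_apply]
    rw [e2, e3] at this
    exact this
  have hU : IsOpen (DD ∩ {z : ℂ | z.re < 0}) := Metric.isOpen_ball.inter (isOpen_lt Complex.continuous_re continuous_const)
  have hmain := hU.ae_eq_zero_of_integral_contDiff_smul_eq_zero (μ := bet k) (f := fun z ↦ wf x (RR z) - wf x z) ((hw'.sub hw).locallyIntegrable.locallyIntegrableOn _) (fun ψ hψ hs hsU ↦ by
    have hc := hψ.continuous
    have i : ∀ (v : ℂ → ℝ), Continuous v → HasCompactSupport v → ∀ u, Integrable u (bet k) → Integrable (fun z ↦ v z * u z) (bet k) := fun v hv hvs u hu ↦ by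
      obtain ⟨C, hC⟩ := hv.bounded_above_of_compact_support hvs
      exact hu.bdd_mul hv.aestronglyMeasurable (Eventually.of_forall hC)
    have hsub : ∀ v : ℂ → ℝ, (∀ z, ψ z = 0 → v z = 0) → tsupport v ⊆ tsupport ψ := fun v hv ↦ closure_mono fun z hz ↦ Function.mem_support.2 fun h' ↦ Function.mem_support.1 hz (hv z h')
    have hc1 : Continuous fun z ↦ max (ψ z) 0 := hc.max continuous_const
    have hc2 : Continuous fun z ↦ max (-ψ z) 0 := hc.neg.max continuous_const
    have hs1 : HasCompactSupport fun z ↦ max (ψ z) 0 := hs.comp_left (g := fun t ↦ max t 0) (by simp)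
    have hs2 : HasCompactSupport fun z ↦ max (-ψ z) 0 := hs.comp_left (g := fun t ↦ max (-t) 0) (by simp)
    have k1 := hkey _ hc1 hs1 ((hsub _ fun z hz ↦ by simp [hz]).trans hsU) (fun z ↦ le_max_right _ _)
    have k2 := hkey _ hc2 hs2 ((hsub _ fun z hz ↦ by simp [hz]).trans hsU) (fun z ↦ le_max_right _ _)
    have e : ∀ z, ψ z • (wf x (RR z) - wf x z) = (max (ψ z) 0 * wf x (RR z) - max (ψ z) 0 * wf x z) - (max (-ψ z) 0 * wf x (RR z) - max (-ψ z) 0 * wf x z) := fun z ↦ by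
      have : ψ z = max (ψ z) 0 - max (-ψ z) 0 := by
        rcases le_total 0 (ψ z) with h | h
        · rw [max_eq_left h, max_eq_right (by linarith)]; ring
        · rw [max_eq_right h, max_eq_left (by linarith)]; ring
      rw [smul_eq_mul]; nth_rw 1 [this]; ring
    simp_rw [e]
    rw [integral_sub (by exact (i _ hc1 hs1 _ hw').sub (i _ hc1 hs1 _ hw)) (by exact (i _ hc2 hs2 _ hw').sub (i _ hc2 hs2 _ hw)), integral_sub (i _ hc1 hs1 _ hw') (i _ hc1 hs1 _ hw), integral_sub (i _ hc2 hs2 _ hw') (i _ hc2 hs2 _ hw), k1, k2]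
    simp)
  filter_upwards [hmain, iso_ae RR hmain, bet_D k] with z h1 h2 hz
  rcases lt_trichotomy z.re 0 with hr | hr | hr
  · linarith [h1 ⟨hz, hr⟩]
  · rw [show RR z = z from by rw [RR_apply]; apply Complex.ext <;> simp [hr]]
  · have := h2 ⟨by simpa using hz, by simp [RR_apply, hr]⟩
    rw [hRR] at this; linarith
theorem rot_eq (α : ℝ) : ∀ᵐ z ∂(bet k), wf x (Complex.exp (α * Complex.I) * z) = wf x z := by
  set d : Circle := Circle.exp (-α / 2)
  obtain ⟨y, hy, hyw⟩ := h.iso (rotation d)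
  have e0 := refl_eq hg h
  have e1 := refl_eq hg hy
  filter_upwards [iso_ae ((rotation d).symm.trans RR) hyw, iso_ae (rotation d).symm hyw, iso_ae (rotation d).symm e1, iso_ae (((rotation d).symm.trans RR).trans (rotation d)) e0] with z h1 h2 h3 h4
  simp only [LinearIsometryEquiv.trans_apply] at h1 h4
  rw [h1, h2, LinearIsometryEquiv.apply_symm_apply, h4] at h3
  rw [h3]
  congr 1
  simp only [RR_apply, rotation_apply, rotation_symm]
  have hd : (d : ℂ) = Complex.exp (((-α / 2 : ℝ) : ℂ) * Complex.I) := Circle.coe_exp _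
  have hdi : ((d⁻¹ : Circle) : ℂ) = Complex.exp (((α / 2 : ℝ) : ℂ) * Complex.I) := by
    rw [Circle.coe_inv, hd, ← Complex.exp_neg]; congr 1; push_cast; ring
  rw [hdi, hd]
  simp only [map_mul, map_neg, ← Complex.exp_conj, Complex.conj_ofReal, Complex.conj_I, Complex.conj_conj, neg_neg, mul_neg]
  rw [← mul_assoc, ← Complex.exp_add]
  congr 2; push_cast; ring
theorem radial : ∃ ω : ℝ → ℝ, StronglyMeasurable ω ∧ ∀ᵐ z ∂(bet k), wf x z = ω (‖z‖ ^ 2) := by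
  obtain ⟨w, hwm, hw⟩ := (wf_mem x).1
  have hE : Measurable fun p : ℂ × ℝ ↦ Complex.exp (p.2 * Complex.I) * p.1 := by fun_prop
  have hm2 : StronglyMeasurable fun p : ℂ × ℝ ↦ w (Complex.exp (p.2 * Complex.I) * p.1) := hwm.comp_measurable hE
  have hrot : ∀ α : ℝ, ∀ᵐ z ∂(bet k), w (Complex.exp (α * Complex.I) * z) = w z := fun α ↦ by
    have : ∀ z, rotation (Circle.exp α) z = Complex.exp (α * Complex.I) * z := fun z ↦ by rw [rotation_apply, Circle.coe_exp]
    filter_upwards [rot_eq hg h α, hw, iso_ae (rotation (Circle.exp α)) hw] with z h1 h2 h3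
    rw [this] at h3
    rw [← h3, h1, h2]
  have hS : MeasurableSet {p : ℂ × ℝ | w (Complex.exp (p.2 * Complex.I) * p.1) = w p.1} :=
    measurableSet_eq_fun hm2.measurable (hwm.measurable.comp measurable_fst)
  have hae : ∀ᵐ z ∂(bet k), ∀ᵐ α : ℝ, w (Complex.exp (α * Complex.I) * z) = w z :=
    (Measure.ae_ae_comm hS).2 (Eventually.of_forall hrot)
  refine ⟨fun s ↦ (2 * Real.pi)⁻¹ * ∫ α in (-Real.pi)..Real.pi, w (Complex.exp (α * Complex.I) * (√s : ℝ)), ?_, ?_⟩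
  · have h3 : StronglyMeasurable fun p : ℝ × ℝ ↦ w (Complex.exp (p.2 * Complex.I) * (√p.1 : ℝ)) := hwm.comp_measurable (by fun_prop)
    have := h3.integral_prod_right' (ν := volume.restrict (Set.Ioc (-Real.pi) Real.pi))
    refine stronglyMeasurable_const.mul ?_
    simpa only [intervalIntegral.integral_of_le (show -Real.pi ≤ Real.pi by linarith [Real.pi_pos])] using this
  · filter_upwards [hw, hae] with z h1 h2
    rw [h1, Real.sqrt_sq (norm_nonneg z)]
    have e1 : ∫ α in (-Real.pi)..Real.pi, w (Complex.exp (α * Complex.I) * z) = 2 * Real.pi * w z := by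
      rw [intervalIntegral.integral_congr_ae (g := fun _ ↦ w z) (h2.mono fun α h _ ↦ h)]
      rw [intervalIntegral.integral_const, smul_eq_mul]; ring
    have e2 : ∫ α in (-Real.pi)..Real.pi, w (Complex.exp (α * Complex.I) * z) = ∫ α in (-Real.pi)..Real.pi, w (Complex.exp (α * Complex.I) * (‖z‖ : ℝ)) := by
      have hp : Function.Periodic (fun α : ℝ ↦ w (Complex.exp (α * Complex.I) * (‖z‖ : ℝ))) (2 * Real.pi) := fun α ↦ by
        simp only
        congr 2
        push_cast
        rw [add_mul, Complex.exp_add, Complex.exp_two_pi_mul_I, mul_one]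
      have e3 : ∀ α : ℝ, w (Complex.exp (α * Complex.I) * z) = w (Complex.exp (((α + z.arg : ℝ) : ℂ) * Complex.I) * (‖z‖ : ℝ)) := fun α ↦ by
        congr 1
        nth_rw 1 [← Complex.norm_mul_exp_arg_mul_I z]
        push_cast
        rw [add_mul, Complex.exp_add]; ring
      simp_rw [e3]
      rw [intervalIntegral.integral_comp_add_right (fun α : ℝ ↦ w (Complex.exp (α * Complex.I) * (‖z‖ : ℝ)))]
      have := hp.intervalIntegral_add_eq (-Real.pi + z.arg) (-Real.pi)
      rw [show -Real.pi + z.arg + 2 * Real.pi = Real.pi + z.arg by ring, show -Real.pi + 2 * Real.pi = Real.pi by ring] at this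
      exact this
    rw [← e2, e1]
    have := Real.pi_pos
    field_simp
end
end Heis
namespace Heis
theorem mono01 {F F' : ℝ → ℝ} (h : ∀ s ∈ Set.Ioo (0:ℝ) 1, HasDerivAt F (F' s) s) (h' : ∀ s ∈ Set.Ioo (0:ℝ) 1, 0 ≤ F' s) : MonotoneOn F (Set.Ioo 0 1) := by
  refine monotoneOn_of_deriv_nonneg (convex_Ioo _ _) (fun s hs ↦ (h s hs).continuousAt.continuousWithinAt) ?_ ?_
  · rw [interior_Ioo]; exact fun s hs ↦ (h s hs).differentiableAt.differentiableWithinAt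
  · rw [interior_Ioo]; exact fun s hs ↦ by rw [(h s hs).deriv]; exact h' s hs
theorem mono_0 {F F' : ℝ → ℝ} (h : ∀ s ∈ Set.Ioo (0:ℝ) 1, HasDerivAt F (F' s) s) (h' : ∀ s ∈ Set.Ioo (0:ℝ) 1, 0 ≤ F' s)
    (hl : Tendsto F (𝓝[>] 0) (𝓝 0)) : ∀ s ∈ Set.Ioo (0:ℝ) 1, 0 ≤ F s := fun s hs ↦ by
  refine le_of_tendsto hl ?_
  filter_upwards [Ioo_mem_nhdsGT hs.1] with t ht
  exact mono01 h h' ⟨ht.1, ht.2.trans hs.2⟩ hs ht.2.le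
theorem mono_1 {F F' : ℝ → ℝ} (h : ∀ s ∈ Set.Ioo (0:ℝ) 1, HasDerivAt F (F' s) s) (h' : ∀ s ∈ Set.Ioo (0:ℝ) 1, 0 ≤ F' s)
    (hl : Tendsto F (𝓝[<] 1) (𝓝 0)) : ∀ s ∈ Set.Ioo (0:ℝ) 1, F s ≤ 0 := fun s hs ↦ by
  refine ge_of_tendsto hl ?_
  filter_upwards [Ioo_mem_nhdsLT hs.2] with t ht
  exact mono01 h h' hs ⟨hs.1.trans ht.1, ht.2⟩ ht.1.le
theorem qform {N s R v e : ℝ} (hN : 1 ≤ N) (h0 : 0 < s) (h1 : s < 1) :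
    (1 - s) * (s + (N - 1) / N) / 4 * v ^ 2 ≤ R ^ 2 + e ^ 2 - (2 - 2 / N) * R * e - (1 - 2 * N * s) * v * (R - e) +
      (N * (s * (1 - s)) / 2 + (1 - 2 * N * s) * (1 - (N + 1) * s) / 2) * v ^ 2 := by
  have hN0 : 0 < N := by linarith
  set b := 1 - 2 * N * s
  have key : R ^ 2 + e ^ 2 - (2 - 2 / N) * R * e - b * v * (R - e) + (N * (s * (1 - s)) / 2 + b * (1 - (N + 1) * s) / 2) * v ^ 2
    = (1 - 1 / (2 * N)) * (R - e - b * v / (2 * (1 - 1 / (2 * N)))) ^ 2 + (R + e) ^ 2 / (2 * N) + (1 - s) * (s + (N - 1) / N) / (4 * (1 - 1 / (2 * N))) * v ^ 2 := by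
    have h2 : 2 * N - 1 ≠ 0 := by linarith
    have h3 : 1 - 1 / (2 * N) = (2 * N - 1) / (2 * N) := by field_simp
    rw [h3]
    simp only [b]
    field_simp
    ring
  rw [key]
  have h3 : 1 / (2 * N) ≤ 1 / 2 := by gcongr; linarith
  have h4 : 0 < 1 / (2 * N) := by positivity
  have h5 : 0 < 1 - 1 / (2 * N) := by linarith
  have h6 : 0 ≤ (N - 1) / N := div_nonneg (by linarith) hN0.le
  have h7 : 0 ≤ (1 - s) * (s + (N - 1) / N) := mul_nonneg (by linarith) (by linarith)
  have h8 : (1 - s) * (s + (N - 1) / N) / 4 * v ^ 2 ≤ (1 - s) * (s + (N - 1) / N) / (4 * (1 - 1 / (2 * N))) * v ^ 2 := by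
    gcongr; linarith
  have : 0 ≤ (1 - 1 / (2 * N)) * (R - e - b * v / (2 * (1 - 1 / (2 * N)))) ^ 2 + (R + e) ^ 2 / (2 * N) := by positivity
  linarith
section
variable {k : ℕ} {ε L : ℝ} {g G : ℝ → ℝ} (he : 0 < ε) (hg : Gd k ε L g G) {l : ℝ} (hl : 0 < l) {ω H : ℝ → ℝ}
  (hω0 : ∀ s ∈ Set.Ioo (0:ℝ) 1, 0 ≤ ω s) (hω : ∀ s ∈ Set.Ioo (0:ℝ) 1, HasDerivAt ω (H s / (s * (1 - s) ^ (k + 1))) s)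
  (hH : ∀ s ∈ Set.Ioo (0:ℝ) 1, HasDerivAt H ((1 - s) ^ k * ((NN k ^ 2 * ω s - l * g (ω s)) / 4)) s)
  (hH0 : Tendsto H (𝓝[>] 0) (𝓝 0)) (hH1 : Tendsto H (𝓝[<] 1) (𝓝 0))
include he hg hl hω0 hω hH hH0 hH1
omit he in
theorem ode_bd : ∃ C V : ℝ, ∀ s ∈ Set.Ioo (0:ℝ) 1, |(NN k ^ 2 * ω s - l * g (ω s)) / 4| ≤ C ∧ |H s / (s * (1 - s) ^ (k + 1))| ≤ V := by
  have hN := NN_pos k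
  set c := l * L / 4 with hcdef
  have hL : 0 < L := (hg.gpos 0).trans_le (hg.gL 0)
  have hc : 0 < c := by positivity
  have hR : ∀ s ∈ Set.Ioo (0:ℝ) 1, -c ≤ (NN k ^ 2 * ω s - l * g (ω s)) / 4 := fun s hs ↦ by
    have h1 := mul_le_mul_of_nonneg_left (hg.gL (ω s)) hl.le
    have h2 : 0 ≤ NN k ^ 2 * ω s := mul_nonneg (by positivity) (hω0 s hs)
    simp only [hcdef]; linarith
  have gen0 : ∀ (κ C : ℝ), 0 ≤ C → (∀ s ∈ Set.Ioo (0:ℝ) 1, -C ≤ κ * ((NN k ^ 2 * ω s - l * g (ω s)) / 4)) → ∀ s ∈ Set.Ioo (0:ℝ) 1, 0 ≤ κ * H s + C * s := fun κ C hC hb ↦ by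
    refine mono_0 (F' := fun s ↦ κ * ((1 - s) ^ k * ((NN k ^ 2 * ω s - l * g (ω s)) / 4)) + C) (fun s hs ↦ ?_) (fun s hs ↦ ?_) ?_
    · exact (((hH s hs).const_mul κ).add ((hasDerivAt_id s).const_mul C)).congr_deriv (by simp)
    · have h1 : (1 - s) ^ k ≤ 1 := pow_le_one₀ (by linarith [hs.2]) (by linarith [hs.1])
      have h2 : 0 ≤ (1 - s) ^ k := pow_nonneg (by linarith [hs.2]) _
      have h3 := mul_le_mul_of_nonneg_left (hb s hs) h2
      have h4 := mul_le_mul_of_nonneg_right h1 hC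
      linarith
    · have h1 : Tendsto (fun s : ℝ ↦ C * s) (𝓝[>] 0) (𝓝 (C * 0)) := (by fun_prop : Continuous fun s : ℝ ↦ C * s).continuousAt.tendsto.mono_left nhdsWithin_le_nhds
      simpa using (hH0.const_mul κ).add h1
  have gen1 : ∀ (κ C : ℝ), (∀ s ∈ Set.Ioo (0:ℝ) 1, -C ≤ κ * ((NN k ^ 2 * ω s - l * g (ω s)) / 4)) → ∀ s ∈ Set.Ioo (0:ℝ) 1, κ * H s - C / NN k * (1 - s) ^ (k + 1) ≤ 0 := fun κ C hb ↦ by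
    refine mono_1 (F' := fun s ↦ κ * ((1 - s) ^ k * ((NN k ^ 2 * ω s - l * g (ω s)) / 4)) + C * (1 - s) ^ k) (fun s hs ↦ ?_) (fun s hs ↦ ?_) ?_
    · have h2 := (((hasDerivAt_id s).const_sub 1).pow (k + 1)).const_mul (C / NN k)
      refine (((hH s hs).const_mul κ).sub h2).congr_deriv ?_
      have : ((k:ℝ) + 1) = NN k := rfl
      simp [this]; field_simp
    · have h2 : 0 ≤ (1 - s) ^ k := pow_nonneg (by linarith [hs.2]) _
      have h3 := mul_le_mul_of_nonneg_left (hb s hs) h2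
      linarith
    · have h1 : Tendsto (fun s : ℝ ↦ C / NN k * (1 - s) ^ (k + 1)) (𝓝[<] 1) (𝓝 (C / NN k * (1 - 1) ^ (k + 1))) := (by fun_prop : Continuous fun s : ℝ ↦ C / NN k * (1 - s) ^ (k + 1)).continuousAt.tendsto.mono_left nhdsWithin_le_nhds
      simpa using (hH1.const_mul κ).sub h1
  have q0 : ∀ s ∈ Set.Ioo (0:ℝ) 1, s ≤ 1 / 2 → ∀ C, 0 ≤ C → C * s / (s * (1 - s) ^ (k + 1)) ≤ C * 2 ^ (k + 1) := fun s hs h2 C hC ↦ by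
    have hs0 := hs.1
    rw [mul_comm C s, mul_div_mul_left _ _ hs0.ne', div_le_iff₀ (pow_pos (by linarith) _), mul_assoc, ← mul_pow]
    exact le_mul_of_one_le_right hC (one_le_pow₀ (by linarith))
  have q1 : ∀ s ∈ Set.Ioo (0:ℝ) 1, 1 / 2 ≤ s → ∀ C, 0 ≤ C → C * (1 - s) ^ (k + 1) / (s * (1 - s) ^ (k + 1)) ≤ 2 * C := fun s hs h2 C hC ↦ by
    have hs1 : 0 < 1 - s := by linarith [hs.2]
    rw [mul_div_mul_right _ _ (pow_ne_zero _ hs1.ne'), div_le_iff₀ hs.1]; nlinarith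
  have hP : ∀ s ∈ Set.Ioo (0:ℝ) 1, 0 < s * (1 - s) ^ (k + 1) := fun s hs ↦ mul_pos hs.1 (pow_pos (by linarith [hs.2]) _)
  have hhalf : (1 / 2 : ℝ) ∈ Set.Ioo (0:ℝ) 1 := by norm_num
  have hM : ∃ M, ∀ s ∈ Set.Ioo (0:ℝ) 1, ω s ≤ M := by
    refine ⟨ω (1 / 2) + c * 2 ^ (k + 1) + 2 * (c / NN k), fun s hs ↦ ?_⟩
    have p1 : 0 < c * 2 ^ (k + 1) := by positivity
    have p2 : 0 < c / NN k := by positivity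
    rcases le_total s (1 / 2) with h | h
    · have := (convex_Icc s (1 / 2)).mul_sub_le_image_sub_of_le_deriv (f := ω) (C := -(c * 2 ^ (k + 1)))
        (fun t ht ↦ (hω t ⟨hs.1.trans_le ht.1, by linarith [ht.2]⟩).continuousAt.continuousWithinAt)
        (fun t ht ↦ by rw [interior_Icc] at ht; exact (hω t ⟨hs.1.trans ht.1, by linarith [ht.2]⟩).differentiableAt.differentiableWithinAt)
        (fun t ht ↦ by
          rw [interior_Icc] at ht
          have ht' : t ∈ Set.Ioo (0:ℝ) 1 := ⟨hs.1.trans ht.1, by linarith [ht.2]⟩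
          rw [(hω t ht').deriv]
          have h1 := gen0 1 c hc.le (by simpa using hR) t ht'
          have h2 := q0 t ht' ht.2.le c hc.le
          have h3 : -(c * t) / (t * (1 - t) ^ (k + 1)) ≤ H t / (t * (1 - t) ^ (k + 1)) := div_le_div_of_nonneg_right (by linarith) (hP t ht').le
          rw [neg_div] at h3; linarith) s (Set.left_mem_Icc.2 h) (1 / 2) (Set.right_mem_Icc.2 h) h
      nlinarith [hs.1]
    · have := (convex_Icc (1 / 2) s).image_sub_le_mul_sub_of_deriv_le (f := ω) (C := 2 * (c / NN k))
        (fun t ht ↦ (hω t ⟨by linarith [ht.1], ht.2.trans_lt hs.2⟩).continuousAt.continuousWithinAt)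
        (fun t ht ↦ by rw [interior_Icc] at ht; exact (hω t ⟨by linarith [ht.1], ht.2.trans hs.2⟩).differentiableAt.differentiableWithinAt)
        (fun t ht ↦ by
          rw [interior_Icc] at ht
          have ht' : t ∈ Set.Ioo (0:ℝ) 1 := ⟨by linarith [ht.1], ht.2.trans hs.2⟩
          rw [(hω t ht').deriv]
          have h1 := gen1 1 c (by simpa using hR) t ht'
          have h2 := q1 t ht' ht.1.le (c / NN k) p2.le
          have h3 : H t / (t * (1 - t) ^ (k + 1)) ≤ c / NN k * (1 - t) ^ (k + 1) / (t * (1 - t) ^ (k + 1)) := div_le_div_of_nonneg_right (by linarith) (hP t ht').le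
          linarith) (1 / 2) (Set.left_mem_Icc.2 h) s (Set.right_mem_Icc.2 h) h
      nlinarith [hs.2]
  obtain ⟨M, hM⟩ := hM
  have hM0 : 0 ≤ M := (hω0 _ hhalf).trans (hM _ hhalf)
  set C := NN k ^ 2 * M / 4 + c
  have hC : 0 < C := by positivity
  have hRC : ∀ s ∈ Set.Ioo (0:ℝ) 1, |(NN k ^ 2 * ω s - l * g (ω s)) / 4| ≤ C := fun s hs ↦ by
    have h1 := hR s hs
    have h2 : NN k ^ 2 * ω s ≤ NN k ^ 2 * M := mul_le_mul_of_nonneg_left (hM s hs) (by positivity)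
    have h3 : 0 < l * g (ω s) := mul_pos hl (hg.gpos _)
    have h4 : 0 ≤ NN k ^ 2 * M := by positivity
    rw [abs_le]; simp only [C]; constructor <;> linarith
  refine ⟨C, C * 2 ^ (k + 1) + 2 * (C / NN k), fun s hs ↦ ⟨hRC s hs, ?_⟩⟩
  have b1 : ∀ s ∈ Set.Ioo (0:ℝ) 1, -C ≤ 1 * ((NN k ^ 2 * ω s - l * g (ω s)) / 4) := fun s hs ↦ by
    have := (abs_le.1 (hRC s hs)).1; linarith
  have b2 : ∀ s ∈ Set.Ioo (0:ℝ) 1, -C ≤ (-1) * ((NN k ^ 2 * ω s - l * g (ω s)) / 4) := fun s hs ↦ by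
    have := (abs_le.1 (hRC s hs)).2; linarith
  rw [abs_div, abs_of_pos (hP s hs)]
  have p1 : 0 < C * 2 ^ (k + 1) := by positivity
  have p2 : 0 < C / NN k := by positivity
  rcases le_total s (1 / 2) with h | h
  · have h1 := gen0 1 C hC.le b1 s hs
    have h2 := gen0 (-1) C hC.le b2 s hs
    have h3 : |H s| ≤ C * s := abs_le.2 ⟨by linarith, by linarith⟩
    have h4 := div_le_div_of_nonneg_right h3 (hP s hs).le
    linarith [q0 s hs h C hC.le]
  · have h1 := gen1 1 C b1 s hs
    have h2 := gen1 (-1) C b2 s hs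
    have h3 : |H s| ≤ C / NN k * (1 - s) ^ (k + 1) := abs_le.2 ⟨by linarith, by linarith⟩
    have h4 := div_le_div_of_nonneg_right h3 (hP s hs).le
    linarith [q1 s hs h (C / NN k) p2.le]
theorem ode_const : ∀ s ∈ Set.Ioo (0:ℝ) 1, ω s = ω (1 / 2) := by
  have hN := NN_pos k
  obtain ⟨C, V, hCV⟩ := ode_bd hg hl hω0 hω hH hH0 hH1
  obtain ⟨g0, g1, hgd⟩ := hg.gd
  set v : ℝ → ℝ := fun s ↦ H s / (s * (1 - s) ^ (k + 1)) with hv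
  set R : ℝ → ℝ := fun s ↦ (NN k ^ 2 * ω s - l * g0 (ω s)) / 4 with hRdef
  have hRR : ∀ s ∈ Set.Ioo (0:ℝ) 1, (NN k ^ 2 * ω s - l * g (ω s)) / 4 = R s := fun s hs ↦ by
    simp only [hRdef, (hgd _ (hω0 s hs)).1]
  set B : ℝ → ℝ := fun s ↦ R s - (1 / 2 - NN k * s) * v s - s * (1 - s) * v s ^ 2 / (ω s + ε) with hBdef
  set v' : ℝ → ℝ := fun s ↦ (R s - (1 - (NN k + 1) * s) * v s) / (s * (1 - s)) with hv'
  have hvd : ∀ s ∈ Set.Ioo (0:ℝ) 1, HasDerivAt v (v' s) s := fun s hs ↦ by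
    have hs1 : 0 < 1 - s := by linarith [hs.2]
    have hs0 := hs.1
    have h2 := (((hasDerivAt_id s).const_sub 1).pow (k + 1))
    have h3 := (hasDerivAt_id s).mul h2
    have h4 := (hH s hs).div h3 (by simp; exact ⟨hs0.ne', hs1.ne'⟩)
    refine h4.congr_deriv ?_
    rw [hRR s hs]
    simp only [hv', hv]
    simp
    have : ((k:ℝ) + 1) = NN k := rfl
    rw [this, pow_succ]
    field_simp
    ring
  have hRd : ∀ s ∈ Set.Ioo (0:ℝ) 1, HasDerivAt R ((NN k ^ 2 * v s - l * (g1 (ω s) * v s)) / 4) s := fun s hs ↦ by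
    have h1 := ((hgd _ (hω0 s hs)).2.1).comp s (hω s hs)
    exact (((hω s hs).const_mul _).sub (h1.const_mul l)).div_const 4
  have hOm : ∀ s ∈ Set.Ioo (0:ℝ) 1, 0 < ω s + ε := fun s hs ↦ by linarith [hω0 s hs]
  set B' : ℝ → ℝ := fun s ↦ (NN k ^ 2 * v s - l * (g1 (ω s) * v s)) / 4 + NN k * v s - (1 / 2 - NN k * s) * v' s
      - ((1 - 2 * s) * v s ^ 2 + s * (1 - s) * (2 * v s * v' s)) / (ω s + ε) + s * (1 - s) * v s ^ 3 / (ω s + ε) ^ 2 with hB'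
  have hBd : ∀ s ∈ Set.Ioo (0:ℝ) 1, HasDerivAt B (B' s) s := fun s hs ↦ by
    have h1 : HasDerivAt (fun s ↦ (1 / 2 - NN k * s) * v s) (-NN k * v s + (1 / 2 - NN k * s) * v' s) s := by
      refine ((((hasDerivAt_id s).const_mul (NN k)).const_sub (1 / 2)).mul (hvd s hs)).congr_deriv ?_
      simp
    have h2 : HasDerivAt (fun s ↦ s * (1 - s) * v s ^ 2) ((1 - 2 * s) * v s ^ 2 + s * (1 - s) * (2 * v s * v' s)) s := by
      refine (((hasDerivAt_id s).mul ((hasDerivAt_id s).const_sub 1)).mul ((hvd s hs).pow 2)).congr_deriv ?_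
      simp only [id_eq, Pi.mul_apply, Pi.pow_apply, Nat.cast_ofNat]; ring
    have h3 := h2.div ((hω s hs).add_const ε) (hOm s hs).ne'
    refine (((hRd s hs).sub h1).sub h3).congr_deriv ?_
    have := hOm s hs
    have e : H s / (s * (1 - s) ^ (k + 1)) = v s := rfl
    simp only [hB', e]
    field_simp
    ring
  have hTd : ∀ s ∈ Set.Ioo (0:ℝ) 1, HasDerivAt (fun s ↦ H s * B s) ((1 - s) ^ k * R s * B s + H s * B' s) s := fun s hs ↦ by
    have h1 := hH s hs
    rw [hRR s hs] at h1
    exact h1.mul (hBd s hs)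
  have hT' : ∀ s ∈ Set.Ioo (0:ℝ) 1, (1 - s) ^ k * ((1 - s) * (s + (NN k - 1) / NN k) / 4 * v s ^ 2) ≤ (1 - s) ^ k * R s * B s + H s * B' s := fun s hs ↦ by
    have hs1 : 0 < 1 - s := by linarith [hs.2]
    have hs0 := hs.1
    have hO := hOm s hs
    have hHv : H s = (1 - s) ^ k * (s * (1 - s) * v s) := by
      simp only [hv]; rw [pow_succ]; field_simp
    rw [hHv, mul_assoc ((1 - s) ^ k), mul_assoc ((1 - s) ^ k), ← mul_add]
    refine mul_le_mul_of_nonneg_left ?_ (pow_nonneg hs1.le _)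
    have hq := qform (N := NN k) (s := s) (R := R s) (v := v s) (e := s * (1 - s) * v s ^ 2 / (ω s + ε)) (NN_ge k) hs0 hs.2
    refine hq.trans ?_
    have hg1 : -NN k / 2 + qq k * R s / (ω s + ε) ≤ (NN k ^ 2 - l * g1 (ω s)) / 4 := by
      have h1 := (hgd _ (hω0 s hs)).2.2
      rw [← (hgd _ (hω0 s hs)).1] at h1
      have h2 := mul_le_mul_of_nonneg_left h1 hl.le
      have h3 : qq k * R s / (ω s + ε) = (qq k * (NN k ^ 2 * ω s) - qq k * (l * g0 (ω s))) / 4 / (ω s + ε) := by simp only [hRdef]; ring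
      rw [h3, ← sub_nonneg]
      have h4 : (NN k ^ 2 - l * g1 (ω s)) / 4 - (-NN k / 2 + (qq k * (NN k ^ 2 * ω s) - qq k * (l * g0 (ω s))) / 4 / (ω s + ε))
        = ((NN k ^ 2 + 2 * NN k) * ε + (l * (qq k * g0 (ω s)) - l * ((ε + ω s) * g1 (ω s)))) / (4 * (ω s + ε)) := by
        unfold qq; field_simp; ring
      rw [h4]
      exact div_nonneg (by have : 0 < (NN k ^ 2 + 2 * NN k) * ε := by positivity
                           linarith) (by positivity)
    have hD : 0 ≤ s * (1 - s) * v s ^ 2 := by positivity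
    have h5 := mul_le_mul_of_nonneg_left hg1 hD
    have h6 : s * (1 - s) * v' s = R s - (1 - (NN k + 1) * s) * v s := by simp only [hv']; field_simp
    have h7 : R s * B s + s * (1 - s) * v s * B' s = (R s * B s + (s * (1 - s) * v s ^ 2) * ((NN k ^ 2 - l * g1 (ω s)) / 4)) + (s * (1 - s) * NN k * v s ^ 2 - (1 / 2 - NN k * s) * v s * (s * (1 - s) * v' s)
       - (s * (1 - s) * (1 - 2 * s) * v s ^ 3 + 2 * (s * (1 - s)) * v s ^ 2 * (s * (1 - s) * v' s)) / (ω s + ε) + (s * (1 - s)) ^ 2 * v s ^ 4 / (ω s + ε) ^ 2) := by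
      simp only [hB']; ring
    rw [h7, h6]
    refine le_trans (le_of_eq ?_) (add_le_add_left (add_le_add_right h5 (R s * B s)) _)
    simp only [hBdef]; unfold qq
    field_simp
    ring
  have hT0 : ∀ s ∈ Set.Ioo (0:ℝ) 1, 0 ≤ (1 - s) ^ k * R s * B s + H s * B' s := fun s hs ↦ by
    refine le_trans ?_ (hT' s hs)
    have hs1 : 0 < 1 - s := by linarith [hs.2]
    have hs0 := hs.1
    have : 0 ≤ (NN k - 1) / NN k := div_nonneg (by linarith [NN_ge k]) hN.le
    positivity
  have hBb : ∀ s ∈ Set.Ioo (0:ℝ) 1, |B s| ≤ C + (1 + NN k) * V + V ^ 2 / ε := fun s hs ↦ by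
    obtain ⟨h1, h2⟩ := hCV s hs
    rw [hRR s hs] at h1
    change |v s| ≤ V at h2
    have hs1 : 0 < 1 - s := by linarith [hs.2]
    have hs0 := hs.1
    have h3 : |(1 / 2 - NN k * s) * v s| ≤ (1 + NN k) * V := by
      rw [abs_mul]
      have : |1 / 2 - NN k * s| ≤ 1 + NN k := abs_le.2 ⟨by nlinarith, by nlinarith⟩
      gcongr
    have h4 : |s * (1 - s) * v s ^ 2 / (ω s + ε)| ≤ V ^ 2 / ε := by
      have hv2 : v s ^ 2 ≤ V ^ 2 := by rw [← sq_abs]; gcongr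
      rw [abs_of_nonneg (div_nonneg (by positivity) (hOm s hs).le)]
      have : s * (1 - s) ≤ 1 := by nlinarith
      gcongr
      · nlinarith [sq_nonneg (v s)]
      · linarith [hω0 s hs]
    simp only [hBdef]
    calc _ ≤ |R s - (1 / 2 - NN k * s) * v s| + |s * (1 - s) * v s ^ 2 / (ω s + ε)| := abs_sub _ _
      _ ≤ |R s| + |(1 / 2 - NN k * s) * v s| + |s * (1 - s) * v s ^ 2 / (ω s + ε)| := by gcongr; exact abs_sub _ _
      _ ≤ _ := by gcongr
  have lim : ∀ F : Filter ℝ, (∀ᶠ s in F, s ∈ Set.Ioo (0:ℝ) 1) → Tendsto H F (𝓝 0) → Tendsto (fun s ↦ H s * B s) F (𝓝 0) := fun F hF hHF ↦ by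
    refine squeeze_zero_norm' (a := fun s ↦ ‖H s‖ * (C + (1 + NN k) * V + V ^ 2 / ε)) ?_ (by simpa using hHF.norm.mul_const (C + (1 + NN k) * V + V ^ 2 / ε))
    filter_upwards [hF] with s hs
    rw [norm_mul]; exact mul_le_mul_of_nonneg_left (hBb s hs) (norm_nonneg _)
  have hTz : ∀ s ∈ Set.Ioo (0:ℝ) 1, H s * B s = 0 := fun s hs ↦
    le_antisymm (mono_1 hTd hT0 (lim _ (Ioo_mem_nhdsLT one_pos) hH1) s hs) (mono_0 hTd hT0 (lim _ (Ioo_mem_nhdsGT one_pos) hH0) s hs)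
  have hvz : ∀ s ∈ Set.Ioo (0:ℝ) 1, v s = 0 := fun s hs ↦ by
    have h1 : HasDerivAt (fun s ↦ H s * B s) 0 s := (hasDerivAt_const s (0:ℝ)).congr_of_eventuallyEq (by
      filter_upwards [isOpen_Ioo.mem_nhds hs] with t ht using hTz t ht)
    have h2 := hT' s hs
    rw [(hTd s hs).unique h1] at h2
    have hs1 : 0 < 1 - s := by linarith [hs.2]
    have hs0 := hs.1
    have h6 : 0 ≤ (NN k - 1) / NN k := div_nonneg (by linarith [NN_ge k]) hN.le
    by_contra h
    have h7 : 0 < v s ^ 2 := by positivity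
    have : 0 < (1 - s) ^ k * ((1 - s) * (s + (NN k - 1) / NN k) / 4 * v s ^ 2) := by positivity
    linarith
  intro s hs
  refine isOpen_Ioo.is_const_of_deriv_eq_zero isPreconnected_Ioo (fun t ht ↦ (hω t ht).differentiableAt.differentiableWithinAt) (fun t ht ↦ ?_) hs (by norm_num)
  rw [(hω t ht).deriv]; exact hvz t ht
end
end Heis
namespace Heis
theorem polar : Measure.map (fun z : ℂ ↦ ‖z‖ ^ 2) (volume.restrict DD) = ENNReal.ofReal Real.pi • volume.restrict (Set.Ioo (0:ℝ) 1) := by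
  have hm : Measurable (fun z : ℂ ↦ ‖z‖ ^ 2) := by fun_prop
  haveI : IsFiniteMeasure (volume.restrict DD) := ⟨by simpa using measure_ball_lt_top⟩
  haveI : IsFiniteMeasure (Measure.map (fun z : ℂ ↦ ‖z‖ ^ 2) (volume.restrict DD)) := Measure.isFiniteMeasure_map _ _
  refine Measure.ext_of_Iic _ _ fun a ↦ ?_
  rw [Measure.map_apply hm measurableSet_Iic, Measure.restrict_apply (hm measurableSet_Iic), Measure.smul_apply, Measure.restrict_apply measurableSet_Iic, smul_eq_mul]
  rcases lt_or_ge a 0 with ha | ha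
  · have e1 : (fun z : ℂ ↦ ‖z‖ ^ 2) ⁻¹' Set.Iic a ∩ DD = ∅ := by
      ext z; simp only [Set.mem_inter_iff, Set.mem_preimage, Set.mem_Iic, Set.mem_empty_iff_false, iff_false]
      rintro ⟨h, -⟩; linarith [sq_nonneg ‖z‖]
    have e2 : Set.Iic a ∩ Set.Ioo (0:ℝ) 1 = ∅ := by
      ext z; simp only [Set.mem_inter_iff, Set.mem_Iic, Set.mem_Ioo, Set.mem_empty_iff_false, iff_false]
      rintro ⟨h, h', -⟩; linarith
    rw [e1, e2]; simp
  rcases lt_or_ge a 1 with ha1 | ha1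
  · have e1 : (fun z : ℂ ↦ ‖z‖ ^ 2) ⁻¹' Set.Iic a ∩ DD = Metric.closedBall 0 (√a) := by
      ext z; simp only [Set.mem_inter_iff, Set.mem_preimage, Set.mem_Iic, DD, mem_ball_zero_iff, mem_closedBall_zero_iff]
      rw [Real.le_sqrt (norm_nonneg _) ha]
      refine ⟨fun h ↦ h.1, fun h ↦ ⟨h, ?_⟩⟩
      nlinarith [norm_nonneg z]
    have e2 : Set.Iic a ∩ Set.Ioo (0:ℝ) 1 = Set.Ioc 0 a := by
      ext z; simp only [Set.mem_inter_iff, Set.mem_Iic, Set.mem_Ioo, Set.mem_Ioc]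
      exact ⟨fun h ↦ ⟨h.2.1, h.1⟩, fun h ↦ ⟨h.2, h.1, by linarith [h.2]⟩⟩
    rw [e1, e2, Complex.volume_closedBall, Real.volume_Ioc, ← ENNReal.ofReal_pow (Real.sqrt_nonneg _), Real.sq_sqrt ha, sub_zero, mul_comm]
    congr 1
    exact (ENNReal.ofReal_eq_coe_nnreal Real.pi_pos.le).symm
  · have e1 : (fun z : ℂ ↦ ‖z‖ ^ 2) ⁻¹' Set.Iic a ∩ DD = DD := by
      refine Set.inter_eq_right.2 fun z hz ↦ ?_
      have : ‖z‖ < 1 := by simpa [DD] using hz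
      simp only [Set.mem_preimage, Set.mem_Iic]; nlinarith [norm_nonneg z]
    have e2 : Set.Iic a ∩ Set.Ioo (0:ℝ) 1 = Set.Ioo 0 1 := Set.inter_eq_right.2 fun z hz ↦ by simp only [Set.mem_Iic]; linarith [hz.2]
    rw [e1, e2, DD, Complex.volume_ball, Real.volume_Ioo]
    simp
    exact (ENNReal.ofReal_eq_coe_nnreal Real.pi_pos.le).symm
theorem polar_int {F : ℝ → ℝ} (hF : AEStronglyMeasurable F (volume.restrict (Set.Ioo (0:ℝ) 1))) :
    ∫ z in DD, F (‖z‖ ^ 2) = Real.pi * ∫ s in (0:ℝ)..1, F s := by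
  have hm : Measurable (fun z : ℂ ↦ ‖z‖ ^ 2) := by fun_prop
  have h := integral_map (μ := volume.restrict DD) hm.aemeasurable (f := F) (by rw [polar]; exact hF.smul_measure _)
  rw [polar, integral_smul_measure, ENNReal.toReal_ofReal Real.pi_pos.le] at h
  rw [← h, intervalIntegral.integral_of_le zero_le_one, integral_Ioc_eq_integral_Ioo, smul_eq_mul]
theorem polar_intble {F : ℝ → ℝ} (hF : AEStronglyMeasurable F (volume.restrict (Set.Ioo (0:ℝ) 1))) :
    IntegrableOn (fun z : ℂ ↦ F (‖z‖ ^ 2)) DD ↔ IntervalIntegrable F volume 0 1 := by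
  have hm : Measurable (fun z : ℂ ↦ ‖z‖ ^ 2) := by fun_prop
  have h := integrable_map_measure (μ := volume.restrict DD) (f := fun z : ℂ ↦ ‖z‖ ^ 2) (g := F) (by rw [polar]; exact hF.smul_measure _) hm.aemeasurable
  rw [polar, integrable_smul_measure (by simp [Real.pi_pos]) (by simp)] at h
  rw [intervalIntegrable_iff_integrableOn_Ioo_of_le zero_le_one, IntegrableOn, IntegrableOn, h]; rfl
theorem polar_ae {p : ℝ → Prop} (hp : MeasurableSet {s | p s}) :
    (∀ᵐ z ∂(volume.restrict DD), p (‖z‖ ^ 2)) ↔ ∀ᵐ s ∂(volume.restrict (Set.Ioo (0:ℝ) 1)), p s := by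
  have hm : Measurable (fun z : ℂ ↦ ‖z‖ ^ 2) := by fun_prop
  have h := ae_map_iff (μ := volume.restrict DD) hm.aemeasurable hp
  rw [polar] at h
  rw [← h, Measure.ae_ennreal_smul_measure_iff (by simp [Real.pi_pos])]
theorem gr_nsq (z : ℂ) : gr (fun z : ℂ ↦ ‖z‖ ^ 2) z = 2 * z := by
  have e : (fun z : ℂ ↦ ‖z‖ ^ 2) = fun z ↦ (-1) * fD z + 1 := by ext z; simp [fD]
  have h1 : DifferentiableAt ℝ fD z := fD_cd.differentiable (by simp) z
  have h2 : HasDerivAt (fun t : ℝ ↦ (-1) * t + 1) (-1) (fD z) := by simpa using ((hasDerivAt_id (fD z)).const_mul (-1:ℝ)).add_const 1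
  rw [e, gr_comp h2 h1, gr_fD]; push_cast; ring
theorem nsq_cd : ContDiff ℝ 1 (fun z : ℂ ↦ ‖z‖ ^ 2) := contDiff_norm_sq ℝ
theorem gr_rad {η : ℝ → ℝ} {η' : ℝ} {z : ℂ} (h : HasDerivAt η η' (‖z‖ ^ 2)) :
    gr (fun z : ℂ ↦ η (‖z‖ ^ 2)) z = (η' : ℂ) * (2 * z) := by
  rw [gr_comp (φ := fun z : ℂ ↦ ‖z‖ ^ 2) h (nsq_cd.differentiable (by simp) z), gr_nsq]
theorem core_rad {η : ℝ → ℝ} (h : ContDiff ℝ 1 η) {b : ℝ} (hb : b < 1) (hz : ∀ s, b ≤ s → η s = 0) :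
    Core (fun z : ℂ ↦ η (‖z‖ ^ 2)) := by
  have hs : tsupport (fun z : ℂ ↦ η (‖z‖ ^ 2)) ⊆ {z | ‖z‖ ^ 2 ≤ b} := by
    refine closure_minimal (fun z hz' ↦ ?_) (isClosed_le (by fun_prop) continuous_const)
    by_contra hc
    simp only [Set.mem_setOf_eq, not_le] at hc
    exact hz' (hz _ hc.le)
  have hD : {z : ℂ | ‖z‖ ^ 2 ≤ b} ⊆ DD := fun z hz' ↦ by
    simp only [Set.mem_setOf_eq] at hz'
    simp only [DD, mem_ball_zero_iff]
    nlinarith [norm_nonneg z]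
  refine ⟨h.comp nsq_cd, ?_, hs.trans hD⟩
  refine (isCompact_closedBall (0:ℂ) 1).of_isClosed_subset (isClosed_tsupport _) ((hs.trans hD).trans ?_)
  exact Metric.ball_subset_closedBall
theorem rad_core {k : ℕ} {q η θ : ℝ → ℝ} (hq : ContDiff ℝ 1 q) (hη : ContDiff ℝ 1 η)
    (hηd : ∀ s, s < 1 → HasDerivAt η (q s / (1 - s) ^ (k + 1)) s) {b : ℝ} (hb : b < 1)
    (hz : ∀ s, b ≤ s → η s = 0) (hθ : ∀ s, θ s = s * q s) {ψ : ℂ → ℝ} (hψ : Core ψ) :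
    ∫ z, inner ℝ ((sf z : ℂ) * gr ψ z) ((sf z : ℂ) * gr (fun z : ℂ ↦ η (‖z‖ ^ 2)) z) ∂bet k
      = - ∫ z, ψ z * (4 * deriv θ (‖z‖ ^ 2) / fD z ^ k) ∂bet k := by
  have hqd := hq.differentiable (by simp)
  have hY : ∀ c : ℂ → ℝ, ContDiff ℝ 1 c → ContDiff ℝ 1 (fun z : ℂ ↦ 2 * q (‖z‖ ^ 2) * c z) := fun c hc ↦
    (contDiff_const.mul (hq.comp nsq_cd)).mul hc
  have hre : ContDiff ℝ 1 (fun z : ℂ ↦ z.re) := Complex.reCLM.contDiff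
  have him : ContDiff ℝ 1 (fun z : ℂ ↦ z.im) := Complex.imCLM.contDiff
  obtain ⟨hi, h0⟩ := ibp hψ (fun z _ ↦ (hY _ hre).contDiffAt) (fun z _ ↦ (hY _ him).contDiffAt)
  have hqg : ∀ z : ℂ, gr (fun z : ℂ ↦ 2 * q (‖z‖ ^ 2)) z = ((2 * deriv q (‖z‖ ^ 2) : ℝ) : ℂ) * (2 * z) := fun z ↦
    gr_rad (η := fun s ↦ 2 * q s) ((hqd _).hasDerivAt.const_mul 2)
  have hdq : ∀ z : ℂ, DifferentiableAt ℝ (fun z : ℂ ↦ 2 * q (‖z‖ ^ 2)) z := fun z ↦ (contDiff_const.mul (hq.comp nsq_cd)).differentiable (by simp) z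
  have hθd : ∀ s, deriv θ s = q s + s * deriv q s := fun s ↦ by
    have : θ = fun s ↦ s * q s := funext hθ
    rw [this]
    exact (((hasDerivAt_id s).mul (hqd s).hasDerivAt).congr_deriv (by simp)).deriv
  have hdiv : ∀ z : ℂ, (gr (fun z : ℂ ↦ 2 * q (‖z‖ ^ 2) * z.re) z).re + (gr (fun z : ℂ ↦ 2 * q (‖z‖ ^ 2) * z.im) z).im = 4 * deriv θ (‖z‖ ^ 2) := fun z ↦ by
    rw [gr_mul (hdq z) (hre.differentiable (by simp) z), gr_mul (hdq z) (him.differentiable (by simp) z), hqg, hθd, gr_re, gr_im]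
    have : ‖z‖ ^ 2 = z.re ^ 2 + z.im ^ 2 := by rw [← Complex.normSq_eq_norm_sq, Complex.normSq_apply]; ring
    simp only [Complex.add_re, Complex.add_im, Complex.mul_re, Complex.mul_im, Complex.ofReal_re, Complex.ofReal_im, Complex.one_re, Complex.one_im, Complex.I_re, Complex.I_im, Complex.re_ofNat, Complex.im_ofNat]
    rw [this]; ring
  rw [bet_int, bet_int]
  have e1 : ∫ z in DD, fD z ^ k • inner ℝ ((sf z : ℂ) * gr ψ z) ((sf z : ℂ) * gr (fun z : ℂ ↦ η (‖z‖ ^ 2)) z)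
      = ∫ z, (gr ψ z).re * (2 * q (‖z‖ ^ 2) * z.re) + (gr ψ z).im * (2 * q (‖z‖ ^ 2) * z.im) := by
    rw [← setInt_core (F := fun z ↦ (gr ψ z).re * (2 * q (‖z‖ ^ 2) * z.re) + (gr ψ z).im * (2 * q (‖z‖ ^ 2) * z.im)) (fun z hz ↦ by rw [hψ.gr0 hz]; simp)]
    refine setIntegral_congr_fun Metric.isOpen_ball.measurableSet fun z hz ↦ ?_
    have hf := fD_pos hz
    have hs1 : ‖z‖ ^ 2 < 1 := by have := hf; simp only [fD] at this; linarith
    have e : (1 - ‖z‖ ^ 2) = fD z := rfl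
    rw [gr_rad (hηd _ hs1), e, inner_C]
    simp only [Complex.mul_re, Complex.mul_im, Complex.ofReal_re, Complex.ofReal_im, Complex.re_ofNat, Complex.im_ofNat, smul_eq_mul]
    have h3 := sf_sq hz
    have h4 : fD z ^ (k + 1) = fD z ^ k * sf z ^ 2 := by rw [h3]; ring
    rw [h4]
    have h5 : sf z ≠ 0 := (sf_pos hz).ne'
    field_simp
    ring
  have e2 : ∫ z in DD, fD z ^ k • (ψ z * (4 * deriv θ (‖z‖ ^ 2) / fD z ^ k)) = ∫ z, ψ z * (4 * deriv θ (‖z‖ ^ 2)) := by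
    rw [← setInt_core (F := fun z ↦ ψ z * (4 * deriv θ (‖z‖ ^ 2))) (fun z hz ↦ by rw [hψ.eq0 hz]; simp)]
    refine setIntegral_congr_fun Metric.isOpen_ball.measurableSet fun z hz ↦ ?_
    have hf := fD_pos hz
    simp only [smul_eq_mul]
    field_simp
  have hθc : Continuous (deriv θ) := by
    have : deriv θ = fun s ↦ q s + s * deriv q s := funext hθd
    rw [this]
    have := hq.continuous_deriv le_rfl
    have := hq.continuous
    fun_prop
  have hi2 : Integrable (fun z ↦ ψ z * (4 * deriv θ (‖z‖ ^ 2))) := by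
    refine int_cs ?_ (hψ.cpt.mul_right)
    have := hψ.cont
    exact this.mul (continuous_const.mul (hθc.comp (by fun_prop)))
  simp only [hdiv] at hi h0
  rw [e1, e2]
  have hi1 : Integrable (fun z ↦ (gr ψ z).re * (2 * q (‖z‖ ^ 2) * z.re) + (gr ψ z).im * (2 * q (‖z‖ ^ 2) * z.im)) := by
    refine (hi.sub hi2).congr (Eventually.of_forall fun z ↦ ?_)
    simp only [Pi.sub_apply]; ring
  rw [integral_add hi1 hi2] at h0
  linarith
theorem rad_HH {k : ℕ} {q η θ : ℝ → ℝ} (hq : ContDiff ℝ 1 q) (hη : ContDiff ℝ 1 η)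
    (hηd : ∀ s, s < 1 → HasDerivAt η (q s / (1 - s) ^ (k + 1)) s) {b : ℝ} (hb : b < 1) (hb0 : 0 ≤ b)
    (hz : ∀ s, b ≤ s → η s = 0) (hzq : ∀ s, b ≤ s → q s = 0) (hθ : ∀ s, θ s = s * q s) {x : VV k} (hx : x ∈ HH k) :
    inner ℝ x (emb k _ (core_rad hη hb hz))
      = NN k ^ 2 * (∫ z, wf x z * η (‖z‖ ^ 2) ∂bet k) - ∫ z, wf x z * (4 * deriv θ (‖z‖ ^ 2) / fD z ^ k) ∂bet k := by
  have hcr := core_rad hη hb hz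
  have hqd := hq.differentiable (by simp)
  have hθd : ∀ s, deriv θ s = q s + s * deriv q s := fun s ↦ by
    have : θ = fun s ↦ s * q s := funext hθ
    rw [this]
    exact (((hasDerivAt_id s).mul (hqd s).hasDerivAt).congr_deriv (by simp)).deriv
  have hq' := hq.continuous_deriv le_rfl
  have hqc := hq.continuous
  have hθc : Continuous (deriv θ) := by
    have : deriv θ = fun s ↦ q s + s * deriv q s := funext hθd
    rw [this]
    fun_prop
  have hθ0 : ∀ s, b ≤ s → deriv θ s = 0 := fun s hs ↦ by
    rw [hθd, hzq s hs]
    have : deriv q s = 0 := by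
      rcases hs.eq_or_lt with h | h
      · refine tendsto_nhds_unique_of_frequently_eq (hq'.tendsto s) tendsto_const_nhds (b := (0:ℝ)) ?_
        refine (Filter.Eventually.frequently (f := 𝓝[>] s) ?_).filter_mono nhdsWithin_le_nhds
        filter_upwards [self_mem_nhdsWithin] with y hy
        have : q =ᶠ[𝓝 y] fun _ ↦ 0 := by
          filter_upwards [lt_mem_nhds (a := b) (b := y) (h ▸ hy)] with u hu using hzq u hu.le
        rw [this.deriv_eq]; simp
      · have : q =ᶠ[𝓝 s] fun _ ↦ 0 := by
          filter_upwards [lt_mem_nhds h] with u hu using hzq u hu.le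
        rw [this.deriv_eq]; simp
    rw [this]; ring
  obtain ⟨v1, hv1⟩ := int_psi (k := k) (ψ := fun z : ℂ ↦ η (‖z‖ ^ 2)) (hcr.cont.measurable) (by
    obtain ⟨c, hc⟩ := hcr.cpt.exists_bound_of_continuous hcr.cont
    exact ⟨c, hc⟩)
  have hmz : Measurable (fun z : ℂ ↦ ‖z‖ ^ 2) := by fun_prop
  obtain ⟨v2, hv2⟩ := int_psi (k := k) (ψ := fun z : ℂ ↦ 4 * deriv θ (‖z‖ ^ 2) / fD z ^ k) (by
    exact ((hθc.measurable.comp hmz).const_mul 4).div (fD_cont.measurable.pow_const k)) (by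
    obtain ⟨c, hc⟩ := (isCompact_Icc (a := (0:ℝ)) (b := b)).exists_bound_of_continuousOn hθc.continuousOn
    refine ⟨4 * c / (1 - b) ^ k, fun z ↦ ?_⟩
    have h1b : 0 < (1 - b) ^ k := pow_pos (by linarith) _
    have hc0 : 0 ≤ c := (norm_nonneg _).trans (hc 0 ⟨le_rfl, hb0⟩)
    rcases le_or_gt b (‖z‖ ^ 2) with h | h
    · rw [hθ0 _ h]; simp; positivity
    · have h2 := hc (‖z‖ ^ 2) ⟨by positivity, h.le⟩
      have h3 : 1 - b ≤ fD z := by simp only [fD]; linarith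
      have h4 : (1 - b) ^ k ≤ fD z ^ k := pow_le_pow_left₀ (by linarith) h3 k
      rw [abs_div, abs_mul, abs_of_pos (h1b.trans_le h4), abs_of_pos (by norm_num : (0:ℝ) < 4)]
      rw [Real.norm_eq_abs] at h2
      gcongr)
  obtain ⟨φ, hφ, ht⟩ := HH_seq hx
  have hL : Tendsto (fun j ↦ inner ℝ (emb k (φ j) (hφ j)) (emb k _ hcr)) atTop (𝓝 (inner ℝ x (emb k _ hcr))) := ht.inner tendsto_const_nhds
  have h1 : Tendsto (fun j ↦ inner ℝ (emb k (φ j) (hφ j)) v1) atTop (𝓝 (inner ℝ x v1)) := ht.inner tendsto_const_nhds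
  have h2 : Tendsto (fun j ↦ inner ℝ (emb k (φ j) (hφ j)) v2) atTop (𝓝 (inner ℝ x v2)) := ht.inner tendsto_const_nhds
  have hR := (h1.const_mul (NN k ^ 2)).sub h2
  rw [← hv1, ← hv2]
  refine tendsto_nhds_unique hL (hR.congr fun j ↦ ?_)
  rw [hv1, hv2, inner_emb]
  have e1 : ∫ z, wf (emb k (φ j) (hφ j)) z * (4 * deriv θ (‖z‖ ^ 2) / fD z ^ k) ∂bet k = ∫ z, φ j z * (4 * deriv θ (‖z‖ ^ 2) / fD z ^ k) ∂bet k := by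
    refine integral_congr_ae ?_
    filter_upwards [emb_w k (hφ j)] with z hz; rw [hz]
  have e2 : ∫ z, inner ℝ (gf (emb k (φ j) (hφ j)) z) ((sf z : ℂ) * gr (fun z : ℂ ↦ η (‖z‖ ^ 2)) z) ∂bet k = ∫ z, inner ℝ ((sf z : ℂ) * gr (φ j) z) ((sf z : ℂ) * gr (fun z : ℂ ↦ η (‖z‖ ^ 2)) z) ∂bet k := by
    refine integral_congr_ae ?_
    filter_upwards [emb_g k (hφ j)] with z hz; rw [hz]
  rw [e1, e2, rad_core hq hη hηd hb hz hθ (hφ j)]; ring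
end Heis
namespace Heis
theorem ibpA {F : ℝ → ℝ} (hF : IntervalIntegrable F volume 0 1) {η : ℝ → ℝ} (hη : ContDiff ℝ 1 η) (h1 : η 1 = 0) :
    ∫ s in (0:ℝ)..1, F s * η s = - ∫ s in (0:ℝ)..1, (∫ t in (0:ℝ)..s, F t) * deriv η s := by
  have hA := hF.absolutelyContinuousOnInterval_intervalIntegral (c := 0) (by simp)
  have hB : AbsolutelyContinuousOnInterval η 0 1 := hη.contDiffOn.absolutelyContinuousOnInterval
  have h := hA.integral_mul_deriv_eq_deriv_mul hB
  rw [h, h1]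
  have : ∫ s in (0:ℝ)..1, deriv (fun s ↦ ∫ t in (0:ℝ)..s, F t) s * η s = ∫ s in (0:ℝ)..1, F s * η s := by
    refine intervalIntegral.integral_congr_ae ?_
    filter_upwards [hF.ae_hasDerivAt_integral] with s hs hs'
    rw [(hs (Set.uIoc_subset_uIcc hs') 0 (by simp)).deriv]
  rw [this]; simp
theorem int_ab {F : ℝ → ℝ} {a b : ℝ} (hab : a ≤ b) (h0 : ∀ s, s ≤ a → F s = 0) (h1 : ∀ s, b ≤ s → F s = 0) :
    ∫ s, F s = ∫ s in a..b, F s := by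
  rw [intervalIntegral.integral_of_le hab]
  refine (setIntegral_eq_integral_of_forall_compl_eq_zero fun s hs ↦ ?_).symm
  simp only [Set.mem_Ioc, not_and_or, not_lt, not_le] at hs
  rcases hs with h | h
  · exact h0 _ h
  · exact h1 _ h.le
theorem int_01 {F : ℝ → ℝ} {a b : ℝ} (ha : 0 ≤ a) (hb : b ≤ 1) (hab : a ≤ b) (h0 : ∀ s, s ≤ a → F s = 0) (h1 : ∀ s, b ≤ s → F s = 0) :
    ∫ s in (0:ℝ)..1, F s = ∫ s in a..b, F s := by
  rw [← int_ab hab h0 h1, ← int_ab (by linarith) (fun s hs ↦ h0 s (hs.trans ha)) (fun s hs ↦ h1 s (hb.trans hs))]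
theorem dbr {ω v : ℝ → ℝ} (hω : LocallyIntegrableOn ω (Set.Ioo 0 1)) (hv : ContinuousOn v (Set.Ioo 0 1))
    (hw : ∀ θ : ℝ → ℝ, ContDiff ℝ 1 θ → ∀ a b, 0 < a → a < b → b < 1 → (∀ s, s ≤ a → θ s = 0) → (∀ s, b ≤ s → θ s = 0) →
      ∫ s in a..b, ω s * deriv θ s = - ∫ s in a..b, v s * θ s) :
    ∃ ω₁ : ℝ → ℝ, (∀ s ∈ Set.Ioo (0:ℝ) 1, HasDerivAt ω₁ (v s) s) ∧ ∀ᵐ s, s ∈ Set.Ioo (0:ℝ) 1 → ω s = ω₁ s := by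
  set Ψ : ℝ → ℝ := fun s ↦ ∫ t in (1/2:ℝ)..s, v t with hΨ
  have hsub : ∀ a b : ℝ, 0 < a → a < 1 → 0 < b → b < 1 → Set.uIcc a b ⊆ Set.Ioo 0 1 := fun a b ha ha1 hb hb1 s hs ↦ by
    rw [Set.mem_uIcc] at hs
    constructor <;> rcases hs with h | h <;> linarith [h.1, h.2]
  have hΨd : ∀ s ∈ Set.Ioo (0:ℝ) 1, HasDerivAt Ψ (v s) s := fun s hs ↦ by
    have hs' : Set.Ioo (0:ℝ) 1 ∈ 𝓝 s := isOpen_Ioo.mem_nhds hs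
    refine intervalIntegral.integral_hasDerivAt_right ((hv.mono (hsub _ _ (by norm_num) (by norm_num) hs.1 hs.2)).intervalIntegrable) ?_ (hv.continuousAt hs')
    exact ContinuousOn.stronglyMeasurableAtFilter isOpen_Ioo hv s hs
  have hΨc : ContinuousOn Ψ (Set.Ioo 0 1) := fun s hs ↦ (hΨd s hs).continuousAt.continuousWithinAt
  have hΨl : LocallyIntegrableOn Ψ (Set.Ioo 0 1) := hΨc.locallyIntegrableOn measurableSet_Ioo
  set h : ℝ → ℝ := fun s ↦ ω s - Ψ s with hh
  have hhl : LocallyIntegrableOn h (Set.Ioo 0 1) := hω.sub hΨl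
  have hii : ∀ {f : ℝ → ℝ}, LocallyIntegrableOn f (Set.Ioo 0 1) → ∀ a b : ℝ, 0 < a → a < b → b < 1 → IntervalIntegrable f volume a b := fun hf a b ha hab hb ↦ by
    have : IntegrableOn _ (Set.uIcc a b) volume := hf.integrableOn_compact_subset (hsub a b ha (by linarith) (by linarith) hb) isCompact_uIcc
    exact this.intervalIntegrable
  have h0 : ∀ θ : ℝ → ℝ, ContDiff ℝ 1 θ → ∀ a b, 0 < a → a < b → b < 1 → (∀ s, s ≤ a → θ s = 0) → (∀ s, b ≤ s → θ s = 0) → ∫ s in a..b, h s * deriv θ s = 0 := fun θ hθ a b ha hab hb z0 z1 ↦ by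
    have hs := hsub a b ha (by linarith) (by linarith) hb
    have hθ' := hθ.continuous_deriv le_rfl
    have e1 := intervalIntegral.integral_mul_deriv_eq_deriv_mul (a := a) (b := b) (u := Ψ) (u' := v) (v := θ) (v' := deriv θ)
      (fun s hs' ↦ hΨd s (hs hs')) (fun s _ ↦ (hθ.differentiable (by simp) s).hasDerivAt)
      ((hv.mono hs).intervalIntegrable) (hθ'.intervalIntegrable _ _)
    rw [z0 a le_rfl, z1 b le_rfl] at e1
    simp only [hh, sub_mul]
    rw [intervalIntegral.integral_sub ((hii hω a b ha hab hb).mul_continuousOn hθ'.continuousOn) ((hii hΨl a b ha hab hb).mul_continuousOn hθ'.continuousOn), hw θ hθ a b ha hab hb z0 z1, e1]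
    ring
  let B : ContDiffBump (1/2:ℝ) := ⟨1/8, 1/4, by norm_num, by norm_num⟩
  set θ0 := B.normed volume with hθ0
  have t0c : ContDiff ℝ 1 θ0 := B.contDiff_normed
  have t0z : ∀ s, s ∉ Set.Ioo (1/4:ℝ) (3/4) → θ0 s = 0 := fun s hs ↦ by
    have := B.support_normed_eq (μ := volume)
    by_contra hc
    have h2 : s ∈ Function.support θ0 := hc
    rw [hθ0, this, Real.ball_eq_Ioo] at h2
    apply hs
    simp only [B] at h2
    constructor <;> linarith [h2.1, h2.2]
  set c := ∫ s in (1/4:ℝ)..(3/4), h s * θ0 s with hc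
  refine ⟨fun s ↦ c + Ψ s, fun s hs ↦ (hΨd s hs).const_add c, ?_⟩
  have hfin := isOpen_Ioo.ae_eq_zero_of_integral_contDiff_smul_eq_zero (μ := volume) (U := Set.Ioo (0:ℝ) 1) (f := fun s ↦ h s - c) (hhl.sub ((continuous_const).locallyIntegrable.locallyIntegrableOn _)) ?_
  · filter_upwards [hfin] with s hs hs'
    have := hs hs'
    simp only [hh] at this
    linarith
  intro ψ hψ hψc hψs
  set K := tsupport ψ ∪ Set.Icc (1/4:ℝ) (3/4) with hK
  have hKc : IsCompact K := IsCompact.union hψc isCompact_Icc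
  have hKn : K.Nonempty := ⟨1/2, Or.inr ⟨by norm_num, by norm_num⟩⟩
  have hKs : K ⊆ Set.Ioo 0 1 := Set.union_subset hψs (fun s hs ↦ ⟨by linarith [hs.1], by linarith [hs.2]⟩)
  obtain ⟨a0, ha0, hal⟩ := hKc.exists_isLeast hKn
  obtain ⟨b0, hb0, hbl⟩ := hKc.exists_isGreatest hKn
  have hA := hKs ha0
  have hB := hKs hb0
  have hab0 : a0 ≤ 1/2 := hal (Or.inr ⟨by norm_num, by norm_num⟩)
  have hab1 : 1/2 ≤ b0 := hbl (Or.inr ⟨by norm_num, by norm_num⟩)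
  have q0 : a0 ≤ 1/4 := hal (Or.inr ⟨by norm_num, by norm_num⟩)
  have q1 : 3/4 ≤ b0 := hbl (Or.inr ⟨by norm_num, by norm_num⟩)
  set a := a0 / 2 with ha
  set b := (1 + b0) / 2 with hb
  have a0' : 0 < a := by have := hA.1; positivity
  have b1' : b < 1 := by linarith [hB.2]
  have hab : a < b := by linarith [hA.1, hB.2]
  have pz0 : ∀ s, s ≤ a → ψ s = 0 := fun s hs ↦ by
    by_contra hc
    have := hal (Or.inl (subset_tsupport _ hc))
    linarith [hA.1]
  have pz1 : ∀ s, b ≤ s → ψ s = 0 := fun s hs ↦ by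
    by_contra hc
    have := hbl (Or.inl (subset_tsupport _ hc))
    linarith [hB.2]
  have tz0 : ∀ s, s ≤ a → θ0 s = 0 := fun s hs ↦ t0z s fun h ↦ by linarith [h.1, hA.1]
  have tz1 : ∀ s, b ≤ s → θ0 s = 0 := fun s hs ↦ t0z s fun h ↦ by linarith [h.2, hB.2]
  set I := ∫ s in a..b, ψ s with hI
  set r : ℝ → ℝ := fun s ↦ ψ s - I * θ0 s with hr
  have hψcont := hψ.continuous
  have htc := t0c.continuous
  have hrc : Continuous r := by fun_prop
  set θ : ℝ → ℝ := fun s ↦ ∫ t in a..s, r t with hθ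
  have hθd : ∀ s, HasDerivAt θ (r s) s := fun s ↦ intervalIntegral.integral_hasDerivAt_right (hrc.intervalIntegrable _ _) (hrc.stronglyMeasurableAtFilter _ _) hrc.continuousAt
  have hde : deriv θ = r := funext fun s ↦ (hθd s).deriv
  have hθ1 : ContDiff ℝ 1 θ := by
    rw [contDiff_one_iff_deriv, hde]; exact ⟨fun s ↦ (hθd s).differentiableAt, hrc⟩
  have i0 : ∫ s in a..b, θ0 s = 1 := by
    rw [← int_ab hab.le tz0 tz1]; exact B.integral_normed
  have ir : ∫ s in a..b, r s = 0 := by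
    simp only [hr]
    rw [intervalIntegral.integral_sub (hψcont.intervalIntegrable _ _) ((by fun_prop : Continuous fun s ↦ I * θ0 s).intervalIntegrable _ _), intervalIntegral.integral_const_mul, i0]; ring
  have e := h0 θ hθ1 a b a0' hab b1' (fun s hs ↦ ?_) (fun s hs ↦ ?_)
  · rw [int_ab hab.le (fun s hs ↦ by rw [pz0 s hs, zero_smul]) (fun s hs ↦ by rw [pz1 s hs, zero_smul])]
    rw [hde] at e
    have hhi := hii hhl a b a0' hab b1'
    have i1 : IntervalIntegrable (fun s ↦ h s * ψ s) volume a b := hhi.mul_continuousOn hψcont.continuousOn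
    have i2 : IntervalIntegrable (fun s ↦ h s * θ0 s) volume a b := hhi.mul_continuousOn htc.continuousOn
    have e1 : ∫ s in a..b, h s * r s = (∫ s in a..b, h s * ψ s) - I * ∫ s in a..b, h s * θ0 s := by
      rw [← intervalIntegral.integral_const_mul, ← intervalIntegral.integral_sub i1 (i2.const_mul I)]
      congr 1; ext s; simp only [hr]; ring
    have e2 : ∫ s in a..b, h s * θ0 s = c := by
      rw [hc, ← int_ab hab.le (fun s hs ↦ by rw [tz0 s hs, mul_zero]) (fun s hs ↦ by rw [tz1 s hs, mul_zero]),
        ← int_ab (by norm_num) (fun s hs ↦ by rw [t0z s (fun h ↦ by linarith [h.1]), mul_zero]) (fun s hs ↦ by rw [t0z s (fun h ↦ by linarith [h.2]), mul_zero])]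
    have e3 : ∫ s in a..b, ψ s • (h s - c) = (∫ s in a..b, h s * ψ s) - c * I := by
      rw [hI, ← intervalIntegral.integral_const_mul, ← intervalIntegral.integral_sub i1 ((by fun_prop : Continuous fun s ↦ c * ψ s).intervalIntegrable _ _)]
      congr 1; ext s; simp only [smul_eq_mul]; ring
    rw [e3]; rw [e1, e2] at e; linarith
  · have : ∫ t in a..s, r t = ∫ t in a..s, (0:ℝ) := by
      refine intervalIntegral.integral_congr fun t ht ↦ ?_
      rw [Set.uIcc_of_ge hs] at ht
      simp only [hr]; rw [pz0 t ht.2, tz0 t ht.2]; ring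
    simp only [hθ]; rw [this]; simp
  · have : ∫ t in b..s, r t = ∫ t in b..s, (0:ℝ) := by
      refine intervalIntegral.integral_congr fun t ht ↦ ?_
      rw [Set.uIcc_of_le hs] at ht
      simp only [hr]; rw [pz1 t ht.1, tz1 t ht.1]; ring
    simp only [hθ]
    rw [← intervalIntegral.integral_add_adjacent_intervals (hrc.intervalIntegrable a b) (hrc.intervalIntegrable b s), ir, this]; simp
end Heis
namespace Heis
theorem max_const {k : ℕ} {ε L : ℝ} {g G : ℝ → ℝ} (he : 0 < ε) (hg : Gd k ε L g G) {m : ℝ} (hm : 0 < m) {x : VV k} (h : Mx k G m x) :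
    ∃ c, 0 ≤ c ∧ ∀ᵐ z ∂bet k, wf x z = c := by
  obtain ⟨l, hl, hEL⟩ := hg.EL hm h.hx h.hm h.mx h.hp
  obtain ⟨ω, hωm, hω⟩ := radial hg h
  have hN := NN_pos k
  have hgm := hg.gc.measurable
  have hωm' := hωm.measurable
  have hmeas : ∀ {F : ℝ → ℝ}, Measurable F → AEStronglyMeasurable F (volume.restrict (Set.Ioo (0:ℝ) 1)) := fun hF ↦ hF.aestronglyMeasurable
  set F : ℝ → ℝ := fun s ↦ (1 - s) ^ k * ((NN k ^ 2 * ω s - l * g (ω s)) / 4) with hF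
  have hFm : Measurable F := by
    have : Measurable fun s ↦ g (ω s) := hgm.comp hωm'
    fun_prop
  have hwi : Integrable (wf x) (bet k) := (wf_mem x).integrable (by norm_num)
  have hgi : Integrable (fun z ↦ g (wf x z)) (bet k) := by
    refine Integrable.mono' (integrable_const L) ((hg.gc.comp_aestronglyMeasurable (wf_mem x).1)) (Eventually.of_forall fun z ↦ ?_)
    rw [Real.norm_eq_abs, abs_of_pos (hg.gpos _)]; exact hg.gL _
  have hω' : ∀ᵐ z ∂(volume.restrict DD), wf x z = ω (‖z‖ ^ 2) := by rw [← bet_ae k]; exact hω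
  have hFD : IntegrableOn (fun z : ℂ ↦ F (‖z‖ ^ 2)) DD := by
    have h1 := ((hwi.const_mul (NN k ^ 2)).sub (hgi.const_mul l)).div_const 4
    rw [bet_intble] at h1
    refine h1.congr ?_
    filter_upwards [hω'] with z hz
    simp only [hF, Pi.sub_apply, smul_eq_mul, hz]; rfl
  have hFi : IntervalIntegrable F volume 0 1 := (polar_intble (hmeas hFm)).1 hFD
  have hωD : IntegrableOn (fun z : ℂ ↦ (fun s ↦ (1 - s) ^ k * ω s) (‖z‖ ^ 2)) DD := by
    have h1 := hwi
    rw [bet_intble] at h1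
    refine h1.congr ?_
    filter_upwards [hω'] with z hz
    simp only [smul_eq_mul, hz]; rfl
  have hωi : IntervalIntegrable (fun s ↦ (1 - s) ^ k * ω s) volume 0 1 := (polar_intble (hmeas (by fun_prop))).1 hωD
  have hωl : LocallyIntegrableOn ω (Set.Ioo 0 1) := by
    have h1 := (intervalIntegrable_iff_integrableOn_Ioo_of_le zero_le_one).1 hωi
    have h2 := h1.locallyIntegrableOn.continuousOn_mul (g := fun s ↦ ((1 - s) ^ k)⁻¹) (by
      refine ContinuousOn.inv₀ (by fun_prop) fun s hs ↦ ?_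
      have : 0 < 1 - s := by linarith [hs.2]
      positivity) isOpen_Ioo.isLocallyClosed
    rw [locallyIntegrableOn_iff isOpen_Ioo.isLocallyClosed] at h2 ⊢
    intro K hK hKc
    refine (h2 K hK hKc).congr ?_
    filter_upwards [ae_restrict_mem hKc.measurableSet] with s hs
    have : 0 < 1 - s := by linarith [(hK hs).2]
    field_simp
  set A : ℝ → ℝ := fun s ↦ ∫ t in (0:ℝ)..s, F t with hA
  have hAc : ContinuousOn A (Set.Icc 0 1) := by
    have := intervalIntegral.continuousOn_primitive_interval (a := 0) (b := 1) (f := F) (μ := volume) (by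
      rw [Set.uIcc_of_le zero_le_one]; exact (intervalIntegrable_iff_integrableOn_Icc_of_le zero_le_one).1 hFi)
    rwa [Set.uIcc_of_le zero_le_one] at this
  have hpol : ∫ z in DD, F (‖z‖ ^ 2) = Real.pi * A 1 := polar_int (hmeas hFm)
  have hA1 : A 1 = 0 := by
    obtain ⟨o, ho, ho1, ho2⟩ := one_HH k
    have e := hEL o ho
    rw [inner_VV] at e
    have e1 : ∫ z, wf x z * wf o z ∂bet k = ∫ z, wf x z ∂bet k := integral_congr_ae (by filter_upwards [ho1] with z hz; rw [hz, mul_one])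
    have e2 : ∫ z, inner ℝ (gf x z) (gf o z) ∂bet k = ∫ z, (0:ℝ) ∂bet k := integral_congr_ae (by filter_upwards [ho2] with z hz; rw [hz]; simp)
    have e3 : ∫ z, g (wf x z) * wf o z ∂bet k = ∫ z, g (wf x z) ∂bet k := integral_congr_ae (by filter_upwards [ho1] with z hz; rw [hz, mul_one])
    rw [e1, e2, e3] at e
    have e4 : ∫ z, (NN k ^ 2 * wf x z - l * g (wf x z)) / 4 ∂bet k = 0 := by
      rw [integral_div, integral_sub (hwi.const_mul _) (hgi.const_mul _), integral_const_mul, integral_const_mul]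
      simp at e; rw [e]; simp
    rw [bet_int] at e4
    have e5 : ∫ z in DD, F (‖z‖ ^ 2) = 0 := by
      rw [← e4]
      refine integral_congr_ae ?_
      filter_upwards [hω'] with z hz
      simp only [hF, smul_eq_mul, hz]; rfl
    rw [hpol] at e5
    rcases mul_eq_zero.1 e5 with h | h
    · exact absurd h Real.pi_ne_zero
    · exact h
  have hP : ∀ s ∈ Set.Ioo (0:ℝ) 1, s * (1 - s) ^ (k + 1) ≠ 0 := fun s hs ↦ by
    have h1 : 0 < 1 - s := by linarith [hs.2]
    have h2 := hs.1
    positivity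
  set v : ℝ → ℝ := fun s ↦ A s / (s * (1 - s) ^ (k + 1)) with hv
  have hvc : ContinuousOn v (Set.Ioo 0 1) := (hAc.mono Set.Ioo_subset_Icc_self).div (by fun_prop) hP
  have hw : ∀ θ : ℝ → ℝ, ContDiff ℝ 1 θ → ∀ a b, 0 < a → a < b → b < 1 → (∀ s, s ≤ a → θ s = 0) → (∀ s, b ≤ s → θ s = 0) →
      ∫ s in a..b, ω s * deriv θ s = - ∫ s in a..b, v s * θ s := fun θ hθ a b ha hab hb z0 z1 ↦ by
    have hθ' := hθ.continuous_deriv le_rfl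
    set q : ℝ → ℝ := fun s ↦ θ s / s with hq
    have hq0 : ∀ s, s ≤ a → q s = 0 := fun s hs ↦ by simp only [hq]; rw [z0 s hs, zero_div]
    have hq1 : ∀ s, b ≤ s → q s = 0 := fun s hs ↦ by simp only [hq]; rw [z1 s hs, zero_div]
    have hqc : ContDiff ℝ 1 q := contDiff_iff_contDiffAt.2 fun s ↦ by
      rcases lt_or_ge s a with h1 | h1
      · exact contDiffAt_const (c := (0:ℝ)) |>.congr_of_eventuallyEq (by filter_upwards [gt_mem_nhds h1] with u hu using hq0 u hu.le)
      · exact hθ.contDiffAt.div contDiffAt_id (by linarith : s ≠ 0) 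
    set r : ℝ → ℝ := fun s ↦ q s / (1 - s) ^ (k + 1) with hr
    have hr0 : ∀ s, s ≤ a → r s = 0 := fun s hs ↦ by simp only [hr]; rw [hq0 s hs, zero_div]
    have hr1 : ∀ s, b ≤ s → r s = 0 := fun s hs ↦ by simp only [hr]; rw [hq1 s hs, zero_div]
    have hrc : Continuous r := continuous_iff_continuousAt.2 fun s ↦ by
      rcases lt_or_ge b s with h1 | h1
      · exact continuousAt_const (y := (0:ℝ)) |>.congr (by filter_upwards [lt_mem_nhds h1] with u hu using (hr1 u hu.le).symm)
      · exact hqc.continuous.continuousAt.div (by fun_prop) (pow_ne_zero _ (by linarith))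
    set η : ℝ → ℝ := fun s ↦ ∫ t in b..s, r t with hη
    have hηd : ∀ s, HasDerivAt η (r s) s := fun s ↦ intervalIntegral.integral_hasDerivAt_right (hrc.intervalIntegrable _ _) (hrc.stronglyMeasurableAtFilter _ _) hrc.continuousAt
    have hde : deriv η = r := funext fun s ↦ (hηd s).deriv
    have hη1 : ContDiff ℝ 1 η := by
      rw [contDiff_one_iff_deriv, hde]; exact ⟨fun s ↦ (hηd s).differentiableAt, hrc⟩
    have hηz : ∀ s, b ≤ s → η s = 0 := fun s hs ↦ by
      have : ∫ t in b..s, r t = ∫ t in b..s, (0:ℝ) := by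
        refine intervalIntegral.integral_congr fun t ht ↦ ?_
        rw [Set.uIcc_of_le hs] at ht
        exact hr1 t ht.1
      simp only [hη]; rw [this]; simp
    have hθq : ∀ s, θ s = s * q s := fun s ↦ by
      simp only [hq]
      rcases eq_or_ne s 0 with h0 | h0
      · rw [z0 s (by linarith)]; simp
      · field_simp
    have hcr := core_rad hη1 hb hηz
    have e := hEL _ (emb_HH (k := k) hcr)
    rw [rad_HH hqc hη1 (fun s _ ↦ hηd s) hb (by linarith) hηz hq1 hθq h.hx] at e
    have e1 : ∫ z, g (wf x z) * wf (emb k _ hcr) z ∂bet k = ∫ z, g (wf x z) * η (‖z‖ ^ 2) ∂bet k := integral_congr_ae (by filter_upwards [emb_w k hcr] with z hz; rw [hz])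
    rw [e1] at e
    obtain ⟨C, hC⟩ := hcr.cpt.exists_bound_of_continuous hcr.cont
    have i1 : Integrable (fun z ↦ wf x z * η (‖z‖ ^ 2)) (bet k) := by
      have := hwi.bdd_mul (f := fun z : ℂ ↦ η (‖z‖ ^ 2)) hcr.cont.aestronglyMeasurable (Eventually.of_forall hC)
      simpa only [mul_comm] using this
    have i2 : Integrable (fun z ↦ g (wf x z) * η (‖z‖ ^ 2)) (bet k) := by
      have := hgi.bdd_mul (f := fun z : ℂ ↦ η (‖z‖ ^ 2)) hcr.cont.aestronglyMeasurable (Eventually.of_forall hC)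
      simpa only [mul_comm] using this
    have e2 : ∫ z, ((NN k ^ 2 * wf x z - l * g (wf x z)) / 4) * η (‖z‖ ^ 2) ∂bet k = (∫ z, wf x z * (4 * deriv θ (‖z‖ ^ 2) / fD z ^ k) ∂bet k) / 4 := by
      have : (fun z ↦ ((NN k ^ 2 * wf x z - l * g (wf x z)) / 4) * η (‖z‖ ^ 2)) = fun z ↦ (NN k ^ 2 * (wf x z * η (‖z‖ ^ 2)) - l * (g (wf x z) * η (‖z‖ ^ 2))) / 4 := by
        ext z; ring
      rw [this, integral_div, integral_sub (i1.const_mul _) (i2.const_mul _), integral_const_mul, integral_const_mul]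
      congr 1
      linarith
    rw [bet_int, bet_int] at e2
    have e3 : ∫ z in DD, fD z ^ k • (((NN k ^ 2 * wf x z - l * g (wf x z)) / 4) * η (‖z‖ ^ 2)) = ∫ z in DD, (fun s ↦ F s * η s) (‖z‖ ^ 2) := by
      refine integral_congr_ae ?_
      filter_upwards [hω'] with z hz
      simp only [hF, smul_eq_mul, hz, fD]; ring
    have e4 : ∫ z in DD, fD z ^ k • (wf x z * (4 * deriv θ (‖z‖ ^ 2) / fD z ^ k)) = ∫ z in DD, (fun s ↦ 4 * (ω s * deriv θ s)) (‖z‖ ^ 2) := by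
      refine integral_congr_ae ?_
      filter_upwards [hω', ae_restrict_mem Metric.isOpen_ball.measurableSet] with z hz hz'
      have := fD_pos hz'
      simp only [smul_eq_mul, hz]; field_simp
    have hηc := hη1.continuous
    rw [e3, e4, polar_int (F := fun s ↦ F s * η s) (hmeas (by fun_prop)), polar_int (F := fun s ↦ 4 * (ω s * deriv θ s)) (hmeas (by fun_prop)), intervalIntegral.integral_const_mul] at e2
    have hpi := Real.pi_pos
    have e5 : ∫ s in (0:ℝ)..1, ω s * deriv θ s = ∫ s in (0:ℝ)..1, F s * η s := by
      have : Real.pi * (∫ s in (0:ℝ)..1, F s * η s) = Real.pi * ∫ s in (0:ℝ)..1, ω s * deriv θ s := by linarith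
      exact (mul_left_cancel₀ hpi.ne' this).symm
    rw [ibpA hFi hη1 (hηz 1 hb.le), hde] at e5
    have dz0 : ∀ s, s ≤ a → deriv θ s = 0 := fun s hs ↦ by
      have h1 : deriv θ s = q s + s * deriv q s := by
        have : θ = fun s ↦ s * q s := funext hθq
        rw [this]
        exact (((hasDerivAt_id s).mul (hqc.differentiable (by simp) s).hasDerivAt).congr_deriv (by simp)).deriv
      have hcl : IsClosed {s | deriv θ s = 0} := isClosed_eq hθ' continuous_const
      have hsub : Set.Iio a ⊆ {s | deriv θ s = 0} := fun u hu ↦ by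
        have : θ =ᶠ[𝓝 u] fun _ ↦ 0 := by filter_upwards [gt_mem_nhds hu] with y hy using z0 y hy.le
        simp [this.deriv_eq]
      have := closure_minimal hsub hcl
      rw [closure_Iio] at this
      exact this hs
    have dz1 : ∀ s, b ≤ s → deriv θ s = 0 := fun s hs ↦ by
      have hcl : IsClosed {s | deriv θ s = 0} := isClosed_eq hθ' continuous_const
      have hsub : Set.Ioi b ⊆ {s | deriv θ s = 0} := fun u hu ↦ by
        have : θ =ᶠ[𝓝 u] fun _ ↦ 0 := by filter_upwards [lt_mem_nhds hu] with y hy using z1 y hy.le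
        simp [this.deriv_eq]
      have := closure_minimal hsub hcl
      rw [closure_Ioi] at this
      exact this hs
    rw [int_01 ha.le hb.le hab.le (fun s hs ↦ by rw [dz0 s hs, mul_zero]) (fun s hs ↦ by rw [dz1 s hs, mul_zero]),
      int_01 ha.le hb.le hab.le (fun s hs ↦ by rw [hr0 s hs, mul_zero]) (fun s hs ↦ by rw [hr1 s hs, mul_zero])] at e5
    rw [e5]; congr 1
    refine intervalIntegral.integral_congr fun s hs ↦ ?_
    rw [Set.uIcc_of_le hab.le] at hs
    have h1 : 0 < 1 - s := by linarith [hs.2]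
    have h2 : 0 < s := by linarith [hs.1]
    simp only [hv, hr, hq, hA]
    field_simp
  obtain ⟨ω₁, hω₁, hωω⟩ := dbr hωl hvc hw
  have hω₁c : ContinuousOn ω₁ (Set.Ioo 0 1) := fun s hs ↦ (hω₁ s hs).continuousAt.continuousWithinAt
  have hω0 : ∀ s ∈ Set.Ioo (0:ℝ) 1, 0 ≤ ω₁ s := by
    have h1 : ∀ᵐ z ∂(volume.restrict DD), 0 ≤ ω (‖z‖ ^ 2) := by
      have := h.hp
      rw [bet_ae] at this
      filter_upwards [hω', this] with z h1 h2; rwa [← h1]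
    have h2 := (polar_ae (p := fun s ↦ 0 ≤ ω s) (measurableSet_le measurable_const hωm')).1 h1
    rw [ae_restrict_iff' measurableSet_Ioo] at h2
    intro s hs
    by_contra hc
    push Not at hc
    have h3 : ∀ᶠ u in 𝓝 s, ω₁ u < 0 ∧ u ∈ Set.Ioo (0:ℝ) 1 := ((hω₁ s hs).continuousAt.eventually_lt continuousAt_const hc).and (isOpen_Ioo.mem_nhds hs)
    have h4 : volume {u | ω₁ u < 0 ∧ u ∈ Set.Ioo (0:ℝ) 1} = 0 := by
      refine measure_mono_null (t := {u | ¬ ((u ∈ Set.Ioo (0:ℝ) 1 → ω u = ω₁ u) ∧ (u ∈ Set.Ioo (0:ℝ) 1 → 0 ≤ ω u))}) (fun u hu hu' ↦ ?_) (hωω.and h2)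
      have := hu'.1 hu.2
      have := hu'.2 hu.2
      linarith [hu.1]
    exact (Measure.measure_pos_of_mem_nhds volume h3).ne' h4
  have hgω : ContinuousOn (fun s ↦ (1 - s) ^ k * ((NN k ^ 2 * ω₁ s - l * g (ω₁ s)) / 4)) (Set.Ioo 0 1) := by
    have := hg.gc.comp_continuousOn hω₁c
    have h2 : ContinuousOn (fun s ↦ g (ω₁ s)) (Set.Ioo 0 1) := this
    exact ContinuousOn.mul (by fun_prop) (((continuousOn_const.mul hω₁c).sub (continuousOn_const.mul h2)).div_const 4)
  have hHd : ∀ s ∈ Set.Ioo (0:ℝ) 1, HasDerivAt A ((1 - s) ^ k * ((NN k ^ 2 * ω₁ s - l * g (ω₁ s)) / 4)) s := fun s hs ↦ by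
    set F1 : ℝ → ℝ := fun s ↦ (1 - s) ^ k * ((NN k ^ 2 * ω₁ s - l * g (ω₁ s)) / 4) with hF1
    have hFF : ∀ᵐ s, s ∈ Set.Ioo (0:ℝ) 1 → F s = F1 s := by
      filter_upwards [hωω] with u hu hu'
      simp only [hF, hF1, hu hu']
    have hEE : ∀ u ∈ Set.Ioo (0:ℝ) 1, A u = ∫ t in (0:ℝ)..u, F1 t := fun u hu ↦ by
      simp only [hA]
      refine intervalIntegral.integral_congr_ae ?_
      filter_upwards [hFF] with y hy hy'
      rw [Set.uIoc_of_le hu.1.le] at hy'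
      exact hy ⟨hy'.1, hy'.2.trans_lt hu.2⟩
    have hI : IntervalIntegrable F1 volume 0 s := by
      have : IntervalIntegrable F volume 0 s := hFi.mono_set (by
        rw [Set.uIcc_of_le hs.1.le, Set.uIcc_of_le zero_le_one]; exact Set.Icc_subset_Icc le_rfl hs.2.le)
      refine this.congr_ae ?_
      rw [Set.uIoc_of_le hs.1.le]
      filter_upwards [ae_restrict_of_ae hFF, ae_restrict_mem measurableSet_Ioc] with y hy hy'
      exact hy ⟨hy'.1, hy'.2.trans_lt hs.2⟩
    have := intervalIntegral.integral_hasDerivAt_right hI (ContinuousOn.stronglyMeasurableAtFilter isOpen_Ioo hgω s hs) (hgω.continuousAt (isOpen_Ioo.mem_nhds hs))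
    exact this.congr_of_eventuallyEq (by filter_upwards [isOpen_Ioo.mem_nhds hs] with u hu using hEE u hu)
  have hT0 : Tendsto A (𝓝[>] 0) (𝓝 0) := by
    have h1 : Tendsto A (𝓝[Set.Icc 0 1] 0) (𝓝 (A 0)) := hAc 0 (by simp)
    have h2 : A 0 = 0 := by simp [hA]
    rw [h2] at h1
    rw [← nhdsWithin_Ioo_eq_nhdsGT (show (0:ℝ) < 1 by norm_num)]
    exact h1.mono_left (nhdsWithin_mono _ Set.Ioo_subset_Icc_self)
  have hT1 : Tendsto A (𝓝[<] 1) (𝓝 0) := by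
    have h1 : Tendsto A (𝓝[Set.Icc 0 1] 1) (𝓝 (A 1)) := hAc 1 (by simp)
    rw [hA1] at h1
    rw [← nhdsWithin_Ioo_eq_nhdsLT (show (0:ℝ) < 1 by norm_num)]
    exact h1.mono_left (nhdsWithin_mono _ Set.Ioo_subset_Icc_self)
  have hfin := ode_const he hg hl hω0 hω₁ hHd hT0 hT1
  refine ⟨ω₁ (1/2), hω0 _ ⟨by norm_num, by norm_num⟩, ?_⟩
  have h3 : ∀ᵐ s ∂(volume.restrict (Set.Ioo (0:ℝ) 1)), ω s = ω₁ (1/2) := by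
    rw [ae_restrict_iff' measurableSet_Ioo]
    filter_upwards [hωω] with s hs hs'
    rw [hs hs', hfin s hs']
  have h4 := (polar_ae (p := fun s ↦ ω s = ω₁ (1/2)) (hωm' (measurableSet_singleton _))).2 h3
  rw [bet_ae]
  filter_upwards [hω', h4] with z h1 h2; rw [h1, h2]
end Heis
namespace Heis
def BB (k : ℕ) : ℝ := (bet k).real Set.univ
def Mc (k : ℕ) : ℝ := BB k * (1 / (NN k ^ 2 * BB k)) ^ (pp k / 2)
theorem BB_pos (k : ℕ) : 0 < BB k := by
  refine ENNReal.toReal_pos (fun h ↦ ?_) (measure_ne_top _ _)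
  have h1 : ae (bet k) = ⊥ := by rw [ae_eq_bot]; exact Measure.measure_univ_eq_zero.1 h
  rw [bet_ae, ae_eq_bot, Measure.restrict_eq_zero] at h1
  exact (Metric.measure_ball_pos volume (0:ℂ) one_pos).ne' h1
theorem pp_gt (k : ℕ) : 2 < pp k := by have := qq_gt k; rw [pp_qq]; linarith
theorem Mc_pos (k : ℕ) : 0 < Mc k := mul_pos (BB_pos k) (Real.rpow_pos_of_pos (by have := BB_pos k; have := NN_pos k; positivity) _)
theorem GG_lim (k : ℕ) {y : ℝ} (hy : 0 ≤ y) : Tendsto (fun j : ℕ ↦ GG k (1 / ((j:ℝ) + 1)) y) atTop (𝓝 (y ^ pp k / pp k)) := by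
  have h0 := tendsto_one_div_add_atTop_nhds_zero_nat (𝕜 := ℝ)
  have hp : 0 < pp k := by linarith [pp_gt k]
  have h1 : Tendsto (fun j : ℕ ↦ XX k (1 / ((j:ℝ) + 1)) y) atTop (𝓝 ((0 + y) ^ pp k)) :=
    (h0.add_const y).rpow_const (Or.inr hp.le)
  have h2 := (h1.div (tendsto_const_nhds (x := (1:ℝ)) |>.add (h0.mul h1)) (by simp)).div_const (pp k)
  simp only [zero_add, zero_mul, add_zero, div_one] at h2
  exact h2
theorem wsq_le {k : ℕ} (x : VV k) : NN k ^ 2 * ∫ z, wf x z ^ 2 ∂bet k ≤ ‖x‖ ^ 2 := by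
  rw [← real_inner_self_eq_norm_sq, inner_VV]
  have : 0 ≤ ∫ z, inner ℝ (gf x z) (gf x z) ∂bet k := integral_nonneg fun z ↦ real_inner_self_nonneg
  have e : ∫ z, wf x z * wf x z ∂bet k = ∫ z, wf x z ^ 2 ∂bet k := by congr 1; ext z; ring
  rw [e]; linarith
theorem sharp_m {k : ℕ} {x : VV k} (hx : x ∈ HH k) {m : ℝ} (hm : 0 < m) (hxm : ‖x‖ ^ 2 ≤ m) :
    ∫⁻ z, ENNReal.ofReal (|wf x z| ^ pp k) ∂bet k ≤ ENNReal.ofReal (Mc k * m ^ (pp k / 2)) := by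
  have hN := NN_pos k
  have hB := BB_pos k
  have hp : 0 < pp k := by linarith [pp_gt k]
  obtain ⟨y, hy, hyw, hyn⟩ := HH_abs hx
  set C := √(m / (NN k ^ 2 * BB k)) with hC
  have key : ∀ j : ℕ, ∫⁻ z, ENNReal.ofReal (GG k (1 / ((j:ℝ) + 1)) |wf x z| - GG k (1 / ((j:ℝ) + 1)) 0) ∂bet k ≤ ENNReal.ofReal (BB k * (GG k (1 / ((j:ℝ) + 1)) C - GG k (1 / ((j:ℝ) + 1)) 0)) := fun j ↦ by
    have he : 0 < 1 / ((j:ℝ) + 1) := by positivity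
    obtain ⟨g, G, hg, hG⟩ := Gd_exists k he
    obtain ⟨u, hu, hum, hup, humx⟩ := hg.max hm
    have hM : Mx k G m u := ⟨hu, hum, hup, humx⟩
    obtain ⟨c, hc, huc⟩ := max_const he hg hm hM
    have hcC : c ≤ C := by
      have h1 := (wsq_le u).trans hum
      have h2 : ∫ z, wf u z ^ 2 ∂bet k = BB k * c ^ 2 := by
        rw [integral_congr_ae (g := fun _ ↦ c ^ 2) (by filter_upwards [huc] with z hz; rw [hz])]
        simp [BB]
      rw [h2] at h1
      apply Real.le_sqrt_of_sq_le
      rw [le_div_iff₀ (by positivity)]; linarith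
    have h1 := humx y hy (hyn.trans hxm)
    have h2 : ∫ z, G (wf u z) ∂bet k = BB k * G c := by
      rw [integral_congr_ae (g := fun _ ↦ G c) (by filter_upwards [huc] with z hz; rw [hz])]
      simp [BB]
    have h3 : G c ≤ G C := hg.mono.monotone hcC
    have hC0 : 0 ≤ C := Real.sqrt_nonneg _
    have h4 : ∫ z, G (wf y z) ∂bet k = ∫ z, (GG k (1 / ((j:ℝ) + 1)) |wf x z| - GG k (1 / ((j:ℝ) + 1)) 0) ∂bet k := by
      refine integral_congr_ae ?_
      filter_upwards [hyw] with z hz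
      rw [hz, hG _ (abs_nonneg _)]
    have h5 : Integrable (fun z ↦ GG k (1 / ((j:ℝ) + 1)) |wf x z| - GG k (1 / ((j:ℝ) + 1)) 0) (bet k) := by
      refine (hg.int y).congr ?_
      filter_upwards [hyw] with z hz
      rw [hz, hG _ (abs_nonneg _)]
    rw [← ofReal_integral_eq_lintegral_ofReal h5 (Eventually.of_forall fun z ↦ ?_), ← h4]
    · refine ENNReal.ofReal_le_ofReal (h1.trans ?_)
      rw [h2, ← hG C hC0]; gcongr
    · change (0:ℝ) ≤ GG k (1 / ((j:ℝ) + 1)) |wf x z| - GG k (1 / ((j:ℝ) + 1)) 0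
      rw [← hG _ (abs_nonneg _)]
      have := hg.mono.monotone (abs_nonneg (wf x z))
      rwa [hg.G0] at this
  have hlim : Tendsto (fun j : ℕ ↦ ENNReal.ofReal (BB k * (GG k (1 / ((j:ℝ) + 1)) C - GG k (1 / ((j:ℝ) + 1)) 0))) atTop (𝓝 (ENNReal.ofReal (BB k * (C ^ pp k / pp k - 0 ^ pp k / pp k)))) :=
    (ENNReal.continuous_ofReal.tendsto _).comp (((GG_lim k (Real.sqrt_nonneg _)).sub (GG_lim k le_rfl)).const_mul _)
  have hpt : ∀ z, Tendsto (fun j : ℕ ↦ ENNReal.ofReal (GG k (1 / ((j:ℝ) + 1)) |wf x z| - GG k (1 / ((j:ℝ) + 1)) 0)) atTop (𝓝 (ENNReal.ofReal (|wf x z| ^ pp k / pp k - 0 ^ pp k / pp k))) := fun z ↦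
    (ENNReal.continuous_ofReal.tendsto _).comp ((GG_lim k (abs_nonneg _)).sub (GG_lim k le_rfl))
  have hf := lintegral_liminf_le' (u := atTop (α := ℕ)) (μ := bet k) (f := fun (j : ℕ) z ↦ ENNReal.ofReal (GG k (1 / ((j:ℝ) + 1)) |wf x z| - GG k (1 / ((j:ℝ) + 1)) 0)) (fun j ↦ by
    have := (wf_mem x).1.aemeasurable
    refine AEMeasurable.ennreal_ofReal ?_
    refine AEMeasurable.sub ?_ aemeasurable_const
    have h2 : AEMeasurable (fun z ↦ ((1 / ((j:ℝ) + 1)) + |wf x z|) ^ pp k) (bet k) := by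
      have : AEMeasurable (fun z ↦ |wf x z|) (bet k) := this.norm
      exact (this.const_add _).pow_const _
    exact ((h2.div ((h2.const_mul _).const_add 1)).div_const _))
  simp only [fun z ↦ (hpt z).liminf_eq] at hf
  have hf2 := hf.trans ((liminf_le_liminf (Eventually.of_forall key)).trans_eq hlim.liminf_eq)
  have e0 : (0:ℝ) ^ pp k = 0 := Real.zero_rpow hp.ne'
  simp only [e0, zero_div, sub_zero] at hf2
  have e1 : ∀ z, ENNReal.ofReal (|wf x z| ^ pp k) = ENNReal.ofReal (pp k) * ENNReal.ofReal (|wf x z| ^ pp k / pp k) := fun z ↦ by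
    rw [← ENNReal.ofReal_mul hp.le]; congr 1; field_simp
  simp only [e1]
  rw [lintegral_const_mul' _ _ ENNReal.ofReal_ne_top]
  refine (mul_le_mul_right hf2 _).trans_eq ?_
  rw [← ENNReal.ofReal_mul hp.le]; congr 1
  have e2 : C ^ pp k = (m * (1 / (NN k ^ 2 * BB k))) ^ (pp k / 2) := by
    rw [hC, Real.sqrt_eq_rpow, ← Real.rpow_mul (by positivity)]
    congr 1
    · ring
    · ring
  rw [e2, Real.mul_rpow hm.le (by positivity), Mc]; field_simp
theorem sharp_l {k : ℕ} {x : VV k} (hx : x ∈ HH k) :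
    ∫⁻ z, ENNReal.ofReal (|wf x z| ^ pp k) ∂bet k ≤ ENNReal.ofReal (Mc k * (‖x‖ ^ 2) ^ (pp k / 2)) := by
  have hp : 0 < pp k := by linarith [pp_gt k]
  have h0 := tendsto_one_div_add_atTop_nhds_zero_nat (𝕜 := ℝ)
  have h1 : Tendsto (fun j : ℕ ↦ ENNReal.ofReal (Mc k * (‖x‖ ^ 2 + 1 / ((j:ℝ) + 1)) ^ (pp k / 2))) atTop (𝓝 (ENNReal.ofReal (Mc k * (‖x‖ ^ 2 + 0) ^ (pp k / 2)))) :=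
    (ENNReal.continuous_ofReal.tendsto _).comp (((h0.const_add _).rpow_const (Or.inr (by positivity))).const_mul _)
  rw [add_zero] at h1
  exact ge_of_tendsto' h1 fun j ↦ sharp_m hx (by positivity) (by have : 0 ≤ 1 / ((j:ℝ) + 1) := (by positivity); linarith)
theorem wp_meas {k : ℕ} (x : VV k) : AEStronglyMeasurable (fun z ↦ |wf x z| ^ pp k) (bet k) := by
  have := (wf_mem x).1.aemeasurable
  have : AEMeasurable (fun z ↦ |wf x z|) (bet k) := this.norm
  exact (this.pow_const _).aestronglyMeasurable
theorem wp_int {k : ℕ} {x : VV k} (hx : x ∈ HH k) : Integrable (fun z ↦ |wf x z| ^ pp k) (bet k) := by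
  refine ⟨wp_meas x, ?_⟩
  rw [hasFiniteIntegral_iff_ofReal (Eventually.of_forall fun z ↦ Real.rpow_nonneg (abs_nonneg _) _)]
  exact (sharp_l hx).trans_lt ENNReal.ofReal_lt_top
theorem sharp {k : ℕ} {x : VV k} (hx : x ∈ HH k) :
    ∫ z, |wf x z| ^ pp k ∂bet k ≤ Mc k * (‖x‖ ^ 2) ^ (pp k / 2) := by
  have h := sharp_l hx
  rw [← ofReal_integral_eq_lintegral_ofReal (wp_int hx) (Eventually.of_forall fun z ↦ Real.rpow_nonneg (abs_nonneg _) _)] at h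
  exact (ENNReal.ofReal_le_ofReal_iff (mul_nonneg (Mc_pos k).le (Real.rpow_nonneg (by positivity) _))).1 h
end Heis
namespace Heis
theorem ladyz : ∃ C : ℝ, 0 ≤ C ∧ ∀ u : ℂ → ℝ, Core u → ∫ z, u z ^ 4 ≤ C * ((∫ z, u z ^ 2) * ∫ z, ‖gr u z‖ ^ 2) := by
  set c : ℝ := ((eLpNormLESNormFDerivOneConst (volume : Measure ℂ) ((2:NNReal):ℝ) : NNReal) : ℝ)
  refine ⟨c ^ 2 * 4, by positivity, fun u hu ↦ ?_⟩
  have hc : 0 ≤ c := NNReal.coe_nonneg _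
  have h1 := eLpNorm_le_eLpNorm_fderiv_one (volume : Measure ℂ) (u := fun z ↦ u z ^ 2) (hu.cd.pow 2)
    (hu.cpt.comp_left (g := fun x : ℝ ↦ x ^ 2) (by norm_num)) (p := 2) (by
      rw [Complex.finrank_real_complex]
      exact NNReal.HolderConjugate.two_two)
  have hI4 : Integrable (fun z ↦ u z ^ 4) := by
    refine int_cs (hu.cont.pow 4) ?_
    exact hu.cpt.comp_left (g := fun x : ℝ ↦ x ^ 4) (by norm_num)
  have hI1 : Integrable (fun z ↦ |u z| * ‖gr u z‖) := by
    refine int_cs (hu.cont.abs.mul hu.grc.norm) ?_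
    exact hu.grs.norm.mul_left
  have e1 : eLpNorm (fun z ↦ u z ^ 2) ((2:NNReal):ENNReal) volume = ENNReal.ofReal (√(∫ z, u z ^ 4)) := by
    rw [show ((2:NNReal):ENNReal) = 2 from rfl, eLpNorm_eq_lintegral_rpow_enorm_toReal two_ne_zero ENNReal.ofNat_ne_top]
    rw [Real.sqrt_eq_rpow, ← ENNReal.ofReal_rpow_of_nonneg (integral_nonneg fun z ↦ by positivity) (by norm_num), ofReal_integral_eq_lintegral_ofReal hI4 (Eventually.of_forall fun z ↦ by positivity)]
    simp only [ENNReal.toReal_ofNat, ENNReal.rpow_ofNat]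
    congr 1
    refine lintegral_congr fun z ↦ ?_
    rw [Real.enorm_eq_ofReal (by positivity), ← ENNReal.ofReal_pow (by positivity)]; congr 1; ring
  have e2 : eLpNorm (fderiv ℝ (fun z ↦ u z ^ 2)) 1 volume ≤ ENNReal.ofReal (2 * ∫ z, |u z| * ‖gr u z‖) := by
    rw [eLpNorm_one_eq_lintegral_enorm, ← integral_const_mul, ofReal_integral_eq_lintegral_ofReal (hI1.const_mul 2) (Eventually.of_forall fun z ↦ by positivity)]
    refine lintegral_mono fun z ↦ ?_
    rw [← ofReal_norm_eq_enorm]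
    refine ENNReal.ofReal_le_ofReal ((norm_fderiv_le_gr _ z).trans ?_)
    rw [gr_comp (g := fun x : ℝ ↦ x ^ 2) (g' := 2 * u z) (by simpa using hasDerivAt_pow 2 (u z)) (hu.diff z)]
    simp [mul_assoc]
  rw [e1] at h1
  have h2 := h1.trans (mul_le_mul_right e2 _)
  rw [← ENNReal.ofReal_coe_nnreal, ← ENNReal.ofReal_mul (NNReal.coe_nonneg _), ENNReal.ofReal_le_ofReal_iff (mul_nonneg hc (by positivity))] at h2
  change _ ≤ c * _ at h2
  have h3 : (∫ z, |u z| * ‖gr u z‖) ^ 2 ≤ (∫ z, u z ^ 2) * ∫ z, ‖gr u z‖ ^ 2 := by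
    have h := integral_mul_le_Lp_mul_Lq_of_nonneg (μ := volume) Real.HolderConjugate.two_two (f := fun z ↦ |u z|) (g := fun z ↦ ‖gr u z‖) (Eventually.of_forall fun z ↦ abs_nonneg _) (Eventually.of_forall fun z ↦ norm_nonneg _)
      (hu.cont.abs.memLp_of_hasCompactSupport hu.cpt.norm) (hu.grc.norm.memLp_of_hasCompactSupport hu.grs.norm)
    simp only [Real.rpow_two, sq_abs, ← Real.sqrt_eq_rpow] at h
    have h0 : 0 ≤ ∫ z, |u z| * ‖gr u z‖ := integral_nonneg fun z ↦ by positivity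
    calc _ ≤ (√(∫ z, u z ^ 2) * √(∫ z, ‖gr u z‖ ^ 2)) ^ 2 := by gcongr
      _ = _ := by rw [mul_pow, Real.sq_sqrt (integral_nonneg fun z ↦ by positivity), Real.sq_sqrt (integral_nonneg fun z ↦ by positivity)]
  have h5 : 0 ≤ ∫ z, |u z| * ‖gr u z‖ := integral_nonneg fun z ↦ by positivity
  have h4 := Real.sqrt_le_iff.1 h2
  calc _ ≤ (c * (2 * ∫ z, |u z| * ‖gr u z‖)) ^ 2 := h4.2
    _ = c ^ 2 * 4 * (∫ z, |u z| * ‖gr u z‖) ^ 2 := by ring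
    _ ≤ _ := by gcongr
theorem pp_le (k : ℕ) : pp k ≤ 4 := by
  unfold pp NN
  have : 2 / ((k:ℝ) + 1) ≤ 2 := div_le_self (by norm_num) (by linarith [Nat.cast_nonneg (α := ℝ) k])
  linarith
theorem pow_pp (k : ℕ) (a : ℝ) : |a| ^ pp k ≤ a ^ 2 + a ^ 4 := by
  have := pp_gt k
  have h4 := pp_le k
  by_cases h : |a| ≤ 1
  · have h1 : |a| ^ pp k ≤ |a| ^ (2:ℝ) := Real.rpow_le_rpow_of_exponent_ge' (abs_nonneg _) h (by norm_num) this.le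
    rw [Real.rpow_two, sq_abs] at h1
    nlinarith [sq_nonneg (a ^ 2)]
  · have h1 : |a| ^ pp k ≤ |a| ^ ((4:ℕ):ℝ) := Real.rpow_le_rpow_of_exponent_le (by linarith) (by exact_mod_cast h4)
    rw [Real.rpow_natCast, show |a| ^ 4 = a ^ 4 by rw [show (4:ℕ) = 2 * 2 by rfl, pow_mul, sq_abs, ← pow_mul]] at h1
    nlinarith [sq_nonneg a]
theorem locp {k : ℕ} (δ : ℕ → ℂ → ℝ) (hδ : ∀ j, Core (δ j)) (C : ℝ) (hC : ∀ j, ‖emb k (δ j) (hδ j)‖ ≤ C)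
    (h : ∀ χ, Core χ → Tendsto (fun j ↦ ∫ z, (χ z * δ j z) ^ 2) atTop (𝓝 0)) {R : ℝ} (hR : R < 1) :
    Tendsto (fun j ↦ ∫ z in Metric.closedBall 0 R, |δ j z| ^ pp k ∂bet k) atTop (𝓝 0) := by
  obtain ⟨χ, hχ, -, h01, h1⟩ := exists_cut R hR
  obtain ⟨A, hA, hA'⟩ := grad_loc k hχ
  obtain ⟨c, hc, hl⟩ := ladyz
  have hp : 0 < pp k := by linarith [pp_gt k]
  have hb : ∀ j, Core fun z ↦ χ z * δ j z := fun j ↦ (hδ j).mul hχ.cd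
  have hlim := (h χ hχ).mul_const (1 + c * (A * C ^ 2))
  rw [zero_mul] at hlim
  refine squeeze_zero (fun j ↦ integral_nonneg fun z ↦ by positivity) (fun j ↦ ?_) hlim
  have i4 : Integrable (fun z ↦ (χ z * δ j z) ^ 4) :=
    int_cs ((hb j).cont.pow 4) ((hb j).cpt.comp_left (g := fun x : ℝ ↦ x ^ 4) (by norm_num))
  have ip : Integrable (fun z ↦ |χ z * δ j z| ^ pp k) := by
    refine int_cs ((hb j).cont.abs.rpow_const fun _ ↦ Or.inr hp.le) ?_
    exact (hb j).cpt.comp_left (g := fun x : ℝ ↦ |x| ^ pp k) (by simp [hp.ne'])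
  calc ∫ z in Metric.closedBall 0 R, |δ j z| ^ pp k ∂bet k = ∫ z in Metric.closedBall 0 R, |χ z * δ j z| ^ pp k ∂bet k := by
        refine setIntegral_congr_fun Metric.isClosed_closedBall.measurableSet fun z hz ↦ ?_
        simp only [Metric.mem_closedBall, dist_zero_right] at hz
        simp only [h1 z hz, one_mul]
    _ ≤ ∫ z, |χ z * δ j z| ^ pp k := by
        have hle : (bet k).restrict (Metric.closedBall 0 R) ≤ volume := Measure.restrict_le_self.trans ((bet_le k).trans Measure.restrict_le_self)
        exact integral_mono_measure hle (Eventually.of_forall fun z ↦ by positivity) ip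
    _ ≤ ∫ z, ((χ z * δ j z) ^ 2 + (χ z * δ j z) ^ 4) := integral_mono ip ((hb j).isq.add i4) fun z ↦ pow_pp k _
    _ = (∫ z, (χ z * δ j z) ^ 2) + ∫ z, (χ z * δ j z) ^ 4 := integral_add (hb j).isq i4
    _ ≤ (∫ z, (χ z * δ j z) ^ 2) + c * ((∫ z, (χ z * δ j z) ^ 2) * (A * C ^ 2)) := by
        have h2 : ∫ z, ‖gr (fun z ↦ χ z * δ j z) z‖ ^ 2 ≤ A * C ^ 2 :=
          (hA' _ (hδ j)).1.trans (mul_le_mul_of_nonneg_left (pow_le_pow_left₀ (norm_nonneg _) (hC j) 2) hA.le)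
        have h3 := hl _ (hb j)
        have h0 : 0 ≤ ∫ z, (χ z * δ j z) ^ 2 := integral_nonneg fun z ↦ by positivity
        refine add_le_add_right (h3.trans ?_) _
        gcongr
    _ = _ := by ring
end Heis
namespace Heis
theorem bl_el {p η : ℝ} (hp : 0 < p) (hη : 0 < η) : ∃ C : ℝ, 0 ≤ C ∧ ∀ a b : ℝ, |(|a + b| ^ p - |a| ^ p)| ≤ η * |a| ^ p + C * |b| ^ p := by
  have hc : ContinuousAt (fun s : ℝ ↦ |1 + s| ^ p) 0 := by
    have : Continuous fun s : ℝ ↦ |1 + s| ^ p := (by fun_prop : Continuous fun s : ℝ ↦ |1 + s|).rpow_const fun _ ↦ Or.inr hp.le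
    exact this.continuousAt
  obtain ⟨θ, hθ, h⟩ := Metric.continuousAt_iff.1 hc η hη
  simp only [dist_zero_right, Real.norm_eq_abs, Real.dist_eq, add_zero, abs_one, Real.one_rpow] at h
  refine ⟨(1 + 1 / θ) ^ p + (1 / θ) ^ p, by positivity, fun a b ↦ ?_⟩
  by_cases hab : |b| < θ * |a|
  · have ha : a ≠ 0 := by rintro rfl; simp at hab; linarith [abs_nonneg b]
    have ha' : 0 < |a| := abs_pos.2 ha
    have h1 := h (x := b / a) (by rw [abs_div, div_lt_iff₀ ha']; exact hab)
    have h2 : |a + b| ^ p = |a| ^ p * |1 + b / a| ^ p := by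
      rw [← Real.mul_rpow (abs_nonneg _) (abs_nonneg _), ← abs_mul]; congr 2; field_simp
    rw [h2, show |a| ^ p * |1 + b / a| ^ p - |a| ^ p = |a| ^ p * (|1 + b / a| ^ p - 1) by ring, abs_mul, abs_of_nonneg (by positivity : 0 ≤ |a| ^ p)]
    have : 0 ≤ ((1 + 1 / θ) ^ p + (1 / θ) ^ p) * |b| ^ p := by positivity
    nlinarith [(by positivity : 0 ≤ |a| ^ p)]
  · push Not at hab
    have h1 : |a| ≤ 1 / θ * |b| := by rw [one_div, inv_mul_eq_div, le_div_iff₀ hθ]; linarith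
    have h2 : |a + b| ≤ (1 + 1 / θ) * |b| := (abs_add_le a b).trans (by linarith)
    have h3 := Real.rpow_le_rpow (abs_nonneg _) h1 hp.le
    have h4 := Real.rpow_le_rpow (abs_nonneg _) h2 hp.le
    rw [Real.mul_rpow (by positivity) (abs_nonneg _)] at h3 h4
    have h5 : 0 ≤ |a| ^ p := by positivity
    have h6 : 0 ≤ |a + b| ^ p := by positivity
    rw [abs_le]; constructor <;> nlinarith
def Ph (k : ℕ) (kk : ℂ → ℝ) (x : VV k) : ℝ := ∫ z, kk z * |wf x z| ^ pp k ∂bet k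
theorem Ph_int {k : ℕ} {kk : ℂ → ℝ} (hm : AEStronglyMeasurable kk (bet k)) {C : ℝ} (hC : ∀ z, |kk z| ≤ C) {x : VV k} (hx : x ∈ HH k) :
    Integrable (fun z ↦ kk z * |wf x z| ^ pp k) (bet k) :=
  (wp_int hx).bdd_mul hm (Eventually.of_forall fun z ↦ hC z)
theorem BL {k : ℕ} {kk : ℂ → ℝ} (hm : AEStronglyMeasurable kk (bet k)) {Ck : ℝ} (hCk : ∀ z, |kk z| ≤ Ck)
    (x : ℕ → VV k) (hx : ∀ j, x j ∈ HH k) {y : VV k} (hy : y ∈ HH k) {C : ℝ} (hC : ∀ j, ‖x j‖ ≤ C)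
    (hae : ∀ᵐ z ∂(bet k), Tendsto (fun j ↦ wf (x j) z) atTop (𝓝 (wf y z))) :
    Tendsto (fun j ↦ Ph k kk (x j) - Ph k kk (x j - y)) atTop (𝓝 (Ph k kk y)) := by
  have hp : 0 < pp k := by linarith [pp_gt k]
  have hCk0 : 0 ≤ Ck := (abs_nonneg _).trans (hCk 0)
  have he : ∀ j, x j - y ∈ HH k := fun j ↦ (HH k).sub_mem (hx j) hy
  have hs : ∀ᵐ z ∂bet k, ∀ j, wf (x j - y) z = wf (x j) z - wf y z := ae_all_iff.2 fun j ↦ wf_sub (x j) y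
  set M := Mc k * ((C + ‖y‖) ^ 2) ^ (pp k / 2)
  have hM0 : 0 ≤ M := mul_nonneg (Mc_pos k).le (by positivity)
  have hM : ∀ j, ∫ z, |wf (x j - y) z| ^ pp k ∂bet k ≤ M := fun j ↦ by
    refine (sharp (he j)).trans (mul_le_mul_of_nonneg_left ?_ (Mc_pos k).le)
    have : ‖x j - y‖ ≤ C + ‖y‖ := (norm_sub_le _ _).trans (by linarith [hC j])
    gcongr
  set D : ℕ → ℂ → ℝ := fun j z ↦ |wf (x j) z| ^ pp k - |wf (x j - y) z| ^ pp k - |wf y z| ^ pp k with hD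
  have iD : ∀ j, Integrable (D j) (bet k) := fun j ↦ ((wp_int (hx j)).sub (wp_int (he j))).sub (wp_int hy)
  have key : Tendsto (fun j ↦ ∫ z, |D j z| ∂bet k) atTop (𝓝 0) := by
    rw [Metric.tendsto_atTop]
    intro ε hε
    set η := ε / (2 * (M + 1))
    have hη : 0 < η := by positivity
    obtain ⟨c, hc, hel⟩ := bl_el hp hη
    set W : ℕ → ℂ → ℝ := fun j z ↦ max (|D j z| - η * |wf (x j - y) z| ^ pp k) 0
    have iW : ∀ j, Integrable (W j) (bet k) := fun j ↦ ((iD j).abs.sub ((wp_int (he j)).const_mul η)).pos_part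
    have hW : Tendsto (fun j ↦ ∫ z, W j z ∂bet k) atTop (𝓝 (∫ _, (0:ℝ) ∂bet k)) := by
      refine tendsto_integral_of_dominated_convergence (fun z ↦ (c + 1) * |wf y z| ^ pp k) (fun j ↦ (iW j).1) ((wp_int hy).const_mul _) (fun j ↦ ?_) ?_
      · filter_upwards [hs] with z hz
        have h0 : 0 ≤ |wf y z| ^ pp k := by positivity
        have h1 := hel (wf (x j - y) z) (wf y z)
        rw [show wf (x j - y) z + wf y z = wf (x j) z by rw [hz j]; ring] at h1
        simp only [W, Real.norm_eq_abs, abs_of_nonneg (le_max_right _ (0:ℝ))]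
        refine max_le ?_ (by positivity)
        have : |D j z| ≤ |(|wf (x j) z| ^ pp k - |wf (x j - y) z| ^ pp k)| + |wf y z| ^ pp k := by
          simp only [hD]; refine (abs_sub _ _).trans ?_; rw [abs_of_nonneg h0]
        linarith
      · filter_upwards [hs, hae] with z hz hzl
        have hcp : Continuous fun s : ℝ ↦ |s| ^ pp k := continuous_abs.rpow_const fun _ ↦ Or.inr hp.le
        have t1 : Tendsto (fun j ↦ |wf (x j) z| ^ pp k) atTop (𝓝 (|wf y z| ^ pp k)) := (hcp.tendsto _).comp hzl
        have t2 : Tendsto (fun j ↦ |wf (x j - y) z| ^ pp k) atTop (𝓝 0) := by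
          have h := (hcp.tendsto _).comp (hzl.sub_const (wf y z))
          simp only [sub_self, abs_zero, Real.zero_rpow hp.ne'] at h
          exact h.congr fun j ↦ by simp [hz j]
        have t3 := (((t1.sub t2).sub_const (|wf y z| ^ pp k)).abs.sub (t2.const_mul η)).max (tendsto_const_nhds (x := (0:ℝ)))
        simpa using t3
    rw [integral_zero] at hW
    obtain ⟨J, hJ⟩ := Metric.tendsto_atTop.1 hW (ε / 2) (by positivity)
    refine ⟨J, fun j hj ↦ ?_⟩
    have h1 := hJ j hj
    rw [Real.dist_eq, sub_zero] at h1 ⊢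
    rw [abs_of_nonneg (integral_nonneg fun z ↦ abs_nonneg _)]
    have h2 : ∫ z, |D j z| ∂bet k ≤ ∫ z, (W j z + η * |wf (x j - y) z| ^ pp k) ∂bet k := by
      refine integral_mono (iD j).abs ((iW j).add ((wp_int (he j)).const_mul η)) fun z ↦ ?_
      have := le_max_left (|D j z| - η * |wf (x j - y) z| ^ pp k) 0
      simp only [W]; linarith
    rw [integral_add (iW j) ((wp_int (he j)).const_mul η), integral_const_mul] at h2
    have h3 : η * ∫ z, |wf (x j - y) z| ^ pp k ∂bet k ≤ η * M := mul_le_mul_of_nonneg_left (hM j) hη.le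
    have h4 : η * M < ε / 2 := by
      have : η * (M + 1) = ε / 2 := by simp only [η]; field_simp
      nlinarith
    linarith [le_abs_self (∫ z, W j z ∂bet k)]
  rw [tendsto_iff_dist_tendsto_zero]
  have hlim := key.const_mul Ck
  rw [mul_zero] at hlim
  refine squeeze_zero (fun j ↦ dist_nonneg) (fun j ↦ ?_) hlim
  rw [Real.dist_eq, Ph, Ph, Ph, ← integral_sub (Ph_int hm hCk (hx j)) (Ph_int hm hCk (he j)), ← integral_sub (by exact (Ph_int hm hCk (hx j)).sub (Ph_int hm hCk (he j))) (Ph_int hm hCk hy), ← integral_const_mul]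
  refine (abs_integral_le_integral_abs).trans (integral_mono_of_nonneg (Eventually.of_forall fun z ↦ abs_nonneg _) ((iD j).abs.const_mul _) (Eventually.of_forall fun z ↦ ?_))
  have : kk z * |wf (x j) z| ^ pp k - kk z * |wf (x j - y) z| ^ pp k - kk z * |wf y z| ^ pp k = kk z * D j z := by simp only [hD]; ring
  simp only [this, abs_mul]
  exact mul_le_mul_of_nonneg_right (hCk z) (abs_nonneg _)
end Heis
namespace Heis
theorem Ph_smul {k : ℕ} (kk : ℂ → ℝ) (c : ℝ) (x : VV k) : Ph k kk (c • x) = |c| ^ pp k * Ph k kk x := by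
  rw [Ph, Ph, ← integral_const_mul]
  refine integral_congr_ae ?_
  filter_upwards [wf_smul c x] with z hz
  rw [hz, abs_mul, Real.mul_rpow (abs_nonneg _) (abs_nonneg _)]; ring
theorem Ph_hom {k : ℕ} {kk : ℂ → ℝ} {M : ℝ} (hM : ∀ y ∈ HH k, ‖y‖ ≤ 1 → Ph k kk y ≤ M) {y : VV k} (hy : y ∈ HH k) :
    Ph k kk y ≤ M * (‖y‖ ^ 2) ^ (pp k / 2) := by
  have hp : 0 < pp k := by linarith [pp_gt k]
  by_cases h0 : ‖y‖ = 0
  · have : y = (0:ℝ) • y := by rw [norm_eq_zero.1 h0]; simp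
    rw [this, Ph_smul]; simp [hp.ne', (by positivity : pp k / 2 ≠ 0)]
  · have hn : 0 < ‖y‖ := lt_of_le_of_ne (norm_nonneg _) (Ne.symm h0)
    have e : y = ‖y‖ • (‖y‖⁻¹ • y) := by rw [smul_smul, mul_inv_cancel₀ h0, one_smul]
    have h1 := hM _ ((HH k).smul_mem ‖y‖⁻¹ hy) (by rw [norm_smul, norm_inv, norm_norm, inv_mul_cancel₀ h0])
    conv_lhs => rw [e, Ph_smul]
    rw [abs_of_pos hn, ← Real.rpow_natCast, ← Real.rpow_mul hn.le, show ((2:ℕ):ℝ) * (pp k / 2) = pp k by push_cast; ring, mul_comm]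
    exact mul_le_mul_of_nonneg_right h1 (by positivity)
theorem esc {k : ℕ} (e : ℕ → VV k) (he : ∀ j, e j ∈ HH k) (δ : ℕ → ℂ → ℝ) (hδ : ∀ j, Core (δ j)) (C : ℝ) (hC : ∀ j, ‖emb k (δ j) (hδ j)‖ ≤ C)
    (h : ∀ χ, Core χ → Tendsto (fun j ↦ ∫ z, (χ z * δ j z) ^ 2) atTop (𝓝 0))
    (hr : Tendsto (fun j ↦ ‖e j - emb k (δ j) (hδ j)‖) atTop (𝓝 0)) {R : ℝ} (hR : R < 1) :
    Tendsto (fun j ↦ ∫ z in Metric.closedBall 0 R, |wf (e j) z| ^ pp k ∂bet k) atTop (𝓝 0) := by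
  have hp : 0 < pp k := by linarith [pp_gt k]
  obtain ⟨c, hc, hel⟩ := bl_el hp one_pos
  have l1 := (locp δ hδ C hC h hR).const_mul (2:ℝ)
  have l2 : Tendsto (fun j ↦ c * (Mc k * (‖e j - emb k (δ j) (hδ j)‖ ^ 2) ^ (pp k / 2))) atTop (𝓝 0) := by
    have := (((hr.pow 2).rpow_const (p := pp k / 2) (Or.inr (by positivity))).const_mul (Mc k)).const_mul c
    simpa [(by positivity : pp k / 2 ≠ 0)] using this
  have l3 := l1.add l2
  rw [mul_zero, add_zero] at l3
  refine squeeze_zero (fun j ↦ integral_nonneg fun z ↦ by positivity) (fun j ↦ ?_) l3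
  have hrm : e j - emb k (δ j) (hδ j) ∈ HH k := (HH k).sub_mem (he j) (emb_HH (hδ j))
  have iδ : Integrable (fun z ↦ |δ j z| ^ pp k) (bet k) := by
    refine (wp_int (emb_HH (k := k) (hδ j))).congr ?_
    filter_upwards [emb_w k (hδ j)] with z hz; rw [hz]
  have h1 : ∫ z in Metric.closedBall 0 R, |wf (e j) z| ^ pp k ∂bet k ≤
      ∫ z in Metric.closedBall 0 R, (2 * |δ j z| ^ pp k + c * |wf (e j - emb k (δ j) (hδ j)) z| ^ pp k) ∂bet k := by
    refine integral_mono_ae (wp_int (he j)).integrableOn ((iδ.const_mul 2).add ((wp_int hrm).const_mul c)).integrableOn (ae_restrict_of_ae ?_)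
    filter_upwards [emb_w k (hδ j), wf_sub (e j) (emb k (δ j) (hδ j))] with z h1 h2
    have h3 := hel (δ j z) (wf (e j - emb k (δ j) (hδ j)) z)
    rw [show δ j z + wf (e j - emb k (δ j) (hδ j)) z = wf (e j) z by rw [h2, h1]; ring] at h3
    have := (le_abs_self _).trans h3
    linarith
  rw [integral_add (iδ.const_mul 2).integrableOn ((wp_int hrm).const_mul c).integrableOn, integral_const_mul, integral_const_mul] at h1
  refine h1.trans (add_le_add_right (mul_le_mul_of_nonneg_left ?_ hc) _)
  exact (setIntegral_le_integral (wp_int hrm) (Eventually.of_forall fun z ↦ by positivity)).trans (sharp hrm)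
theorem Ph_split {k : ℕ} {kk : ℂ → ℝ} (hm : AEStronglyMeasurable kk (bet k)) {Ck : ℝ} (hCk : ∀ z, |kk z| ≤ Ck)
    {R m : ℝ} (hR : ∀ z ∈ DD, R < ‖z‖ → kk z ≤ m) (hm0 : 0 ≤ m) {e : VV k} (he : e ∈ HH k) :
    Ph k kk e ≤ Ck * (∫ z in Metric.closedBall 0 R, |wf e z| ^ pp k ∂bet k) + m * (Mc k * (‖e‖ ^ 2) ^ (pp k / 2)) := by
  have hCk0 : 0 ≤ Ck := (abs_nonneg _).trans (hCk 0)
  have i1 := (wp_int he).indicator (Metric.isClosed_closedBall (x := (0:ℂ)) (ε := R)).measurableSet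
  have h1 : Ph k kk e ≤ ∫ z, (Ck * (Metric.closedBall 0 R).indicator (fun z ↦ |wf e z| ^ pp k) z + m * |wf e z| ^ pp k) ∂bet k := by
    refine integral_mono_ae (Ph_int hm hCk he) ((i1.const_mul Ck).add ((wp_int he).const_mul m)) ?_
    filter_upwards [bet_D k] with z hz
    have h0 : 0 ≤ |wf e z| ^ pp k := by positivity
    by_cases hzR : z ∈ Metric.closedBall (0:ℂ) R
    · simp only [Set.indicator_of_mem hzR]
      nlinarith [(le_abs_self _).trans (hCk z)]
    · simp only [Set.indicator_of_notMem hzR]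
      simp only [Metric.mem_closedBall, dist_zero_right, not_le] at hzR
      nlinarith [hR z hz hzR]
  rw [integral_add (i1.const_mul Ck) ((wp_int he).const_mul m), integral_const_mul, integral_const_mul, integral_indicator Metric.isClosed_closedBall.measurableSet] at h1
  refine h1.trans (add_le_add_right (mul_le_mul_of_nonneg_left (sharp he) hm0) _)
theorem Ph_bump {k : ℕ} {kk : ℂ → ℝ} (hkc : ContinuousOn kk DD) {Ck : ℝ} (hm : AEStronglyMeasurable kk (bet k)) (hCk : ∀ z, |kk z| ≤ Ck)
    {z0 : ℂ} (hz0 : z0 ∈ DD) (hpos : 0 < kk z0) : ∃ y ∈ HH k, ‖y‖ ≤ 1 ∧ 0 < Ph k kk y := by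
  have hp : 0 < pp k := by linarith [pp_gt k]
  have h1 : ∀ᶠ z in 𝓝 z0, 0 < kk z ∧ z ∈ DD :=
    (((hkc.continuousAt (Metric.isOpen_ball.mem_nhds hz0)).eventually (lt_mem_nhds hpos))).and (Metric.isOpen_ball.mem_nhds hz0)
  obtain ⟨r, hr, hr'⟩ := Metric.eventually_nhds_iff.1 h1
  let b : ContDiffBump z0 := ⟨r / 4, r / 2, by positivity, by linarith⟩
  have hb : Core b := ⟨b.contDiff, b.hasCompactSupport, fun z hz ↦ by
    rw [b.tsupport_eq] at hz
    exact (hr' (lt_of_le_of_lt (Metric.mem_closedBall.1 hz) (by simp only [b]; linarith))).2⟩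
  have hbr : ∀ z, r ≤ dist z z0 → b z = 0 := fun z hz ↦ b.zero_of_le_dist (by simp only [b]; linarith)
  have hP : 0 < Ph k kk (emb k b hb) := by
    have e : Ph k kk (emb k b hb) = ∫ z, kk z * |b z| ^ pp k ∂bet k := integral_congr_ae (by
      filter_upwards [emb_w k hb] with z hz; rw [hz])
    have hi : Integrable (fun z ↦ kk z * |b z| ^ pp k) (bet k) := (Ph_int hm hCk (emb_HH (k := k) hb)).congr (by
      filter_upwards [emb_w k hb] with z hz; rw [hz])
    have hnn : ∀ z, 0 ≤ kk z * |b z| ^ pp k := fun z ↦ by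
      by_cases h : dist z z0 < r
      · exact mul_nonneg (hr' h).1.le (by positivity)
      · rw [hbr z (not_lt.1 h)]; simp [hp.ne']
    rw [e]
    refine lt_of_le_of_ne (integral_nonneg hnn) fun h0 ↦ ?_
    have h2 := (integral_eq_zero_iff_of_nonneg hnn hi).1 h0.symm
    rw [EventuallyEq, bet_ae, ae_restrict_iff' measurableSet_ball] at h2
    refine (Metric.measure_ball_pos volume z0 (by positivity : 0 < r / 4)).ne' (measure_mono_null (fun z hz ↦ ?_) (ae_iff.1 h2))
    have hz' : dist z z0 < r := by rw [Metric.mem_ball] at hz; linarith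
    simp only [Classical.not_imp]
    refine ⟨(hr' hz').2, ?_⟩
    rw [b.one_of_mem_closedBall (Metric.ball_subset_closedBall hz)]
    simpa using (hr' hz').1.ne'
  set v := emb k b hb
  have hv : v ∈ HH k := emb_HH hb
  refine ⟨(‖v‖ + 1)⁻¹ • v, (HH k).smul_mem _ hv, ?_, ?_⟩
  · rw [norm_smul, norm_inv, Real.norm_of_nonneg (by positivity), inv_mul_le_iff₀ (by positivity)]; linarith
  · rw [Ph_smul]; have : 0 < |(‖v‖ + 1)⁻¹| := abs_pos.2 (by positivity)
    positivity
theorem attain {k : ℕ} {kk : ℂ → ℝ} (hkc : ContinuousOn kk DD) {Ck : ℝ} (hm : AEStronglyMeasurable kk (bet k)) (hCk : ∀ z, |kk z| ≤ Ck)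
    {z0 : ℂ} (hz0 : z0 ∈ DD) (hpos : 0 < kk z0) {Ki : ℝ} (hKi : ∀ δ > 0, ∃ R < 1, ∀ z ∈ DD, R < ‖z‖ → kk z ≤ Ki + δ)
    (halt : Ki ≤ 0 ∨ 0 ≤ ∫ z, (kk z - Ki) ∂bet k) :
    ∃ x ∈ HH k, ‖x‖ = 1 ∧ 0 < Ph k kk x ∧ ∀ y ∈ HH k, ‖y‖ ≤ 1 → Ph k kk y ≤ Ph k kk x := by
  have hp2 : 1 < pp k / 2 := by linarith [pp_gt k]
  have hMc := Mc_pos k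
  have hCk0 : 0 ≤ Ck := (abs_nonneg _).trans (hCk 0)
  set S : Set ℝ := {r | ∃ y ∈ HH k, ‖y‖ ≤ 1 ∧ Ph k kk y = r} with hS
  have hbd : BddAbove S := ⟨Ck * Mc k, by
    rintro _ ⟨y, hy, hy1, rfl⟩
    calc Ph k kk y ≤ ∫ z, Ck * |wf y z| ^ pp k ∂bet k := integral_mono (Ph_int hm hCk hy) ((wp_int hy).const_mul _) fun z ↦
          mul_le_mul_of_nonneg_right ((le_abs_self _).trans (hCk z)) (by positivity)
      _ ≤ Ck * (Mc k * 1) := by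
          rw [integral_const_mul]
          refine mul_le_mul_of_nonneg_left ((sharp hy).trans (mul_le_mul_of_nonneg_left ?_ hMc.le)) hCk0
          exact Real.rpow_le_one (by positivity) (pow_le_one₀ (norm_nonneg _) hy1) (by positivity)
      _ = _ := by ring⟩
  set MK := sSup S
  have hle : ∀ y ∈ HH k, ‖y‖ ≤ 1 → Ph k kk y ≤ MK := fun y hy h ↦ le_csSup hbd ⟨y, hy, h, rfl⟩
  obtain ⟨y0, hy0, hy01, hy0p⟩ := Ph_bump (k := k) hkc hm hCk hz0 hpos
  have hMK : 0 < MK := hy0p.trans_le (hle y0 hy0 hy01)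
  set m := max Ki 0
  by_cases hcase : MK ≤ m * Mc k
  · have hKi0 : 0 < Ki := by
      by_contra h
      have : m = 0 := max_eq_right (not_lt.1 h)
      rw [this] at hcase; linarith
    have hm' : m = Ki := max_eq_left hKi0.le
    have halt' := halt.resolve_left (not_le.2 hKi0)
    have ik : Integrable kk (bet k) := by
      have := (integrable_const (1:ℝ) (μ := bet k)).bdd_mul hm (Eventually.of_forall fun z ↦ hCk z)
      simpa using this
    rw [integral_sub ik (integrable_const _)] at halt'
    simp only [integral_const, smul_eq_mul] at halt'
    obtain ⟨o, ho, how, hog⟩ := one_HH k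
    have hB := BB_pos k
    have hN := NN_pos k
    have hno : ‖o‖ ^ 2 = NN k ^ 2 * BB k := by
      rw [norm_VV, integral_congr_ae (g := fun _ ↦ (1:ℝ)) (by filter_upwards [how] with z hz; rw [hz]; norm_num),
        integral_congr_ae (f := fun z ↦ ‖gf o z‖ ^ 2) (g := fun _ ↦ (0:ℝ)) (by filter_upwards [hog] with z hz; rw [hz]; simp)]
      simp [BB]
    have hno0 : 0 < ‖o‖ := by
      have : 0 < ‖o‖ ^ 2 := by rw [hno]; positivity
      exact lt_of_le_of_ne (norm_nonneg _) fun h ↦ by rw [← h] at this; simp at this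
    have hPo : Ph k kk (‖o‖⁻¹ • o) = (1 / (NN k ^ 2 * BB k)) ^ (pp k / 2) * ∫ z, kk z ∂bet k := by
      rw [Ph_smul, abs_of_pos (by positivity), ← hno]
      congr 1
      · rw [one_div, ← inv_pow, ← Real.rpow_natCast, ← Real.rpow_mul (by positivity)]; congr 1; push_cast; ring
      · refine integral_congr_ae ?_
        filter_upwards [how] with z hz; rw [hz]; simp
    have hge : MK ≤ Ph k kk (‖o‖⁻¹ • o) := by
      refine hcase.trans ?_
      rw [hPo, hm', Mc]
      have : 0 ≤ (1 / (NN k ^ 2 * BB k)) ^ (pp k / 2) := by positivity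
      change 0 ≤ _ - BB k * Ki at halt'
      have h9 := mul_nonneg this halt'
      rw [mul_sub] at h9
      linarith
    exact ⟨‖o‖⁻¹ • o, (HH k).smul_mem _ ho, by rw [norm_smul, norm_inv, norm_norm, inv_mul_cancel₀ hno0.ne'], hMK.trans_le hge, fun y hy h ↦ (hle y hy h).trans hge⟩
  push Not at hcase
  have hm0 : 0 ≤ m := le_max_right _ _
  obtain ⟨r, -, hr, hrS⟩ := exists_seq_tendsto_sSup (S := S) ⟨_, y0, hy0, hy01, rfl⟩ hbd
  choose x hx hx1 hxr using hrS
  obtain ⟨s, hs, y, hy, hw, hae, δ, hδ, hd0, hdb, hdχ⟩ := L3 x hx 1 hx1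
  have hBL := BL hm hCk (fun j ↦ x (s j)) (fun j ↦ hx _) hy (fun j ↦ hx1 _) hae
  have hxl : Tendsto (fun j ↦ Ph k kk (x (s j))) atTop (𝓝 MK) := by
    simp only [hxr]; exact hr.comp hs.tendsto_atTop
  have hel : Tendsto (fun j ↦ Ph k kk (x (s j) - y)) atTop (𝓝 (MK - Ph k kk y)) := by
    refine (hxl.sub hBL).congr fun j ↦ by ring
  set E := ‖y‖ ^ 2 with hE
  have hwy := hw y
  rw [real_inner_self_eq_norm_sq] at hwy
  have hE1 : E ≤ 1 := by
    have : E ≤ ‖y‖ := le_of_tendsto hwy (Eventually.of_forall fun j ↦ (real_inner_le_norm _ _).trans (by nlinarith [hx1 (s j), norm_nonneg y]))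
    nlinarith [norm_nonneg y]
  have hE0 : 0 ≤ E := sq_nonneg _
  have hen : ∀ j, ‖x (s j) - y‖ ^ 2 ≤ 1 - 2 * inner ℝ (x (s j)) y + E := fun j ↦ by
    rw [norm_sub_sq_real]
    have : ‖x (s j)‖ ^ 2 ≤ 1 := pow_le_one₀ (norm_nonneg _) (hx1 _)
    linarith
  have hT : Tendsto (fun j ↦ (1 - 2 * inner ℝ (x (s j)) y + E) ^ (pp k / 2)) atTop (𝓝 ((1 - E) ^ (pp k / 2))) := by
    have := ((hwy.const_mul 2).const_sub 1).add_const E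
    rw [show 1 - 2 * E + E = 1 - E by ring] at this
    exact this.rpow_const (Or.inr (by positivity))
  have hemem : ∀ j, x (s j) - y ∈ HH k := fun j ↦ (HH k).sub_mem (hx _) hy
  have key : ∀ ε > 0, MK - Ph k kk y ≤ (m + ε) * (Mc k * (1 - E) ^ (pp k / 2)) := fun ε hε ↦ by
    obtain ⟨R, hR, hR'⟩ := hKi ε hε
    have hes := esc (fun j ↦ x (s j) - y) hemem δ hδ _ hdb hdχ hd0 hR
    have := (hes.const_mul Ck).add ((hT.const_mul (Mc k)).const_mul (m + ε))
    rw [mul_zero, zero_add] at this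
    refine le_of_tendsto_of_tendsto' hel this fun j ↦ ?_
    refine (Ph_split hm hCk (m := m + ε) (fun z hz hzR ↦ (hR' z hz hzR).trans (by linarith [le_max_left Ki 0])) (by positivity) (hemem j)).trans ?_
    have := hen j
    gcongr
  have key0 : MK - Ph k kk y ≤ m * (Mc k * (1 - E) ^ (pp k / 2)) := by
    have h : Tendsto (fun ε : ℝ ↦ (m + ε) * (Mc k * (1 - E) ^ (pp k / 2))) (𝓝[>] 0) (𝓝 ((m + 0) * (Mc k * (1 - E) ^ (pp k / 2)))) :=
      ((continuous_const.add continuous_id).mul continuous_const).continuousWithinAt.tendsto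
    rw [add_zero] at h
    exact ge_of_tendsto h (eventually_nhdsWithin_of_forall fun ε hε ↦ key ε hε)
  have hyM := Ph_hom hle hy
  have a1 : E ^ (pp k / 2) ≤ E := by
    have := Real.rpow_le_rpow_of_exponent_ge' hE0 hE1 (by norm_num) hp2.le
    rwa [Real.rpow_one] at this
  have a2 : (1 - E) ^ (pp k / 2) ≤ 1 - E := by
    have := Real.rpow_le_rpow_of_exponent_ge' (by linarith : 0 ≤ 1 - E) (by linarith) (by norm_num) hp2.le
    rwa [Real.rpow_one] at this
  have hEe : E = 1 := by
    by_contra h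
    have : 0 < 1 - E := by have := lt_of_le_of_ne hE1 h; linarith
    have b1 : MK * E ^ (pp k / 2) ≤ MK * E := mul_le_mul_of_nonneg_left a1 hMK.le
    have b2 : m * (Mc k * (1 - E) ^ (pp k / 2)) ≤ m * (Mc k * (1 - E)) := by gcongr
    nlinarith
  have hge : MK ≤ Ph k kk y := by
    rw [hEe] at key0; simp only [sub_self] at key0; rw [Real.zero_rpow (by positivity)] at key0; linarith
  have hny : ‖y‖ = 1 := by
    rw [hE] at hEe
    exact (pow_eq_one_iff_of_nonneg (norm_nonneg _) two_ne_zero).1 hEe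
  exact ⟨y, hy, hny, hMK.trans_le hge, fun v hv h ↦ (hle v hv h).trans hge⟩
end Heis
namespace Heis
theorem wpp_int {k : ℕ} {x y : VV k} (hx : x ∈ HH k) (hy : y ∈ HH k) : Integrable (fun z ↦ (|wf x z| + |wf y z|) ^ pp k) (bet k) := by
  have hp : 0 < pp k := by linarith [pp_gt k]
  obtain ⟨c, hc, hel⟩ := bl_el hp one_pos
  refine (((wp_int hx).const_mul 2).add ((wp_int hy).const_mul c)).mono' ?_ (Eventually.of_forall fun z ↦ ?_)
  · exact (((wf_mem x).1.norm.add (wf_mem y).1.norm).aemeasurable.pow_const _).aestronglyMeasurable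
  · have h := hel |wf x z| |wf y z|
    simp only [abs_abs, abs_of_nonneg (add_nonneg (abs_nonneg (wf x z)) (abs_nonneg (wf y z)))] at h
    rw [Real.norm_of_nonneg (by positivity)]
    have := (le_abs_self _).trans h
    simp only [Pi.add_apply]; linarith
theorem wq_le (k : ℕ) (a b : ℝ) {c : ℝ} (h : |c| ≤ |a| + |b|) : |(|c| ^ (pp k - 2) * c * b)| ≤ (|a| + |b|) ^ pp k := by
  have hp := pp_gt k
  have h0 : 0 ≤ |a| + |b| := by positivity
  rw [abs_mul, abs_mul, abs_of_nonneg (by positivity : 0 ≤ |c| ^ (pp k - 2))]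
  calc _ ≤ (|a| + |b|) ^ (pp k - 2) * (|a| + |b|) * (|a| + |b|) := by
        have : |b| ≤ |a| + |b| := by linarith [abs_nonneg a]
        have : |c| ^ (pp k - 2) ≤ (|a| + |b|) ^ (pp k - 2) := Real.rpow_le_rpow (abs_nonneg _) h (by linarith)
        gcongr
    _ = _ := by
        by_cases h1 : |a| + |b| = 0
        · rw [h1]; simp [(by linarith : pp k ≠ 0)]
        · have := lt_of_le_of_ne h0 (Ne.symm h1)
          rw [mul_assoc, ← sq, ← Real.rpow_natCast _ 2, ← Real.rpow_add this]; norm_num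
theorem wq_int {k : ℕ} {kk : ℂ → ℝ} (hm : AEStronglyMeasurable kk (bet k)) {Ck : ℝ} (hCk : ∀ z, |kk z| ≤ Ck)
    {x y : VV k} (hx : x ∈ HH k) (hy : y ∈ HH k) : Integrable (fun z ↦ kk z * (|wf x z| ^ (pp k - 2) * wf x z * wf y z)) (bet k) := by
  refine Integrable.bdd_mul (c := Ck) ((wpp_int hx hy).mono' ?_ (Eventually.of_forall fun z ↦ wq_le k _ _ (by linarith [abs_nonneg (wf y z)]))) hm (Eventually.of_forall fun z ↦ hCk z)
  have h1 := (wf_mem x).1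
  exact ((h1.norm.aemeasurable.pow_const _).aestronglyMeasurable.mul h1).mul (wf_mem y).1
theorem Ph_der {k : ℕ} {kk : ℂ → ℝ} (hm : AEStronglyMeasurable kk (bet k)) {Ck : ℝ} (hCk : ∀ z, |kk z| ≤ Ck)
    {x y : VV k} (hx : x ∈ HH k) (hy : y ∈ HH k) :
    HasDerivAt (fun t : ℝ ↦ Ph k kk (x + t • y)) (pp k * ∫ z, kk z * (|wf x z| ^ (pp k - 2) * wf x z * wf y z) ∂bet k) 0 := by
  have hp := pp_gt k
  have e : (fun t : ℝ ↦ Ph k kk (x + t • y)) = fun t : ℝ ↦ ∫ z, kk z * |wf x z + t * wf y z| ^ pp k ∂bet k := by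
    ext t
    refine integral_congr_ae ?_
    filter_upwards [wf_add x (t • y), wf_smul t y] with z h1 h2
    rw [h1, h2]
  rw [e, ← integral_const_mul]
  have hms : ∀ t : ℝ, AEStronglyMeasurable (fun z ↦ wf x z + t * wf y z) (bet k) := fun t ↦ (wf_mem x).1.add ((wf_mem y).1.const_mul t)
  have h := hasDerivAt_integral_of_dominated_loc_of_deriv_le (μ := bet k) (𝕜 := ℝ) (F := fun t z ↦ kk z * |wf x z + t * wf y z| ^ pp k)
    (F' := fun t z ↦ kk z * (pp k * |wf x z + t * wf y z| ^ (pp k - 2) * (wf x z + t * wf y z) * wf y z)) (x₀ := 0) (s := Metric.ball 0 1)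
    (bound := fun z ↦ Ck * (pp k * (|wf x z| + |wf y z|) ^ pp k)) (Metric.ball_mem_nhds _ one_pos)
    (Eventually.of_forall fun t ↦ hm.mul ((hms t).norm.aemeasurable.pow_const _).aestronglyMeasurable)
    (by simpa using Ph_int hm hCk hx)
    (hm.mul ((((hms 0).norm.aemeasurable.pow_const _).aestronglyMeasurable.const_mul _ |>.mul (hms 0)).mul (wf_mem y).1))
    (Eventually.of_forall fun z t ht ↦ ?_) (((wpp_int hx hy).const_mul _).const_mul _) (Eventually.of_forall fun z t ht ↦ ?_)
  · refine h.2.congr_deriv (integral_congr_ae (Eventually.of_forall fun z ↦ ?_))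
    simp only [zero_mul, add_zero]; ring
  · have ht' : |t| ≤ 1 := by rw [Metric.mem_ball, dist_zero_right] at ht; exact ht.le
    rw [norm_mul]
    have h1 := wq_le k (wf x z) (wf y z) (c := wf x z + t * wf y z) ((abs_add_le _ _).trans (by
      rw [abs_mul]; nlinarith [abs_nonneg (wf y z)]))
    have : pp k * |wf x z + t * wf y z| ^ (pp k - 2) * (wf x z + t * wf y z) * wf y z = pp k * (|wf x z + t * wf y z| ^ (pp k - 2) * (wf x z + t * wf y z) * wf y z) := by ring
    rw [this, norm_mul, Real.norm_of_nonneg (by linarith : 0 ≤ pp k)]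
    have h2 : 0 ≤ Ck := (abs_nonneg _).trans (hCk 0)
    have h3 := hCk z
    rw [← Real.norm_eq_abs] at h1 h3
    gcongr
  · have h1 : HasDerivAt (fun t ↦ wf x z + t * wf y z) (wf y z) t := by
      simpa using ((hasDerivAt_id t).mul_const (wf y z)).const_add (wf x z)
    exact ((hasDerivAt_abs_rpow _ (by linarith : 1 < pp k)).comp t h1).const_mul (kk z)
theorem solB {k : ℕ} {kk : ℂ → ℝ} (hkc : ContinuousOn kk DD) {Ck : ℝ} (hm : AEStronglyMeasurable kk (bet k)) (hCk : ∀ z, |kk z| ≤ Ck)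
    {z0 : ℂ} (hz0 : z0 ∈ DD) (hpos : 0 < kk z0) {Ki : ℝ} (hKi : ∀ δ > 0, ∃ R < 1, ∀ z ∈ DD, R < ‖z‖ → kk z ≤ Ki + δ)
    (halt : Ki ≤ 0 ∨ 0 ≤ ∫ z, (kk z - Ki) ∂bet k) :
    ∃ x ∈ HH k, x ≠ 0 ∧ (∀ᵐ z ∂bet k, 0 ≤ wf x z) ∧ ∀ y ∈ HH k, Integrable (fun z ↦ kk z * (wf x z ^ qq k * wf y z)) (bet k) ∧
      inner ℝ x y = ∫ z, kk z * (wf x z ^ qq k * wf y z) ∂bet k := by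
  have hp := pp_gt k
  obtain ⟨x1, hx1, hn1, hP1, hmax1⟩ := attain hkc hm hCk hz0 hpos hKi halt
  obtain ⟨x, hx, hxw, hxn⟩ := HH_abs hx1
  have hPx : Ph k kk x = Ph k kk x1 := integral_congr_ae (by filter_upwards [hxw] with z hz; rw [hz, abs_abs])
  have hx1' : ‖x‖ = 1 := by
    rw [hn1, one_pow] at hxn
    have h1 := Ph_hom hmax1 hx
    rw [hPx] at h1
    have h2 : 1 ≤ (‖x‖ ^ 2) ^ (pp k / 2) := by
      by_contra h; push Not at h; nlinarith
    have h3 : 1 ≤ ‖x‖ ^ 2 := by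
      by_contra h; push Not at h
      linarith [Real.rpow_lt_one (by positivity) h (by linarith : 0 < pp k / 2)]
    exact (pow_eq_one_iff_of_nonneg (norm_nonneg _) two_ne_zero).1 (le_antisymm hxn h3)
  have hEL := EL hx (Ph k kk) (fun y ↦ pp k * ∫ z, kk z * (|wf x z| ^ (pp k - 2) * wf x z * wf y z) ∂bet k)
    (fun y hy h ↦ by rw [hPx]; exact hmax1 y hy (h.trans hx1'.le)) (fun u hu v hv c ↦ by
      have e : ∫ z, kk z * (|wf x z| ^ (pp k - 2) * wf x z * wf (u + c • v) z) ∂bet k =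
          ∫ z, (kk z * (|wf x z| ^ (pp k - 2) * wf x z * wf u z) + c * (kk z * (|wf x z| ^ (pp k - 2) * wf x z * wf v z))) ∂bet k := by
        refine integral_congr_ae ?_
        filter_upwards [wf_add u (c • v), wf_smul c v] with z h1 h2
        rw [h1, h2]; ring
      simp only [e]
      rw [integral_add (wq_int hm hCk hx hu) ((wq_int hm hCk hx hv).const_mul c), integral_const_mul]; ring) (fun y hy ↦ Ph_der hm hCk hx hy)
  have hq : ∀ᵐ z ∂bet k, 0 ≤ wf x z ∧ |wf x z| ^ (pp k - 2) * wf x z = wf x z ^ qq k := by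
    filter_upwards [hxw] with z hz
    have h0 : 0 ≤ wf x z := by rw [hz]; exact abs_nonneg _
    refine ⟨h0, ?_⟩
    have hq1 := qq_gt k
    rw [abs_of_nonneg h0]
    rcases h0.eq_or_lt with h | h
    · rw [← h, mul_zero, Real.zero_rpow (by linarith)]
    · rw [pp_qq, ← Real.rpow_add_one h.ne']; congr 1; ring
  set P := Ph k kk x
  have hP : 0 < P := by rw [hPx]; exact hP1
  have hdx : ∫ z, kk z * (|wf x z| ^ (pp k - 2) * wf x z * wf x z) ∂bet k = P := by
    refine integral_congr_ae ?_
    filter_upwards [hq] with z hz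
    rw [hz.2, abs_of_nonneg hz.1, pp_qq]
    rcases hz.1.eq_or_lt with h | h
    · rw [← h, mul_zero, Real.zero_rpow (by linarith [qq_gt k])]
    · rw [Real.rpow_add_one h.ne']
  simp only [hdx, hx1', one_pow, mul_one] at hEL
  have hq1 := qq_gt k
  set l : ℝ := (1 / P) ^ (1 / (qq k - 1))
  have hl : 0 < l := by positivity
  have hlq : l ^ qq k = l * (1 / P) := by
    have h1 : l ^ (qq k - 1) = 1 / P := by
      rw [← Real.rpow_mul (by positivity), one_div_mul_cancel (by linarith), Real.rpow_one]
    rw [← h1, mul_comm, ← Real.rpow_add_one hl.ne']; congr 1; ring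
  refine ⟨l • x, (HH k).smul_mem _ hx, ?_, ?_, fun y hy ↦ ?_⟩
  · refine smul_ne_zero hl.ne' fun h ↦ ?_
    rw [h] at hx1'; simp at hx1'
  · filter_upwards [hq, wf_smul l x] with z h1 h2
    rw [h2]; exact mul_nonneg hl.le h1.1
  · have e : (fun z ↦ kk z * (wf (l • x) z ^ qq k * wf y z)) =ᵐ[bet k] fun z ↦ l * (1 / P) * (kk z * (|wf x z| ^ (pp k - 2) * wf x z * wf y z)) := by
      filter_upwards [hq, wf_smul l x] with z h1 h2
      rw [h2, Real.mul_rpow hl.le h1.1, h1.2, hlq]; ring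
    refine ⟨((wq_int hm hCk hx hy).const_mul _).congr e.symm, ?_⟩
    rw [integral_congr_ae e, integral_const_mul, real_inner_smul_left]
    have h3 := hEL y hy
    have h4 : ∫ z, kk z * (|wf x z| ^ (pp k - 2) * wf x z * wf y z) ∂bet k = P * inner ℝ x y :=
      mul_left_cancel₀ (by linarith : pp k ≠ 0) (h3.trans (by ring))
    rw [h4]; field_simp
end Heis
namespace Heis
def th (δ s : ℝ) : ℝ := (1 - s / (|s| + δ)) / δ
theorem th_der {δ : ℝ} (hδ : 0 < δ) (s : ℝ) : HasDerivAt (th δ) (-(1 / (|s| + δ) ^ 2)) s := by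
  have h : HasDerivAt (fun s : ℝ ↦ s / (|s| + δ)) (δ / (|s| + δ) ^ 2) s := by
    rcases lt_trichotomy s 0 with hs | hs | hs
    · have h1 : HasDerivAt (fun s : ℝ ↦ s / (-s + δ)) (δ / (|s| + δ) ^ 2) s := by
        refine ((hasDerivAt_id s).div ((hasDerivAt_id s).neg.add_const δ) (by simp; linarith)).congr_deriv ?_
        rw [abs_of_neg hs]; simp
      refine h1.congr_of_eventuallyEq ?_
      filter_upwards [gt_mem_nhds hs] with t ht
      rw [abs_of_neg ht]
    · subst hs
      rw [hasDerivAt_iff_tendsto_slope_zero]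
      have : Tendsto (fun t : ℝ ↦ 1 / (|t| + δ)) (𝓝[≠] 0) (𝓝 (1 / (|0| + δ))) :=
        (ContinuousAt.div continuousAt_const (by fun_prop) (by simp; exact hδ.ne')).continuousWithinAt.tendsto
      have e : δ / (|0| + δ) ^ 2 = 1 / (|0| + δ) := by simp; field_simp
      rw [e]
      refine this.congr' (eventually_nhdsWithin_of_forall fun t ht ↦ ?_)
      have : t ≠ 0 := ht
      simp; field_simp
    · have h1 : HasDerivAt (fun s : ℝ ↦ s / (s + δ)) (δ / (|s| + δ) ^ 2) s := by
        refine ((hasDerivAt_id s).div ((hasDerivAt_id s).add_const δ) (by simp; linarith)).congr_deriv ?_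
        rw [abs_of_pos hs]; simp
      refine h1.congr_of_eventuallyEq ?_
      filter_upwards [lt_mem_nhds hs] with t ht
      rw [abs_of_pos ht]
  refine ((h.const_sub 1).div_const δ).congr_deriv ?_
  have : |s| + δ ≠ 0 := by positivity
  field_simp
theorem th_cd {δ : ℝ} (hδ : 0 < δ) : ContDiff ℝ 1 (th δ) := by
  rw [contDiff_one_iff_deriv]
  refine ⟨fun s ↦ (th_der hδ s).differentiableAt, ?_⟩
  rw [show deriv (th δ) = fun s ↦ -(1 / (|s| + δ) ^ 2) from funext fun s ↦ (th_der hδ s).deriv]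
  exact (continuous_const.div (by fun_prop) fun s ↦ by positivity).neg
theorem th_bd {δ : ℝ} (hδ : 0 < δ) (s : ℝ) : 0 ≤ th δ s ∧ th δ s ≤ 2 / δ ∧ s * th δ s ≤ 1 := by
  have h0 : 0 < |s| + δ := by positivity
  have h1 : |s / (|s| + δ)| ≤ 1 := by
    rw [abs_div, abs_of_pos h0, div_le_one h0]; linarith
  have h2 := abs_le.1 h1
  refine ⟨div_nonneg (by linarith) hδ.le, div_le_div_of_nonneg_right (by linarith) hδ.le, ?_⟩
  rcases le_or_gt 0 s with hs | hs
  · have : s * th δ s = s / (s + δ) := by rw [th, abs_of_nonneg hs]; field_simp; ring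
    rw [this, div_le_one (by linarith)]; linarith
  · have : 0 ≤ th δ s := div_nonneg (by linarith) hδ.le
    nlinarith
theorem th_nn {δ : ℝ} (hδ : 0 < δ) {s : ℝ} (hs : 0 ≤ s) : th δ s = 1 / (s + δ) := by
  rw [th, abs_of_nonneg hs]; field_simp; ring
theorem th_w {δ : ℝ} (hδ : 0 < δ) (s : ℝ) {w : ℝ} (hw : 0 ≤ w) : (th δ s * (|s| + δ)) ^ 2 ≤ 8 + 8 * (s - w) ^ 2 / δ ^ 2 := by
  have h0 : 0 < |s| + δ := by positivity
  rcases le_or_gt 0 s with hs | hs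
  · rw [th_nn hδ hs, abs_of_nonneg hs, one_div_mul_cancel (by positivity)]
    have : 0 ≤ 8 * (s - w) ^ 2 / δ ^ 2 := by positivity
    linarith
  · have hb := th_bd hδ s
    have h1 : th δ s * (|s| + δ) ≤ 2 + 2 * (|s - w| / δ) := by
      calc _ ≤ 2 / δ * (|s - w| + δ) := by
            refine mul_le_mul hb.2.1 (add_le_add_left ?_ _) h0.le (by positivity)
            rw [abs_of_neg hs, abs_of_neg (by linarith)]; linarith
        _ = _ := by field_simp; ring
    calc _ ≤ (2 + 2 * (|s - w| / δ)) ^ 2 := pow_le_pow_left₀ (mul_nonneg hb.1 h0.le) h1 2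
      _ ≤ 8 + 8 * (|s - w| / δ) ^ 2 := by nlinarith [sq_nonneg (1 - |s - w| / δ)]
      _ = _ := by rw [div_pow, sq_abs]; ring
theorem core_th {χ φ : ℂ → ℝ} (hχ : Core χ) (hφ : Core φ) {δ : ℝ} (hδ : 0 < δ) : Core (fun z ↦ th δ (φ z) * (χ z * χ z)) :=
  (hχ.mul hχ.cd).mul ((th_cd hδ).comp hφ.cd)
theorem gr_th {χ φ : ℂ → ℝ} (hχ : Core χ) (hφ : Core φ) {δ : ℝ} (hδ : 0 < δ) (z : ℂ) :
    gr (fun z ↦ th δ (φ z) * (χ z * χ z)) z = ((2 * χ z * th δ (φ z) : ℝ) : ℂ) * gr χ z - ((χ z ^ 2 / (|φ z| + δ) ^ 2 : ℝ) : ℂ) * gr φ z := by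
  rw [gr_mul (φ := fun z ↦ th δ (φ z)) (((th_cd hδ).comp hφ.cd).differentiable one_ne_zero z) ((hχ.mul hχ.cd).diff z), gr_mul (hχ.diff z) (hχ.diff z), gr_comp (th_der hδ _) (hφ.diff z)]
  push_cast; ring
theorem pt_th {χ φ w δ N s : ℝ} (hδ : 0 < δ) (hχ : |χ| ≤ 1) (hw : 0 ≤ w) (hs0 : 0 ≤ s) (hs : s ≤ 1) {a b : ℂ} {G : ℝ} (hG : ‖b‖ ≤ G) :
    N ^ 2 * (φ * (th δ φ * (χ * χ))) + inner ℝ ((s:ℂ) * a) ((s:ℂ) * (((2 * χ * th δ φ : ℝ) : ℂ) * b - ((χ ^ 2 / (|φ| + δ) ^ 2 : ℝ) : ℂ) * a)) ≤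
      N ^ 2 - 1 / 2 * (χ ^ 2 / (|φ| + δ) ^ 2 * ‖(s:ℂ) * a‖ ^ 2) + 16 * G ^ 2 + 16 * G ^ 2 * (φ - w) ^ 2 / δ ^ 2 := by
  have hD : 0 < |φ| + δ := by positivity
  have hb := th_bd hδ φ
  have hχ2 : χ * χ ≤ 1 := by rw [← abs_mul_abs_self]; nlinarith [abs_nonneg χ]
  have h1 : φ * (th δ φ * (χ * χ)) ≤ 1 := by nlinarith [mul_self_nonneg χ]
  have e1 : inner ℝ ((s:ℂ) * a) ((s:ℂ) * (((2 * χ * th δ φ : ℝ) : ℂ) * b - ((χ ^ 2 / (|φ| + δ) ^ 2 : ℝ) : ℂ) * a)) =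
      2 * (s * (χ / (|φ| + δ))) * (s * (th δ φ * (|φ| + δ))) * inner ℝ a b - χ ^ 2 / (|φ| + δ) ^ 2 * (s ^ 2 * ‖a‖ ^ 2) := by
    have : ∀ r : ℝ, ∀ c : ℂ, ((r:ℂ) * c) = r • c := fun r c ↦ (Complex.real_smul).symm
    simp only [this, inner_sub_right, real_inner_smul_left, real_inner_smul_right, real_inner_self_eq_norm_sq]
    field_simp
  have e2 : ‖(s:ℂ) * a‖ ^ 2 = s ^ 2 * ‖a‖ ^ 2 := by rw [norm_mul, Complex.norm_real, mul_pow, Real.norm_eq_abs, sq_abs]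
  rw [e1, e2]
  set p := s * (χ / (|φ| + δ))
  set r := s * (th δ φ * (|φ| + δ)) with hr
  have h3 : r ^ 2 ≤ 8 + 8 * (φ - w) ^ 2 / δ ^ 2 := by
    refine le_trans ?_ (th_w hδ φ hw)
    rw [hr, mul_pow]
    exact mul_le_of_le_one_left (sq_nonneg _) (pow_le_one₀ hs0 hs)
  have h4 : 2 * p * r * inner ℝ a b ≤ 1 / 2 * (p ^ 2 * ‖a‖ ^ 2) + 2 * (r ^ 2 * G ^ 2) := by
    have h5 : |inner ℝ a b| ≤ ‖a‖ * G := (abs_real_inner_le_norm a b).trans (mul_le_mul_of_nonneg_left hG (norm_nonneg _))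
    have h6 : 2 * p * r * inner ℝ a b ≤ 2 * (|p| * |r|) * (‖a‖ * G) := by
      refine (le_abs_self _).trans ?_
      rw [abs_mul, abs_mul, abs_mul, abs_two, mul_assoc 2]
      gcongr
    have h7 : 2 * (|p| * |r|) * (‖a‖ * G) ≤ 1 / 2 * (|p| ^ 2 * ‖a‖ ^ 2) + 2 * (|r| ^ 2 * G ^ 2) := by
      nlinarith [sq_nonneg (|p| * ‖a‖ - 2 * |r| * G)]
    rw [sq_abs, sq_abs] at h7; linarith
  have h8 : p ^ 2 * ‖a‖ ^ 2 = χ ^ 2 / (|φ| + δ) ^ 2 * (s ^ 2 * ‖a‖ ^ 2) := by simp only [p]; field_simp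
  have h9 : 2 * (r ^ 2 * G ^ 2) ≤ 16 * G ^ 2 + 16 * G ^ 2 * (φ - w) ^ 2 / δ ^ 2 := by
    calc _ ≤ 2 * ((8 + 8 * (φ - w) ^ 2 / δ ^ 2) * G ^ 2) := by gcongr
      _ = _ := by ring
  nlinarith [sq_nonneg N]
end Heis
namespace Heis
theorem posT {k : ℕ} {kk : ℂ → ℝ} (hm : AEStronglyMeasurable kk (bet k)) {Ck : ℝ} (hCk : ∀ z, |kk z| ≤ Ck) {x : VV k} (hx : x ∈ HH k)
    (hw : ∀ᵐ z ∂bet k, 0 ≤ wf x z) (hs : ∀ y ∈ HH k, inner ℝ x y = ∫ z, kk z * (wf x z ^ qq k * wf y z) ∂bet k)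
    (φ : ℕ → ℂ → ℝ) (hφ : ∀ j, Core (φ j)) (hφx : Tendsto (fun j ↦ emb k (φ j) (hφ j)) atTop (𝓝 x))
    (hae : ∀ᵐ z ∂(bet k), Tendsto (fun j ↦ φ j z) atTop (𝓝 (wf x z))) {χ : ℂ → ℝ} (hχ : Core χ) (hχ1 : ∀ z, |χ z| ≤ 1) :
    ∃ C : ℝ, ∀ δ > 0, ∀ᶠ j in atTop, ∫ z, χ z ^ 2 / (|φ j z| + δ) ^ 2 * ‖(sf z : ℂ) * gr (φ j) z‖ ^ 2 ∂bet k ≤ C := by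
  obtain ⟨G, hG⟩ := hχ.grc.bounded_above_of_compact_support hχ.grs
  have hq := qq_gt k
  have hCk0 : 0 ≤ Ck := (abs_nonneg _).trans (hCk 0)
  have hN := NN_pos k
  have hχ2 : ∀ z, χ z * χ z ≤ 1 := fun z ↦ by rw [← abs_mul_abs_self]; nlinarith [abs_nonneg (χ z), hχ1 z]
  set I := ∫ z, (1 + |wf x z| ^ pp k) ∂bet k
  have iI : Integrable (fun z ↦ 1 + |wf x z| ^ pp k) (bet k) := (integrable_const 1).add (wp_int hx)
  set C0 := (NN k ^ 2 + 16 * G ^ 2) * BB k + Ck * I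
  refine ⟨2 * (C0 + 1), fun δ hδ ↦ ?_⟩
  set ψ : ∀ j, Core (fun z ↦ th δ (φ j z) * (χ z * χ z)) := fun j ↦ core_th hχ (hφ j) hδ
  set L := ∫ z, kk z * (wf x z ^ qq k * (th δ (wf x z) * (χ z * χ z))) ∂bet k
  have hpow : ∀ r : ℝ, 0 ≤ r → ∀ e, 0 ≤ e → e ≤ pp k → r ^ e ≤ 1 + |r| ^ pp k := fun r hr e he0 he ↦ by
    rw [abs_of_nonneg hr]
    have : 0 ≤ r ^ pp k := by positivity
    rcases le_or_gt r 1 with h | h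
    · linarith [Real.rpow_le_one hr h he0]
    · linarith [Real.rpow_le_rpow_of_exponent_le h.le he]
  have hL : Tendsto (fun j ↦ inner ℝ x (emb k _ (ψ j))) atTop (𝓝 L) := by
    have e : ∀ j, inner ℝ x (emb k _ (ψ j)) = ∫ z, kk z * (wf x z ^ qq k * (th δ (φ j z) * (χ z * χ z))) ∂bet k := fun j ↦ by
      rw [hs _ (emb_HH (ψ j))]
      refine integral_congr_ae ?_
      filter_upwards [emb_w k (ψ j)] with z hz; rw [hz]
    simp only [e]
    have hmw : AEStronglyMeasurable (fun z ↦ wf x z ^ qq k) (bet k) := ((wf_mem x).1.aemeasurable.pow_const _).aestronglyMeasurable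
    refine tendsto_integral_of_dominated_convergence (fun z ↦ Ck * ((1 + |wf x z| ^ pp k) * (2 / δ))) (fun j ↦ hm.mul (hmw.mul (ψ j).cont.aestronglyMeasurable)) ((iI.mul_const _).const_mul _) (fun j ↦ ?_) ?_
    · filter_upwards [hw] with z hz
      have hb := th_bd hδ (φ j z)
      rw [norm_mul, norm_mul, Real.norm_eq_abs, Real.norm_of_nonneg (by positivity), Real.norm_of_nonneg (mul_nonneg hb.1 (mul_self_nonneg _))]
      have h1 := hpow _ hz (qq k) (by linarith) (by rw [pp_qq]; linarith)
      have h2 : th δ (φ j z) * (χ z * χ z) ≤ 2 / δ := by nlinarith [hχ2 z, hb.1, hb.2.1]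
      have h3 := hCk z
      have h4 := mul_nonneg hb.1 (mul_self_nonneg (χ z))
      gcongr
    · filter_upwards [hae] with z hz
      exact ((((th_cd hδ).continuous.tendsto _).comp hz).mul_const _).const_mul _ |>.const_mul _
  have hLb : -L ≤ Ck * I := by
    rw [← integral_const_mul]
    refine (neg_le_abs _).trans (abs_integral_le_integral_abs.trans (integral_mono_of_nonneg (Eventually.of_forall fun z ↦ abs_nonneg _) (iI.const_mul _) ?_))
    filter_upwards [hw] with z hz
    have h0 : 0 ≤ th δ (wf x z) := (th_bd hδ _).1
    rw [abs_mul]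
    refine mul_le_mul (hCk z) ?_ (abs_nonneg _) hCk0
    rw [abs_of_nonneg (mul_nonneg (by positivity) (mul_nonneg h0 (mul_self_nonneg _)))]
    refine le_trans ?_ (hpow _ hz (qq k - 1) (by linarith) (by rw [pp_qq]; linarith))
    rw [th_nn hδ hz]
    rcases hz.eq_or_lt with h | h
    · rw [← h, Real.zero_rpow (by linarith : qq k ≠ 0), zero_mul]; positivity
    · calc wf x z ^ qq k * (1 / (wf x z + δ) * (χ z * χ z)) ≤ wf x z ^ qq k * (1 / wf x z * 1) := by
            have := hχ2 z
            have := mul_self_nonneg (χ z)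
            have : 1 / (wf x z + δ) ≤ 1 / wf x z := one_div_le_one_div_of_le h (by linarith)
            gcongr
        _ = _ := by rw [Real.rpow_sub_one h.ne']; ring
  have hnb : ∃ A, ∀ j, ‖emb k (φ j) (hφ j)‖ ≤ A := by
    obtain ⟨A, hA⟩ := hφx.norm.bddAbove_range
    exact ⟨A, fun j ↦ hA ⟨j, rfl⟩⟩
  obtain ⟨A, hA⟩ := hnb
  have hgi : ∀ j, Integrable (fun z ↦ ‖(sf z : ℂ) * gr (φ j) z‖ ^ 2) (bet k) := fun j ↦ ((hφ j).mG k).integrable_norm_pow two_ne_zero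
  have hgA : ∀ j, ∫ z, ‖(sf z : ℂ) * gr (φ j) z‖ ^ 2 ∂bet k ≤ A ^ 2 := fun j ↦ by
    have h1 := norm_emb (k := k) (hφ j)
    have h2 : 0 ≤ ∫ z, φ j z ^ 2 ∂bet k := integral_nonneg fun z ↦ sq_nonneg _
    have h3 : ‖emb k (φ j) (hφ j)‖ ^ 2 ≤ A ^ 2 := pow_le_pow_left₀ (norm_nonneg _) (hA j) 2
    nlinarith [mul_nonneg (sq_nonneg (NN k)) h2]
  set B2 := NN k ^ 2 * ((2 / δ) ^ 2 * BB k) + (2 * (4 / δ * G) ^ 2 * BB k + 2 * (1 / δ ^ 2) ^ 2 * A ^ 2)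
  have hψn : ∀ j, ‖emb k _ (ψ j)‖ ^ 2 ≤ B2 := fun j ↦ by
    rw [norm_emb]
    have hc : ∀ c : ℝ, ∫ _, c ∂bet k = c * BB k := fun c ↦ by simp [BB, mul_comm]
    refine add_le_add (mul_le_mul_of_nonneg_left ?_ (sq_nonneg _)) ?_
    · rw [← hc]
      refine integral_mono ((memLp_cs (ψ j).cont (ψ j).cpt k 2).integrable_sq) (integrable_const _) fun z ↦ ?_
      have hb := th_bd hδ (φ j z)
      refine pow_le_pow_left₀ (mul_nonneg hb.1 (mul_self_nonneg _)) ?_ 2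
      nlinarith [hχ2 z, hb.1, hb.2.1]
    · have h1 : ∫ z, ‖(sf z : ℂ) * gr (fun z ↦ th δ (φ j z) * (χ z * χ z)) z‖ ^ 2 ∂bet k ≤ ∫ z, (2 * (4 / δ * G) ^ 2 + 2 * (1 / δ ^ 2) ^ 2 * ‖(sf z : ℂ) * gr (φ j) z‖ ^ 2) ∂bet k := by
        refine integral_mono (((ψ j).mG k).integrable_norm_pow two_ne_zero) ((integrable_const _).add ((hgi j).const_mul _)) fun z ↦ ?_
        have hb := th_bd hδ (φ j z)
        have h2 : ‖(sf z : ℂ) * gr (fun z ↦ th δ (φ j z) * (χ z * χ z)) z‖ ≤ 4 / δ * G + 1 / δ ^ 2 * ‖(sf z : ℂ) * gr (φ j) z‖ := by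
          rw [gr_th hχ (hφ j) hδ, mul_sub, mul_left_comm, mul_left_comm (sf z : ℂ)]
          refine (norm_sub_le _ _).trans (add_le_add ?_ ?_)
          · rw [norm_mul, norm_mul, Complex.norm_real, Complex.norm_real, Real.norm_of_nonneg (sf_nn z), Real.norm_eq_abs, abs_mul, abs_mul, abs_two, abs_of_nonneg hb.1]
            have h3 : 2 * |χ z| * th δ (φ j z) ≤ 4 / δ := by
              calc _ ≤ 2 * 1 * (2 / δ) := by have := hχ1 z; have := hb.2.1; have := hb.1; gcongr
                _ = _ := by ring
            have h4 : sf z * ‖gr χ z‖ ≤ G := (mul_le_of_le_one_left (norm_nonneg _) (sf_le z)).trans (hG z)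
            exact mul_le_mul h3 h4 (mul_nonneg (sf_nn z) (norm_nonneg _)) (by positivity)
          · rw [norm_mul, Complex.norm_real, Real.norm_of_nonneg (by positivity)]
            refine mul_le_mul_of_nonneg_right ?_ (norm_nonneg _)
            have : χ z ^ 2 ≤ 1 := by rw [sq]; exact hχ2 z
            gcongr
            linarith [abs_nonneg (φ j z)]
        calc _ ≤ (4 / δ * G + 1 / δ ^ 2 * ‖(sf z : ℂ) * gr (φ j) z‖) ^ 2 := pow_le_pow_left₀ (norm_nonneg _) h2 2
          _ ≤ _ := by nlinarith [sq_nonneg (4 / δ * G - 1 / δ ^ 2 * ‖(sf z : ℂ) * gr (φ j) z‖)]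
      refine h1.trans ?_
      rw [integral_add (integrable_const _) ((hgi j).const_mul _), hc, integral_const_mul]
      have := hgA j
      gcongr
  have hB2 : 0 ≤ B2 := (sq_nonneg _).trans (hψn 0)
  have iT : ∀ j, Integrable (fun z ↦ χ z ^ 2 / (|φ j z| + δ) ^ 2 * ‖(sf z : ℂ) * gr (φ j) z‖ ^ 2) (bet k) := fun j ↦ by
    refine (hgi j).bdd_mul (c := 1 / δ ^ 2) ?_ (Eventually.of_forall fun z ↦ ?_)
    · exact (Continuous.div (hχ.cont.pow 2) ((((hφ j).cont.abs).add continuous_const).pow 2) fun z ↦ (pow_pos (by positivity : 0 < |φ j z| + δ) 2).ne').aestronglyMeasurable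
    · rw [Real.norm_of_nonneg (by positivity)]
      have : χ z ^ 2 ≤ 1 := by rw [sq]; exact hχ2 z
      gcongr
      linarith [abs_nonneg (φ j z)]
  have hmain : ∀ j, 1 / 2 * ∫ z, χ z ^ 2 / (|φ j z| + δ) ^ 2 * ‖(sf z : ℂ) * gr (φ j) z‖ ^ 2 ∂bet k ≤
      (NN k ^ 2 + 16 * G ^ 2) * BB k + 16 * G ^ 2 / δ ^ 2 * (‖emb k (φ j) (hφ j) - x‖ ^ 2 / NN k ^ 2) + ‖emb k (φ j) (hφ j) - x‖ * √B2 - inner ℝ x (emb k _ (ψ j)) := fun j ↦ by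
    have i1 : Integrable (fun z ↦ φ j z * (th δ (φ j z) * (χ z * χ z))) (bet k) :=
      mm (memLp_cs (hφ j).cont (hφ j).cpt k 2) (memLp_cs (ψ j).cont (ψ j).cpt k 2)
    have i2 : Integrable (fun z ↦ inner ℝ ((sf z : ℂ) * gr (φ j) z) ((sf z : ℂ) * gr (fun z ↦ th δ (φ j z) * (χ z * χ z)) z)) (bet k) :=
      (L2.integrable_inner (𝕜 := ℝ) (((hφ j).mG k).toLp _) (((ψ j).mG k).toLp _)).congr (by
        filter_upwards [((hφ j).mG k).coeFn_toLp, ((ψ j).mG k).coeFn_toLp] with z h1 h2; rw [h1, h2])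
    have i3 : Integrable (fun z ↦ (φ j z - wf x z) ^ 2) (bet k) := ((memLp_cs (hφ j).cont (hφ j).cpt k 2).sub (wf_mem x)).integrable_sq
    have e1 : inner ℝ (emb k (φ j) (hφ j)) (emb k _ (ψ j)) = ∫ z, (NN k ^ 2 * (φ j z * (th δ (φ j z) * (χ z * χ z))) + inner ℝ ((sf z : ℂ) * gr (φ j) z) ((sf z : ℂ) * gr (fun z ↦ th δ (φ j z) * (χ z * χ z)) z)) ∂bet k := by
      rw [integral_add (i1.const_mul _) i2, integral_const_mul, inner_emb]
      congr 1
      · congr 1; refine integral_congr_ae ?_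
        filter_upwards [emb_w k (hφ j)] with z hz; rw [hz]
      · refine integral_congr_ae ?_
        filter_upwards [emb_g k (hφ j)] with z hz; rw [hz]
    have iR : Integrable (fun z ↦ NN k ^ 2 - 1 / 2 * (χ z ^ 2 / (|φ j z| + δ) ^ 2 * ‖(sf z : ℂ) * gr (φ j) z‖ ^ 2) + 16 * G ^ 2 + 16 * G ^ 2 / δ ^ 2 * (φ j z - wf x z) ^ 2) (bet k) :=
      (((integrable_const _).sub ((iT j).const_mul _)).add (integrable_const _)).add (i3.const_mul _)
    have e2 := integral_mono_ae ((i1.const_mul _).add i2) iR (by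
      filter_upwards [hw] with z hz
      have := pt_th (N := NN k) (φ := φ j z) hδ (hχ1 z) hz (sf_nn z) (sf_le z) (a := gr (φ j) z) (hG z)
      simp only [Pi.add_apply, gr_th hχ (hφ j) hδ]
      refine this.trans (le_of_eq ?_); ring)
    simp only [Pi.add_apply] at e2
    rw [← e1, integral_add (by exact ((integrable_const _).sub ((iT j).const_mul _)).add (integrable_const _)) (i3.const_mul _), integral_add (by exact (integrable_const _).sub ((iT j).const_mul _)) (integrable_const _), integral_sub (integrable_const _) ((iT j).const_mul _), integral_const_mul (1 / 2 : ℝ), integral_const_mul (16 * G ^ 2 / δ ^ 2)] at e2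
    simp only [integral_const, smul_eq_mul] at e2
    change _ ≤ BB k * _ - _ + BB k * _ + _ at e2
    have e3 : ∫ z, (φ j z - wf x z) ^ 2 ∂bet k ≤ ‖emb k (φ j) (hφ j) - x‖ ^ 2 / NN k ^ 2 := by
      rw [le_div_iff₀ (by positivity), mul_comm]
      refine le_trans (le_of_eq ?_) (wsq_le _)
      congr 1; refine integral_congr_ae ?_
      filter_upwards [emb_w k (hφ j), wf_sub (emb k (φ j) (hφ j)) x] with z h1 h2; rw [h2, h1]
    have e4 : -inner ℝ (emb k (φ j) (hφ j)) (emb k _ (ψ j)) ≤ ‖emb k (φ j) (hφ j) - x‖ * √B2 - inner ℝ x (emb k _ (ψ j)) := by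
      have h1 : inner ℝ (emb k (φ j) (hφ j)) (emb k _ (ψ j)) = inner ℝ (emb k (φ j) (hφ j) - x) (emb k _ (ψ j)) + inner ℝ x (emb k _ (ψ j)) := by
        rw [inner_sub_left]; ring
      have h2 := abs_real_inner_le_norm (emb k (φ j) (hφ j) - x) (emb k _ (ψ j))
      have h3 : ‖emb k _ (ψ j)‖ ≤ √B2 := Real.le_sqrt_of_sq_le (hψn j)
      have h4 := mul_le_mul_of_nonneg_left h3 (norm_nonneg (emb k (φ j) (hφ j) - x))
      rw [h1]; linarith [neg_abs_le (inner ℝ (emb k (φ j) (hφ j) - x) (emb k _ (ψ j)))]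
    have e5 : 16 * G ^ 2 / δ ^ 2 * ∫ z, (φ j z - wf x z) ^ 2 ∂bet k ≤ 16 * G ^ 2 / δ ^ 2 * (‖emb k (φ j) (hφ j) - x‖ ^ 2 / NN k ^ 2) := by gcongr
    linarith
  have h0 : Tendsto (fun j ↦ ‖emb k (φ j) (hφ j) - x‖) atTop (𝓝 0) := tendsto_iff_norm_sub_tendsto_zero.1 hφx
  have hlim := (((((h0.pow 2).div_const (NN k ^ 2)).const_mul (16 * G ^ 2 / δ ^ 2)).const_add ((NN k ^ 2 + 16 * G ^ 2) * BB k)).add (h0.mul_const √B2)).sub hL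
  have hlt : (NN k ^ 2 + 16 * G ^ 2) * BB k + 16 * G ^ 2 / δ ^ 2 * (0 ^ 2 / NN k ^ 2) + 0 * √B2 - L < C0 + 1 := by
    simp only [C0]; norm_num; linarith
  filter_upwards [hlim.eventually (gt_mem_nhds hlt)] with j hj
  linarith [hmain j]
end Heis
namespace Heis
theorem wf_sm {k : ℕ} (x : VV k) : StronglyMeasurable (wf x) := ((Lp.stronglyMeasurable x.fst).measurable.div_const _).stronglyMeasurable
theorem gr_ars {φ : ℂ → ℝ} (hφ : Core φ) {δ : ℝ} (hδ : 0 < δ) (z : ℂ) : ‖gr (fun z ↦ Real.arsinh (φ z / δ)) z‖ ^ 2 ≤ 2 / (|φ z| + δ) ^ 2 * ‖gr φ z‖ ^ 2 := by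
  have h1 : HasDerivAt (fun s : ℝ ↦ Real.arsinh (s / δ)) ((√(1 + (φ z / δ) ^ 2))⁻¹ * (1 / δ)) (φ z) :=
    HasDerivAt.comp (h₂ := Real.arsinh) (φ z) (Real.hasDerivAt_arsinh (φ z / δ)) ((hasDerivAt_id _).div_const δ)
  rw [gr_comp (g := fun s : ℝ ↦ Real.arsinh (s / δ)) h1 (hφ.diff z), norm_mul, mul_pow, Complex.norm_real, Real.norm_of_nonneg (by positivity)]
  refine mul_le_mul_of_nonneg_right ?_ (sq_nonneg _)
  rw [mul_pow, inv_pow, Real.sq_sqrt (by positivity)]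
  have e : (1 + (φ z / δ) ^ 2)⁻¹ * (1 / δ) ^ 2 = 1 / (δ ^ 2 + φ z ^ 2) := by field_simp
  rw [e, div_le_div_iff₀ (by positivity) (by positivity), one_mul]
  nlinarith [sq_nonneg (|φ z| - δ), sq_abs (φ z)]
theorem pos_ball {k : ℕ} {kk : ℂ → ℝ} (hm : AEStronglyMeasurable kk (bet k)) {Ck : ℝ} (hCk : ∀ z, |kk z| ≤ Ck) {x : VV k} (hx : x ∈ HH k)
    (hw : ∀ᵐ z ∂bet k, 0 ≤ wf x z) (hs : ∀ y ∈ HH k, inner ℝ x y = ∫ z, kk z * (wf x z ^ qq k * wf y z) ∂bet k)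
    {R : ℝ} (hR0 : 0 < R) (hR : R < 1) : (∀ᵐ z ∂volume.restrict (Metric.ball (0:ℂ) R), wf x z ≠ 0) ∨ (∀ᵐ z ∂volume.restrict (Metric.ball (0:ℂ) R), wf x z ≤ 0) := by
  obtain ⟨φ, hφ, hφx, hae⟩ := HH_seq_ae hx
  obtain ⟨χ, hχ, -, h01, h1⟩ := exists_cut R hR
  obtain ⟨C, hC⟩ := posT hm hCk hx hw hs φ hφ hφx hae hχ (fun z ↦ abs_le.2 ⟨by linarith [(h01 z).1], (h01 z).2⟩)
  set B := Metric.ball (0:ℂ) R with hB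
  have hBD : B ⊆ DD := Metric.ball_subset_ball hR.le
  set μ := volume.restrict B
  set c := 1 - R ^ 2
  have hc : 0 < c := by simp only [c]; nlinarith
  have hμ : ∀ F : ℂ → ENNReal, Measurable F → ∫⁻ z, F z ∂μ ≤ ENNReal.ofReal ((c ^ k)⁻¹) * ∫⁻ z in B, F z ∂bet k := fun F hF ↦ by
    rw [bet, restrict_withDensity measurableSet_ball, Measure.restrict_restrict measurableSet_ball, Set.inter_eq_left.2 hBD,
      lintegral_withDensity_eq_lintegral_mul _ (by have := fD_cont; fun_prop) hF, ← lintegral_const_mul _ (by have := fD_cont; fun_prop)]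
    refine setLIntegral_mono' measurableSet_ball fun z hz ↦ ?_
    rw [Pi.mul_apply, ← mul_assoc, ← ENNReal.ofReal_mul (by positivity)]
    refine le_mul_of_one_le_left' ?_
    rw [ENNReal.one_le_ofReal, inv_mul_eq_div, one_le_div (by positivity)]
    rw [hB, Metric.mem_ball, dist_zero_right] at hz
    have : c ≤ fD z := by simp only [c, fD]; nlinarith [norm_nonneg z]
    gcongr
  set K : ENNReal := 16 * volume B * (ENNReal.ofReal ((c ^ k)⁻¹) * ENNReal.ofReal (2 / c * C))
  have hK : K ≠ ⊤ := ENNReal.mul_ne_top (ENNReal.mul_ne_top (by norm_num) measure_ball_lt_top.ne) (ENNReal.mul_ne_top ENNReal.ofReal_ne_top ENNReal.ofReal_ne_top)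
  have hμae : ∀ᵐ z ∂μ, Tendsto (fun j ↦ φ j z) atTop (𝓝 (wf x z)) := by
    rw [bet_ae] at hae; exact ae_restrict_of_ae_restrict_of_subset hBD hae
  have hP : ∀ δ > 0, ∫⁻ a, ∫⁻ b, ENNReal.ofReal ((Real.arsinh (wf x a / δ) - Real.arsinh (wf x b / δ)) ^ 2) ∂μ ∂μ ≤ K := fun δ hδ ↦ by
    have hcd : ∀ j, ContDiff ℝ 1 fun z ↦ Real.arsinh (φ j z / δ) := fun j ↦ Real.contDiff_arsinh.comp ((hφ j).cd.div_const δ)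
    have hj : ∀ᶠ j in atTop, ∫⁻ a, ∫⁻ b, ENNReal.ofReal ((Real.arsinh (φ j a / δ) - Real.arsinh (φ j b / δ)) ^ 2) ∂μ ∂μ ≤ K := by
      filter_upwards [hC δ hδ] with j hj
      refine (poin (hcd j) R hR.le).trans (mul_le_mul_right ((hμ _ ?_).trans (mul_le_mul_right ?_ _)) _)
      · have := gr_cont (hcd j); fun_prop
      · have hTc : Continuous fun z ↦ χ z ^ 2 / (|φ j z| + δ) ^ 2 * ‖(sf z : ℂ) * gr (φ j) z‖ ^ 2 := by
          refine ((hχ.cont.pow 2).div ((((hφ j).cont.abs).add continuous_const).pow 2) fun z ↦ (pow_pos (by positivity : 0 < |φ j z| + δ) 2).ne').mul ?_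
          have := sf_cont; have := (hφ j).grc; fun_prop
        have hTi : Integrable (fun z ↦ χ z ^ 2 / (|φ j z| + δ) ^ 2 * ‖(sf z : ℂ) * gr (φ j) z‖ ^ 2) (bet k) := by
          refine memLp_one_iff_integrable.1 (memLp_cs hTc ?_ k 1)
          refine hχ.cpt.mono fun z hz h0 ↦ hz ?_
          simp [h0]
        calc _ ≤ ∫⁻ z in B, ENNReal.ofReal (2 / c * (χ z ^ 2 / (|φ j z| + δ) ^ 2 * ‖(sf z : ℂ) * gr (φ j) z‖ ^ 2)) ∂bet k := by
              refine setLIntegral_mono' measurableSet_ball fun z hz ↦ ENNReal.ofReal_le_ofReal ((gr_ars (hφ j) hδ z).trans ?_)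
              have hzD := hBD hz
              rw [hB, Metric.mem_ball, dist_zero_right] at hz
              have : c ≤ fD z := by simp only [c, fD]; nlinarith [norm_nonneg z]
              rw [h1 z hz.le, norm_mul, mul_pow, Complex.norm_real, Real.norm_eq_abs, sq_abs, sf_sq hzD]
              have e : 2 / c * (1 ^ 2 / (|φ j z| + δ) ^ 2 * (fD z * ‖gr (φ j) z‖ ^ 2)) = fD z / c * (2 / (|φ j z| + δ) ^ 2 * ‖gr (φ j) z‖ ^ 2) := by field_simp
              rw [e]
              exact le_mul_of_one_le_left (by positivity) ((one_le_div hc).2 this)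
          _ ≤ ∫⁻ z, ENNReal.ofReal (2 / c * (χ z ^ 2 / (|φ j z| + δ) ^ 2 * ‖(sf z : ℂ) * gr (φ j) z‖ ^ 2)) ∂bet k := setLIntegral_le_lintegral _ _
          _ ≤ _ := by
              rw [← ofReal_integral_eq_lintegral_ofReal (hTi.const_mul _) (Eventually.of_forall fun z ↦ by positivity), integral_const_mul]
              exact ENNReal.ofReal_le_ofReal (mul_le_mul_of_nonneg_left hj (by positivity))
    have hcj : ∀ j, Continuous fun p : ℂ × ℂ ↦ (Real.arsinh (φ j p.1 / δ) - Real.arsinh (φ j p.2 / δ)) ^ 2 := fun j ↦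
      (((hcd j).continuous.comp continuous_fst).sub ((hcd j).continuous.comp continuous_snd)).pow 2
    have hinn : ∀ᵐ a ∂μ, ∫⁻ b, ENNReal.ofReal ((Real.arsinh (wf x a / δ) - Real.arsinh (wf x b / δ)) ^ 2) ∂μ ≤
        liminf (fun j ↦ ∫⁻ b, ENNReal.ofReal ((Real.arsinh (φ j a / δ) - Real.arsinh (φ j b / δ)) ^ 2) ∂μ) atTop := by
      filter_upwards [hμae] with a ha
      refine le_trans (lintegral_mono_ae ?_) (lintegral_liminf_le' (u := atTop (α := ℕ)) (f := fun (j:ℕ) b ↦ ENNReal.ofReal ((Real.arsinh (φ j a / δ) - Real.arsinh (φ j b / δ)) ^ 2)) fun j ↦ ?_)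
      · filter_upwards [hμae] with b hb
        have t : Tendsto (fun j ↦ ENNReal.ofReal ((Real.arsinh (φ j a / δ) - Real.arsinh (φ j b / δ)) ^ 2)) atTop (𝓝 (ENNReal.ofReal ((Real.arsinh (wf x a / δ) - Real.arsinh (wf x b / δ)) ^ 2))) :=
          (ENNReal.continuous_ofReal.tendsto _).comp ((((Real.continuous_arsinh.tendsto _).comp (ha.div_const δ)).sub ((Real.continuous_arsinh.tendsto _).comp (hb.div_const δ))).pow 2)
        exact t.liminf_eq.ge
      · exact (ENNReal.continuous_ofReal.comp ((hcj j).comp (by fun_prop : Continuous fun b : ℂ ↦ (a, b)))).measurable.aemeasurable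
    refine (lintegral_mono_ae hinn).trans ((lintegral_liminf_le' (u := atTop (α := ℕ)) fun j ↦ ?_).trans ?_)
    · exact (Measurable.lintegral_prod_right' (ENNReal.continuous_ofReal.comp (hcj j)).measurable).aemeasurable
    · exact liminf_le_of_frequently_le' hj.frequently
  by_cases hZ : μ {z | wf x z = 0} = 0
  · left; rw [ae_iff]; simpa using hZ
  right
  have hset : ∀ η > 0, μ {z | η ≤ wf x z} = 0 := fun η hη ↦ by
    by_contra hne
    have hZm : MeasurableSet {z | wf x z = 0} := (wf_sm x).measurable (measurableSet_singleton 0)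
    have hEm : MeasurableSet {z | η ≤ wf x z} := (wf_sm x).measurable measurableSet_Ici
    have hlow : ∀ δ > 0, ENNReal.ofReal (Real.arsinh (η / δ) ^ 2) * (μ {z | wf x z = 0} * μ {z | η ≤ wf x z}) ≤ K := fun δ hδ ↦ by
      refine le_trans ?_ (hP δ hδ)
      calc ENNReal.ofReal (Real.arsinh (η / δ) ^ 2) * (μ {z | wf x z = 0} * μ {z | η ≤ wf x z})
          = ∫⁻ a in {z | wf x z = 0}, (ENNReal.ofReal (Real.arsinh (η / δ) ^ 2) * μ {z | η ≤ wf x z}) ∂μ := by rw [setLIntegral_const]; ring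
        _ ≤ ∫⁻ a in {z | wf x z = 0}, ∫⁻ b, ENNReal.ofReal ((Real.arsinh (wf x a / δ) - Real.arsinh (wf x b / δ)) ^ 2) ∂μ ∂μ := by
            refine setLIntegral_mono' hZm fun a ha ↦ ?_
            rw [← setLIntegral_const]
            refine le_trans (setLIntegral_mono' hEm fun b hb ↦ ?_) (setLIntegral_le_lintegral _ _)
            have ha' : wf x a = 0 := ha
            have hb' : η ≤ wf x b := hb
            rw [ha', zero_div, Real.arsinh_zero, zero_sub, neg_sq]
            refine ENNReal.ofReal_le_ofReal (pow_le_pow_left₀ (Real.arsinh_nonneg_iff.2 (by positivity)) (Real.arsinh_le_arsinh.2 ?_) 2)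
            gcongr
        _ ≤ _ := setLIntegral_le_lintegral _ _
    set V := μ {z | wf x z = 0} * μ {z | η ≤ wf x z}
    have hV : V ≠ 0 := mul_ne_zero hZ hne
    have hlt : K / V < ⊤ := ENNReal.div_lt_top hK hV
    obtain ⟨r, hr⟩ := ENNReal.lt_iff_exists_nnreal_btwn.1 hlt
    have hδ : 0 < η / Real.sinh ((r:ℝ) + 1) := div_pos hη (Real.sinh_pos_iff.2 (by positivity))
    have h2 := hlow _ hδ
    rw [div_div_cancel₀ hη.ne', Real.arsinh_sinh] at h2
    have hVt : V ≠ ⊤ := by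
      have hf : μ Set.univ ≠ ⊤ := by rw [Measure.restrict_apply_univ]; exact measure_ball_lt_top.ne
      exact ENNReal.mul_ne_top (ne_top_of_le_ne_top hf (measure_mono (Set.subset_univ _))) (ne_top_of_le_ne_top hf (measure_mono (Set.subset_univ _)))
    rw [← ENNReal.le_div_iff_mul_le (Or.inl hV) (Or.inl hVt)] at h2
    have h3 := h2.trans_lt hr.1
    rw [← ENNReal.ofReal_coe_nnreal, ENNReal.ofReal_lt_ofReal_iff'] at h3
    have : (0:ℝ) ≤ r := r.2
    nlinarith [h3.1]
  have hun : {z | ¬ wf x z ≤ 0} ⊆ ⋃ m : ℕ, {z | 1 / ((m:ℝ) + 1) ≤ wf x z} := fun z hz ↦ by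
    have hz' : 0 < wf x z := not_le.1 hz
    obtain ⟨m, hm⟩ := exists_nat_one_div_lt hz'
    exact Set.mem_iUnion.2 ⟨m, hm.le⟩
  rw [ae_iff]
  exact measure_mono_null hun (measure_iUnion_null fun m ↦ hset _ (by positivity))
theorem solD {k : ℕ} {kk : ℂ → ℝ} (hkc : ContinuousOn kk DD) {Ck : ℝ} (hm : AEStronglyMeasurable kk (bet k)) (hCk : ∀ z, |kk z| ≤ Ck)
    {z0 : ℂ} (hz0 : z0 ∈ DD) (hpos : 0 < kk z0) {Ki : ℝ} (hKi : ∀ δ > 0, ∃ R < 1, ∀ z ∈ DD, R < ‖z‖ → kk z ≤ Ki + δ)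
    (halt : Ki ≤ 0 ∨ 0 ≤ ∫ z, (kk z - Ki) ∂bet k) :
    ∃ x ∈ HH k, (∀ᵐ z ∂bet k, 0 < wf x z) ∧ ∀ y ∈ HH k, Integrable (fun z ↦ kk z * (wf x z ^ qq k * wf y z)) (bet k) ∧
      inner ℝ x y = ∫ z, kk z * (wf x z ^ qq k * wf y z) ∂bet k := by
  obtain ⟨x, hx, hx0, hw, hs⟩ := solB hkc hm hCk hz0 hpos hKi halt
  refine ⟨x, hx, ?_, hs⟩
  set r : ℕ → ℝ := fun m ↦ 1 - 1 / ((m:ℝ) + 2) with hr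
  have hr0 : ∀ m, 0 < r m := fun m ↦ by
    have : 1 / ((m:ℝ) + 2) ≤ 1 / 2 := one_div_le_one_div_of_le (by norm_num) (by linarith [Nat.cast_nonneg (α := ℝ) m])
    simp only [hr]; linarith
  have hr1 : ∀ m, r m < 1 := fun m ↦ by
    have : 0 < 1 / ((m:ℝ) + 2) := by positivity
    simp only [hr]; linarith
  have hmono : Monotone r := fun a b hab ↦ by
    have : (a:ℝ) ≤ b := by exact_mod_cast hab
    simp only [hr]
    gcongr
  have hU : DD = ⋃ m, Metric.ball (0:ℂ) (r m) := by
    ext z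
    simp only [Set.mem_iUnion, Metric.mem_ball, dist_zero_right]
    refine ⟨fun h ↦ ?_, fun ⟨m, h⟩ ↦ h.trans (hr1 m)⟩
    obtain ⟨m, hm⟩ := exists_nat_one_div_lt (sub_pos.2 h)
    refine ⟨m, ?_⟩
    have : 1 / ((m:ℝ) + 2) ≤ 1 / ((m:ℝ) + 1) := one_div_le_one_div_of_le (by positivity) (by linarith)
    simp only [hr]; linarith
  have hal := fun m ↦ pos_ball hm hCk hx hw (fun y hy ↦ (hs y hy).2) (hr0 m) (hr1 m)
  have hw' := hw
  rw [bet_ae] at hw' ⊢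
  by_cases h : ∃ m0, ∀ m ≥ m0, ∀ᵐ z ∂volume.restrict (Metric.ball (0:ℂ) (r m)), wf x z ≠ 0
  · obtain ⟨m0, h⟩ := h
    have h2 : ∀ᵐ z ∂volume.restrict DD, wf x z ≠ 0 := by
      rw [hU, ae_restrict_iUnion_iff]
      intro m
      exact ae_restrict_of_ae_restrict_of_subset (Metric.ball_subset_ball (hmono (le_max_left m m0))) (h _ (le_max_right m m0))
    filter_upwards [h2, hw'] with z h3 h4
    exact lt_of_le_of_ne h4 (Ne.symm h3)
  · exfalso
    push Not at h
    have h2 : ∀ᵐ z ∂volume.restrict DD, wf x z ≤ 0 := by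
      rw [hU, ae_restrict_iUnion_iff]
      intro m
      obtain ⟨m', hmm, h3⟩ := h m
      exact ae_restrict_of_ae_restrict_of_subset (Metric.ball_subset_ball (hmono hmm)) ((hal m').resolve_left h3)
    rw [← bet_ae k] at h2
    refine hx0 (inner_self_eq_zero (𝕜 := ℝ).1 ?_)
    rw [(hs x hx).2]
    refine integral_eq_zero_of_ae ?_
    filter_upwards [h2, hw] with z h3 h4
    simp [le_antisymm h3 h4]
end Heis
namespace Heis
abbrev EE (n : ℕ) : Type := (Fin n → ℝ) × (Fin n → ℝ)
instance haarE (n : ℕ) : (volume : Measure (EE n)).IsAddHaarMeasure := Measure.prod.instIsAddHaarMeasure _ _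
instance haarR (n : ℕ) : (volume : Measure ((Fin n → ℝ) × ℝ)).IsAddHaarMeasure := inferInstanceAs ((volume.prod volume : Measure ((Fin n → ℝ) × ℝ)).IsAddHaarMeasure)
instance haarP (n : ℕ) : (volume : Measure (Pt n)).IsAddHaarMeasure := Measure.prod.instIsAddHaarMeasure _ _
def nq {n : ℕ} (v : EE n) : ℝ := ∑ j, v.1 j ^ 2 + ∑ j, v.2 j ^ 2
def Pc (z : ℂ) : ℂ := (1 - z) / (1 + z)
def HP : Set ℂ := {P | 0 < P.re}
theorem nq_nn {n : ℕ} (v : EE n) : 0 ≤ nq v := by unfold nq; positivity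
theorem nq_pos {n : ℕ} {v : EE n} (h : v ≠ 0) : 0 < nq v := by
  refine (nq_nn v).lt_of_ne fun h0 ↦ h ?_
  have a1 : 0 ≤ ∑ j, v.1 j ^ 2 := by positivity
  have a2 : 0 ≤ ∑ j, v.2 j ^ 2 := by positivity
  unfold nq at h0
  have b1 : ∑ j, v.1 j ^ 2 = 0 := by linarith
  have b2 : ∑ j, v.2 j ^ 2 = 0 := by linarith
  rw [Finset.sum_eq_zero_iff_of_nonneg fun j _ ↦ by positivity] at b1 b2
  refine Prod.ext (funext fun j ↦ ?_) (funext fun j ↦ ?_)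
  · simpa using b1 j (Finset.mem_univ _)
  · simpa using b2 j (Finset.mem_univ _)
theorem nq_smul {n : ℕ} (r : ℝ) (v : EE n) : nq (r • v) = r ^ 2 * nq v := by
  simp [nq, mul_pow, Finset.mul_sum, mul_add]
theorem nq_cd {n : ℕ} : ContDiff ℝ (⊤ : ℕ∞) (nq (n := n)) := by unfold nq; fun_prop
theorem nq_cont {n : ℕ} : Continuous (nq (n := n)) := nq_cd.continuous
theorem one_add_ne {z : ℂ} (hz : z ∈ DD) : 1 + z ≠ 0 := fun h ↦ by
  have : z = -1 := by linear_combination h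
  rw [this] at hz; simp at hz
theorem one_add_ne' {z : ℂ} (hz : 0 ≤ z.re) : 1 + z ≠ 0 := fun h ↦ by
  have := congrArg Complex.re h; simp at this; linarith
theorem Pc_re {z : ℂ} : (Pc z).re = fD z / ‖1 + z‖ ^ 2 := by
  rw [Pc, Complex.div_re, ← add_div, fD, normsq_C, normsq_C, Complex.normSq_apply]; simp; ring_nf
theorem Pc_HP {z : ℂ} (hz : z ∈ DD) : Pc z ∈ HP := by
  have := norm_pos_iff.2 (one_add_ne hz)
  have := fD_pos hz
  show 0 < (Pc z).re
  rw [Pc_re]; positivity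
theorem one_Pc {z : ℂ} (hz : 1 + z ≠ 0) : 1 + Pc z = 2 / (1 + z) := by unfold Pc; field_simp; ring
theorem Pc_Pc {z : ℂ} (hz : 1 + z ≠ 0) : Pc (Pc z) = z := by
  have h := one_Pc hz
  rw [Pc, h, Pc]; field_simp; ring
theorem Pc_DD {z : ℂ} (hz : z ∈ HP) : Pc z ∈ DD := by
  have h1 := one_add_ne' (le_of_lt hz)
  have h2 := Pc_re (z := Pc z)
  rw [Pc_Pc h1, one_Pc h1] at h2
  have h3 : 0 < ‖2 / (1 + z)‖ := norm_pos_iff.2 (div_ne_zero two_ne_zero h1)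
  have h4 : 0 < fD (Pc z) := by
    have : 0 < fD (Pc z) / ‖2 / (1 + z)‖ ^ 2 := by rw [← h2]; exact hz
    by_contra hc
    exact absurd this (not_lt.2 (div_nonpos_of_nonpos_of_nonneg (not_lt.1 hc) (by positivity)))
  unfold fD at h4
  simp only [Metric.mem_ball, dist_zero_right]; nlinarith [norm_nonneg (Pc z)]
theorem Pc_der {z : ℂ} (hz : 1 + z ≠ 0) : HasDerivAt Pc (-2 / (1 + z) ^ 2) z := by
  have := ((hasDerivAt_id z).const_sub 1).div ((hasDerivAt_id z).const_add 1) hz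
  refine (this.congr_deriv ?_)
  simp; ring
theorem Pc_img : Pc '' DD = HP := by
  ext z; constructor
  · rintro ⟨w, hw, rfl⟩; exact Pc_HP hw
  · exact fun hz ↦ ⟨Pc z, Pc_DD hz, Pc_Pc (one_add_ne' (le_of_lt hz))⟩
theorem Pc_meas : Measurable Pc := by unfold Pc; fun_prop
theorem det_lin (c : ℂ) : ((ContinuousLinearMap.toSpanSingleton ℂ c).restrictScalars ℝ : ℂ →L[ℝ] ℂ).det = ‖c‖ ^ 2 := by
  rw [ContinuousLinearMap.det, normsq_C, ← LinearMap.det_toMatrix Complex.basisOneI, Matrix.det_fin_two]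
  simp [LinearMap.toMatrix_apply]; ring
theorem cay_lint (F : ℂ → ENNReal) : ∫⁻ P in HP, F P = ∫⁻ z in DD, ENNReal.ofReal (4 / ‖1 + z‖ ^ 4) * F (Pc z) := by
  have := lintegral_image_eq_lintegral_abs_det_fderiv_mul volume measurableSet_ball (s := DD) (f := Pc)
    (fun z hz ↦ ((Pc_der (one_add_ne hz)).hasFDerivAt.restrictScalars ℝ).hasFDerivWithinAt)
    (fun z hz w hw h ↦ by rw [← Pc_Pc (one_add_ne hz), h, Pc_Pc (one_add_ne hw)]) F
  rw [Pc_img] at this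
  rw [this]
  refine setLIntegral_congr_fun measurableSet_ball fun z hz ↦ ?_
  simp only [det_lin, norm_div, norm_neg, norm_pow]
  rw [abs_of_nonneg (by positivity)]
  norm_num [div_pow, ← pow_mul]
theorem half_lint {k : ℕ} {a b : ℝ} (ha : 0 < a) (hb : 0 < b) (s : ℝ) {H : ℝ → ℝ → ENNReal} (hH : Measurable (Function.uncurry H)) :
    ∫⁻ r in Set.Ioi (0:ℝ), ENNReal.ofReal (r ^ (2 * k + 1)) * ∫⁻ t, H r t =
      ENNReal.ofReal (1 / (2 * b ^ (k + 1) * a ^ (k + 2))) * ∫⁻ P in HP, ENNReal.ofReal (P.re ^ k) * H (√(P.re / a) / √b) (s + P.im / a) := by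
  have e1 : ∫⁻ P in HP, ENNReal.ofReal (P.re ^ k) * H (√(P.re / a) / √b) (s + P.im / a) =
      ∫⁻ ρ in Set.Ioi (0:ℝ), ∫⁻ τ, ENNReal.ofReal (ρ ^ k) * H (√(ρ / a) / √b) (s + τ / a) := by
    have hm : Measurable fun q : ℝ × ℝ ↦ ENNReal.ofReal (q.1 ^ k) * H (√(q.1 / a) / √b) (s + q.2 / a) := by
      have : Measurable fun q : ℝ × ℝ ↦ H (√(q.1 / a) / √b) (s + q.2 / a) := hH.comp (f := fun q : ℝ × ℝ ↦ (√(q.1 / a) / √b, s + q.2 / a)) (by fun_prop)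
      fun_prop
    rw [← lintegral_prod (μ := volume.restrict (Set.Ioi (0:ℝ))) (fun q : ℝ × ℝ ↦ ENNReal.ofReal (q.1 ^ k) * H (√(q.1 / a) / √b) (s + q.2 / a)) hm.aemeasurable]
    have h2 : HP = Complex.measurableEquivRealProd ⁻¹' (Set.Ioi 0 ×ˢ Set.univ) := by ext z; simp [HP]
    have h3 : (volume.restrict (Set.Ioi (0:ℝ))).prod (volume : Measure ℝ) = (volume : Measure (ℝ × ℝ)).restrict (Set.Ioi 0 ×ˢ Set.univ) := by
      rw [Measure.volume_eq_prod, ← Measure.prod_restrict, Measure.restrict_univ]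
    rw [h3, h2]
    exact (Complex.volume_preserving_equiv_real_prod.restrict_preimage_emb (MeasurableEquiv.measurableEmbedding _) _).lintegral_comp_emb
      (MeasurableEquiv.measurableEmbedding _) (fun q : ℝ × ℝ ↦ ENNReal.ofReal (q.1 ^ k) * H (√(q.1 / a) / √b) (s + q.2 / a))
  have e2 : ∀ G : ℝ → ENNReal, ∫⁻ τ, G (s + τ / a) = ENNReal.ofReal a * ∫⁻ t, G t := fun G ↦ by
    have := lintegral_image_eq_lintegral_abs_deriv_mul MeasurableSet.univ (f := fun t ↦ a * (t - s)) (f' := fun _ ↦ a)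
      (fun t _ ↦ ((((hasDerivAt_id t).sub_const s).const_mul a).congr_deriv (mul_one a)).hasDerivWithinAt)
      (fun t _ t' _ h ↦ by simpa [ha.ne'] using h) (fun τ ↦ G (s + τ / a))
    have hi : (fun t ↦ a * (t - s)) '' Set.univ = Set.univ := by
      rw [Set.image_univ, Set.range_eq_univ]; exact fun y ↦ ⟨y / a + s, by field_simp; ring⟩
    rw [hi, Measure.restrict_univ] at this
    rw [this, ← lintegral_const_mul' _ _ ENNReal.ofReal_ne_top]
    refine lintegral_congr fun t ↦ ?_
    rw [abs_of_pos ha]; congr 2; field_simp; ring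
  have e3 : ∀ G : ℝ → ENNReal, ∫⁻ ρ in Set.Ioi (0:ℝ), ENNReal.ofReal (ρ ^ k) * G (√(ρ / a) / √b) =
      ENNReal.ofReal (2 * (a * b) ^ (k + 1)) * ∫⁻ r in Set.Ioi (0:ℝ), ENNReal.ofReal (r ^ (2 * k + 1)) * G r := fun G ↦ by
    have := lintegral_image_eq_lintegral_abs_deriv_mul (measurableSet_Ioi (a := (0:ℝ))) (f := fun r ↦ a * b * r ^ 2) (f' := fun r ↦ a * b * (2 * r))
      (fun t _ ↦ by simpa using ((hasDerivAt_pow 2 t).const_mul (a * b)).hasDerivWithinAt)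
      (fun t ht t' ht' h ↦ by
        have h1 : t ^ 2 = t' ^ 2 := mul_left_cancel₀ (mul_pos ha hb).ne' h
        exact (pow_left_inj₀ (le_of_lt ht) (le_of_lt ht') two_ne_zero).1 h1) (fun ρ ↦ ENNReal.ofReal (ρ ^ k) * G (√(ρ / a) / √b))
    have hi : (fun r ↦ a * b * r ^ 2) '' Set.Ioi 0 = Set.Ioi 0 := by
      ext y; constructor
      · rintro ⟨r, hr, rfl⟩; rw [Set.mem_Ioi] at *; positivity
      · intro hy; rw [Set.mem_Ioi] at hy
        exact ⟨√(y / (a * b)), Real.sqrt_pos.2 (by positivity), by simp only; rw [Real.sq_sqrt (by positivity)]; field_simp⟩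
    rw [hi] at this
    rw [this, ← lintegral_const_mul' _ _ ENNReal.ofReal_ne_top]
    refine setLIntegral_congr_fun measurableSet_Ioi fun r hr ↦ ?_
    rw [Set.mem_Ioi] at hr
    have hs : √(a * b * r ^ 2 / a) / √b = r := by
      rw [← Real.sqrt_div (by positivity), show a * b * r ^ 2 / a / b = r ^ 2 by field_simp, Real.sqrt_sq hr.le]
    simp only [hs, ← mul_assoc]
    rw [← ENNReal.ofReal_mul (abs_nonneg _), ← ENNReal.ofReal_mul (by positivity), abs_of_pos (by positivity)]
    congr 2; ring
  rw [e1]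
  have e4 : ∀ ρ : ℝ, ∫⁻ τ, ENNReal.ofReal (ρ ^ k) * H (√(ρ / a) / √b) (s + τ / a) = ENNReal.ofReal (ρ ^ k) * (ENNReal.ofReal a * ∫⁻ t, H (√(ρ / a) / √b) t) := fun ρ ↦ by
    rw [lintegral_const_mul' _ _ ENNReal.ofReal_ne_top, e2]
  simp only [e4]
  rw [e3 (fun r ↦ ENNReal.ofReal a * ∫⁻ t, H r t), ← lintegral_const_mul' _ _ ENNReal.ofReal_ne_top, ← lintegral_const_mul' _ _ ENNReal.ofReal_ne_top]
  refine setLIntegral_congr_fun measurableSet_Ioi fun r hr ↦ ?_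
  rw [Set.mem_Ioi] at hr
  simp only [← mul_assoc]
  rw [← ENNReal.ofReal_mul (by positivity), ← ENNReal.ofReal_mul (by positivity), ← ENNReal.ofReal_mul (by positivity)]
  congr 2; field_simp; ring
end Heis
namespace Heis
abbrev Sp (k : ℕ) : Type := Metric.sphere (0 : EE (k + 1)) 1
def Sm {n : ℕ} (a s : ℝ) (v : EE n) (z : ℂ) : Pt n :=
  ((√((Pc z).re / a) / √(nq v)) • v.1, (√((Pc z).re / a) / √(nq v)) • v.2, s + (Pc z).im / a)
def cs (k : ℕ) (a : ℝ) (w : Sp k) : ℝ := 2 / (nq w.1 ^ (k + 1) * a ^ (k + 2))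
def sg (k : ℕ) (a : ℝ) : Measure (Sp k) := (Measure.toSphere (volume : Measure (EE (k + 1)))).withDensity fun w ↦ ENNReal.ofReal (cs k a w)
def Wt (k : ℕ) (z : ℂ) : ℝ := 1 / ‖1 + z‖ ^ (2 * k + 4)
def bw (k : ℕ) : Measure ℂ := (bet k).withDensity fun z ↦ ENNReal.ofReal (Wt k z)
theorem sp_ne {k : ℕ} (w : Sp k) : w.1 ≠ 0 := fun h ↦ by have := w.2; rw [h] at this; simp at this
theorem sp_nq {k : ℕ} (w : Sp k) : 0 < nq w.1 := nq_pos (sp_ne w)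
theorem cs_cont (k : ℕ) {a : ℝ} (ha : 0 < a) : Continuous (cs k a) :=
  continuous_const.div (((nq_cont.comp continuous_subtype_val).pow _).mul continuous_const) fun w ↦ (mul_pos (pow_pos (sp_nq w) _) (by positivity)).ne'
theorem Wt_nn (k : ℕ) (z : ℂ) : 0 ≤ Wt k z := by unfold Wt; positivity
theorem Wt_meas (k : ℕ) : Measurable (Wt k) := by unfold Wt; fun_prop
instance (k : ℕ) (a : ℝ) : SFinite (sg k a) := by unfold sg; infer_instance
instance (k : ℕ) : SFinite (bw k) := by unfold bw; infer_instance
theorem sg_fin (k : ℕ) {a : ℝ} (ha : 0 < a) : IsFiniteMeasure (sg k a) := by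
  haveI : CompactSpace (Sp k) := isCompact_iff_compactSpace.1 (isCompact_sphere _ _)
  refine isFiniteMeasure_withDensity_ofReal ?_
  exact ((BoundedContinuousFunction.mkOfCompact ⟨cs k a, cs_cont k ha⟩).integrable _).2
theorem Sm_meas {k : ℕ} (a s : ℝ) : Measurable fun q : Sp k × ℂ ↦ Sm a s q.1.1 q.2 := by
  have h1 : Measurable fun q : Sp k × ℂ ↦ Pc q.2 := Pc_meas.comp measurable_snd
  have h2 : Measurable fun q : Sp k × ℂ ↦ nq q.1.1 := nq_cont.measurable.comp (measurable_subtype_coe.comp measurable_fst)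
  have h3 : Measurable fun q : Sp k × ℂ ↦ √((Pc q.2).re / a) / √(nq q.1.1) := by
    have := Complex.measurable_re.comp h1
    exact (this.div_const a).sqrt.div h2.sqrt
  have h4 : Measurable fun q : Sp k × ℂ ↦ q.1.1 := measurable_subtype_coe.comp measurable_fst
  have h5 := Complex.measurable_im.comp h1
  exact (h3.smul (measurable_fst.comp h4)).prodMk ((h3.smul (measurable_snd.comp h4)).prodMk ((h5.div_const a).const_add s))
theorem sm_e0 {n : ℕ} {F : Pt n → ENNReal} (hF : Measurable F) : ∫⁻ p, F p = ∫⁻ v : EE n, ∫⁻ t : ℝ, F (v.1, v.2, t) := by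
  have h := (volume_preserving_prodAssoc (α₁ := Fin n → ℝ) (β₁ := Fin n → ℝ) (γ₁ := ℝ)).lintegral_comp_emb (MeasurableEquiv.measurableEmbedding _) F
  have hF' : Measurable fun q : EE n × ℝ ↦ F (q.1.1, q.1.2, q.2) := hF.comp (f := fun q : EE n × ℝ ↦ (q.1.1, q.1.2, q.2)) (by fun_prop)
  rw [← h]
  exact lintegral_prod (fun q : EE n × ℝ ↦ F (q.1.1, q.1.2, q.2)) hF'.aemeasurable
theorem sm_e1 {k : ℕ} {H : EE (k + 1) → ENNReal} (hHm : Measurable H) :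
    ∫⁻ v, H v = ∫⁻ w : Sp k, (∫⁻ r in Set.Ioi (0:ℝ), ENNReal.ofReal (r ^ (2 * k + 1)) * H (r • w.1)) ∂Measure.toSphere (volume : Measure (EE (k + 1))) := by
  haveI : NullSingletonClass (volume : Measure (Fin (k + 1) → ℝ)) := inferInstance
  haveI : NullSingletonClass (volume : Measure (EE (k + 1))) := Measure.prod.instNullSingletonClass_fst
  have c1 : ∫⁻ v, H v = ∫⁻ v in ({0}ᶜ : Set (EE (k + 1))), H v := by rw [restrict_compl_singleton]
  rw [c1, ← lintegral_subtype_comap (measurableSet_singleton _).compl,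
    ← ((Measure.measurePreserving_homeomorphUnitSphereProd (volume : Measure (EE (k+1)))).symm (homeomorphUnitSphereProd _).toMeasurableEquiv).lintegral_comp_emb
      (Homeomorph.toMeasurableEquiv _).symm.measurableEmbedding]
  have hd : Module.finrank ℝ (EE (k + 1)) - 1 = 2 * k + 1 := by simp; omega
  rw [hd]
  have hm : Measurable fun q : Sp k × Set.Ioi (0:ℝ) ↦ H (q.2.1 • q.1.1) := hHm.comp (by fun_prop)
  refine (lintegral_prod (fun q : Sp k × Set.Ioi (0:ℝ) ↦ H (q.2.1 • q.1.1)) hm.aemeasurable).trans (lintegral_congr fun w ↦ ?_)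
  rw [Measure.volumeIoiPow, lintegral_withDensity_eq_lintegral_mul _ (by fun_prop) (by exact hm.comp measurable_prodMk_left)]
  exact lintegral_subtype_comap measurableSet_Ioi fun r ↦ ENNReal.ofReal (r ^ (2 * k + 1)) * H (r • w.1)
theorem sm_pf {k : ℕ} {a : ℝ} (ha : 0 < a) (s : ℝ) {F : Pt (k + 1) → ENNReal} (hF : Measurable F) :
    ∫⁻ p, F p = ∫⁻ w, ∫⁻ z, F (Sm a s w.1 z) ∂bw k ∂sg k a := by
  have hF' : Measurable fun q : EE (k + 1) × ℝ ↦ F (q.1.1, q.1.2, q.2) := hF.comp (f := fun q : EE (k + 1) × ℝ ↦ (q.1.1, q.1.2, q.2)) (by fun_prop)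
  have hFS : Measurable fun q : Sp k × ℂ ↦ F (Sm a s q.1.1 q.2) := hF.comp (Sm_meas a s)
  rw [sm_e0 hF, sm_e1 hF'.lintegral_prod_right', sg, lintegral_withDensity_eq_lintegral_mul _ (cs_cont k ha).measurable.ennreal_ofReal (by exact hFS.lintegral_prod_right')]
  refine lintegral_congr fun w ↦ ?_
  have hFw : Measurable fun z ↦ F (Sm a s w.1 z) := hFS.comp (f := fun z : ℂ ↦ (w, z)) measurable_prodMk_left
  have hc := sp_nq w
  refine (half_lint (k := k) ha hc s (H := fun r t ↦ F ((r • w.1).1, (r • w.1).2, t))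
    (by exact hF.comp (f := fun q : ℝ × ℝ ↦ ((q.1 • w.1).1, (q.1 • w.1).2, q.2)) (by fun_prop))).trans ?_
  have e1 : cs k a w = 1 / (2 * nq w.1 ^ (k + 1) * a ^ (k + 2)) * 4 := by unfold cs; ring
  have e2 : ∫⁻ z, F (Sm a s w.1 z) ∂bw k = ∫⁻ z in DD, ENNReal.ofReal (fD z ^ k) * (ENNReal.ofReal (Wt k z) * F (Sm a s w.1 z)) := by
    rw [bw, lintegral_withDensity_eq_lintegral_mul _ (Wt_meas k).ennreal_ofReal hFw]
    exact bet_lint k _ ((Wt_meas k).ennreal_ofReal.mul hFw).aemeasurable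
  rw [cay_lint, Pi.mul_apply, e1, e2, ENNReal.ofReal_mul (by positivity), mul_assoc (ENNReal.ofReal (1 / _))]
  congr 1
  rw [← lintegral_const_mul' _ _ ENNReal.ofReal_ne_top]
  refine setLIntegral_congr_fun measurableSet_ball fun z hz ↦ ?_
  have hf := fD_pos hz
  have hn := norm_pos_iff.2 (one_add_ne hz)
  have e : 4 / ‖1 + z‖ ^ 4 * (Pc z).re ^ k = 4 * (fD z ^ k * Wt k z) := by rw [Pc_re, Wt, div_pow]; field_simp; ring
  rw [← mul_assoc, ← ENNReal.ofReal_mul (by positivity), e, ENNReal.ofReal_mul (by positivity), ENNReal.ofReal_mul (by positivity), mul_assoc, mul_assoc]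
  rfl
theorem sm_mp {k : ℕ} {a : ℝ} (ha : 0 < a) (s : ℝ) :
    MeasurePreserving (fun q : Sp k × ℂ ↦ Sm a s q.1.1 q.2) ((sg k a).prod (bw k)) volume := by
  refine ⟨Sm_meas a s, Measure.ext_of_lintegral _ fun F hF ↦ ?_⟩
  rw [lintegral_map hF (Sm_meas a s), sm_pf ha s hF, lintegral_prod (fun q : Sp k × ℂ ↦ F (Sm a s q.1.1 q.2)) (hF.comp (Sm_meas a s)).aemeasurable]
end Heis
namespace Heis
theorem gr_hol {φ : ℂ → ℝ} {g : ℂ → ℂ} {c z : ℂ} (hg : HasDerivAt g c z) (h : DifferentiableAt ℝ φ (g z)) :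
    gr (fun z ↦ φ (g z)) z = gr φ (g z) * (starRingEnd ℂ) c := by
  have h1 := h.hasFDerivAt.comp z (hg.hasFDerivAt.restrictScalars ℝ)
  refine (gr_eq h1).trans ?_
  apply Complex.ext <;> simp [fderiv_gr] <;> ring
def PP {n : ℕ} (a s : ℝ) (p : Pt n) : ℂ := ⟨a * nq (p.1, p.2.1), a * (p.2.2 - s)⟩
def Zm {n : ℕ} (a s : ℝ) (p : Pt n) : ℂ := Pc (PP a s p)
theorem PP_nn {n : ℕ} {a : ℝ} (ha : 0 < a) (s : ℝ) (p : Pt n) : 0 ≤ (PP a s p).re := mul_nonneg ha.le (nq_nn _)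
theorem PP_cd {n : ℕ} (a s : ℝ) : ContDiff ℝ (⊤ : ℕ∞) (PP (n := n) a s) := by
  have h1 : ContDiff ℝ (⊤ : ℕ∞) fun p : Pt n ↦ nq (p.1, p.2.1) := nq_cd.comp (f := fun p : Pt n ↦ (p.1, p.2.1)) (by fun_prop)
  have : PP (n := n) a s = fun p ↦ Complex.equivRealProdCLM.symm (a * nq (p.1, p.2.1), a * (p.2.2 - s)) := by
    funext p; apply Complex.ext <;> simp [PP]
  rw [this]
  exact Complex.equivRealProdCLM.symm.contDiff.comp ((contDiff_const.mul h1).prodMk (by fun_prop))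
theorem Pc_cd {z : ℂ} (hz : 1 + z ≠ 0) : ContDiffAt ℝ (⊤ : ℕ∞) Pc z := by
  have h1 : ContDiffAt ℝ (⊤ : ℕ∞) (fun z : ℂ ↦ 1 - z) z := by fun_prop
  have h2 : ContDiffAt ℝ (⊤ : ℕ∞) (fun z : ℂ ↦ 1 + z) z := by fun_prop
  have h3 := (contDiffAt_inv ℂ hz (n := (⊤ : ℕ∞))).restrict_scalars ℝ
  exact h1.mul (h3.comp z h2)
theorem PP_ne {n : ℕ} {a : ℝ} (ha : 0 < a) (s : ℝ) (p : Pt n) : 1 + PP a s p ≠ 0 := one_add_ne' (PP_nn ha s p)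
theorem Zm_cd {n : ℕ} {a : ℝ} (ha : 0 < a) (s : ℝ) : ContDiff ℝ (⊤ : ℕ∞) (Zm (n := n) a s) :=
  contDiff_iff_contDiffAt.2 fun p ↦ (Pc_cd (PP_ne ha s p)).comp p (PP_cd a s).contDiffAt
theorem PP_Sm {n : ℕ} {a : ℝ} (ha : 0 < a) (s : ℝ) {v : EE n} (hv : v ≠ 0) {z : ℂ} (hz : z ∈ DD) : PP a s (Sm a s v z) = Pc z := by
  have h1 : 0 < (Pc z).re := Pc_HP hz
  have h2 := nq_pos hv
  apply Complex.ext
  · show a * nq ((√((Pc z).re / a) / √(nq v)) • v) = _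
    rw [nq_smul, div_pow, Real.sq_sqrt (by positivity), Real.sq_sqrt h2.le]; field_simp
  · show a * (s + (Pc z).im / a - s) = _
    field_simp; ring
theorem Zm_Sm {n : ℕ} {a : ℝ} (ha : 0 < a) (s : ℝ) {v : EE n} (hv : v ≠ 0) {z : ℂ} (hz : z ∈ DD) : Zm a s (Sm a s v z) = z := by
  rw [Zm, PP_Sm ha s hv hz, Pc_Pc (one_add_ne hz)]
theorem one_Zm {n : ℕ} {a : ℝ} (ha : 0 < a) (s : ℝ) (p : Pt n) : 1 + Zm a s p = 2 / (1 + PP a s p) := one_Pc (PP_ne ha s p)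
theorem Zm_ne {n : ℕ} {a : ℝ} (ha : 0 < a) (s : ℝ) (p : Pt n) : 1 + Zm a s p ≠ 0 := by
  rw [one_Zm ha]; exact div_ne_zero two_ne_zero (PP_ne ha s p)
theorem PP_Zm {n : ℕ} {a : ℝ} (ha : 0 < a) (s : ℝ) (p : Pt n) : Pc (Zm a s p) = PP a s p := Pc_Pc (PP_ne ha s p)
theorem Zm_DD {n : ℕ} {a : ℝ} (ha : 0 < a) (s : ℝ) {p : Pt n} (hp : (p.1, p.2.1) ≠ 0) : Zm a s p ∈ DD :=
  Pc_DD (mul_pos ha (nq_pos hp))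
theorem PP_bd {n : ℕ} {a : ℝ} (ha : 0 < a) (s M : ℝ) : ∃ R, ∀ p : Pt n, ‖PP a s p‖ ≤ M → ‖p‖ ≤ R := by
  refine ⟨max (√(M / a)) (M / a + |s|), fun p hp ↦ ?_⟩
  have h1 := (Complex.re_le_norm _).trans hp
  have h2 := (Complex.abs_im_le_norm _).trans hp
  simp only [PP] at h1 h2
  rw [abs_mul, abs_of_pos ha] at h2
  have h1' : nq (p.1, p.2.1) ≤ M / a := by rw [le_div_iff₀ ha]; linarith
  have h2' : |p.2.2 - s| ≤ M / a := by rw [le_div_iff₀ ha]; linarith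
  have e1 : 0 ≤ ∑ j, p.1 j ^ 2 := by positivity
  have e2 : 0 ≤ ∑ j, p.2.1 j ^ 2 := by positivity
  have c1 : ‖p.1‖ ≤ √(M / a) := (pi_norm_le_iff_of_nonneg (Real.sqrt_nonneg _)).2 fun j ↦ Real.abs_le_sqrt <| by
    have := Finset.single_le_sum (f := fun j ↦ p.1 j ^ 2) (fun i _ ↦ sq_nonneg _) (Finset.mem_univ j)
    simp only [nq] at h1'; linarith
  have c2 : ‖p.2.1‖ ≤ √(M / a) := (pi_norm_le_iff_of_nonneg (Real.sqrt_nonneg _)).2 fun j ↦ Real.abs_le_sqrt <| by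
    have := Finset.single_le_sum (f := fun j ↦ p.2.1 j ^ 2) (fun i _ ↦ sq_nonneg _) (Finset.mem_univ j)
    simp only [nq] at h1'; linarith
  have c3 : ‖p.2.2‖ ≤ M / a + |s| := by
    rw [Real.norm_eq_abs]; have := abs_add_le (p.2.2 - s) s; rw [sub_add_cancel] at this; linarith
  exact max_le (c1.trans (le_max_left _ _)) (max_le (c2.trans (le_max_left _ _)) (c3.trans (le_max_right _ _)))
theorem Core.cz {n : ℕ} {a : ℝ} (ha : 0 < a) (s : ℝ) {h : ℂ → ℝ} (hh : Core h) :
    ContDiff ℝ 1 (fun p : Pt n ↦ h (Zm a s p)) ∧ HasCompactSupport (fun p : Pt n ↦ h (Zm a s p)) := by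
  refine ⟨hh.cd.comp ((Zm_cd ha s).of_le (by simp)), ?_⟩
  obtain ⟨M, hM⟩ := hh.cpt.exists_bound_of_continuousOn (f := fun z : ℂ ↦ (1 + z)⁻¹)
    (ContinuousOn.inv₀ (by fun_prop) fun z hz ↦ one_add_ne (hh.sub hz))
  obtain ⟨R, hR⟩ := PP_bd (n := n) ha s (1 + 2 * M)
  refine HasCompactSupport.of_support_subset_isCompact (isCompact_closedBall 0 R) fun p hp ↦ ?_
  have h1 := hM _ (subset_tsupport h hp)
  simp only [Metric.mem_closedBall, dist_zero_right]
  refine hR p ?_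
  have e : PP a s p = 2 * (1 + Zm a s p)⁻¹ - 1 := by rw [one_Zm ha]; field_simp; ring
  rw [e]
  refine (norm_sub_le _ _).trans ?_
  rw [norm_mul]; simp only [Complex.norm_ofNat, norm_one] at *; linarith
theorem PP_der {n : ℕ} (a s : ℝ) (p v : Pt n) : fderiv ℝ (PP (n := n) a s) p v =
    ⟨2 * a * (∑ j, p.1 j * v.1 j + ∑ j, p.2.1 j * v.2.1 j), a * v.2.2⟩ := by
  have hd := ((PP_cd (n := n) a s).differentiable (by simp) p).hasFDerivAt
  have hc : HasDerivAt (fun r : ℝ ↦ p + r • v) v 0 := by simpa using ((hasDerivAt_id (0:ℝ)).smul_const v).const_add p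
  have h1 : HasDerivAt (fun r : ℝ ↦ PP a s (p + r • v)) (fderiv ℝ (PP (n := n) a s) p v) 0 := by
    have := HasFDerivAt.comp_hasDerivAt (x := (0:ℝ)) (f := fun r : ℝ ↦ p + r • v) (l := PP a s) (by simpa using hd) hc
    exact this
  have hr := Complex.reCLM.hasFDerivAt.comp_hasDerivAt 0 h1
  have hi := Complex.imCLM.hasFDerivAt.comp_hasDerivAt 0 h1
  have hx : ∀ x y : ℝ, HasDerivAt (fun r : ℝ ↦ (x + r * y) ^ 2) (2 * x * y) 0 := fun x y ↦ by
    have := (((hasDerivAt_id (0:ℝ)).mul_const y).const_add x).pow 2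
    exact this.congr_deriv (by simp)
  have hr' : HasDerivAt (fun r : ℝ ↦ a * (∑ j, (p.1 j + r * v.1 j) ^ 2 + ∑ j, (p.2.1 j + r * v.2.1 j) ^ 2))
    (a * (∑ j, 2 * p.1 j * v.1 j + ∑ j, 2 * p.2.1 j * v.2.1 j)) 0 :=
    ((HasDerivAt.fun_sum fun j _ ↦ hx _ _).add (HasDerivAt.fun_sum fun j _ ↦ hx _ _)).const_mul a
  have hi' : HasDerivAt (fun r : ℝ ↦ a * (p.2.2 + r * v.2.2 - s)) (a * v.2.2) 0 := by
    have := ((((hasDerivAt_id (0:ℝ)).mul_const v.2.2).const_add p.2.2).sub_const s).const_mul a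
    exact this.congr_deriv (by simp)
  apply Complex.ext
  · refine (hr.unique hr').trans ?_
    simp only [mul_add, Finset.mul_sum]
    congr 1 <;> exact Finset.sum_congr rfl fun j _ ↦ by ring
  · exact hi.unique hi'
def Ag {n : ℕ} (a s : ℝ) (h : ℂ → ℝ) (p : Pt n) : ℂ := gr h (Zm a s p) * (starRingEnd ℂ) (-2 / (1 + PP a s p) ^ 2)
theorem HZ_der {n : ℕ} {a : ℝ} (ha : 0 < a) (s : ℝ) {h : ℂ → ℝ} {p : Pt n} (hh : DifferentiableAt ℝ h (Zm a s p)) (v : Pt n) :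
    fderiv ℝ (fun p : Pt n ↦ h (Zm a s p)) p v = (Ag a s h p).re * (2 * a * (∑ j, p.1 j * v.1 j + ∑ j, p.2.1 j * v.2.1 j)) + (Ag a s h p).im * (a * v.2.2) := by
  have h1 : DifferentiableAt ℝ (fun z ↦ h (Pc z)) (PP a s p) := hh.comp (PP a s p) ((Pc_cd (PP_ne ha s p)).differentiableAt (by simp))
  have h2 := h1.hasFDerivAt.comp p ((PP_cd a s).differentiable (by simp) p).hasFDerivAt
  have h3 : fderiv ℝ (fun p : Pt n ↦ h (Zm a s p)) p = _ := h2.fderiv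
  rw [h3, ContinuousLinearMap.comp_apply, fderiv_gr, PP_der, gr_hol (Pc_der (PP_ne ha s p)) hh]
  rfl
theorem HZ_X {n : ℕ} {a : ℝ} (ha : 0 < a) (s : ℝ) {h : ℂ → ℝ} {p : Pt n} (hh : DifferentiableAt ℝ h (Zm a s p)) (j : Fin n) :
    Xd n j (fun p : Pt n ↦ h (Zm a s p)) p = 2 * a * ((Ag a s h p).re * p.1 j + (Ag a s h p).im * p.2.1 j) := by
  rw [Xd, HZ_der ha s hh, HZ_der ha s hh]
  simp [ex, et, Pi.single_apply]; ring
theorem HZ_Y {n : ℕ} {a : ℝ} (ha : 0 < a) (s : ℝ) {h : ℂ → ℝ} {p : Pt n} (hh : DifferentiableAt ℝ h (Zm a s p)) (j : Fin n) :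
    Yd n j (fun p : Pt n ↦ h (Zm a s p)) p = 2 * a * ((Ag a s h p).re * p.2.1 j - (Ag a s h p).im * p.1 j) := by
  rw [Yd, HZ_der ha s hh, HZ_der ha s hh]
  simp [ey, et, Pi.single_apply]; ring
def Rd {n : ℕ} (Φ : Pt n → ℝ) (p : Pt n) : ℝ := fderiv ℝ Φ p (p.2.1, -p.1, 0)
def Ed {n : ℕ} (Φ : Pt n → ℝ) (p : Pt n) : ℝ := fderiv ℝ Φ p (p.1, p.2.1, 0)
theorem fd_sum {n : ℕ} (Φ : Pt n → ℝ) (p : Pt n) (v w : Fin n → ℝ) :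
    fderiv ℝ Φ p (v, w, 0) = ∑ j, v j * fderiv ℝ Φ p (ex n j) + ∑ j, w j * fderiv ℝ Φ p (ey n j) := by
  have : ((v, w, 0) : Pt n) = ∑ j, v j • ex n j + ∑ j, w j • ey n j := by
    refine Prod.ext ?_ (Prod.ext ?_ ?_)
    · funext i; simp [ex, ey, Prod.fst_sum, Pi.single_apply, Finset.sum_apply]
    · funext i; simp [ex, ey, Prod.fst_sum, Prod.snd_sum, Pi.single_apply, Finset.sum_apply]
    · simp [ex, ey, Prod.snd_sum]
  rw [this, map_add, map_sum, map_sum]; simp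
theorem HZ_dot {n : ℕ} {a : ℝ} (ha : 0 < a) (s : ℝ) {h : ℂ → ℝ} {p : Pt n} (hh : DifferentiableAt ℝ h (Zm a s p)) (Φ : Pt n → ℝ) :
    ∑ j, (Xd n j (fun p : Pt n ↦ h (Zm a s p)) p * Xd n j Φ p + Yd n j (fun p : Pt n ↦ h (Zm a s p)) p * Yd n j Φ p) =
      2 * a * ((Ag a s h p).im * Rd Φ p) + 2 * a * ((Ag a s h p).re * Ed Φ p + (Ag a s h p).im * (2 * nq (p.1, p.2.1) * fderiv ℝ Φ p (et n))) := by
  rw [Rd, Ed, fd_sum, fd_sum, nq]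
  simp only [HZ_X ha s hh, HZ_Y ha s hh, Finset.mul_sum, ← Finset.sum_add_distrib, Finset.sum_mul]
  exact Finset.sum_congr rfl fun j _ ↦ by simp [Xd, Yd]; ring
end Heis
namespace Heis
theorem Sm_der {n : ℕ} {a : ℝ} (ha : 0 < a) (s : ℝ) (v : EE n) {z : ℂ} (hz : z ∈ DD) :
    ContDiffAt ℝ 1 (Sm a s v) z ∧ ∀ w, fderiv ℝ (Sm a s v) z w =
      ((-2 / (1 + z) ^ 2 * w).re / (2 * (Pc z).re)) • ((Sm a s v z).1, (Sm a s v z).2.1, 0) + ((-2 / (1 + z) ^ 2 * w).im / a) • et n := by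
  have hr : 0 < (Pc z).re := Pc_HP hz
  have hP : HasFDerivAt Pc _ z := (Pc_der (one_add_ne hz)).hasFDerivAt.restrictScalars ℝ
  have h1 : HasFDerivAt (fun z ↦ (Pc z).re) _ z := Complex.reCLM.hasFDerivAt.comp z hP
  have h2 : HasFDerivAt (fun z ↦ (Pc z).im) _ z := Complex.imCLM.hasFDerivAt.comp z hP
  have hg : HasDerivAt (fun r : ℝ ↦ √(r / a) / √(nq v)) (1 / (2 * (Pc z).re) * (√((Pc z).re / a) / √(nq v))) (Pc z).re := by
    have h := (((hasDerivAt_id (Pc z).re).div_const a).sqrt (by simp only [id]; positivity)).div_const (√(nq v))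
    refine h.congr_deriv ?_
    have e : √((Pc z).re / a) ^ 2 = (Pc z).re / a := Real.sq_sqrt (by positivity)
    have : 0 < √((Pc z).re / a) := Real.sqrt_pos.2 (by positivity)
    have e2 : (Pc z).re = a * √((Pc z).re / a) ^ 2 := by rw [e]; field_simp
    simp only [id]
    by_cases h0 : √(nq v) = 0
    · simp [h0]
    field_simp
    exact e2
  have h3 := hg.comp_hasFDerivAt z h1
  constructor
  · have hc := (Pc_cd (one_add_ne hz)).of_le (show ((1 : WithTop ℕ∞)) ≤ ((⊤ : ℕ∞) : WithTop ℕ∞) by simp)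
    have c1 : ContDiffAt ℝ 1 (fun z ↦ (Pc z).re) z := Complex.reCLM.contDiff.contDiffAt.comp z hc
    have c2 : ContDiffAt ℝ 1 (fun z ↦ (Pc z).im) z := Complex.imCLM.contDiff.contDiffAt.comp z hc
    have c3 : ContDiffAt ℝ 1 (fun z ↦ √((Pc z).re / a) / √(nq v)) z := ((c1.div_const a).sqrt (by positivity)).div_const _
    exact (c3.smul contDiffAt_const).prodMk ((c3.smul contDiffAt_const).prodMk (contDiffAt_const.add (c2.div_const a)))
  · intro w
    have h4 : HasFDerivAt (Sm a s v) _ z := (h3.smul_const v.1).prodMk ((h3.smul_const v.2).prodMk ((h2.mul_const a⁻¹).const_add s))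
    rw [h4.fderiv]
    have e : w * (-2 / (1 + z) ^ 2) = -2 / (1 + z) ^ 2 * w := mul_comm _ _
    refine Prod.ext ?_ (Prod.ext ?_ ?_)
    · funext j; simp [Sm, et, e]; ring
    · funext j; simp [Sm, et, e]; ring
    · simp [et, e]; ring
theorem gr_Sm {n : ℕ} {a : ℝ} (ha : 0 < a) (s : ℝ) (v : EE n) {z : ℂ} (hz : z ∈ DD) {Φ : Pt n → ℝ} (hΦ : Differentiable ℝ Φ) :
    gr (fun z ↦ Φ (Sm a s v z)) z = (starRingEnd ℂ) (-2 / (1 + z) ^ 2) *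
      ⟨Ed Φ (Sm a s v z) / (2 * (Pc z).re), fderiv ℝ Φ (Sm a s v z) (et n) / a⟩ := by
  obtain ⟨h1, h2⟩ := Sm_der ha s v hz
  have h3 := (hΦ (Sm a s v z)).hasFDerivAt.comp z (h1.differentiableAt one_ne_zero).hasFDerivAt
  refine (gr_eq h3).trans ?_
  simp only [ContinuousLinearMap.comp_apply, h2, map_add, map_smul, Ed, smul_eq_mul]
  generalize -2 / (1 + z) ^ 2 = c
  apply Complex.ext <;> simp <;> ring
theorem pt_id {n : ℕ} {a : ℝ} (ha : 0 < a) (s : ℝ) {v : EE n} (hv : v ≠ 0) {z : ℂ} (hz : z ∈ DD) {Φ : Pt n → ℝ} (hΦ : Differentiable ℝ Φ) (h : ℂ → ℝ) :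
    2 * a * ((Ag a s h (Sm a s v z)).re * Ed Φ (Sm a s v z) + (Ag a s h (Sm a s v z)).im * (2 * nq ((Sm a s v z).1, (Sm a s v z).2.1) * fderiv ℝ Φ (Sm a s v z) (et n))) =
      a * fD z * ‖1 + z‖ ^ 2 * inner ℝ (gr h z) (gr (fun z ↦ Φ (Sm a s v z)) z) := by
  have hr : 0 < (Pc z).re := Pc_HP hz
  have h1 := one_add_ne hz
  have hn := norm_pos_iff.2 h1
  have e1 : a * nq ((Sm a s v z).1, (Sm a s v z).2.1) = (Pc z).re := congrArg Complex.re (PP_Sm ha s hv hz)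
  have e1' : nq ((Sm a s v z).1, (Sm a s v z).2.1) = (Pc z).re / a := by rw [← e1]; field_simp
  rw [gr_Sm ha s v hz hΦ, Ag, Zm_Sm ha s hv hz, PP_Sm ha s hv hz, one_Pc h1, e1']
  have ed : (-2 / (2 / (1 + z)) ^ 2 : ℂ) = -(1 + z) ^ 2 / 2 := by field_simp
  have ef : fD z = (Pc z).re * ‖1 + z‖ ^ 2 := by rw [Pc_re]; field_simp
  rw [ed, ef]
  set E := Ed Φ (Sm a s v z); set T := fderiv ℝ Φ (Sm a s v z) (et n); set r := (Pc z).re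
  set c : ℂ := -2 / (1 + z) ^ 2 with hc
  have hd : -(1 + z) ^ 2 / 2 = ((‖1 + z‖ ^ 4 / 4 : ℝ) : ℂ) * (starRingEnd ℂ) c := by
    have : ((‖1 + z‖ ^ 4 : ℝ) : ℂ) = ((1 + z) * (starRingEnd ℂ) (1 + z)) ^ 2 := by
      rw [Complex.mul_conj, Complex.normSq_eq_norm_sq]; push_cast; ring
    have h2 : (starRingEnd ℂ) (1 + z) ≠ 0 := (map_ne_zero _).2 h1
    rw [Complex.ofReal_div, this, hc, map_div₀, map_pow]; simp only [map_neg, map_ofNat, Complex.ofReal_ofNat]; field_simp; ring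
  rw [hd]
  have e4 : (starRingEnd ℂ) (((‖1 + z‖ ^ 4 / 4 : ℝ) : ℂ) * (starRingEnd ℂ) c) = ((‖1 + z‖ ^ 4 / 4 : ℝ) : ℂ) * c := by
    rw [map_mul, Complex.conj_conj, Complex.conj_ofReal]
  rw [e4, inner_C]
  simp only [Complex.mul_re, Complex.mul_im, Complex.ofReal_re, Complex.ofReal_im, Complex.conj_re, Complex.conj_im]
  field_simp; ring
theorem bw_pr (k : ℕ) {a : ℝ} (ha : 0 < a) : (sg k a).prod (bw k) = ((sg k a).prod (bet k)).withDensity fun q ↦ ENNReal.ofReal (Wt k q.2) := by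
  haveI := sg_fin k ha
  unfold bw
  rw [prod_withDensity_right (Wt_meas k).ennreal_ofReal]
theorem Wx_meas (k : ℕ) (a : ℝ) : Measurable fun q : Sp k × ℂ ↦ ENNReal.ofReal (Wt k q.2) :=
  ((Wt_meas k).comp measurable_snd).ennreal_ofReal
theorem tr_int {k : ℕ} {a : ℝ} (ha : 0 < a) (s : ℝ) {f : Pt (k + 1) → ℝ} (hf : AEStronglyMeasurable f volume) :
    ∫ p, f p = ∫ q, Wt k q.2 * f (Sm a s q.1.1 q.2) ∂((sg k a).prod (bet k)) := by
  have h := (sm_mp (k := k) ha s).map_eq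
  rw [← h, integral_map (Sm_meas a s).aemeasurable (by rwa [h]), bw_pr k ha,
    integral_withDensity_eq_integral_toReal_smul (Wx_meas k a) (Eventually.of_forall fun _ ↦ ENNReal.ofReal_lt_top)]
  refine integral_congr_ae (Eventually.of_forall fun q ↦ ?_)
  simp [ENNReal.toReal_ofReal (Wt_nn k q.2)]
theorem tr_intb {k : ℕ} {a : ℝ} (ha : 0 < a) (s : ℝ) {f : Pt (k + 1) → ℝ} (hf : AEStronglyMeasurable f volume) :
    Integrable f ↔ Integrable (fun q : Sp k × ℂ ↦ Wt k q.2 * f (Sm a s q.1.1 q.2)) ((sg k a).prod (bet k)) := by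
  have h := (sm_mp (k := k) ha s).integrable_comp hf
  rw [← h, bw_pr k ha, integrable_withDensity_iff_integrable_smul' (Wx_meas k a) (Eventually.of_forall fun _ ↦ ENNReal.ofReal_lt_top)]
  refine integrable_congr (Eventually.of_forall fun q ↦ ?_)
  simp [ENNReal.toReal_ofReal (Wt_nn k q.2)]
theorem pr_D {k : ℕ} {a : ℝ} (ha : 0 < a) : ∀ᵐ q ∂((sg k a).prod (bet k)), q.2 ∈ DD := by
  haveI := sg_fin k ha
  exact Measure.quasiMeasurePreserving_snd.ae (bet_D k)
end Heis
namespace Heis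
def kap (k : ℕ) (z : ℂ) : ℝ := ‖1 + z‖ ^ (k + 1)
theorem kap_pos {k : ℕ} {z : ℂ} (hz : 1 + z ≠ 0) : 0 < kap k z := pow_pos (norm_pos_iff.2 hz) _
theorem nr_gr (z : ℂ) : DifferentiableAt ℝ (fun z : ℂ ↦ ‖1 + z‖ ^ 2) z ∧ gr (fun z : ℂ ↦ ‖1 + z‖ ^ 2) z = 2 * (1 + z) := by
  have h := (hasStrictFDerivAt_norm_sq (1 + z)).hasFDerivAt.comp z ((hasFDerivAt_id (𝕜 := ℝ) z).const_add 1)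
  refine ⟨h.differentiableAt, (gr_eq h).trans ?_⟩
  apply Complex.ext <;> simp; ring
theorem kap_cd {k : ℕ} {z : ℂ} (hz : 1 + z ≠ 0) : ContDiffAt ℝ (⊤ : ℕ∞) (kap k) z :=
  ((contDiffAt_const.add contDiffAt_id).norm ℝ hz).pow _
theorem kap_c1 {k : ℕ} : ∀ z ∈ DD, ContDiffAt ℝ 1 (kap k) z := fun z hz ↦ (kap_cd (one_add_ne hz)).of_le (by simp)
theorem kap_gr {k : ℕ} {z : ℂ} (hz : 1 + z ≠ 0) : gr (kap k) z = ((NN k * kap k z / ‖1 + z‖ ^ 2 : ℝ) : ℂ) * (1 + z) := by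
  have hn := norm_pos_iff.2 hz
  have h1 : HasDerivAt (fun t : ℝ ↦ √t ^ (k + 1)) ((k + 1 : ℝ) * ‖1 + z‖ ^ k * (1 / (2 * ‖1 + z‖))) (‖1 + z‖ ^ 2) := by
    have := ((hasDerivAt_id (‖1 + z‖ ^ 2)).sqrt (by simp only [id]; positivity)).pow (k + 1)
    refine this.congr_deriv ?_
    simp [Real.sqrt_sq hn.le]
  have e : kap k = fun z ↦ √(‖1 + z‖ ^ 2) ^ (k + 1) := by funext z; rw [kap, Real.sqrt_sq (norm_nonneg _)]
  have := gr_comp h1 (nr_gr z).1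
  rw [e, this, (nr_gr z).2, ← mul_assoc]
  congr 1
  rw [← Complex.ofReal_ofNat, ← Complex.ofReal_mul, NN]
  simp only [Real.sqrt_sq hn.le]
  congr 1; field_simp; ring
theorem dk_pt {k : ℕ} {ψ φ : ℂ → ℝ} (h : Core ψ) (h' : Core φ) {z : ℂ} (hz : z ∈ DD) :
    (kap k z ^ 2)⁻¹ * inner ℝ (gr (fun z ↦ kap k z * ψ z) z) (gr (fun z ↦ kap k z * φ z) z) =
      inner ℝ (gr ψ z) (gr φ z) + NN k / ‖1 + z‖ ^ 2 * inner ℝ (gr (fun z ↦ ψ z * φ z) z) (1 + z) + NN k ^ 2 / ‖1 + z‖ ^ 2 * (ψ z * φ z) := by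
  have h1 := one_add_ne hz
  have hn := norm_pos_iff.2 h1
  have hk := kap_pos (k := k) h1
  rw [h.gr_mulOn kap_c1, h'.gr_mulOn kap_c1, gr_mul h.diff.differentiableAt h'.diff.differentiableAt, kap_gr h1]
  simp only [inner_C, Complex.mul_re, Complex.mul_im, Complex.add_re, Complex.add_im, Complex.ofReal_re, Complex.ofReal_im, Complex.one_re, Complex.one_im]
  have e := normsq_C (1 + z)
  simp only [Complex.add_re, Complex.add_im, Complex.one_re, Complex.one_im] at e
  field_simp
  have e2 : (1 + z.re) ^ 2 = ‖1 + z‖ ^ 2 - (0 + z.im) ^ 2 := by linarith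
  ring_nf at e2 ⊢
  linear_combination (NN k ^ 2 * ψ z * φ z * kap k z ^ 2) * e2
theorem dk_div {k : ℕ} {χ : ℂ → ℝ} (h : Core χ) : Integrable (fun z ↦ fD z ^ (k + 1) * (NN k / ‖1 + z‖ ^ 2 * inner ℝ (gr χ z) (1 + z) + NN k ^ 2 / ‖1 + z‖ ^ 2 * χ z) - fD z ^ k * (NN k ^ 2 * χ z)) ∧
    ∫ z, (fD z ^ (k + 1) * (NN k / ‖1 + z‖ ^ 2 * inner ℝ (gr χ z) (1 + z) + NN k ^ 2 / ‖1 + z‖ ^ 2 * χ z) - fD z ^ k * (NN k ^ 2 * χ z)) = 0 := by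
  set y : ℂ → ℝ := fun z ↦ (NN k * fD z ^ (k + 1)) * (‖1 + z‖ ^ 2)⁻¹ with hy
  have hyd : ∀ z ∈ DD, ContDiffAt ℝ 1 y z := fun z hz ↦ by
    have h1 := one_add_ne hz
    have hn := norm_pos_iff.2 h1
    have c1 : ContDiffAt ℝ 1 (fun z : ℂ ↦ ‖1 + z‖ ^ 2) z := ((contDiffAt_const.add contDiffAt_id).norm ℝ h1).pow _
    exact (contDiffAt_const.mul ((fD_cd.contDiffAt.of_le (by simp)).pow _)).mul (c1.inv (pow_pos hn 2).ne')
  have c1 : ContDiff ℝ 1 fun z : ℂ ↦ 1 + z.re := contDiff_const.add (id_cd.1.of_le (by simp))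
  have c2 : ContDiff ℝ 1 fun z : ℂ ↦ z.im := id_cd.2.of_le (by simp)
  have hgy : ∀ z ∈ DD, gr y z = ((-2 * NN k ^ 2 * fD z ^ k / ‖1 + z‖ ^ 2 : ℝ) : ℂ) * z - ((2 * y z / ‖1 + z‖ ^ 2 : ℝ) : ℂ) * (1 + z) := fun z hz ↦ by
    have h1 := one_add_ne hz
    have hn := norm_pos_iff.2 h1
    have hf : gr (fun z ↦ NN k * fD z ^ (k + 1)) z = ((NN k * ((k + 1 : ℕ) * fD z ^ k) : ℝ) : ℂ) * (-2 * z) :=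
      gr_comp_fD (g := fun t ↦ NN k * t ^ (k + 1)) ((hasDerivAt_pow (k + 1) (fD z)).const_mul (NN k))
    have hi := gr_comp (g := fun t : ℝ ↦ t⁻¹) (φ := fun z : ℂ ↦ ‖1 + z‖ ^ 2) (z := z) (hasDerivAt_inv (pow_pos hn 2).ne') (nr_gr z).1
    rw [(nr_gr z).2] at hi
    have hm := gr_mul (φ := fun z ↦ NN k * fD z ^ (k + 1)) (ψ := fun z ↦ (‖1 + z‖ ^ 2)⁻¹) (z := z)
      (by have := fD_cd.differentiable (by simp) z; fun_prop) ((nr_gr z).1.inv (pow_pos hn 2).ne')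
    rw [hf, hi] at hm
    refine hm.trans ?_
    have hN : ((k + 1 : ℕ) : ℝ) = NN k := by simp [NN]
    rw [hN]
    apply Complex.ext <;> simp only [hy, Complex.sub_re, Complex.add_re, Complex.sub_im, Complex.add_im, Complex.mul_re, Complex.mul_im, Complex.ofReal_re, Complex.ofReal_im, Complex.neg_re, Complex.neg_im, Complex.re_ofNat, Complex.im_ofNat, Complex.one_re, Complex.one_im] <;> field_simp <;> ring
  have hi := ibp h (fun z hz ↦ (hyd z hz).mul c1.contDiffAt) (fun z hz ↦ (hyd z hz).mul c2.contDiffAt)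
  have e : (fun z ↦ fD z ^ (k + 1) * (NN k / ‖1 + z‖ ^ 2 * inner ℝ (gr χ z) (1 + z) + NN k ^ 2 / ‖1 + z‖ ^ 2 * χ z) - fD z ^ k * (NN k ^ 2 * χ z)) = fun z ↦ (((gr χ z).re * (y z * (1 + z.re)) + (gr χ z).im * (y z * z.im)) + χ z * ((gr (fun z ↦ y z * (1 + z.re)) z).re + (gr (fun z ↦ y z * z.im) z).im)) := by
    funext z
    by_cases hz : z ∈ DD
    · have h1 := one_add_ne hz
      have hn := norm_pos_iff.2 h1
      have g1 := gr_mul ((hyd z hz).differentiableAt one_ne_zero) (c1.differentiable one_ne_zero z)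
      have g2 := gr_mul ((hyd z hz).differentiableAt one_ne_zero) (c2.differentiable one_ne_zero z)
      have g3 : gr (fun z : ℂ ↦ 1 + z.re) z = 1 := by
        rw [gr_add (φ := fun _ ↦ (1:ℝ)) (by fun_prop) (id_cd.1.differentiable (by simp) z), gr_re]; simp [gr]; rfl
      rw [g1, g2, g3, gr_im, hgy z hz]
      have e := normsq_C (1 + z)
      have e3 : fD z = 1 - (z.re ^ 2 + z.im ^ 2) := by rw [← normsq_C]; rfl
      simp only [Complex.add_re, Complex.add_im, Complex.one_re, Complex.one_im] at e
      simp only [inner_C, hy, Complex.sub_re, Complex.sub_im, Complex.mul_re, Complex.mul_im, Complex.add_re, Complex.add_im, Complex.ofReal_re, Complex.ofReal_im, Complex.one_re, Complex.one_im, Complex.I_re, Complex.I_im]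
      rw [pow_succ]
      field_simp
      rw [e, e3]; ring
    · simp [h.eq0 hz, h.gr0 hz]
  rw [e]; exact hi
theorem inner_emb' {k : ℕ} {ψ φ : ℂ → ℝ} (h : Core ψ) (h' : Core φ) : Integrable (fun z ↦ fD z ^ k * (NN k ^ 2 * (ψ z * φ z) + fD z * inner ℝ (gr ψ z) (gr φ z))) ∧
    inner ℝ (emb k ψ h) (emb k φ h') = ∫ z, fD z ^ k * (NN k ^ 2 * (ψ z * φ z) + fD z * inner ℝ (gr ψ z) (gr φ z)) := by
  have hD := fD_cont
  have hc1 := h.cont; have hc2 := h'.cont; have hg1 := h.grc; have hg2 := h'.grc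
  have k1 : HasCompactSupport fun z ↦ ψ z * φ z := h.cpt.mul_right
  have k2 : HasCompactSupport fun z ↦ fD z * inner ℝ (gr ψ z) (gr φ z) := HasCompactSupport.intro h.cpt fun z hz ↦ by rw [gr_supp ψ hz]; simp
  have j1 : Integrable (fun z ↦ ψ z * φ z) (bet k) := memLp_one_iff_integrable.1 (memLp_cs (by fun_prop) k1 k 1)
  have j2 : Integrable (fun z ↦ fD z * inner ℝ (gr ψ z) (gr φ z)) (bet k) := memLp_one_iff_integrable.1 (memLp_cs (by fun_prop) k2 k 1)
  have e0 : ∫ z, inner ℝ (gf (emb k ψ h) z) ((sf z : ℂ) * gr φ z) ∂(bet k) = ∫ z, fD z * inner ℝ (gr ψ z) (gr φ z) ∂bet k := by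
    refine integral_congr_ae ?_
    filter_upwards [emb_g k h, bet_D k] with z h1 h2
    rw [h1, ← sf_sq h2]; simp only [inner_C]; simp; ring
  refine ⟨int_cs (by fun_prop) (HasCompactSupport.intro h.cpt fun z hz ↦ by rw [gr_supp ψ hz, image_eq_zero_of_notMem_tsupport hz]; simp), ?_⟩
  rw [inner_emb, e0, integral_congr_ae (g := fun z ↦ ψ z * φ z) (by filter_upwards [emb_w k h] with z hz; rw [hz]),
    ← integral_const_mul, ← integral_add (j1.const_mul _) j2, bet_int]
  exact setInt_core fun z hz ↦ by rw [h.eq0 hz, h.gr0 hz]; simp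
theorem dk {k : ℕ} {ψ φ : ℂ → ℝ} (h : Core ψ) (h' : Core φ) :
    ∫ z, fD z * ((kap k z ^ 2)⁻¹ * inner ℝ (gr (fun z ↦ kap k z * ψ z) z) (gr (fun z ↦ kap k z * φ z) z)) ∂bet k = inner ℝ (emb k ψ h) (emb k φ h') := by
  have hm : Core fun z ↦ ψ z * φ z := h'.mulOn fun z _ ↦ h.cd.contDiffAt
  obtain ⟨a1, a2⟩ := dk_div (k := k) hm
  obtain ⟨b1, b2⟩ := inner_emb' (k := k) h h'
  rw [b2, bet_int, setInt_core fun z hz ↦ by rw [(h.mulOn kap_c1).gr0 hz]; simp, ← add_zero (∫ z, fD z ^ k * (NN k ^ 2 * (ψ z * φ z) + fD z * inner ℝ (gr ψ z) (gr φ z))), ← a2,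
    ← integral_add b1 a1]
  refine integral_congr_ae (Eventually.of_forall fun z ↦ ?_)
  by_cases hz : z ∈ DD
  · simp only [smul_eq_mul]; rw [dk_pt h h' hz]; ring
  · simp [h.eq0 hz, h.gr0 hz, (h.mulOn kap_c1).gr0 hz, hm.gr0 hz]
end Heis
namespace Heis
def Ro (n : ℕ) (θ : ℝ) : Pt n →ₗ[ℝ] Pt n where
  toFun p := (Real.cos θ • p.1 + Real.sin θ • p.2.1, -Real.sin θ • p.1 + Real.cos θ • p.2.1, p.2.2)
  map_add' p q := by refine Prod.ext ?_ (Prod.ext ?_ ?_) <;> simp <;> abel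
  map_smul' c p := by
    refine Prod.ext ?_ (Prod.ext ?_ ?_)
    · funext j; simp; ring
    · funext j; simp; ring
    · simp
theorem Ro_cont (n : ℕ) (θ : ℝ) : Continuous (Ro n θ) := (Ro n θ).continuous_of_finiteDimensional
theorem Ro_mp (n : ℕ) (θ : ℝ) : MeasurePreserving (Ro n θ) volume volume := by
  let σ : Pt n →ₗ[ℝ] Pt n := ⟨⟨fun p ↦ (p.2.1, p.1, p.2.2), fun p q ↦ rfl⟩, fun c p ↦ rfl⟩
  have h1 : LinearMap.det (Ro n θ) * LinearMap.det (Ro n (-θ)) = 1 := by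
    rw [← LinearMap.det_comp, ← LinearMap.det_id (A := ℝ) (M := Pt n)]; congr 1
    refine LinearMap.ext fun p ↦ Prod.ext ?_ (Prod.ext ?_ ?_)
    · funext j; simp [Ro]; linear_combination (p.1 j) * Real.cos_sq_add_sin_sq θ
    · funext j; simp [Ro]; linear_combination (p.2.1 j) * Real.cos_sq_add_sin_sq θ
    · simp [Ro]
  have h2 : LinearMap.det σ * LinearMap.det σ = 1 := by
    rw [← LinearMap.det_comp, ← LinearMap.det_id (A := ℝ) (M := Pt n)]; congr 1
  have h3 : LinearMap.det (Ro n (-θ)) = LinearMap.det σ * (LinearMap.det (Ro n θ) * LinearMap.det σ) := by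
    rw [← LinearMap.det_comp, ← LinearMap.det_comp]; congr 1
    refine LinearMap.ext fun p ↦ Prod.ext ?_ (Prod.ext ?_ ?_)
    · funext j; simp [Ro, σ]; ring
    · funext j; simp [Ro, σ]; ring
    · simp [Ro, σ]
  have h4 : LinearMap.det (Ro n θ) ^ 2 = 1 := by rw [h3] at h1; linear_combination h1 - LinearMap.det (Ro n θ) ^ 2 * h2
  refine ⟨(Ro_cont n θ).measurable, ?_⟩
  rw [Measure.map_linearMap_addHaar_eq_smul_addHaar _ (fun h ↦ by rw [h] at h4; norm_num at h4)]
  rcases (mul_self_eq_one_iff.1 ((sq _).symm.trans h4)) with h | h <;> simp [h]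
theorem Ro_der {n : ℕ} {Ψ : Pt n → ℝ} (hd : Differentiable ℝ Ψ) (p : Pt n) (θ : ℝ) :
    HasDerivAt (fun θ ↦ Ψ (Ro n θ p)) (Rd Ψ (Ro n θ p)) θ := by
  have h1 : HasDerivAt (fun θ ↦ Ro n θ p) ((Ro n θ p).2.1, -(Ro n θ p).1, 0) θ := by
    have c := Real.hasDerivAt_cos θ
    have d := Real.hasDerivAt_sin θ
    refine (((c.smul_const p.1).add (d.smul_const p.2.1)).prodMk (((d.neg.smul_const p.1).add (c.smul_const p.2.1)).prodMk (hasDerivAt_const θ p.2.2))).congr_deriv ?_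
    refine Prod.ext ?_ (Prod.ext ?_ ?_)
    · simp [Ro]
    · simp [Ro]; abel
    · simp
  exact (hd _).hasFDerivAt.comp_hasDerivAt θ h1
theorem fd_cs {n : ℕ} {Ψ : Pt n → ℝ} (h1 : ContDiff ℝ 1 Ψ) (h2 : HasCompactSupport Ψ) {v : Pt n → Pt n} (hv : Continuous v) :
    Continuous (fun p ↦ fderiv ℝ Ψ p (v p)) ∧ HasCompactSupport (fun p ↦ fderiv ℝ Ψ p (v p)) :=
  ⟨(h1.continuous_fderiv one_ne_zero).clm_apply hv, (h2.fderiv ℝ).mono fun p hp h ↦ hp (by simp [h])⟩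
theorem rot0 {n : ℕ} {Ψ g : Pt n → ℝ} (h1 : ContDiff ℝ 1 Ψ) (h2 : HasCompactSupport Ψ) (hg : Continuous g) (hg2 : HasCompactSupport g)
    (hr : ∀ θ p, g (Ro n θ p) = g p) : ∫ p, g p * Rd Ψ p = 0 := by
  obtain ⟨b1, b2⟩ := fd_cs h1 h2 (v := fun p ↦ (p.2.1, -p.1, 0)) (by fun_prop)
  obtain ⟨C, hC⟩ := b2.exists_bound_of_continuous b1
  have hgi : Integrable g := hg.integrable_of_hasCompactSupport hg2
  have hcon : ∀ θ, ∫ p, g p * Ψ (Ro n θ p) = ∫ p, g p * Ψ p := fun θ ↦ by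
    have := integral_map (μ := volume) (Ro_mp n θ).measurable.aemeasurable (f := fun p ↦ g p * Ψ p) (hg.mul h1.continuous).aestronglyMeasurable
    rw [(Ro_mp n θ).map_eq] at this
    simp only [hr] at this; exact this.symm
  have hd := hasDerivAt_integral_of_dominated_loc_of_deriv_le (μ := volume) (F := fun θ p ↦ g p * Ψ (Ro n θ p)) (F' := fun θ p ↦ g p * Rd Ψ (Ro n θ p)) (x₀ := (0:ℝ)) (s := Set.univ)
    (bound := fun p ↦ |g p| * C) univ_mem (Eventually.of_forall fun θ ↦ (hg.mul (h1.continuous.comp (Ro_cont n θ))).aestronglyMeasurable) 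
    ((hg.mul (h1.continuous.comp (Ro_cont n 0))).integrable_of_hasCompactSupport hg2.mul_right)
    (hg.mul (b1.comp (Ro_cont n 0))).aestronglyMeasurable
    (Eventually.of_forall fun p θ _ ↦ by rw [norm_mul]; exact mul_le_mul_of_nonneg_left (hC _) (abs_nonneg _)) (hgi.abs.mul_const C)
    (Eventually.of_forall fun p θ _ ↦ (Ro_der (h1.differentiable one_ne_zero) p θ).const_mul _)
  have h3 := hd.2
  simp only [hcon] at h3
  have h4 := h3.unique (hasDerivAt_const _ _)
  have e : ∀ p, Ro n 0 p = p := fun p ↦ by simp [Ro]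
  simpa [e] using h4
theorem Xd_eq {n : ℕ} (j : Fin n) (u : Pt n → ℝ) : Xd n j u = fun p ↦ fderiv ℝ u p (ex n j + (2 * p.2.1 j) • et n) := by funext p; simp [Xd]
theorem Yd_eq {n : ℕ} (j : Fin n) (u : Pt n → ℝ) : Yd n j u = fun p ↦ fderiv ℝ u p (ey n j + (-2 * p.1 j) • et n) := by funext p; simp [Yd]; ring
theorem Xd_cs {n : ℕ} {u : Pt n → ℝ} (h1 : ContDiff ℝ 1 u) (h2 : HasCompactSupport u) (j : Fin n) :
    (Continuous (Xd n j u) ∧ HasCompactSupport (Xd n j u)) ∧ Continuous (Yd n j u) ∧ HasCompactSupport (Yd n j u) := by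
  rw [Xd_eq, Yd_eq]; exact ⟨fd_cs h1 h2 (by fun_prop), fd_cs h1 h2 (by fun_prop)⟩
def HF (k : ℕ) (a s : ℝ) (ψ : ℂ → ℝ) (p : Pt (k + 1)) : ℝ := kap k (Zm a s p) * ψ (Zm a s p)
theorem HF_cs {k : ℕ} {a : ℝ} (ha : 0 < a) (s : ℝ) {ψ : ℂ → ℝ} (h : Core ψ) : ContDiff ℝ 1 (HF k a s ψ) ∧ HasCompactSupport (HF k a s ψ) :=
  (h.mulOn kap_c1).cz ha s
theorem wt_kap {k : ℕ} {z : ℂ} (hz : z ∈ DD) (a x : ℝ) : Wt k z * (a * fD z * ‖1 + z‖ ^ 2 * x) = a * (fD z * ((kap k z ^ 2)⁻¹ * x)) := by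
  have := norm_pos_iff.2 (one_add_ne hz)
  simp only [Wt, kap]; field_simp; ring
theorem dot_ag {k : ℕ} {a : ℝ} (ha : 0 < a) (s : ℝ) {h : ℂ → ℝ} (hh : Core h) {Ψ : Pt (k + 1) → ℝ} (h1 : ContDiff ℝ 1 Ψ) (h2 : HasCompactSupport Ψ) :
    ∫ p, (Ag a s h p).im * Rd Ψ p = 0 := by
  obtain ⟨c1, c2⟩ := hh.cz (n := k + 1) ha s
  obtain ⟨b1, b2⟩ := fd_cs c1 c2 (v := fun _ ↦ a⁻¹ • et (k + 1)) (by fun_prop)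
  have e : ∀ p, fderiv ℝ (fun p : Pt (k + 1) ↦ h (Zm a s p)) p (a⁻¹ • et (k + 1)) = (Ag a s h p).im := fun p ↦ by
    rw [HZ_der ha s (hh.diff _)]; simp [et]; field_simp
  simp only [e] at b1 b2
  refine rot0 h1 h2 b1 b2 fun θ p ↦ ?_
  have : PP a s (Ro (k + 1) θ p) = PP a s p := by
    have : nq ((Ro (k + 1) θ p).1, (Ro (k + 1) θ p).2.1) = nq (p.1, p.2.1) := by
      simp only [nq, Ro, ← Finset.sum_add_distrib]
      refine Finset.sum_congr rfl fun j _ ↦ ?_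
      simp
      linear_combination (p.1 j ^ 2 + p.2.1 j ^ 2) * Real.cos_sq_add_sin_sq θ
    simp only [PP, this]; simp [Ro]
  simp only [Ag, Zm, this]
theorem I2 {k : ℕ} {a : ℝ} (ha : 0 < a) (s : ℝ) {ψ : ℂ → ℝ} (h : Core ψ) {Ψ : Pt (k + 1) → ℝ} (h1 : ContDiff ℝ 1 Ψ) (h2 : HasCompactSupport Ψ)
    {φ : Sp k → ℂ → ℝ} (hφ : ∀ v, Core (φ v)) (he : ∀ v : Sp k, ∀ z ∈ DD, Ψ (Sm a s v z) = kap k z * φ v z) :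
    Integrable (fun v ↦ inner ℝ (emb k ψ h) (emb k (φ v) (hφ v))) (sg k a) ∧
    ∫ p, hDot (k + 1) (HF k a s ψ) Ψ p = a * ∫ v, inner ℝ (emb k ψ h) (emb k (φ v) (hφ v)) ∂sg k a := by
  haveI := sg_fin k ha
  have hh := h.mulOn (kap_c1 (k := k))
  obtain ⟨c1, c2⟩ := HF_cs (k := k) ha s h
  have hd := h1.differentiable one_ne_zero
  set R : Pt (k + 1) → ℝ := fun p ↦ hDot (k + 1) (HF k a s ψ) Ψ p - 2 * a * ((Ag a s (fun z ↦ kap k z * ψ z) p).im * Rd Ψ p) with hR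
  obtain ⟨b1, b2⟩ := fd_cs c1 c2 (v := fun _ ↦ a⁻¹ • et (k + 1)) (by fun_prop)
  have e : ∀ p, fderiv ℝ (HF k a s ψ) p (a⁻¹ • et (k + 1)) = (Ag a s (fun z ↦ kap k z * ψ z) p).im := fun p ↦ by
    have := HZ_der ha s (hh.diff (Zm a s p)) (a⁻¹ • et (k + 1))
    unfold HF; rw [this]; simp [et]; field_simp
  simp only [e] at b1 b2
  obtain ⟨d1, d2⟩ := fd_cs h1 h2 (v := fun p ↦ (p.2.1, -p.1, 0)) (by fun_prop)
  have i1 : Integrable (hDot (k + 1) (HF k a s ψ) Ψ) := by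
    unfold hDot
    refine integrable_finset_sum _ fun j _ ↦ ?_
    obtain ⟨⟨x1, x2⟩, x3, x4⟩ := Xd_cs c1 c2 j
    obtain ⟨⟨y1, y2⟩, y3, y4⟩ := Xd_cs h1 h2 j
    exact ((x1.mul y1).integrable_of_hasCompactSupport x2.mul_right).add ((x3.mul y3).integrable_of_hasCompactSupport x4.mul_right)
  have i2 : Integrable fun p ↦ 2 * a * ((Ag a s (fun z ↦ kap k z * ψ z) p).im * Rd Ψ p) :=
    ((b1.mul d1).integrable_of_hasCompactSupport b2.mul_right).const_mul _
  have i3 : Integrable R := i1.sub i2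
  have e1 : ∫ p, hDot (k + 1) (HF k a s ψ) Ψ p = ∫ p, R p := by
    rw [hR, integral_sub i1 i2, integral_const_mul, dot_ag ha s hh h1 h2]; simp
  have e2 : ∀ᵐ q ∂(sg k a).prod (bet k), Wt k q.2 * R (Sm a s q.1.1 q.2) =
      a * (fD q.2 * ((kap k q.2 ^ 2)⁻¹ * inner ℝ (gr (fun z ↦ kap k z * ψ z) q.2) (gr (fun z ↦ kap k z * φ q.1 z) q.2))) := by
    filter_upwards [pr_D (k := k) ha] with q hq
    have g1 : R (Sm a s q.1.1 q.2) = _ := (sub_eq_iff_eq_add'.2 (HZ_dot ha s (hh.diff (Zm a s (Sm a s q.1.1 q.2))) Ψ)).trans (pt_id ha s (sp_ne q.1) hq hd _)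
    have g2 : gr (fun z ↦ Ψ (Sm a s q.1.1 z)) q.2 = gr (fun z ↦ kap k z * φ q.1 z) q.2 := by
      have : (fun z ↦ Ψ (Sm a s q.1.1 z)) =ᶠ[𝓝 q.2] (fun z ↦ kap k z * φ q.1 z) := by
        filter_upwards [Metric.isOpen_ball.mem_nhds hq] with z hz using he _ z hz
      simp only [gr, this.fderiv_eq]
    rw [g1, g2, wt_kap hq]
  have i4 := (integrable_congr e2).1 ((tr_intb ha s i3.aestronglyMeasurable).1 i3)
  have i5 := i4.integral_prod_left
  have e3 : ∀ v, ∫ z, a * (fD z * ((kap k z ^ 2)⁻¹ * inner ℝ (gr (fun z ↦ kap k z * ψ z) z) (gr (fun z ↦ kap k z * φ v z) z))) ∂bet k = a * inner ℝ (emb k ψ h) (emb k (φ v) (hφ v)) := fun v ↦ by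
    rw [integral_const_mul, dk h (hφ v)]
  simp only [e3] at i5
  refine ⟨(integrable_const_mul_iff (isUnit_iff_ne_zero.2 ha.ne') _).1 i5, ?_⟩
  rw [e1, tr_int ha s i3.aestronglyMeasurable, integral_congr_ae e2, integral_prod _ i4]
  simp only [e3, integral_const_mul]
theorem I1 {k : ℕ} {a : ℝ} (ha : 0 < a) (s : ℝ) {ψ : ℂ → ℝ} (h : Core ψ) :
    ∫ p, hDot (k + 1) (HF k a s ψ) (HF k a s ψ) p = a * (((sg k a).real Set.univ) * ‖emb k ψ h‖ ^ 2) := by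
  obtain ⟨c1, c2⟩ := HF_cs (k := k) ha s h
  rw [(I2 ha s h c1 c2 (φ := fun _ ↦ ψ) (fun _ ↦ h) fun v z hz ↦ by rw [HF, Zm_Sm ha s (sp_ne v) hz]).2]
  simp
end Heis
namespace Heis
theorem L2_lim {α : Type*} [MeasurableSpace α] {μ : Measure α} {V : Type*} [NormedAddCommGroup V] {f : ℕ → α → ℝ} {v : ℕ → V} {x : V} {C : ℝ} (hC : 0 ≤ C)
    (hf : ∀ m, MemLp (f m) 2 μ) (hb : ∀ m l, ∫ a, (f m a - f l a) ^ 2 ∂μ ≤ C * ‖v m - v l‖ ^ 2) (hv : Tendsto v atTop (𝓝 x)) :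
    ∃ g, MemLp g 2 μ ∧ ∀ η, MemLp η 2 μ → Tendsto (fun m ↦ ∫ a, f m a * η a ∂μ) atTop (𝓝 (∫ a, g a * η a ∂μ)) := by
  have hin : ∀ {f g : α → ℝ} (hf : MemLp f 2 μ) (hg : MemLp g 2 μ), inner ℝ (hf.toLp f) (hg.toLp g) = ∫ a, f a * g a ∂μ := fun hf hg ↦ by
    rw [L2.inner_def]
    refine integral_congr_ae ?_
    filter_upwards [hf.coeFn_toLp, hg.coeFn_toLp] with a h1 h2
    rw [h1, h2]; simp [mul_comm]
  have hd : ∀ m l, dist ((hf m).toLp (f m)) ((hf l).toLp (f l)) ≤ √C * dist (v m) (v l) := fun m l ↦ by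
    rw [dist_eq_norm, ← MemLp.toLp_sub, dist_eq_norm]
    refine abs_le_of_sq_le_sq' ?_ (by positivity) |>.2
    rw [← real_inner_self_eq_norm_sq, hin, mul_pow, Real.sq_sqrt hC]
    simpa [sq] using hb m l
  have hc : CauchySeq fun m ↦ (hf m).toLp (f m) := by
    rw [Metric.cauchySeq_iff']
    intro ε hε
    obtain ⟨N, hN⟩ := Metric.cauchySeq_iff'.1 hv.cauchySeq (ε / (√C + 1)) (by positivity)
    refine ⟨N, fun m hm ↦ (hd m N).trans_lt ?_⟩
    have h1 := hN m hm
    rw [lt_div_iff₀ (by positivity)] at h1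
    nlinarith [dist_nonneg (x := v m) (y := v N)]
  obtain ⟨F, hF⟩ := cauchySeq_tendsto_of_complete hc
  refine ⟨F, Lp.memLp F, fun η hη ↦ ?_⟩
  have h1 : Tendsto (fun m ↦ inner ℝ ((hf m).toLp (f m)) (hη.toLp η)) atTop (𝓝 (inner ℝ F (hη.toLp η))) := hF.inner tendsto_const_nhds
  simp only [hin] at h1
  convert h1 using 2
  rw [← hin (Lp.memLp F) hη, Lp.toLp_coeFn]
theorem Zm_qmp {k : ℕ} {a : ℝ} (ha : 0 < a) (s : ℝ) : Measure.QuasiMeasurePreserving (Zm a s : Pt (k + 1) → ℂ) volume (bet k) := by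
  haveI := sg_fin k ha
  have hm := (Zm_cd (n := k + 1) ha s).continuous.measurable
  refine ⟨hm, Measure.AbsolutelyContinuous.mk fun S hS h0 ↦ ?_⟩
  rw [Measure.map_apply hm hS, ← (sm_mp (k := k) ha s).measure_preimage (hm hS).nullMeasurableSet, bw_pr k ha]
  refine withDensity_absolutelyContinuous _ _ ?_
  have h1 : ∀ᵐ z ∂bet k, z ∉ S := by rw [ae_iff]; simpa using h0
  have h2 : ∀ᵐ q ∂(sg k a).prod (bet k), q.2 ∉ S := Measure.quasiMeasurePreserving_snd.ae h1
  have h3 : ∀ᵐ q ∂(sg k a).prod (bet k), Sm a s q.1.1 q.2 ∉ Zm a s ⁻¹' S := by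
    filter_upwards [h2, pr_D ha] with q q1 q2
    rwa [Set.mem_preimage, Zm_Sm ha s (sp_ne q.1) q2]
  rw [ae_iff] at h3
  simp only [not_not] at h3; exact h3
theorem Zm_D {k : ℕ} {a : ℝ} (ha : 0 < a) (s : ℝ) : ∀ᵐ p : Pt (k + 1), Zm a s p ∈ DD := (Zm_qmp ha s).ae (bet_D k)
theorem kz_cont {k n : ℕ} {a : ℝ} (ha : 0 < a) (s : ℝ) : ContDiff ℝ (⊤ : ℕ∞) (fun p : Pt n ↦ kap k (Zm a s p)) :=
  contDiff_iff_contDiffAt.2 fun p ↦ (kap_cd (Zm_ne ha s p)).comp p (Zm_cd ha s).contDiffAt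
theorem HF_meas {k : ℕ} {a : ℝ} (ha : 0 < a) (s : ℝ) {w : ℂ → ℝ} (hw : StronglyMeasurable w) : StronglyMeasurable (HF k a s w) :=
  (kz_cont ha s).continuous.stronglyMeasurable.mul (hw.comp_measurable (Zm_cd ha s).continuous.measurable)
theorem HF_bd {k : ℕ} {a : ℝ} (ha : 0 < a) (s : ℝ) {η : Pt (k + 1) → ℝ} (h1 : Continuous η) (h2 : HasCompactSupport η) :
    ∃ C, ∀ y : VV k, Integrable (fun p ↦ HF k a s (wf y) p * η p) ∧ |∫ p, HF k a s (wf y) p * η p| ≤ C * ‖y‖ := by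
  haveI := sg_fin k ha
  have hZ := (Zm_cd (n := k + 1) ha s).continuous
  have hB : Continuous fun p : Pt (k + 1) ↦ Wt k (Zm a s p) * (kap k (Zm a s p) * η p) := by
    have := (kz_cont (k := k) (n := k + 1) ha s).continuous
    unfold Wt
    exact (continuous_const.div (by fun_prop) fun p ↦ pow_ne_zero _ (norm_ne_zero_iff.2 (Zm_ne ha s p))).mul (this.mul h1)
  obtain ⟨C, hC⟩ := (h2.mul_left (f := fun p ↦ kap k (Zm a s p)) |>.mul_left (f := fun p ↦ Wt k (Zm a s p))).exists_bound_of_continuous hB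
  have hC0 : 0 ≤ C := (norm_nonneg _).trans (hC 0)
  refine ⟨C * ((sg k a).real Set.univ * ((bet k).real Set.univ + 1)), fun y ↦ ?_⟩
  have hm : AEStronglyMeasurable (fun p ↦ HF k a s (wf y) p * η p) := ((HF_meas ha s (wf_sm y)).mul h1.stronglyMeasurable).aestronglyMeasurable
  have hw : Integrable (wf y) (bet k) := (wf_mem y).integrable (by norm_num)
  have hw2 : Integrable (fun q : Sp k × ℂ ↦ C * |wf y q.2|) ((sg k a).prod (bet k)) := (hw.abs.comp_snd (sg k a)).const_mul C
  have hle : ∀ᵐ q ∂(sg k a).prod (bet k), ‖Wt k q.2 * (HF k a s (wf y) (Sm a s q.1.1 q.2) * η (Sm a s q.1.1 q.2))‖ ≤ C * |wf y q.2| := by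
    filter_upwards [pr_D ha] with q hq
    have : ‖Wt k (Zm a s (Sm a s q.1.1 q.2)) * (kap k (Zm a s (Sm a s q.1.1 q.2)) * η (Sm a s q.1.1 q.2))‖ ≤ C := hC (Sm a s q.1.1 q.2)
    rw [HF, Zm_Sm ha s (sp_ne q.1) hq] at *
    have e : Wt k q.2 * (kap k q.2 * wf y q.2 * η (Sm a s q.1.1 q.2)) = Wt k q.2 * (kap k q.2 * η (Sm a s q.1.1 q.2)) * wf y q.2 := by ring
    rw [e, norm_mul]
    exact mul_le_mul_of_nonneg_right this (abs_nonneg _)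
  have hi : Integrable (fun q : Sp k × ℂ ↦ Wt k q.2 * (HF k a s (wf y) (Sm a s q.1.1 q.2) * η (Sm a s q.1.1 q.2))) ((sg k a).prod (bet k)) := by
    refine hw2.mono' ?_ hle
    have : Measurable fun q : Sp k × ℂ ↦ Wt k q.2 * (HF k a s (wf y) (Sm a s q.1.1 q.2) * η (Sm a s q.1.1 q.2)) :=
      ((Wt_meas k).comp measurable_snd).mul (((HF_meas ha s (wf_sm y)).mul h1.stronglyMeasurable).measurable.comp (Sm_meas a s))
    exact this.aestronglyMeasurable
  refine ⟨(tr_intb ha s hm).2 hi, ?_⟩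
  rw [tr_int ha s hm]
  refine (norm_integral_le_of_norm_le hw2 hle).trans ?_
  rw [integral_const_mul, integral_fun_snd (fun z ↦ |wf y z|), smul_eq_mul, mul_assoc, mul_assoc]
  exact mul_le_mul_of_nonneg_left (mul_le_mul_of_nonneg_left (w_abs_le y) measureReal_nonneg) hC0
theorem HF_lim {k : ℕ} {a : ℝ} (ha : 0 < a) (s : ℝ) {η : Pt (k + 1) → ℝ} (h1 : Continuous η) (h2 : HasCompactSupport η) {x : VV k} {ψ : ℕ → ℂ → ℝ}
    (h : ∀ m, Core (ψ m)) (hx : Tendsto (fun m ↦ emb k (ψ m) (h m)) atTop (𝓝 x)) :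
    Tendsto (fun m ↦ ∫ p, HF k a s (ψ m) p * η p) atTop (𝓝 (∫ p, HF k a s (wf x) p * η p)) := by
  obtain ⟨C, hC⟩ := HF_bd ha s h1 h2
  have e1 : ∀ m, ∫ p, HF k a s (ψ m) p * η p = ∫ p, HF k a s (wf (emb k (ψ m) (h m))) p * η p := fun m ↦ by
    refine integral_congr_ae ?_
    filter_upwards [(Zm_qmp ha s).ae (emb_w k (h m))] with p hp
    simp only [HF, hp]
  rw [tendsto_iff_norm_sub_tendsto_zero]
  have h0 : Tendsto (fun m ↦ C * ‖emb k (ψ m) (h m) - x‖) atTop (𝓝 0) := by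
    simpa using (tendsto_iff_norm_sub_tendsto_zero.1 hx).const_mul C
  refine squeeze_zero (fun _ ↦ norm_nonneg _) (fun m ↦ ?_) h0
  rw [e1, ← integral_sub (hC _).1 (hC _).1]
  refine le_trans (le_of_eq ?_) (hC (emb k (ψ m) (h m) - x)).2
  rw [Real.norm_eq_abs]; congr 1
  refine integral_congr_ae ?_
  filter_upwards [(Zm_qmp ha s).ae (wf_sub (emb k (ψ m) (h m)) x)] with p hp
  simp only [HF, hp]; ring
theorem int_fd {n : ℕ} {w : Pt n → ℝ} (h1 : ContDiff ℝ 1 w) (h2 : HasCompactSupport w) (v : Pt n) : ∫ p, fderiv ℝ w p v = 0 := by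
  obtain ⟨b1, b2⟩ := fd_cs h1 h2 (v := fun _ ↦ v) continuous_const
  have := integral_mul_fderiv_eq_neg_fderiv_mul_of_integrable (μ := (volume : Measure (Pt n))) (f := fun _ ↦ (1:ℝ)) (g := w) (v := v) (by simp)
    (by simpa using b1.integrable_of_hasCompactSupport b2) (by simpa using h1.continuous.integrable_of_hasCompactSupport h2) (by simp) (fun p _ ↦ h1.differentiable one_ne_zero p)
  simpa using this
theorem int_Xd {n : ℕ} {w : Pt n → ℝ} (h1 : ContDiff ℝ 1 w) (h2 : HasCompactSupport w) (j : Fin n) : ∫ p, Xd n j w p = 0 ∧ ∫ p, Yd n j w p = 0 := by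
  have key : ∀ (l : Pt n →L[ℝ] ℝ) (v : Pt n), l (et n) = 0 → ∫ p, fderiv ℝ w p (v + l p • et n) = 0 := fun l v hl ↦ by
    have c : ContDiff ℝ 1 fun p ↦ l p * w p := l.contDiff.mul h1
    have e : ∀ p, fderiv ℝ w p (v + l p • et n) = fderiv ℝ w p v + fderiv ℝ (fun p ↦ l p * w p) p (et n) := fun p ↦ by
      rw [fderiv_fun_mul l.differentiableAt (h1.differentiable one_ne_zero p)]; simp [hl]
    obtain ⟨b1, b2⟩ := fd_cs h1 h2 (v := fun _ ↦ v) continuous_const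
    obtain ⟨b3, b4⟩ := fd_cs c h2.mul_left (v := fun _ ↦ et n) continuous_const
    simp only [e]
    rw [integral_add (b1.integrable_of_hasCompactSupport b2) (b3.integrable_of_hasCompactSupport b4), int_fd h1 h2, int_fd c h2.mul_left, add_zero]
  rw [Xd_eq, Yd_eq]
  constructor
  · have := key ((2:ℝ) • (ContinuousLinearMap.proj j).comp ((ContinuousLinearMap.fst ℝ _ _).comp (ContinuousLinearMap.snd ℝ _ _))) (ex n j) (by simp [et])
    simpa using this
  · have := key ((-2:ℝ) • (ContinuousLinearMap.proj j).comp (ContinuousLinearMap.fst ℝ _ _)) (ey n j) (by simp [et])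
    simpa using this
theorem Xd_mul {n : ℕ} {u w : Pt n → ℝ} {p : Pt n} (h1 : DifferentiableAt ℝ u p) (h2 : DifferentiableAt ℝ w p) (j : Fin n) :
    Xd n j (fun p ↦ u p * w p) p = u p * Xd n j w p + w p * Xd n j u p ∧ Yd n j (fun p ↦ u p * w p) p = u p * Yd n j w p + w p * Yd n j u p := by
  simp only [Xd, Yd]; rw [fderiv_fun_mul h1 h2]; simp; constructor <;> ring
theorem Xd_ibp {n : ℕ} {u w : Pt n → ℝ} (h1 : ContDiff ℝ 1 u) (h2 : HasCompactSupport u) (h3 : ContDiff ℝ 1 w) (h4 : HasCompactSupport w) (j : Fin n) :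
    ∫ p, u p * Xd n j w p = -∫ p, Xd n j u p * w p ∧ ∫ p, u p * Yd n j w p = -∫ p, Yd n j u p * w p := by
  obtain ⟨⟨x1, x2⟩, x3, x4⟩ := Xd_cs h1 h2 j
  obtain ⟨⟨y1, y2⟩, y3, y4⟩ := Xd_cs h3 h4 j
  obtain ⟨e1, e2⟩ := int_Xd (h1.mul h3) h2.mul_right j
  have d1 := h1.differentiable one_ne_zero; have d2 := h3.differentiable one_ne_zero
  have c1 := h1.continuous; have c2 := h3.continuous
  have e3 := fun p ↦ Xd_mul (d1 p) (d2 p) j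
  simp only [(e3 _).1, (e3 _).2] at e1 e2
  have ii : ∀ {f g : Pt n → ℝ}, Continuous f → Continuous g → HasCompactSupport f → Integrable (fun p ↦ f p * g p) := fun hf hg hc ↦ (hf.mul hg).integrable_of_hasCompactSupport hc.mul_right
  rw [integral_add (ii c1 y1 h2) (ii c2 x1 h4)] at e1
  rw [integral_add (ii c1 y3 h2) (ii c2 x3 h4)] at e2
  simp only [mul_comm (w _)] at e1 e2
  exact ⟨by linarith, by linarith⟩
end Heis
namespace Heis
theorem Xd_sub {n : ℕ} {u w : Pt n → ℝ} (h1 : Differentiable ℝ u) (h2 : Differentiable ℝ w) (j : Fin n) (p : Pt n) :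
    Xd n j (fun p ↦ u p - w p) p = Xd n j u p - Xd n j w p ∧ Yd n j (fun p ↦ u p - w p) p = Yd n j u p - Yd n j w p := by
  simp only [Xd, Yd]; rw [fderiv_fun_sub (h1 p) (h2 p)]; simp; constructor <;> ring
theorem cs_L2 {n : ℕ} {f : Pt n → ℝ} (h1 : Continuous f) (h2 : HasCompactSupport f) : MemLp f 2 volume := h1.memLp_of_hasCompactSupport h2
theorem Xd_sq {k : ℕ} {a : ℝ} (ha : 0 < a) (s : ℝ) {ψ : ℂ → ℝ} (h : Core ψ) (j : Fin (k + 1)) :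
    ∫ p, Xd (k + 1) j (HF k a s ψ) p ^ 2 ≤ a * (sg k a).real Set.univ * ‖emb k ψ h‖ ^ 2 ∧
    ∫ p, Yd (k + 1) j (HF k a s ψ) p ^ 2 ≤ a * (sg k a).real Set.univ * ‖emb k ψ h‖ ^ 2 := by
  obtain ⟨c1, c2⟩ := HF_cs (k := k) ha s h
  rw [mul_assoc, ← I1 ha s h]
  have hi : Integrable (hDot (k + 1) (HF k a s ψ) (HF k a s ψ)) := by
    unfold hDot
    refine integrable_finset_sum _ fun j _ ↦ ?_
    obtain ⟨⟨x1, x2⟩, x3, x4⟩ := Xd_cs c1 c2 j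
    exact ((x1.mul x1).integrable_of_hasCompactSupport x2.mul_right).add ((x3.mul x3).integrable_of_hasCompactSupport x4.mul_right)
  have hle : ∀ p, Xd (k + 1) j (HF k a s ψ) p ^ 2 + Yd (k + 1) j (HF k a s ψ) p ^ 2 ≤ hDot (k + 1) (HF k a s ψ) (HF k a s ψ) p := fun p ↦ by
    simp only [hDot, ← sq]
    exact Finset.single_le_sum (f := fun j ↦ Xd (k + 1) j (HF k a s ψ) p ^ 2 + Yd (k + 1) j (HF k a s ψ) p ^ 2) (fun _ _ ↦ by positivity) (Finset.mem_univ j)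
  constructor
  · exact integral_mono_of_nonneg (Eventually.of_forall fun _ ↦ sq_nonneg _) hi (Eventually.of_forall fun p ↦ by have := hle p; have := sq_nonneg (Yd (k + 1) j (HF k a s ψ) p); simp only; linarith)
  · exact integral_mono_of_nonneg (Eventually.of_forall fun _ ↦ sq_nonneg _) hi (Eventually.of_forall fun p ↦ by have := hle p; have := sq_nonneg (Xd (k + 1) j (HF k a s ψ) p); simp only; linarith)
theorem wgrad {k : ℕ} {a : ℝ} (ha : 0 < a) (s : ℝ) {x : VV k} {ψ : ℕ → ℂ → ℝ}
    (h : ∀ m, Core (ψ m)) (hx : Tendsto (fun m ↦ emb k (ψ m) (h m)) atTop (𝓝 x)) :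
    ∃ G, HasWeakHGrad (k + 1) (HF k a s (wf x)) G ∧ ∀ j η, MemLp η 2 volume →
      Tendsto (fun m ↦ ∫ p, Xd (k + 1) j (HF k a s (ψ m)) p * η p) atTop (𝓝 (∫ p, (G p).1 j * η p)) ∧
      Tendsto (fun m ↦ ∫ p, Yd (k + 1) j (HF k a s (ψ m)) p * η p) atTop (𝓝 (∫ p, (G p).2 j * η p)) := by
  have hC : 0 ≤ a * (sg k a).real Set.univ := by positivity
  have cs := fun m ↦ HF_cs (k := k) ha s (h m)
  have hs : ∀ m l, HF k a s (fun z ↦ ψ m z - ψ l z) = fun p ↦ HF k a s (ψ m) p - HF k a s (ψ l) p := fun m l ↦ by funext p; simp [HF]; ring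
  have hd := fun m l j p ↦ Xd_sub ((cs m).1.differentiable one_ne_zero) ((cs l).1.differentiable one_ne_zero) j p
  have hb := fun j m l ↦ Xd_sq (k := k) ha s ((h m).sub' (h l)) j
  simp only [hs, (hd _ _ _ _).1, (hd _ _ _ _).2, ← emb_sub (h _) (h _)] at hb
  choose GX hX1 hX2 using fun j ↦ L2_lim hC (fun m ↦ cs_L2 (Xd_cs (cs m).1 (cs m).2 j).1.1 (Xd_cs (cs m).1 (cs m).2 j).1.2) (fun m l ↦ (hb j m l).1) hx
  choose GY hY1 hY2 using fun j ↦ L2_lim hC (fun m ↦ cs_L2 (Xd_cs (cs m).1 (cs m).2 j).2.1 (Xd_cs (cs m).1 (cs m).2 j).2.2) (fun m l ↦ (hb j m l).2) hx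
  refine ⟨fun p ↦ (fun j ↦ GX j p, fun j ↦ GY j p), ⟨fun j ↦ ⟨hX1 j, hY1 j⟩, fun φ hφ j ↦ ?_⟩, fun j η hη ↦ ⟨hX2 j η hη, hY2 j η hη⟩⟩
  have c1 : ContDiff ℝ 1 φ := hφ.1.of_le (by simp)
  obtain ⟨⟨x1, x2⟩, x3, x4⟩ := Xd_cs c1 hφ.2 j
  have hL := cs_L2 c1.continuous hφ.2
  constructor
  · have l1 := HF_lim ha s x1 x2 h hx
    simp only [(Xd_ibp (cs _).1 (cs _).2 c1 hφ.2 j).1] at l1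
    exact tendsto_nhds_unique l1 (hX2 j φ hL).neg
  · have l1 := HF_lim ha s x3 x4 h hx
    simp only [(Xd_ibp (cs _).1 (cs _).2 c1 hφ.2 j).2] at l1
    exact tendsto_nhds_unique l1 (hY2 j φ hL).neg
theorem sum_int {n : ℕ} {F F' E E' : Fin n → Pt n → ℝ} (h1 : ∀ j, MemLp (F j) 2 volume) (h2 : ∀ j, MemLp (E j) 2 volume) (h3 : ∀ j, MemLp (F' j) 2 volume) (h4 : ∀ j, MemLp (E' j) 2 volume) :
    ∫ p, ∑ j, (F j p * E j p + F' j p * E' j p) = ∑ j, ((∫ p, F j p * E j p) + ∫ p, F' j p * E' j p) := by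
  have i1 : ∀ j, Integrable fun p ↦ F j p * E j p := fun j ↦ (h1 j).integrable_mul (h2 j)
  have i2 : ∀ j, Integrable fun p ↦ F' j p * E' j p := fun j ↦ (h3 j).integrable_mul (h4 j)
  rw [integral_finset_sum _ fun j _ ↦ (by exact (i1 j).add (i2 j))]
  exact Finset.sum_congr rfl fun j _ ↦ integral_add (i1 j) (i2 j)
theorem gd_lim {k : ℕ} {a : ℝ} {s : ℝ} {ψ : ℕ → ℂ → ℝ} {G : Pt (k + 1) → (Fin (k + 1) → ℝ) × (Fin (k + 1) → ℝ)} {u : Pt (k + 1) → ℝ} (hG : HasWeakHGrad (k + 1) u G) (ha : 0 < a) (h : ∀ m, Core (ψ m))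
    (hl : ∀ j η, MemLp η 2 volume →
      Tendsto (fun m ↦ ∫ p, Xd (k + 1) j (HF k a s (ψ m)) p * η p) atTop (𝓝 (∫ p, (G p).1 j * η p)) ∧
      Tendsto (fun m ↦ ∫ p, Yd (k + 1) j (HF k a s (ψ m)) p * η p) atTop (𝓝 (∫ p, (G p).2 j * η p)))
    {Ψ : Pt (k + 1) → ℝ} (h1 : ContDiff ℝ 1 Ψ) (h2 : HasCompactSupport Ψ) :
    Tendsto (fun m ↦ ∫ p, hDot (k + 1) (HF k a s (ψ m)) Ψ p) atTop (𝓝 (∫ p, gDot (k + 1) G Ψ p)) := by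
  have cs := fun m ↦ HF_cs (k := k) ha s (h m)
  have hq := fun j ↦ Xd_cs h1 h2 j
  have hX := fun j ↦ cs_L2 (hq j).1.1 (hq j).1.2
  have hY := fun j ↦ cs_L2 (hq j).2.1 (hq j).2.2
  have e1 := fun m ↦ sum_int (fun j ↦ cs_L2 (Xd_cs (cs m).1 (cs m).2 j).1.1 (Xd_cs (cs m).1 (cs m).2 j).1.2) hX (fun j ↦ cs_L2 (Xd_cs (cs m).1 (cs m).2 j).2.1 (Xd_cs (cs m).1 (cs m).2 j).2.2) hY
  have e2 := sum_int (fun j ↦ (hG.1 j).1) hX (fun j ↦ (hG.1 j).2) hY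
  simp only [hDot, gDot]
  simp only [e1, e2]
  exact tendsto_finset_sum _ fun j _ ↦ (hl j _ (hX j)).1.add (hl j _ (hY j)).2
theorem wk0 {α : Type*} [MeasurableSpace α] {μ : Measure α} {f : ℕ → α → ℝ} {g : α → ℝ} {B : ℝ} (hg : MemLp g 2 μ) (hf : ∀ j, MemLp (f j) 2 μ)
    (hB : ∀ j, ∫ x, f j x ^ 2 ∂μ ≤ B) (h0 : ∀ᵐ x ∂μ, ∀ᶠ j in atTop, f j x = 0) : Tendsto (fun j ↦ ∫ x, g x * f j x ∂μ) atTop (𝓝 0) := by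
  have hB0 : 0 ≤ B := (integral_nonneg fun x ↦ sq_nonneg (f 0 x)).trans (hB 0)
  set r : ℕ → α → ℝ := fun j x ↦ if f j x = 0 then 0 else g x ^ 2 with hr
  have hrm : ∀ j, AEStronglyMeasurable (r j) μ := fun j ↦ by
    have h1 : AEMeasurable (f j) μ := (hf j).1.aemeasurable
    have h2 : AEMeasurable g μ := hg.1.aemeasurable
    have h3 : Measurable fun y : ℝ × ℝ ↦ if y.1 = 0 then 0 else y.2 ^ 2 := Measurable.ite (measurable_fst (measurableSet_singleton 0)) measurable_const (by fun_prop)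
    exact (h3.comp_aemeasurable (h1.prodMk h2)).aestronglyMeasurable
  have hrb : ∀ j x, ‖r j x‖ ≤ g x ^ 2 := fun j x ↦ by simp only [hr]; split_ifs <;> simp [sq_nonneg]
  have hri := fun j ↦ hg.integrable_sq.mono' (hrm j) (Eventually.of_forall (hrb j))
  have hl : Tendsto (fun j ↦ ∫ x, r j x ∂μ) atTop (𝓝 (∫ x, (0:ℝ) ∂μ)) := by
    refine tendsto_integral_of_dominated_convergence (fun x ↦ g x ^ 2) hrm hg.integrable_sq (fun j ↦ Eventually.of_forall (hrb j)) ?_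
    filter_upwards [h0] with x hx
    exact tendsto_const_nhds.congr' (hx.mono fun j hj ↦ by simp [hr, hj])
  rw [integral_zero] at hl
  have hb : ∀ ε > 0, ∀ j, |∫ x, g x * f j x ∂μ| ≤ ε * B + ε⁻¹ * ∫ x, r j x ∂μ := fun ε hε j ↦ by
    have hi := (hf j).integrable_sq
    have := norm_integral_le_of_norm_le (f := fun x ↦ g x * f j x) (g := fun x ↦ ε * f j x ^ 2 + ε⁻¹ * r j x) (μ := μ) ((hi.const_mul _).add ((hri j).const_mul _)) (Eventually.of_forall fun x ↦ by
      simp only [hr, Real.norm_eq_abs, abs_mul]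
      split_ifs with h
      · simp [h]
      · have e : ε * (ε⁻¹ * |g x|) = |g x| := by field_simp
        rw [← sq_abs (f j x), ← sq_abs (g x)]
        have e2 : ε * |f j x| ^ 2 + ε⁻¹ * |g x| ^ 2 - 2 * (|g x| * |f j x|) = ε * (|f j x| - ε⁻¹ * |g x|) ^ 2 := by field_simp; ring
        nlinarith [mul_nonneg hε.le (sq_nonneg (|f j x| - ε⁻¹ * |g x|)), mul_nonneg (abs_nonneg (g x)) (abs_nonneg (f j x))])
    rw [integral_add (hi.const_mul _) ((hri j).const_mul _), integral_const_mul, integral_const_mul] at this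
    exact this.trans (by gcongr; exact hB j)
  rw [Metric.tendsto_atTop]
  intro δ hδ
  set ε := δ / (2 * (B + 1)) with hε
  have hε0 : 0 < ε := by positivity
  have h1 : ε * B < δ / 2 := by rw [hε, div_mul_eq_mul_div, div_lt_iff₀ (by positivity)]; nlinarith
  have h2 : Tendsto (fun j ↦ ε⁻¹ * ∫ x, r j x ∂μ) atTop (𝓝 0) := by simpa using hl.const_mul ε⁻¹
  obtain ⟨N, hN⟩ := eventually_atTop.1 (h2.eventually (gt_mem_nhds (half_pos hδ)))
  refine ⟨N, fun j hj ↦ ?_⟩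
  rw [dist_zero_right]
  have := hb ε hε0 j; have := hN j hj
  rw [Real.norm_eq_abs]; linarith
end Heis
namespace Heis
theorem phc {k : ℕ} {a : ℝ} (ha : 0 < a) (s : ℝ) {χ : ℂ → ℝ} (h : Core χ) {Φ : Pt (k + 1) → ℝ} (h1 : ContDiff ℝ 1 Φ) (v : Sp k) :
    Core (fun z ↦ Φ (Sm a s v.1 z) * χ z) := h.mulOn fun z hz ↦ h1.contDiffAt.comp z (Sm_der ha s v.1 hz).1
theorem phb {k : ℕ} {a : ℝ} (ha : 0 < a) (s : ℝ) {χ : ℂ → ℝ} (h : Core χ) {Φ : Pt (k + 1) → ℝ} (h1 : ContDiff ℝ 1 Φ) (h2 : HasCompactSupport Φ) :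
    ∃ B, ∀ v, ‖emb k _ (phc ha s h h1 v)‖ ≤ B := by
  obtain ⟨C0, hC0⟩ := h2.exists_bound_of_continuous h1.continuous
  obtain ⟨b1, b2⟩ := fd_cs h1 h2 (v := fun p ↦ (p.1, p.2.1, 0)) (by fun_prop)
  obtain ⟨b3, b4⟩ := fd_cs h1 h2 (v := fun p ↦ et (k + 1)) (by fun_prop)
  obtain ⟨C1, hC1⟩ := b2.exists_bound_of_continuous b1
  obtain ⟨C2, hC2⟩ := b4.exists_bound_of_continuous b3
  obtain ⟨C3, hC3⟩ := h.cpt.exists_bound_of_continuous h.cont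
  obtain ⟨C4, hC4⟩ := h.grs.exists_bound_of_continuous h.grc
  have hM : ContinuousOn (fun z : ℂ ↦ ‖-2 / (1 + z) ^ 2‖ * (C1 / (2 * (Pc z).re) + C2 / a)) (tsupport χ) := fun z hz ↦ by
    have hz := h.sub hz
    have hr : 0 < (Pc z).re := Pc_HP hz
    have hP : ContinuousAt Pc z := (Pc_cd (one_add_ne hz)).continuousAt
    have h3 : ContinuousAt (fun z ↦ (Pc z).re) z := Complex.continuous_re.continuousAt.comp hP
    have h4 : ContinuousAt (fun z : ℂ ↦ -2 / (1 + z) ^ 2) z := continuousAt_const.div (by fun_prop) (pow_ne_zero _ (one_add_ne hz))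
    exact (h4.norm.mul ((continuousAt_const.div (continuousAt_const.mul h3) (mul_pos two_pos hr).ne').add continuousAt_const)).continuousWithinAt
  obtain ⟨C5, hC5⟩ := h.cpt.exists_bound_of_continuousOn hM
  have p0 : 0 ≤ C0 := (norm_nonneg _).trans (hC0 0)
  have p1 : 0 ≤ C1 := (norm_nonneg _).trans (hC1 0)
  have p2 : 0 ≤ C2 := (norm_nonneg _).trans (hC2 0)
  have p3 : 0 ≤ C3 := (norm_nonneg _).trans (hC3 0)
  have p4 : 0 ≤ C4 := (norm_nonneg _).trans (hC4 0)
  have hgr : ∀ v : Sp k, ∀ z ∈ DD, ‖gr (fun z ↦ Φ (Sm a s v.1 z) * χ z) z‖ ≤ C0 * C4 + C3 * |C5| := fun v z hz ↦ by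
    have hc : ∀ z ∈ DD, ContDiffAt ℝ 1 (fun z ↦ Φ (Sm a s v.1 z)) z := fun z hz ↦ h1.contDiffAt.comp z (Sm_der ha s v.1 hz).1
    have p5 : 0 ≤ C0 * C4 + C3 * |C5| := by positivity
    by_cases hs : z ∈ tsupport χ
    · rw [gr_mul ((hc z hz).differentiableAt one_ne_zero) (h.diff z), gr_Sm ha s v.1 hz (h1.differentiable one_ne_zero)]
      refine (norm_add_le _ _).trans ?_
      have hr : 0 < (Pc z).re := Pc_HP hz
      simp only [norm_mul, Complex.norm_real, RCLike.norm_conj]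
      have e1 : ‖(⟨Ed Φ (Sm a s v.1 z) / (2 * (Pc z).re), fderiv ℝ Φ (Sm a s v.1 z) (et (k + 1)) / a⟩ : ℂ)‖ ≤ C1 / (2 * (Pc z).re) + C2 / a := by
        refine (Complex.norm_le_abs_re_add_abs_im _).trans ?_
        simp only [abs_div, abs_of_pos ha, abs_of_pos (show 0 < 2 * (Pc z).re by positivity)]
        gcongr
        · exact hC1 _
        · exact hC2 _
      have e2 := (le_abs_self _).trans ((hC5 z hs).trans (le_abs_self C5))
      refine add_le_add (mul_le_mul (hC0 _) (hC4 _) (norm_nonneg _) p0) (mul_le_mul (hC3 _) ?_ (by positivity) p3)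
      exact (mul_le_mul_of_nonneg_left e1 (norm_nonneg _)).trans e2
    · rw [gr_supp _ fun hs' ↦ hs ((tsupport_mul_subset_right (f := fun z ↦ Φ (Sm a s v.1 z)) (g := χ)) hs')]; simpa using p5
  set D := C0 * C4 + C3 * |C5| with hD
  have pD : 0 ≤ D := by positivity
  refine ⟨√((NN k ^ 2 * (C0 * C3) ^ 2 + D ^ 2) * (bet k).real Set.univ), fun v ↦ Real.le_sqrt_of_sq_le ?_⟩
  rw [norm_VV, add_mul, mul_assoc]
  refine add_le_add (mul_le_mul_of_nonneg_left ?_ (sq_nonneg _)) ?_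
  · have := integral_mono_of_nonneg (μ := bet k) (f := fun z ↦ wf (emb k _ (phc ha s h h1 v)) z ^ 2) (g := fun _ ↦ (C0 * C3) ^ 2) (Eventually.of_forall fun _ ↦ sq_nonneg _) (integrable_const _) (by
      filter_upwards [emb_w k (phc ha s h h1 v)] with z hz
      rw [hz, ← sq_abs, abs_mul]
      gcongr
      · exact hC0 _
      · exact hC3 _)
    rw [integral_const, smul_eq_mul, mul_comm] at this; exact this
  · have := integral_mono_of_nonneg (μ := bet k) (f := fun z ↦ ‖gf (emb k _ (phc ha s h h1 v)) z‖ ^ 2) (g := fun _ ↦ D ^ 2) (Eventually.of_forall fun _ ↦ sq_nonneg _) (integrable_const _) (by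
      filter_upwards [emb_g k (phc ha s h h1 v), bet_D k] with z hz hz2
      rw [hz, norm_mul, Complex.norm_real, Real.norm_of_nonneg (sf_nn _)]
      have := mul_le_mul (sf_le z) (hgr v z hz2) (norm_nonneg _) zero_le_one
      rw [one_mul] at this
      have h0 : 0 ≤ sf z * ‖gr (fun z ↦ Φ (Sm a s v.1 z) * χ z) z‖ := mul_nonneg (sf_nn _) (norm_nonneg _)
      exact pow_le_pow_left₀ h0 this 2)
    rw [integral_const, smul_eq_mul, mul_comm] at this; exact this
theorem weq0 {k : ℕ} {a : ℝ} (ha : 0 < a) {s : ℝ} {x : VV k} {ψ : ℕ → ℂ → ℝ} (h : ∀ m, Core (ψ m)) (hx : Tendsto (fun m ↦ emb k (ψ m) (h m)) atTop (𝓝 x))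
    {G : Pt (k + 1) → (Fin (k + 1) → ℝ) × (Fin (k + 1) → ℝ)} {u : Pt (k + 1) → ℝ} (hG : HasWeakHGrad (k + 1) u G)
    (hl : ∀ j η, MemLp η 2 volume →
      Tendsto (fun m ↦ ∫ p, Xd (k + 1) j (HF k a s (ψ m)) p * η p) atTop (𝓝 (∫ p, (G p).1 j * η p)) ∧
      Tendsto (fun m ↦ ∫ p, Yd (k + 1) j (HF k a s (ψ m)) p * η p) atTop (𝓝 (∫ p, (G p).2 j * η p)))
    {χ : ℂ → ℝ} (hχ : Core χ) {Φ : Pt (k + 1) → ℝ} (h1 : ContDiff ℝ 1 Φ) (h2 : HasCompactSupport Φ) :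
    ∫ p, gDot (k + 1) G (fun p ↦ Φ p * HF k a s χ p) p = a * ∫ v, inner ℝ x (emb k _ (phc ha s hχ h1 v)) ∂sg k a := by
  haveI := sg_fin k ha
  obtain ⟨c1, c2⟩ := HF_cs (k := k) ha s hχ
  have l1 := gd_lim hG ha h hl (h1.mul c1) c2.mul_left
  have hI := fun m ↦ I2 (k := k) ha s (h m) (h1.mul c1) c2.mul_left (phc ha s hχ h1) fun v z hz ↦ by
    simp only [HF, Zm_Sm ha s (sp_ne v) hz]; ring
  simp only [(hI _).2] at l1
  refine tendsto_nhds_unique l1 (Tendsto.const_mul a ?_)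
  obtain ⟨B, hB⟩ := phb ha s hχ h1 h2
  obtain ⟨C, hC⟩ := (Metric.isBounded_range_of_tendsto _ hx).exists_norm_le
  refine tendsto_integral_of_dominated_convergence (fun _ ↦ C * B) (fun m ↦ (hI m).1.aestronglyMeasurable) (integrable_const _) (fun m ↦ Eventually.of_forall fun v ↦ ?_)
    (Eventually.of_forall fun v ↦ hx.inner tendsto_const_nhds)
  refine (norm_inner_le_norm _ _).trans ?_
  have := hC _ (Set.mem_range_self m)
  exact mul_le_mul this (hB v) (norm_nonneg _) ((norm_nonneg _).trans this)
end Heis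
namespace Heis
theorem sqb {n : ℕ} {F h E C Φ : Pt n → ℝ} {M C0 C1 : ℝ} (hF : MemLp F 2 volume) (hE : MemLp E 2 volume) (hC : MemLp C 2 volume) (hM : ∫ p, F p ^ 2 ≤ M)
    (h0 : ∀ p, |Φ p| ≤ C0) (h1 : ∀ p, |h p| ≤ C1) : ∫ p, (Φ p * F p + h p * E p - C p) ^ 2 ≤ 3 * (C0 ^ 2 * M + C1 ^ 2 * ∫ p, E p ^ 2) + 3 * ∫ p, C p ^ 2 := by
  have i1 := hF.integrable_sq.const_mul (C0 ^ 2)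
  have i2 := hE.integrable_sq.const_mul (C1 ^ 2)
  have i3 := hC.integrable_sq
  have := integral_mono_of_nonneg (μ := volume) (f := fun p ↦ (Φ p * F p + h p * E p - C p) ^ 2) (g := fun p ↦ 3 * (C0 ^ 2 * F p ^ 2 + C1 ^ 2 * E p ^ 2) + 3 * C p ^ 2)
    (Eventually.of_forall fun _ ↦ sq_nonneg _) (((i1.add i2).const_mul 3).add (i3.const_mul 3)) (Eventually.of_forall fun p ↦ by
      have a1 := mul_le_mul_of_nonneg_right (sq_le_sq' (abs_le.1 (h0 p)).1 (abs_le.1 (h0 p)).2) (sq_nonneg (F p))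
      have a2 := mul_le_mul_of_nonneg_right (sq_le_sq' (abs_le.1 (h1 p)).1 (abs_le.1 (h1 p)).2) (sq_nonneg (E p))
      simp only
      nlinarith [sq_nonneg (Φ p * F p - h p * E p), sq_nonneg (Φ p * F p + C p), sq_nonneg (h p * E p + C p)])
  rw [integral_add ((by exact (i1.add i2).const_mul 3)) (i3.const_mul 3), integral_const_mul, integral_const_mul, integral_add i1 i2, integral_const_mul, integral_const_mul] at this
  have := mul_le_mul_of_nonneg_left hM (sq_nonneg C0)
  linarith
theorem gd_cut {k : ℕ} {a : ℝ} (ha : 0 < a) {s : ℝ} {G : Pt (k + 1) → (Fin (k + 1) → ℝ) × (Fin (k + 1) → ℝ)} {u : Pt (k + 1) → ℝ} (hG : HasWeakHGrad (k + 1) u G)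
    {χ : ℕ → ℂ → ℝ} (hχ : ∀ j, Core (χ j)) {B : ℝ} (hB : ∀ j, ‖emb k (χ j) (hχ j)‖ ^ 2 ≤ B) (h01 : ∀ j z, 0 ≤ χ j z ∧ χ j z ≤ 1)
    (hev : ∀ r < 1, ∀ᶠ j in atTop, ∀ z, ‖z‖ ≤ r → χ j z = 1)
    {Φ : Pt (k + 1) → ℝ} (h1 : ContDiff ℝ 1 Φ) (h2 : HasCompactSupport Φ) :
    Tendsto (fun j ↦ ∫ p, gDot (k + 1) G (fun p ↦ Φ p * HF k a s (χ j) p) p) atTop (𝓝 (∫ p, gDot (k + 1) G (fun p ↦ Φ p * kap k (Zm a s p)) p)) := by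
  have cs := fun j ↦ HF_cs (k := k) ha s (hχ j)
  have cU : ContDiff ℝ 1 fun p ↦ Φ p * kap k (Zm a s p) := h1.mul ((kz_cont ha s).of_le (by simp))
  have sU : HasCompactSupport fun p ↦ Φ p * kap k (Zm a s p) := h2.mul_right
  have cP : ∀ j, ContDiff ℝ 1 fun p ↦ Φ p * HF k a s (χ j) p := fun j ↦ h1.mul (cs j).1
  have sP : ∀ j, HasCompactSupport fun p ↦ Φ p * HF k a s (χ j) p := fun j ↦ h2.mul_right
  have L := fun {w : Pt (k + 1) → ℝ} (c : ContDiff ℝ 1 w) (d : HasCompactSupport w) i ↦ 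
    (⟨cs_L2 (Xd_cs c d i).1.1 (Xd_cs c d i).1.2, cs_L2 (Xd_cs c d i).2.1 (Xd_cs c d i).2.2⟩ : MemLp (Xd (k + 1) i w) 2 volume ∧ MemLp (Yd (k + 1) i w) 2 volume)
  simp only [gDot]
  simp only [sum_int (fun i ↦ (hG.1 i).1) (fun i ↦ (L (cP _) (sP _) i).1) (fun i ↦ (hG.1 i).2) (fun i ↦ (L (cP _) (sP _) i).2),
    sum_int (fun i ↦ (hG.1 i).1) (fun i ↦ (L cU sU i).1) (fun i ↦ (hG.1 i).2) (fun i ↦ (L cU sU i).2)]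
  obtain ⟨C0, hC0⟩ := h2.exists_bound_of_continuous h1.continuous
  have hH : ∀ j p, |HF k a s (χ j) p| ≤ 2 ^ (k + 1) := fun j p ↦ by
    rw [HF, abs_mul]
    by_cases hz : Zm a s p ∈ DD
    · have e1 : |χ j (Zm a s p)| ≤ 1 := abs_le.2 ⟨by linarith [(h01 j (Zm a s p)).1], (h01 j _).2⟩
      have e2 : ‖1 + Zm a s p‖ ≤ 2 := (norm_add_le _ _).trans (by rw [norm_one]; have := mem_ball_zero_iff.1 hz; linarith)
      rw [kap, abs_of_nonneg (by positivity)]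
      have := pow_le_pow_left₀ (norm_nonneg _) e2 (k + 1)
      nlinarith [abs_nonneg (χ j (Zm a s p)), pow_nonneg (norm_nonneg (1 + Zm a s p)) (k + 1)]
    · rw [(hχ j).eq0 hz]; simp
  have hz0 : ∀ᵐ p : Pt (k + 1), ∀ᶠ j in atTop, (fun p ↦ Φ p * HF k a s (χ j) p) =ᶠ[𝓝 p] fun p ↦ Φ p * kap k (Zm a s p) := by
    filter_upwards [Zm_D ha s] with p hp
    have hp' : ‖Zm a s p‖ < 1 := mem_ball_zero_iff.1 hp
    have hn : ∀ᶠ p' in 𝓝 p, ‖Zm a s p'‖ < (1 + ‖Zm a s p‖) / 2 := (Zm_cd ha s).continuous.norm.continuousAt.eventually (gt_mem_nhds (by linarith))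
    filter_upwards [hev ((1 + ‖Zm a s p‖) / 2) (by linarith)] with j hj
    filter_upwards [hn] with p' hp'
    rw [HF, hj _ hp'.le, mul_one]
  have hdiff := fun j p i ↦ Xd_mul (h1.differentiable one_ne_zero p) ((cs j).1.differentiable one_ne_zero p) i
  have hm : 0 ≤ a * (sg k a).real Set.univ := by positivity
  refine tendsto_finset_sum _ fun i _ ↦ ?_
  have d1 := wk0 (hG.1 i).1 (fun j ↦ (L (cP j) (sP j) i).1.sub (L cU sU i).1) (fun j ↦ by
    have := sqb (L (cs j).1 (cs j).2 i).1 (L h1 h2 i).1 (L cU sU i).1 ((Xd_sq ha s (hχ j) i).1.trans (mul_le_mul_of_nonneg_left (hB j) hm)) hC0 (hH j)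
    simp only [Pi.sub_apply, (hdiff j _ i).1]; exact this) (by
    filter_upwards [hz0] with p hp
    filter_upwards [hp] with j hj
    simp only [Pi.sub_apply, Xd, hj.fderiv_eq]; ring)
  have d2 := wk0 (hG.1 i).2 (fun j ↦ (L (cP j) (sP j) i).2.sub (L cU sU i).2) (fun j ↦ by
    have := sqb (L (cs j).1 (cs j).2 i).2 (L h1 h2 i).2 (L cU sU i).2 ((Xd_sq ha s (hχ j) i).2.trans (mul_le_mul_of_nonneg_left (hB j) hm)) hC0 (hH j)
    simp only [Pi.sub_apply, (hdiff j _ i).2]; exact this) (by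
    filter_upwards [hz0] with p hp
    filter_upwards [hp] with j hj
    simp only [Pi.sub_apply, Yd, hj.fderiv_eq]; ring)
  simp only [Pi.sub_apply, mul_sub] at d1 d2
  have fin : ∀ {g : Pt (k + 1) → ℝ} {f : ℕ → Pt (k + 1) → ℝ} {f0 : Pt (k + 1) → ℝ}, MemLp g 2 volume → (∀ j, MemLp (f j) 2 volume) → MemLp f0 2 volume →
      Tendsto (fun j ↦ ∫ p, (g p * f j p - g p * f0 p)) atTop (𝓝 0) → Tendsto (fun j ↦ ∫ p, g p * f j p) atTop (𝓝 (∫ p, g p * f0 p)) := fun hg hf hf0 ht ↦ by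
    rw [tendsto_iff_norm_sub_tendsto_zero]
    have e := fun j ↦ integral_sub (μ := volume) (by exact hg.integrable_mul (hf j)) (by exact hg.integrable_mul hf0)
    simp only [Pi.mul_apply] at e
    simp only [e] at ht
    simpa using ht.norm
  exact (fin (hG.1 i).1 (fun j ↦ (L (cP j) (sP j) i).1) (L cU sU i).1 d1).add (fin (hG.1 i).2 (fun j ↦ (L (cP j) (sP j) i).2) (L cU sU i).2 d2)
end Heis
namespace Heis
theorem weq {k : ℕ} {a : ℝ} (ha : 0 < a) (s : ℝ) {x : VV k} (hx : x ∈ HH k) {kk : ℂ → ℝ} {Ck : ℝ} (hm : AEStronglyMeasurable kk (bet k)) (hCk : ∀ z, |kk z| ≤ Ck)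
    (hp : ∀ᵐ z ∂bet k, 0 < wf x z)
    (hs : ∀ y ∈ HH k, inner ℝ x y = ∫ z, kk z * (wf x z ^ qq k * wf y z) ∂bet k) : ∃ G, HasWeakHGrad (k + 1) (HF k a s (wf x)) G ∧
    ∀ Φ : Pt (k + 1) → ℝ, ContDiff ℝ 1 Φ → HasCompactSupport Φ → ∫ p, gDot (k + 1) G (fun p ↦ Φ p * kap k (Zm a s p)) p =
      a * ∫ q, kk q.2 * wf x q.2 ^ qq k * Φ (Sm a s q.1.1 q.2) ∂((sg k a).prod (bet k)) := by
  haveI := sg_fin k ha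
  obtain ⟨ψ, h, hψ, -⟩ := HH_seq_ae hx
  obtain ⟨G, hG, hl⟩ := wgrad ha s h hψ
  obtain ⟨χ, hχ, B, hB, h01, hev⟩ := cutB k
  refine ⟨G, hG, fun Φ h1 h2 ↦ ?_⟩
  have hev' : ∀ r < 1, ∀ᶠ j in atTop, ∀ z, ‖z‖ ≤ r → χ j z = 1 := fun r hr ↦ (hev r hr).mono fun j hj z hz ↦ (hj z hz).1
  refine tendsto_nhds_unique (gd_cut ha hG hχ hB h01 hev' h1 h2) ?_
  obtain ⟨C0, hC0⟩ := h2.exists_bound_of_continuous h1.continuous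
  have hw : Integrable (fun z ↦ wf x z ^ qq k) (bet k) := by
    refine Integrable.mono' ((integrable_const (1:ℝ)).add (wp_int hx)) ((wf_sm x).measurable.pow_const _).aestronglyMeasurable ?_
    filter_upwards [hp] with z hz
    rw [Real.norm_eq_abs, abs_of_nonneg (by positivity), Pi.add_apply, abs_of_pos hz]
    rcases le_total (wf x z) 1 with h | h
    · have := Real.rpow_le_one hz.le h (by linarith [qq_gt k] : 0 ≤ qq k)
      have := Real.rpow_nonneg hz.le (pp k); linarith
    · have := Real.rpow_le_rpow_of_exponent_le h (by rw [pp_qq]; linarith : qq k ≤ pp k); linarith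
  have hk : Integrable (fun z ↦ kk z * wf x z ^ qq k) (bet k) := hw.bdd_mul hm (Eventually.of_forall hCk)
  have hk' : Integrable (fun q : Sp k × ℂ ↦ kk q.2 * wf x q.2 ^ qq k) ((sg k a).prod (bet k)) := hk.comp_snd (sg k a)
  have mΦ : AEStronglyMeasurable (fun q : Sp k × ℂ ↦ Φ (Sm a s q.1.1 q.2)) ((sg k a).prod (bet k)) := (h1.continuous.measurable.comp (Sm_meas a s)).aestronglyMeasurable
  have mχ : ∀ j, AEStronglyMeasurable (fun q : Sp k × ℂ ↦ χ j q.2) ((sg k a).prod (bet k)) := fun j ↦ ((hχ j).cont.measurable.comp measurable_snd).aestronglyMeasurable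
  have b1 : ∀ j z, |χ j z| ≤ 1 := fun j z ↦ abs_le.2 ⟨by linarith [(h01 j z).1], (h01 j z).2⟩
  have hI : Integrable (fun q : Sp k × ℂ ↦ kk q.2 * wf x q.2 ^ qq k * Φ (Sm a s q.1.1 q.2)) ((sg k a).prod (bet k)) := hk'.mul_bdd mΦ (Eventually.of_forall fun q ↦ hC0 _)
  have hIj : ∀ j, Integrable (fun q : Sp k × ℂ ↦ kk q.2 * wf x q.2 ^ qq k * Φ (Sm a s q.1.1 q.2) * χ j q.2) ((sg k a).prod (bet k)) := fun j ↦ hI.mul_bdd (mχ j) (Eventually.of_forall fun q ↦ b1 j _)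
  have hj : ∀ j, ∫ p, gDot (k + 1) G (fun p ↦ Φ p * HF k a s (χ j) p) p = a * ∫ q, kk q.2 * wf x q.2 ^ qq k * Φ (Sm a s q.1.1 q.2) * χ j q.2 ∂((sg k a).prod (bet k)) := fun j ↦ by
    rw [weq0 ha h hψ hG hl (hχ j) h1 h2, integral_prod _ (hIj j)]
    congr 1
    refine integral_congr_ae (Eventually.of_forall fun v ↦ ?_)
    simp only
    rw [hs _ (emb_HH _)]
    refine integral_congr_ae ?_
    filter_upwards [emb_w k (phc ha s (hχ j) h1 v)] with z hz
    rw [hz]; ring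
  simp only [hj]
  refine Tendsto.const_mul a ?_
  refine tendsto_integral_of_dominated_convergence _ (fun j ↦ (hIj j).aestronglyMeasurable) hI.norm (fun j ↦ Eventually.of_forall fun q ↦ ?_) ?_
  · rw [norm_mul]; exact mul_le_of_le_one_right (norm_nonneg _) (b1 j _)
  · filter_upwards [pr_D (k := k) ha] with q hq
    refine tendsto_const_nhds.congr' ?_
    filter_upwards [hev' _ (mem_ball_zero_iff.1 hq)] with j hj
    rw [hj _ le_rfl, mul_one]
end Heis
namespace Heis
theorem kp {k : ℕ} {z : ℂ} (hz : 1 + z ≠ 0) : Wt k z * kap k z ^ pp k = 1 := by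
  have h : 0 < ‖1 + z‖ := norm_pos_iff.2 hz
  have : (((k + 1 : ℕ) : ℝ)) * pp k = ((2 * k + 4 : ℕ) : ℝ) := by
    unfold pp NN; push_cast; field_simp; ring
  rw [Wt, kap, ← Real.rpow_natCast _ (k + 1), ← Real.rpow_mul h.le, this, Real.rpow_natCast]
  field_simp
theorem QsE (k : ℕ) : Qs (k + 1) = pp k := by
  unfold Qs Qh pp NN; push_cast
  have : (k:ℝ) + 1 ≠ 0 := by positivity
  field_simp; ring
theorem sg_pos {k : ℕ} {a : ℝ} (ha : 0 < a) : 0 < (sg k a).real Set.univ := by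
  haveI := sg_fin k ha
  by_contra h
  have h0 : sg k a = 0 := Measure.measure_univ_eq_zero.1 ((measureReal_eq_zero_iff).1 (le_antisymm (not_lt.1 h) measureReal_nonneg))
  have := tr_int (k := k) ha 0 (f := (Metric.ball 0 1).indicator fun _ ↦ (1:ℝ)) ((measurable_const.indicator measurableSet_ball).aestronglyMeasurable)
  rw [h0, Measure.zero_prod, integral_zero_measure, integral_indicator_const _ measurableSet_ball, smul_eq_mul, mul_one] at this
  exact (ENNReal.toReal_pos (Metric.measure_ball_pos volume _ one_pos).ne' measure_ball_lt_top.ne).ne' this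
theorem bub {k : ℕ} {μ : ℝ} (hμ : 0 < μ) (s : ℝ) (p : Pt (k + 1)) : bubble (k + 1) μ s p = μ ^ (-NN k) * (2 ^ (k + 1))⁻¹ * kap k (Zm (1 / μ ^ 2) s p) := by
  have ha : 0 < 1 / μ ^ 2 := by positivity
  have hz : znorm (k + 1) p ^ 2 = nq (p.1, p.2.1) := Real.sq_sqrt (by positivity)
  have hD : ((p.2.2 - s) / μ ^ 2) ^ 2 + (1 + (znorm (k + 1) p) ^ 2 / μ ^ 2) ^ 2 = ‖1 + PP (1 / μ ^ 2) s p‖ ^ 2 := by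
    rw [hz, ← Complex.normSq_eq_norm_sq, Complex.normSq_apply]; simp [PP]; ring
  have hQ : Qh (k + 1) - 2 = 2 * NN k := by unfold Qh NN; push_cast; ring
  have h1 : 0 < ‖1 + PP (1 / μ ^ 2) s p‖ := norm_pos_iff.2 (PP_ne ha s p)
  rw [bubble, hD, hQ, kap, one_Zm ha, norm_div, div_pow, ← Real.rpow_natCast ‖1 + PP (1 / μ ^ 2) s p‖ 2, ← Real.rpow_mul h1.le]
  rw [show -(2 * NN k) / 2 = -NN k by ring, show ((2:ℕ):ℝ) * (-(2 * NN k) / 4) = -((k + 1 : ℕ) : ℝ) by unfold NN; push_cast; ring, Real.rpow_neg h1.le, Real.rpow_natCast]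
  simp; field_simp
theorem SmM {k : ℕ} (a s : ℝ) (v : EE k) : Measurable (Sm a s v) := by
  have h1 : Measurable fun z ↦ √((Pc z).re / a) / √(nq v) := ((Complex.measurable_re.comp Pc_meas).div_const a).sqrt.div_const _
  have h2 : Measurable fun z ↦ s + (Pc z).im / a := ((Complex.measurable_im.comp Pc_meas).div_const a).const_add s
  exact (measurable_pi_lambda _ fun j ↦ h1.mul_const _).prodMk ((measurable_pi_lambda _ fun j ↦ h1.mul_const _).prodMk h2)
theorem kdat {k : ℕ} {K : Pt (k + 1) → ℝ} {Kinf : ℝ} (hK : Continuous K) (hc : IsCyl (k + 1) K) (hl : Tendsto K (cocompact _) (𝓝 Kinf)) (h0 : ∃ p, 0 < K p)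
    (hs : ∀ t, K (0, 0, t) ≤ Kinf) {a : ℝ} (ha : 0 < a) (s : ℝ) : ∃ (kk : ℂ → ℝ) (Ck : ℝ), ContinuousOn kk DD ∧ Measurable kk ∧ (∀ z, |kk z| ≤ Ck) ∧
      (∃ z0 ∈ DD, 0 < kk z0) ∧ (∀ δ > 0, ∃ R < 1, ∀ z ∈ DD, R < ‖z‖ → kk z ≤ Kinf + δ) ∧ ∀ (v : Sp k), ∀ z ∈ DD, K (Sm a s v.1 z) = kk z := by
  obtain ⟨Kt, hKt⟩ := hc
  set κ : ℂ → ℝ := fun w ↦ Kt (√(w.re / a)) (s + w.im / a) with hκ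
  have hκP : ∀ p, K p = κ (PP a s p) := fun p ↦ by
    rw [hKt, hκ]
    simp only [PP]
    rw [mul_div_cancel_left₀ _ ha.ne', mul_div_cancel_left₀ _ ha.ne']
    simp [znorm, nq]
  have hbd : ∃ C, ∀ p, |K p| ≤ C := by
    have : ∀ᶠ p in cocompact _, |K p| < |Kinf| + 1 := hl.abs.eventually (gt_mem_nhds (by linarith))
    obtain ⟨S, hS, hS'⟩ := mem_cocompact.1 this
    obtain ⟨C, hC⟩ := hS.exists_bound_of_continuousOn hK.continuousOn
    refine ⟨max C (|Kinf| + 1), fun p ↦ ?_⟩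
    by_cases hp : p ∈ S
    · exact (hC p hp).trans (le_max_left _ _)
    · exact (le_of_lt (hS' hp)).trans (le_max_right _ _)
  obtain ⟨C, hC⟩ := hbd
  have v0 : Nonempty (Sp k) := by
    by_contra h
    rw [not_nonempty_iff] at h
    have := sg_pos (k := k) ha
    rw [Measure.eq_zero_of_isEmpty (sg k a)] at this
    simp at this
  obtain ⟨v0⟩ := v0
  have hS : ∀ (v : Sp k), ∀ z ∈ DD, K (Sm a s v.1 z) = DD.indicator (fun z ↦ K (Sm a s v0.1 z)) z := fun v z hz ↦ by
    rw [Set.indicator_of_mem hz, hκP, hκP, PP_Sm ha s (sp_ne v) hz, PP_Sm ha s (sp_ne v0) hz]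
  have hZ : ∀ p, Zm a s p ∈ DD → DD.indicator (fun z ↦ K (Sm a s v0.1 z)) (Zm a s p) = K p := fun p hp ↦ by
    rw [Set.indicator_of_mem hp, hκP, hκP p, PP_Sm ha s (sp_ne v0) hp, PP_Zm ha]
  have mS := SmM a s v0.1
  refine ⟨DD.indicator fun z ↦ K (Sm a s v0.1 z), C, ?_, (hK.measurable.comp mS).indicator measurableSet_ball, fun z ↦ ?_, ?_, ?_, hS⟩
  · refine ContinuousOn.congr (f := fun z ↦ K (Sm a s v0.1 z)) (fun z hz ↦ ?_) fun z hz ↦ Set.indicator_of_mem hz _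
    exact (hK.continuousAt.comp (Sm_der ha s v0.1 hz).1.continuousAt).continuousWithinAt
  · by_cases hz : z ∈ DD
    · rw [Set.indicator_of_mem hz]; exact hC _
    · rw [Set.indicator_of_notMem hz, abs_zero]; exact (abs_nonneg _).trans (hC 0)
  · obtain ⟨p, hp, hp'⟩ := (Measure.dense_of_ae (Zm_D (k := k) ha s)).inter_open_nonempty _ (isOpen_lt continuous_const hK) h0
    exact ⟨_, hp', by rw [hZ p hp']; exact hp⟩
  · intro δ hδ
    have cS : IsCompact {p | Kinf + δ ≤ K p} := by
      have : ∀ᶠ p in cocompact _, K p < Kinf + δ := hl.eventually (gt_mem_nhds (by linarith))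
      obtain ⟨S, hS, hS'⟩ := mem_cocompact.1 this
      refine hS.of_isClosed_subset (isClosed_le continuous_const hK) fun p hp ↦ ?_
      by_contra h
      exact (show K p < _ from hS' h).not_ge hp
    have hD : ∀ p, Kinf + δ ≤ K p → ‖Zm a s p‖ < 1 := fun p hp ↦ mem_ball_zero_iff.1 (Zm_DD ha s fun h ↦ by
      have e : p = (0, 0, p.2.2) := by
        rw [Prod.mk_eq_zero] at h
        exact Prod.ext h.1 (Prod.ext h.2 rfl)
      rw [e] at hp; have := hs p.2.2; linarith)
    rcases Set.eq_empty_or_nonempty {p | Kinf + δ ≤ K p} with he | hne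
    · refine ⟨0, one_pos, fun z hz _ ↦ ?_⟩
      rw [Set.indicator_of_mem hz]
      by_contra h
      have : Sm a s v0.1 z ∈ {p | Kinf + δ ≤ K p} := (not_le.1 h).le
      rw [he] at this; exact this
    · obtain ⟨p0, hp0, hm⟩ := cS.exists_isMaxOn hne (Zm_cd ha s).continuous.norm.continuousOn
      refine ⟨_, hD p0 hp0, fun z hz hR ↦ ?_⟩
      rw [Set.indicator_of_mem hz]
      by_contra h
      have := hm (show Sm a s v0.1 z ∈ {p | Kinf + δ ≤ K p} from (not_le.1 h).le)
      simp only [Set.mem_setOf_eq] at this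
      rw [Zm_Sm ha s (sp_ne v0) hz] at this
      linarith
end Heis
namespace Heis
theorem halt' {k : ℕ} {K : Pt (k + 1) → ℝ} {Kinf : ℝ} (hK : Continuous K) {μ s : ℝ} (hμ : 0 < μ) (h : 0 ≤ ∫ p, (K p - Kinf) * bubble (k + 1) μ s p ^ Qs (k + 1))
    {kk : ℂ → ℝ} (hS : ∀ (v : Sp k), ∀ z ∈ DD, K (Sm (1 / μ ^ 2) s v.1 z) = kk z) : 0 ≤ ∫ z, (kk z - Kinf) ∂bet k := by
  have ha : 0 < 1 / μ ^ 2 := by positivity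
  haveI := sg_fin k ha
  set c := μ ^ (-NN k) * (2 ^ (k + 1))⁻¹ with hc
  have c0 : 0 < c := by positivity
  have kc : Continuous fun p : Pt (k + 1) ↦ kap k (Zm (1 / μ ^ 2) s p) := (kz_cont ha s).continuous
  have kp0 : ∀ p : Pt (k + 1), 0 < kap k (Zm (1 / μ ^ 2) s p) := fun p ↦ kap_pos (Zm_ne ha s p)
  simp only [bub hμ, QsE, ← hc] at h
  rw [tr_int (f := fun p ↦ (K p - Kinf) * (c * kap k (Zm (1 / μ ^ 2) s p)) ^ pp k) ha s (((hK.sub continuous_const).mul ((continuous_const.mul kc).rpow_const fun p ↦ Or.inl (mul_pos c0 (kp0 p)).ne')).aestronglyMeasurable)] at h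
  have e : ∫ q, Wt k q.2 * ((K (Sm (1 / μ ^ 2) s q.1.1 q.2) - Kinf) * (c * kap k (Zm (1 / μ ^ 2) s (Sm (1 / μ ^ 2) s q.1.1 q.2))) ^ pp k) ∂((sg k (1 / μ ^ 2)).prod (bet k)) =
      ∫ q, c ^ pp k * (kk q.2 - Kinf) ∂((sg k (1 / μ ^ 2)).prod (bet k)) := by
    refine integral_congr_ae ?_
    filter_upwards [pr_D ha] with q hq
    rw [hS _ _ hq, Zm_Sm ha s (sp_ne _) hq, Real.mul_rpow c0.le (kap_pos (one_add_ne hq)).le]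
    linear_combination (kk q.2 - Kinf) * c ^ pp k * kp (k := k) (one_add_ne hq)
  rw [e, integral_const_mul (c ^ pp k), integral_fun_snd (f := fun z ↦ kk z - Kinf), smul_eq_mul] at h
  exact nonneg_of_mul_nonneg_right (nonneg_of_mul_nonneg_right h (Real.rpow_pos_of_pos c0 _)) (sg_pos ha)
theorem fin {k : ℕ} {K : Pt (k + 1) → ℝ} (hK : Continuous K) {a : ℝ} (ha : 0 < a) (s : ℝ) {kk : ℂ → ℝ} {Ck : ℝ} (hm : Measurable kk) (hCk : ∀ z, |kk z| ≤ Ck)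
    (hS : ∀ (v : Sp k), ∀ z ∈ DD, K (Sm a s v.1 z) = kk z) {x : VV k} (hx : x ∈ HH k) (hp : ∀ᵐ z ∂bet k, 0 < wf x z)
    (hs : ∀ y ∈ HH k, inner ℝ x y = ∫ z, kk z * (wf x z ^ qq k * wf y z) ∂bet k) : ∃ u, IsWeakSol (k + 1) K u := by
  haveI := sg_fin k ha
  obtain ⟨G, hG, hW⟩ := weq ha s hx hm.aestronglyMeasurable hCk hp hs
  set l := a ^ (NN k / 2) with hl
  have l0 : 0 < l := by positivity
  have lq : l ^ qq k = a * l := by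
    have := NN_pos k
    rw [hl, ← Real.rpow_mul ha.le, ← Real.rpow_one_add' ha.le (by positivity)]
    congr 1; unfold qq; field_simp; ring
  have mH := HF_meas (k := k) ha s (wf_sm x)
  have kp0 : ∀ p : Pt (k + 1), 0 < kap k (Zm a s p) := fun p ↦ kap_pos (Zm_ne ha s p)
  have hp2 : ∀ᵐ q ∂((sg k a).prod (bet k)), q.2 ∈ DD ∧ 0 < wf x q.2 := by
    filter_upwards [pr_D (k := k) ha, Measure.quasiMeasurePreserving_snd.ae hp] with q h1 h2 using ⟨h1, h2⟩
  have hpq : Qs (k + 1) - 1 = qq k := by rw [QsE, pp_qq]; ring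
  have p0 : 0 < pp k := by linarith [pp_qq k, qq_gt k]
  refine ⟨fun p ↦ l * HF k a s (wf x) p, ?_, ?_, ?_, fun p ↦ (l • (G p).1, l • (G p).2), ⟨fun j ↦ ⟨(hG.1 j).1.const_mul l, (hG.1 j).2.const_mul l⟩, fun φ hφ j ↦ ?_⟩, fun φ hφ ↦ ?_⟩
  · refine ⟨fun r t ↦ l * (kap k (Pc ⟨a * r ^ 2, a * (t - s)⟩) * wf x (Pc ⟨a * r ^ 2, a * (t - s)⟩)), fun p ↦ ?_⟩
    have hz : znorm (k + 1) p ^ 2 = nq (p.1, p.2.1) := Real.sq_sqrt (by positivity)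
    simp only [hz]; rfl
  · rw [QsE]
    refine MemLp.const_mul ?_ l
    refine (integrable_norm_rpow_iff mH.aestronglyMeasurable (by simpa using p0) ENNReal.ofReal_ne_top).1 ?_
    rw [ENNReal.toReal_ofReal p0.le, tr_intb ha s ((mH.measurable.norm.pow_const _).aestronglyMeasurable)]
    refine ((wp_int hx).comp_snd (sg k a)).congr ?_
    filter_upwards [pr_D (k := k) ha] with q hq
    simp only [HF]
    rw [Zm_Sm ha s (sp_ne _) hq, norm_mul, Real.norm_eq_abs, Real.norm_eq_abs, abs_of_pos (kap_pos (one_add_ne hq)), Real.mul_rpow (kap_pos (one_add_ne hq)).le (abs_nonneg _)]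
    linear_combination (-|wf x q.2| ^ pp k) * kp (k := k) (one_add_ne hq)
  · filter_upwards [(Zm_qmp ha s).ae hp] with p h
    exact mul_pos l0 (mul_pos (kp0 p) h)
  · have h := hG.2 φ hφ j
    simp only [Pi.smul_apply, smul_eq_mul, mul_assoc]
    rw [integral_const_mul l, integral_const_mul l, integral_const_mul l, integral_const_mul l, h.1, h.2]
    constructor <;> ring
  · have hΦ : ContDiff ℝ 1 fun p ↦ φ p * (kap k (Zm a s p))⁻¹ := (hφ.1.of_le (by simp)).mul (((kz_cont ha s).of_le (by simp)).inv fun p ↦ (kp0 p).ne')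
    have h := hW _ hΦ hφ.2.mul_right
    have e1 : (fun p ↦ φ p * (kap k (Zm a s p))⁻¹ * kap k (Zm a s p)) = φ := by
      funext p; rw [mul_assoc, inv_mul_cancel₀ (kp0 p).ne', mul_one]
    rw [e1] at h
    have e2 : ∀ p, gDot (k + 1) (fun p ↦ (l • (G p).1, l • (G p).2)) φ p = l * gDot (k + 1) G φ p := fun p ↦ by
      simp only [gDot, Finset.mul_sum, Pi.smul_apply, smul_eq_mul]
      exact Finset.sum_congr rfl fun j _ ↦ by ring
    simp only [e2, hpq]
    rw [integral_const_mul l, h, tr_int (f := fun p ↦ K p * (l * HF k a s (wf x) p) ^ qq k * φ p) ha s ((hK.measurable.mul ((mH.measurable.const_mul l).pow_const _)).mul hφ.1.continuous.measurable).aestronglyMeasurable,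
      ← mul_assoc, mul_comm l a, ← lq, ← integral_const_mul (l ^ qq k)]
    refine integral_congr_ae ?_
    filter_upwards [hp2] with q hq
    have kq := kap_pos (k := k) (one_add_ne hq.1)
    have hk := kp (k := k) (one_add_ne hq.1)
    rw [pp_qq, Real.rpow_add_one kq.ne'] at hk
    simp only [HF]
    rw [Zm_Sm ha s (sp_ne _) hq.1, hS _ _ hq.1, Real.mul_rpow l0.le (mul_pos kq hq.2).le, Real.mul_rpow kq.le hq.2.le]
    have e3 : Wt k q.2 * kap k q.2 ^ qq k = (kap k q.2)⁻¹ := by field_simp; linarith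
    linear_combination (-(kk q.2 * l ^ qq k * wf x q.2 ^ qq k * φ (Sm a s q.1.1 q.2))) * e3
end Heis
open Heis
theorem mainThm (n : ℕ) (hn : 1 ≤ n) (K : Pt n → ℝ) (Kinf : ℝ) (hKcont : Continuous K) (hKcyl : CylHolder n K)
    (hKlim : Tendsto K (cocompact _) (𝓝 Kinf)) (hKpos : ∃ p, 0 < K p) (hsup : ∀ t : ℝ, K (0, 0, t) ≤ Kinf)
    (halt : Kinf ≤ 0 ∨ ∃ μ : ℝ, 0 < μ ∧ ∃ s : ℝ, 0 ≤ ∫ p : Pt n, (K p - Kinf) * bubble n μ s p ^ Qs n) : ∃ u, IsWeakSol n K u := by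
  obtain ⟨k, rfl⟩ := Nat.exists_eq_add_of_le' hn
  have hc : IsCyl (k + 1) K := ⟨hKcyl.choose, hKcyl.choose_spec.1⟩
  obtain ⟨a, ha, s, h⟩ : ∃ a : ℝ, 0 < a ∧ ∃ s, Kinf ≤ 0 ∨ ∀ kk : ℂ → ℝ, (∀ (v : Sp k), ∀ z ∈ DD, K (Sm a s v.1 z) = kk z) → 0 ≤ ∫ z, (kk z - Kinf) ∂bet k := by
    rcases halt with h | ⟨μ, hμ, s, h⟩
    · exact ⟨1, one_pos, 0, Or.inl h⟩
    · exact ⟨1 / μ ^ 2, by positivity, s, Or.inr fun kk hS ↦ halt' hKcont hμ h hS⟩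
  obtain ⟨kk, Ck, h1, h2, h3, ⟨z0, h4, h5⟩, h6, h7⟩ := kdat hKcont hc hKlim hKpos hsup ha s
  obtain ⟨x, hx, hp, hs⟩ := solD h1 h2.aestronglyMeasurable h3 h4 h5 h6 (h.imp_right fun h ↦ h kk h7)
  exact fin hKcont ha s h2 h3 h7 hx hp fun y hy ↦ (hs y hy).2
/-- Theorem 1.1, Bianchi–Egnell type existence.
If `K` is continuous, cylindrically symmetric with locally Hölder profile, has a
finite limit `K(∞)` at infinity, is positive somewhere, `sup_t K(0,t) ≤ K(∞)`, and
either `K(∞) ≤ 0` or `∫ (K - K(∞)) U_{μ,s}^{Q*} ≥ 0` for some `μ > 0`, `s ∈ ℝ`, then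
`-Δ_{ℍⁿ} u = K u^{Q*-1}` has a positive cylindrically symmetric finite-energy weak
solution. -/
theorem webster_existence_BianchiEgnell (n : ℕ) (hn : 1 ≤ n)
    (K : Pt n → ℝ) (Kinf : ℝ)
    (hKcont : Continuous K)
    (hKcyl : CylHolder n K)
    (hKlim : Tendsto K (cocompact (Pt n)) (𝓝 Kinf))
    (hKpos : ∃ p : Pt n, 0 < K p)
    (hsup : ∀ t : ℝ, K (0, 0, t) ≤ Kinf)
    (halt : Kinf ≤ 0 ∨ ∃ μ : ℝ, 0 < μ ∧ ∃ s : ℝ,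
        0 ≤ ∫ p : Pt n, (K p - Kinf) * bubble n μ s p ^ Qs n) :
    ∃ u : Pt n → ℝ, IsWeakSol n K u := by
  exact mainThm n hn K Kinf hKcont hKcyl hKlim hKpos hsup halt
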